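/- Let S be a finite set of rational primes. When ordered by absolute discriminant, the average size of Cl(K)_S[3], as K ranges over imaginary quadratic fields in which every prime of S splits completely, equals 1 + 3^{-|S|}. -/

import Mathlib

open IntermediateField NumberField Filter Asymptotics
open scoped nonZeroDivisors

/-- A square root of `d` in `ℂ`. -/
noncomputable def sqrtD (d : ℤ) : ℂ :=
  if 0 ≤ d then ((Real.sqrt d : ℝ) : ℂ) else Complex.I * ((Real.sqrt (-d) : ℝ) : ℂ)

lemma sqrtD_sq (d : ℤ) : (sqrtD d) ^ 2 = (d : ℂ) := by
  unfold sqrtD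
  split_ifs with h
  · rw [← Complex.ofReal_pow, Real.sq_sqrt (by exact_mod_cast h)]
    simp
  · rw [mul_pow, Complex.I_sq, ← Complex.ofReal_pow,
      Real.sq_sqrt (by push_neg at h; nlinarith [show (d:ℝ) < 0 from by exact_mod_cast h])]
    push_cast
    ring

/-- The quadratic field `K = ℚ(√d)` realized inside `ℂ`.  For `d` a fundamental
discriminant, these realize all quadratic fields (identified with their
fundamental discriminants), `d > 0` giving the real ones and `d < 0` the
imaginary ones. -/
noncomputable def Kd (d : ℤ) : IntermediateField ℚ ℂ := ℚ⟮sqrtD d⟯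

instance (d : ℤ) : FiniteDimensional ℚ (Kd d) := by
  apply IntermediateField.adjoin.finiteDimensional
  have : IsAlgebraic ℚ (sqrtD d) := by
    refine ⟨Polynomial.X ^ 2 - Polynomial.C (d : ℚ), ?_, ?_⟩
    · exact Polynomial.X_pow_sub_C_ne_zero (by norm_num) _
    · simp [sqrtD_sq d]
  exact this.isIntegral

instance (d : ℤ) : NumberField (Kd d) := ⟨⟩

/-- The ring of integers `O_K` of `K = ℚ(√d)`. -/
noncomputable abbrev Od (d : ℤ) := 𝓞 (Kd d)

/-- `d` is a fundamental discriminant, i.e. the discriminant of a quadratic field: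
either `d ≡ 1 (mod 4)` and `d` squarefree, or `d = 4m` with `m` squarefree and
`m ≡ 2, 3 (mod 4)` (and `d ≠ 1`, which is not the discriminant of a quadratic field). -/
def IsFundamentalDiscriminant (d : ℤ) : Prop :=
  d ≠ 1 ∧ ((d % 4 = 1 ∧ Squarefree d) ∨
    ∃ m : ℤ, d = 4 * m ∧ (m % 4 = 2 ∨ m % 4 = 3) ∧ Squarefree m)

/-- The average of `f` over the family of quadratic fields (identified with their
fundamental discriminants `d`) satisfying `F`, ordered by absolute discriminant,
exists and equals `A`:
`lim_{X→∞} (∑_{F d, |d| < X} f d) / #{d : F d, |d| < X} = A`. -/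
noncomputable def HasAverage (F : ℤ → Prop) (f : ℤ → ℝ) (A : ℝ) : Prop :=
  Tendsto (fun X : ℝ =>
      (∑ᶠ d ∈ {d : ℤ | F d ∧ |(d : ℝ)| < X}, f d) /
        (Nat.card {d : ℤ // F d ∧ |(d : ℝ)| < X} : ℝ))
    atTop (nhds A)

/-- The rational prime `p` splits (completely) in `K = ℚ(√d)`: `pO_K` is a product of
two distinct prime ideals. -/
def SplitsIn (p : ℕ) (d : ℤ) : Prop :=
  ∃ P Q : Ideal (Od d), P ≠ Q ∧ P.IsPrime ∧ Q.IsPrime ∧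
    Ideal.span {((p : ℕ) : Od d)} = P * Q

/-- The subgroup `⟨S_K⟩` of the class group generated by the classes of the primes
of `O_K` lying above the primes in `S`. -/
noncomputable def SClassSubgroup (S : Finset ℕ) (d : ℤ) : Subgroup (ClassGroup (Od d)) :=
  Subgroup.closure {c | ∃ P : (Ideal (Od d))⁰, (P : Ideal (Od d)).IsPrime ∧
    (∃ p ∈ S, ((p : ℕ) : Od d) ∈ (P : Ideal (Od d))) ∧ c = ClassGroup.mk0 P}

/-- `Cl(K)_S := Cl(K)/⟨S_K⟩` for `K = ℚ(√d)`. -/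
noncomputable def ClS (S : Finset ℕ) (d : ℤ) :=
  ClassGroup (Od d) ⧸ SClassSubgroup S d

noncomputable instance (S : Finset ℕ) (d : ℤ) : CommGroup (ClS S d) := by
  unfold ClS; infer_instance

namespace DH

/-! ### Binary cubic forms `a x³ + 3 b x² y + 3 c x y² + d y³` and their Hessians -/

section Forms

variable {R : Type*} [CommRing R]

/-- The coefficient of `x²` in the Hessian of `(a, b, c, d)`. -/
def hA (f : Fin 4 → R) : R := f 1 ^ 2 - f 0 * f 2

/-- The coefficient of `x y` in the Hessian of `(a, b, c, d)`. -/
def hB (f : Fin 4 → R) : R := f 1 * f 2 - f 0 * f 3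

/-- The coefficient of `y²` in the Hessian of `(a, b, c, d)`. -/
def hC (f : Fin 4 → R) : R := f 2 ^ 2 - f 1 * f 3

/-- The discriminant of the Hessian. -/
def disc (f : Fin 4 → R) : R := hB f ^ 2 - 4 * hA f * hC f

/-- Substitution of variables in a binary cubic form. -/
def act (g : Matrix (Fin 2) (Fin 2) R) (f : Fin 4 → R) : Fin 4 → R :=
  ![f 0 * g 0 0 ^ 3 + 3 * f 1 * g 0 0 ^ 2 * g 1 0 + 3 * f 2 * g 0 0 * g 1 0 ^ 2
      + f 3 * g 1 0 ^ 3,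
    f 0 * g 0 0 ^ 2 * g 0 1 + f 1 * (g 0 0 ^ 2 * g 1 1 + 2 * g 0 0 * g 0 1 * g 1 0)
      + f 2 * (2 * g 0 0 * g 1 0 * g 1 1 + g 0 1 * g 1 0 ^ 2) + f 3 * g 1 0 ^ 2 * g 1 1,
    f 0 * g 0 0 * g 0 1 ^ 2 + f 1 * (2 * g 0 0 * g 0 1 * g 1 1 + g 0 1 ^ 2 * g 1 0)
      + f 2 * (g 0 0 * g 1 1 ^ 2 + 2 * g 0 1 * g 1 0 * g 1 1) + f 3 * g 1 0 * g 1 1 ^ 2,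
    f 0 * g 0 1 ^ 3 + 3 * f 1 * g 0 1 ^ 2 * g 1 1 + 3 * f 2 * g 0 1 * g 1 1 ^ 2
      + f 3 * g 1 1 ^ 3]

lemma act_mul (g h : Matrix (Fin 2) (Fin 2) R) (f : Fin 4 → R) :
    act (g * h) f = act h (act g f) := by
  ext i
  fin_cases i <;> simp [act, Matrix.mul_apply, Fin.sum_univ_two] <;> ring

lemma act_one (f : Fin 4 → R) : act 1 f = f := by
  ext i
  fin_cases i <;> simp [act]

lemma act_smul (g : Matrix (Fin 2) (Fin 2) R) (r : R) (f : Fin 4 → R) :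
    act g (r • f) = r • act g f := by
  ext i
  fin_cases i <;> simp [act] <;> ring

lemma act_neg_one (f : Fin 4 → R) : act (-1) f = -f := by
  ext i
  fin_cases i <;> simp [act] <;> ring

lemma hA_act (g : Matrix (Fin 2) (Fin 2) R) (f : Fin 4 → R) :
    hA (act g f) = g.det ^ 2 *
      (hA f * g 0 0 ^ 2 + hB f * g 0 0 * g 1 0 + hC f * g 1 0 ^ 2) := by
  simp [act, hA, hB, hC, Matrix.det_fin_two]; ring

lemma hB_act (g : Matrix (Fin 2) (Fin 2) R) (f : Fin 4 → R) :
    hB (act g f) = g.det ^ 2 * (2 * hA f * g 0 0 * g 0 1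
      + hB f * (g 0 0 * g 1 1 + g 0 1 * g 1 0) + 2 * hC f * g 1 0 * g 1 1) := by
  simp [act, hA, hB, hC, Matrix.det_fin_two]; ring

lemma hC_act (g : Matrix (Fin 2) (Fin 2) R) (f : Fin 4 → R) :
    hC (act g f) = g.det ^ 2 *
      (hA f * g 0 1 ^ 2 + hB f * g 0 1 * g 1 1 + hC f * g 1 1 ^ 2) := by
  simp [act, hA, hB, hC, Matrix.det_fin_two]; ring

lemma disc_act (g : Matrix (Fin 2) (Fin 2) R) (f : Fin 4 → R) :
    disc (act g f) = g.det ^ 6 * disc f := by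
  rw [disc, hA_act, hB_act, hC_act, disc, Matrix.det_fin_two]; ring

lemma syzygy_left (f : Fin 4 → R) : hA f * f 2 - hB f * f 1 + hC f * f 0 = 0 := by
  simp only [hA, hB, hC]; ring

lemma syzygy_right (f : Fin 4 → R) : hA f * f 3 - hB f * f 2 + hC f * f 1 = 0 := by
  simp only [hA, hB, hC]; ring

lemma syzygy_cubic (f : Fin 4 → R) :
    (2 * hA f * f 1 - f 0 * hB f) ^ 2 - disc f * f 0 ^ 2 = 4 * hA f ^ 3 := by
  simp only [disc, hA, hB, hC]; ring

lemma syzygy_cubic' (f : Fin 4 → R) :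
    (2 * hC f * f 2 - f 3 * hB f) ^ 2 - disc f * f 3 ^ 2 = 4 * hC f ^ 3 := by
  simp only [disc, hA, hB, hC]; ring

lemma hA_smul (r : R) (f : Fin 4 → R) : hA (r • f) = r ^ 2 * hA f := by
  simp [hA]; ring

lemma hB_smul (r : R) (f : Fin 4 → R) : hB (r • f) = r ^ 2 * hB f := by
  simp [hB]; ring

lemma hC_smul (r : R) (f : Fin 4 → R) : hC (r • f) = r ^ 2 * hC f := by
  simp [hC]; ring

lemma disc_smul (r : R) (f : Fin 4 → R) : disc (r • f) = r ^ 4 * disc f := by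
  simp [disc, hA_smul, hB_smul, hC_smul]; ring

lemma hA_neg (f : Fin 4 → R) : hA (-f) = hA f := by simp [hA]

lemma hB_neg (f : Fin 4 → R) : hB (-f) = hB f := by simp [hB]

lemma hC_neg (f : Fin 4 → R) : hC (-f) = hC f := by simp [hC]

lemma disc_neg (f : Fin 4 → R) : disc (-f) = disc f := by
  simp [disc, hA_neg, hB_neg, hC_neg]

variable {R' : Type*} [CommRing R'] (φ : R →+* R')

lemma hA_map (f : Fin 4 → R) : hA (fun i => φ (f i)) = φ (hA f) := by simp [hA]

lemma hB_map (f : Fin 4 → R) : hB (fun i => φ (f i)) = φ (hB f) := by simp [hB]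

lemma hC_map (f : Fin 4 → R) : hC (fun i => φ (f i)) = φ (hC f) := by simp [hC]

lemma disc_map (f : Fin 4 → R) : disc (fun i => φ (f i)) = φ (disc f) := by
  simp only [disc, hA_map, hB_map, hC_map, map_sub, map_mul, map_pow, map_ofNat]

lemma hA_cast (f : Fin 4 → ℤ) : hA (fun i => (f i : R)) = ((hA f : ℤ) : R) := hA_map (Int.castRingHom R) f

lemma hB_cast (f : Fin 4 → ℤ) : hB (fun i => (f i : R)) = ((hB f : ℤ) : R) := hB_map (Int.castRingHom R) f

lemma hC_cast (f : Fin 4 → ℤ) : hC (fun i => (f i : R)) = ((hC f : ℤ) : R) := hC_map (Int.castRingHom R) f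

lemma disc_cast (f : Fin 4 → ℤ) : disc (fun i => (f i : R)) = ((disc f : ℤ) : R) :=
  disc_map (Int.castRingHom R) f

end Forms

section Reduced

/-- The Hessian is positive definite and weakly reduced. -/
def WRed {R : Type*} [CommRing R] [LinearOrder R] (f : Fin 4 → R) : Prop :=
  0 < hA f ∧ |hB f| ≤ hA f ∧ hA f ≤ hC f

/-- The Hessian is positive definite and strictly reduced. -/
def SRed (f : Fin 4 → ℤ) : Prop :=
  0 < hA f ∧ -hA f < hB f ∧ hB f ≤ hA f ∧ hA f < hC f

lemma SRed.wRed {f : Fin 4 → ℤ} (h : SRed f) : WRed f :=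
  ⟨h.1, abs_le.mpr ⟨h.2.1.le, h.2.2.1⟩, h.2.2.2.le⟩

lemma wRed_cast {f : Fin 4 → ℤ} : WRed (fun i => (f i : ℝ)) ↔ WRed f := by
  simp only [WRed, hA_cast, hB_cast, hC_cast]
  norm_cast

lemma WRed.sq_hB_le {f : Fin 4 → ℝ} (h : WRed f) : hB f ^ 2 ≤ hA f * hC f := by
  obtain ⟨h0, h1, h2⟩ := h
  have := sq_le_sq' (abs_le.mp h1).1 (abs_le.mp h1).2
  nlinarith

lemma WRed.three_mul_le {f : Fin 4 → ℝ} (h : WRed f) : 3 * (hA f * hC f) ≤ -disc f := by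
  have := h.sq_hB_le
  simp only [disc]; linarith

lemma WRed.hC_pos {f : Fin 4 → ℝ} (h : WRed f) : 0 < hC f := h.1.trans_le h.2.2

lemma WRed.disc_neg {f : Fin 4 → ℝ} (h : WRed f) : disc f < 0 := by
  have := h.three_mul_le
  have := mul_pos h.1 h.hC_pos
  linarith

lemma WRed.sq_zero_le {f : Fin 4 → ℝ} (h : WRed f) : 3 * (f 0 ^ 2 * hC f) ≤ 4 * hA f ^ 2 := by
  have h1 := syzygy_cubic f
  have h2 := h.three_mul_le
  have h3 : 3 * (hA f * hC f) * f 0 ^ 2 ≤ -disc f * f 0 ^ 2 := by gcongr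
  have h4 : hA f * (3 * (f 0 ^ 2 * hC f)) ≤ hA f * (4 * hA f ^ 2) := by
    nlinarith [sq_nonneg (2 * hA f * f 1 - f 0 * hB f)]
  exact le_of_mul_le_mul_left h4 h.1

lemma WRed.sq_three_le {f : Fin 4 → ℝ} (h : WRed f) : 3 * (f 3 ^ 2 * hA f) ≤ 4 * hC f ^ 2 := by
  have h1 := syzygy_cubic' f
  have h2 := h.three_mul_le
  have h3 : 3 * (hA f * hC f) * f 3 ^ 2 ≤ -disc f * f 3 ^ 2 := by gcongr
  have h4 : hC f * (3 * (f 3 ^ 2 * hA f)) ≤ hC f * (4 * hC f ^ 2) := by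
    nlinarith [sq_nonneg (2 * hC f * f 2 - f 3 * hB f)]
  exact le_of_mul_le_mul_left h4 h.hC_pos

lemma WRed.sq_one_le {f : Fin 4 → ℝ} (h : WRed f) : 3 * f 1 ^ 2 ≤ 4 * hA f := by
  have h1 := syzygy_cubic f
  have h2 := h.three_mul_le
  have h5 := h.sq_hB_le
  have h3 : 3 * (hB f ^ 2) * f 0 ^ 2 ≤ -disc f * f 0 ^ 2 := by
    gcongr
    linarith
  have h4 : hA f ^ 2 * (3 * f 1 ^ 2) ≤ hA f ^ 2 * (4 * hA f) := by
    nlinarith [sq_nonneg ((2 * hA f * f 1 - f 0 * hB f) - 3 * (f 0 * hB f))]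
  exact le_of_mul_le_mul_left h4 (pow_pos h.1 2)

lemma WRed.sq_two_le {f : Fin 4 → ℝ} (h : WRed f) : 3 * f 2 ^ 2 ≤ 4 * hC f := by
  have h1 := syzygy_cubic' f
  have h2 := h.three_mul_le
  have h5 := h.sq_hB_le
  have h3 : 3 * (hB f ^ 2) * f 3 ^ 2 ≤ -disc f * f 3 ^ 2 := by
    gcongr
    linarith
  have h4 : hC f ^ 2 * (3 * f 2 ^ 2) ≤ hC f ^ 2 * (4 * hC f) := by
    nlinarith [sq_nonneg ((2 * hC f * f 2 - f 3 * hB f) - 3 * (f 3 * hB f))]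
  exact le_of_mul_le_mul_left h4 (pow_pos h.hC_pos 2)

/-- Reduction theory of positive definite binary quadratic forms. -/
lemma exists_reduced_quadratic (A B C : ℤ) (hA : 0 < A) (hD : B ^ 2 - 4 * A * C < 0) :
    ∃ g : Matrix (Fin 2) (Fin 2) ℤ, g.det = 1 ∧
      0 < A * g 0 0 ^ 2 + B * g 0 0 * g 1 0 + C * g 1 0 ^ 2 ∧
      |2 * A * g 0 0 * g 0 1 + B * (g 0 0 * g 1 1 + g 0 1 * g 1 0) + 2 * C * g 1 0 * g 1 1| ≤
        A * g 0 0 ^ 2 + B * g 0 0 * g 1 0 + C * g 1 0 ^ 2 ∧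
      A * g 0 0 ^ 2 + B * g 0 0 * g 1 0 + C * g 1 0 ^ 2 ≤
        A * g 0 1 ^ 2 + B * g 0 1 * g 1 1 + C * g 1 1 ^ 2 := by
  induction hn : A.toNat using Nat.strong_induction_on generalizing A B C with
  | _ n ih =>
  set k : ℤ := -((B + A) / (2 * A)) with hk
  have h2 : (0 : ℤ) < 2 * A := by linarith
  have e1 := Int.mul_ediv_add_emod (B + A) (2 * A)
  have e2 := Int.emod_nonneg (B + A) h2.ne'
  have e3 := Int.emod_lt_of_pos (B + A) h2
  have hB' : |B + 2 * A * k| ≤ A := by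
    rw [abs_le]
    constructor <;> rw [hk] <;> nlinarith
  set B' := B + 2 * A * k with hB'd
  set C' := A * k ^ 2 + B * k + C with hC'
  have hD' : B' ^ 2 - 4 * A * C' < 0 := by
    have : B' ^ 2 - 4 * A * C' = B ^ 2 - 4 * A * C := by rw [hB'd, hC']; ring
    linarith
  by_cases hAC : A ≤ C'
  · refine ⟨!![1, k; 0, 1], by simp [Matrix.det_fin_two], ?_, ?_, ?_⟩
    · simpa using hA
    · simpa [add_comm, hB'd] using hB'
    · simpa [hC'] using hAC
  · have hC0 : 0 < C' := by nlinarith [sq_nonneg B']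
    obtain ⟨g, hg, g1, g2, g3⟩ := ih C'.toNat (by omega) C' (-B') A hC0 (by linarith [neg_sq B']) rfl
    refine ⟨!![1, k; 0, 1] * !![0, 1; -1, 0] * g, ?_, ?_, ?_, ?_⟩
    · rw [Matrix.det_mul, Matrix.det_mul, hg]; simp [Matrix.det_fin_two]
    all_goals simp only [Matrix.mul_apply, Fin.sum_univ_two, Matrix.of_apply, Matrix.cons_val',
      Matrix.cons_val_zero, Matrix.cons_val_one, Matrix.cons_val_fin_one]
    · convert g1 using 1; rw [hC', hB'd]; ring
    · convert g2 using 1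
      · congr 1; rw [hC', hB'd]; ring
      · rw [hC', hB'd]; ring
    · convert g3 using 1 <;> rw [hC', hB'd] <;> ring

lemma hA_pos_of_disc_neg {f : Fin 4 → ℤ} (h : disc f < 0) : 0 < hA f := by
  have h1 := syzygy_cubic f
  have h2 : 0 ≤ hA f ^ 3 := by nlinarith [sq_nonneg (2 * hA f * f 1 - f 0 * hB f), sq_nonneg (f 0)]
  have h3 : 0 ≤ hA f := by
    by_contra h4
    push Not at h4
    have := Odd.pow_neg (n := 3) (by decide) h4
    linarith
  rcases h3.lt_or_eq with h4 | h4
  · exact h4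
  · rw [disc, ← h4] at h
    nlinarith [sq_nonneg (hB f)]

lemma exists_act_wRed (f : Fin 4 → ℤ) (h : disc f < 0) :
    ∃ g : Matrix (Fin 2) (Fin 2) ℤ, g.det = 1 ∧ WRed (act g f) := by
  obtain ⟨g, h1, h2, h3, h4⟩ := exists_reduced_quadratic (hA f) (hB f) (hC f)
    (hA_pos_of_disc_neg h) h
  refine ⟨g, h1, ?_⟩
  rw [WRed, hA_act, hB_act, hC_act, h1]
  simpa using ⟨h2, h3, h4⟩

/-- A strictly reduced form takes its minimum only at `(±1, 0)`. -/
lemma le_quadratic {A B C x y : ℤ} (hA : 0 < A) (h1 : |B| ≤ A) (h2 : A < C) (hxy : x ≠ 0 ∨ y ≠ 0) :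
    A ≤ A * x ^ 2 + B * x * y + C * y ^ 2 ∧
      (A * x ^ 2 + B * x * y + C * y ^ 2 = A → y = 0) := by
  by_cases hy : y = 0
  · subst hy
    have hx : x ≠ 0 := by simpa using hxy
    have : 1 ≤ x ^ 2 := by have := pow_pos (abs_pos.mpr hx) 2; rw [sq_abs] at this; omega
    simp only [implies_true, and_true]
    nlinarith
  · have hy2 : 1 ≤ y ^ 2 := by have := pow_pos (abs_pos.mpr hy) 2; rw [sq_abs] at this; omega
    have key : -(A * |x| * |y|) ≤ B * x * y := by
      have : |B * x * y| ≤ A * |x| * |y| := by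
        rw [abs_mul, abs_mul]; gcongr
      linarith [neg_abs_le (B * x * y)]
    have h3 : A < A * x ^ 2 + B * x * y + C * y ^ 2 := by
      rw [← sq_abs x, ← sq_abs y] at *
      set u := |x|
      set v := |y|
      have hu : 0 ≤ u := abs_nonneg x
      have hv : 1 ≤ v := Int.one_le_abs hy
      have hCv : A * v ^ 2 < C * v ^ 2 := by gcongr
      have h5 : u * v ≤ u ^ 2 + v ^ 2 - 1 := by
        rcases le_total u v with h | h
        · rcases h.lt_or_eq with h' | h'
          · nlinarith
          · rw [h']; nlinarith
        · nlinarith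
      nlinarith
    exact ⟨h3.le, fun h => absurd h h3.ne'⟩

/-- A unimodular substitution between strictly reduced quadratic forms is `±1`. -/
lemma eq_one_or_of_strictly_reduced {A B C A' B' C' : ℤ} (g : Matrix (Fin 2) (Fin 2) ℤ)
    (hg : g.det = 1) (hA : 0 < A) (h0 : -A < B) (h1 : B ≤ A) (h2 : A < C)
    (hA' : 0 < A') (h0' : -A' < B') (h1' : B' ≤ A') (h2' : A' < C')
    (eA : A' = A * g 0 0 ^ 2 + B * g 0 0 * g 1 0 + C * g 1 0 ^ 2)
    (eB : B' = 2 * A * g 0 0 * g 0 1 + B * (g 0 0 * g 1 1 + g 0 1 * g 1 0)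
      + 2 * C * g 1 0 * g 1 1)
    (eC : C' = A * g 0 1 ^ 2 + B * g 0 1 * g 1 1 + C * g 1 1 ^ 2) :
    g = 1 ∨ g = -1 := by
  rw [Matrix.det_fin_two] at hg
  have n1 : g 0 0 ≠ 0 ∨ g 1 0 ≠ 0 := by
    by_contra! h; rw [h.1, h.2] at hg; simp at hg
  have n2 : g 1 1 ≠ 0 ∨ -g 1 0 ≠ 0 := by
    by_contra! h
    rw [neg_eq_zero] at h
    rw [h.1, h.2] at hg; simp at hg
  obtain ⟨p1, p2⟩ := le_quadratic hA (abs_le.mpr ⟨h0.le, h1⟩) h2 n1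
  obtain ⟨q1, -⟩ := le_quadratic hA' (abs_le.mpr ⟨h0'.le, h1'⟩) h2' n2
  have hAe : A = A' * g 1 1 ^ 2 + B' * g 1 1 * (-g 1 0) + C' * (-g 1 0) ^ 2 := by
    rw [eA, eB, eC]
    linear_combination (-(A * (g 0 0 * g 1 1 - g 0 1 * g 1 0 + 1))) * hg
  have hAA : A' = A := le_antisymm (by linarith) (by linarith)
  have hr : g 1 0 = 0 := p2 (by linarith)
  rw [hr] at hg eA eB
  have hps : g 0 0 * g 1 1 = 1 := by linarith
  have hB2 : B' = 2 * A * (g 0 0 * g 0 1) + B := by rw [eB]; linear_combination B * hps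
  have hq : g 0 0 * g 0 1 = 0 := by
    rw [hAA] at h0' h1'
    by_contra hne
    rcases lt_or_gt_of_ne hne with h | h
    · nlinarith
    · nlinarith
  rcases Int.eq_one_or_neg_one_of_mul_eq_one' hps with ⟨e1, e2⟩ | ⟨e1, e2⟩
  · left
    rw [e1, one_mul] at hq
    ext i j; fin_cases i <;> fin_cases j <;> simp [e1, e2, hq, hr]
  · right
    rw [e1] at hq
    have hq : g 0 1 = 0 := by linarith
    ext i j; fin_cases i <;> fin_cases j <;> simp [e1, e2, hq, hr]

lemma eq_or_eq_neg_of_act {f f' : Fin 4 → ℤ} (hf : SRed f) (hf' : SRed f')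
    (g : Matrix (Fin 2) (Fin 2) ℤ) (hg : g.det = 1) (h : f' = act g f) : f' = f ∨ f' = -f := by
  have := eq_one_or_of_strictly_reduced g hg hf.1 hf.2.1 hf.2.2.1 hf.2.2.2
    hf'.1 hf'.2.1 hf'.2.2.1 hf'.2.2.2
    (by rw [h, hA_act, hg]; ring) (by rw [h, hB_act, hg]; ring) (by rw [h, hC_act, hg]; ring)
  rcases this with rfl | rfl
  · left; rw [h, act_one]
  · right; rw [h, act_neg_one]

end Reduced

/-! ### Imaginary quadratic orders with an explicit basis -/

/-- The ring `O` is `ℤ[τ]` with `τ² = t τ - m`, with conjugation `σ`. -/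
structure QuadBasis (O : Type*) [CommRing O] (t m : ℤ) where
  τ : O
  σ : O →+* O
  re : O → ℤ
  im : O → ℤ
  sq : τ * τ = t * τ - m
  σ_τ : σ τ = t - τ
  eta : ∀ x, x = re x + im x * τ
  re_mk : ∀ u v : ℤ, re (u + v * τ) = u
  im_mk : ∀ u v : ℤ, im (u + v * τ) = v

namespace QuadBasis

variable {O : Type*} [CommRing O] {t m : ℤ} (q : QuadBasis O t m)

lemma ext_iff {x y : O} : x = y ↔ q.re x = q.re y ∧ q.im x = q.im y := by
  constructor
  · rintro rfl; simp
  · rintro ⟨h1, h2⟩; rw [q.eta x, q.eta y, h1, h2]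

lemma re_intCast (u : ℤ) : q.re u = u := by simpa using q.re_mk u 0

lemma im_intCast (u : ℤ) : q.im u = 0 := by simpa using q.im_mk u 0

lemma re_add (x y : O) : q.re (x + y) = q.re x + q.re y := by
  rw [← q.re_mk (q.re x + q.re y) (q.im x + q.im y)]
  congr 1
  conv_lhs => rw [q.eta x, q.eta y]
  push_cast; ring

lemma im_add (x y : O) : q.im (x + y) = q.im x + q.im y := by
  rw [← q.im_mk (q.re x + q.re y) (q.im x + q.im y)]
  congr 1
  conv_lhs => rw [q.eta x, q.eta y]
  push_cast; ring

lemma mul_eq (x y : O) : x * y = ((q.re x * q.re y - m * (q.im x * q.im y) : ℤ) : O) +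
    ((q.re x * q.im y + q.im x * q.re y + t * (q.im x * q.im y) : ℤ) : O) * q.τ := by
  conv_lhs => rw [q.eta x, q.eta y]
  push_cast
  linear_combination (q.im x * q.im y : O) * q.sq

lemma re_mul (x y : O) : q.re (x * y) = q.re x * q.re y - m * (q.im x * q.im y) := by
  rw [q.mul_eq, q.re_mk]

lemma im_mul (x y : O) :
    q.im (x * y) = q.re x * q.im y + q.im x * q.re y + t * (q.im x * q.im y) := by
  rw [q.mul_eq, q.im_mk]

lemma re_τ : q.re q.τ = 0 := by simpa using q.re_mk 0 1

lemma im_τ : q.im q.τ = 1 := by simpa using q.im_mk 0 1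

lemma re_zero : q.re 0 = 0 := by simpa using q.re_intCast 0

lemma im_zero : q.im 0 = 0 := by simpa using q.im_intCast 0

lemma re_one : q.re 1 = 1 := by simpa using q.re_intCast 1

lemma im_one : q.im 1 = 0 := by simpa using q.im_intCast 1

lemma re_neg (x : O) : q.re (-x) = -q.re x := by
  have := q.re_add x (-x)
  rw [add_neg_cancel, re_zero] at this
  linarith

lemma im_neg (x : O) : q.im (-x) = -q.im x := by
  have := q.im_add x (-x)
  rw [add_neg_cancel, im_zero] at this
  linarith

/-- The norm form. -/
def nm (x : O) : ℤ := q.re x ^ 2 + t * (q.re x * q.im x) + m * q.im x ^ 2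

lemma σ_eq (x : O) : q.σ x = ((q.re x + t * q.im x : ℤ) : O) + ((-q.im x : ℤ) : O) * q.τ := by
  conv_lhs => rw [q.eta x]
  simp only [map_add, map_mul, map_intCast, q.σ_τ]
  push_cast; ring

lemma re_σ (x : O) : q.re (q.σ x) = q.re x + t * q.im x := by rw [σ_eq, re_mk]

lemma im_σ (x : O) : q.im (q.σ x) = -q.im x := by rw [σ_eq, im_mk]

lemma mul_σ (x : O) : x * q.σ x = (q.nm x : O) := by
  rw [q.ext_iff, re_mul, im_mul, re_σ, im_σ, re_intCast, im_intCast, nm]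
  constructor <;> ring

lemma σ_σ (x : O) : q.σ (q.σ x) = x := by
  simp only [q.ext_iff, re_σ, im_σ]
  constructor <;> ring

lemma nm_mul (x y : O) : q.nm (x * y) = q.nm x * q.nm y := by
  simp only [nm, re_mul, im_mul]; ring

lemma nm_intCast (u : ℤ) : q.nm u = u ^ 2 := by simp [nm, re_intCast, im_intCast]

include q in
lemma intCast_injective : Function.Injective (Int.cast : ℤ → O) := fun u v h => by
  rw [← q.re_intCast u, h, q.re_intCast]

include q in
lemma intCast_ne_zero {u : ℤ} (h : u ≠ 0) : (u : O) ≠ 0 := fun h' =>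
  h (q.intCast_injective (by simpa using h'))

lemma four_nm (x : O) :
    4 * q.nm x = (2 * q.re x + t * q.im x) ^ 2 - (t ^ 2 - 4 * m) * q.im x ^ 2 := by
  rw [nm]; ring

lemma nm_pos (hd : t ^ 2 - 4 * m < 0) {x : O} (hx : x ≠ 0) : 0 < q.nm x := by
  have h4 := q.four_nm x
  by_cases h : q.im x = 0
  · have h' : q.re x ≠ 0 := fun h' => hx (by
      rw [q.ext_iff, q.re_zero, q.im_zero]; exact ⟨h', h⟩)
    rw [h] at h4
    have := pow_pos (abs_pos.mpr h') 2
    rw [sq_abs] at this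
    nlinarith
  · have := pow_pos (abs_pos.mpr h) 2
    rw [sq_abs] at this
    nlinarith [sq_nonneg (2 * q.re x + t * q.im x)]

lemma nm_eq_one_of_isUnit (hd : t ^ 2 - 4 * m < 0) {x : O} (hx : IsUnit x) (h0 : x ≠ 0) :
    q.nm x = 1 := by
  obtain ⟨y, hy⟩ := hx.exists_right_inv
  have h := congrArg q.nm hy
  rw [nm_mul] at h
  have h1 : q.nm 1 = 1 := by simpa using q.nm_intCast 1
  rw [h1] at h
  have := q.nm_pos hd h0
  rcases Int.eq_one_or_neg_one_of_mul_eq_one h with h' | h' <;> omega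

include q in
lemma eq_one_or_neg_one_of_isUnit (hd : t ^ 2 - 4 * m < -4) {x : O} (hx : IsUnit x)
    (h0 : x ≠ 0) : x = 1 ∨ x = -1 := by
  have h1 := q.nm_eq_one_of_isUnit (by linarith) hx h0
  have h4 := q.four_nm x
  have him : q.im x = 0 := by
    by_contra h
    have := pow_pos (abs_pos.mpr h) 2
    rw [sq_abs] at this
    nlinarith [sq_nonneg (2 * q.re x + t * q.im x)]
  have hre : q.re x ^ 2 = 1 := by rw [nm, him] at h1; linarith
  rcases sq_eq_one_iff.mp hre with h | h
  · left; rw [q.ext_iff, re_one, im_one]; exact ⟨h, him⟩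
  · right; rw [q.ext_iff, re_neg, im_neg, re_one, im_one]; exact ⟨h, by simpa using him⟩

/-- The ideal `(A, k + τ)`. -/
def idl (A k : ℤ) : Ideal O := Ideal.span {(A : O), (k : O) + q.τ}

lemma mem_idl {A k C : ℤ} (h : k ^ 2 + t * k + m = A * C) {x : O} :
    x ∈ q.idl A k ↔ A ∣ q.re x - k * q.im x := by
  constructor
  · intro hx
    refine Submodule.span_induction (p := fun x _ => A ∣ q.re x - k * q.im x) ?_ ?_ ?_ ?_ hx
    · rintro y (rfl | rfl)
      · simp [re_intCast, im_intCast]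
      · simp [re_add, im_add, re_intCast, im_intCast, re_τ, im_τ]
    · simp [re_zero, im_zero]
    · intro x y _ _ h1 h2
      rw [re_add, im_add]
      have := dvd_add h1 h2
      rwa [show q.re x - k * q.im x + (q.re y - k * q.im y)
        = q.re x + q.re y - k * (q.im x + q.im y) by ring] at this
    · intro a x _ ⟨w, hw⟩
      rw [smul_eq_mul, re_mul, im_mul]
      refine ⟨q.re a * w - k * q.im a * w - C * (q.im a * q.im x), ?_⟩
      linear_combination (q.re a - k * q.im a) * hw - (q.im a * q.im x) * h
  · rintro ⟨w, hw⟩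
    have : x = w * (A : O) + q.im x * ((k : O) + q.τ) := by
      have hw' : (q.re x : O) = A * w + k * q.im x := by
        rw [show q.re x = A * w + k * q.im x by linarith]
        push_cast; rfl
      conv_lhs => rw [q.eta x, hw']
      ring
    rw [this]
    exact Ideal.mem_span_pair.mpr ⟨_, _, rfl⟩

end QuadBasis

lemma span_pair_pow_three {O : Type*} [CommRing O] (a b : O) :
    Ideal.span {a, b} ^ 3 = Ideal.span {a ^ 3, a ^ 2 * b, a * b ^ 2, b ^ 3} := by
  rw [pow_succ, pow_two, Ideal.span_mul_span', Ideal.span_mul_span']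
  congr 1
  ext x
  simp only [Set.insert_eq, Set.union_mul, Set.mul_union, Set.singleton_mul_singleton,
    Set.mem_union, Set.mem_singleton_iff]
  ring_nf
  tauto

namespace QuadBasis

variable {O : Type*} [CommRing O] {t m : ℤ} (q : QuadBasis O t m)

lemma mul_conj {A k C : ℤ} (h : k ^ 2 + t * k + m = A * C) :
    ((k : O) + q.τ) * q.σ ((k : O) + q.τ) = (A : O) * C := by
  rw [q.mul_σ, nm]
  simp only [re_add, im_add, re_intCast, im_intCast, re_τ, im_τ]
  rw [← Int.cast_mul, ← h]; congr 1; ring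

lemma idl_mul_map {A k C : ℤ} (h : k ^ 2 + t * k + m = A * C)
    (hp : ∃ x y z : ℤ, x * A + y * (2 * k + t) + z * C = 1) :
    q.idl A k * (q.idl A k).map q.σ = Ideal.span {(A : O)} := by
  have hc := q.mul_conj h
  rw [idl, Ideal.map_span, Set.image_pair, Ideal.span_pair_mul_span_pair, map_intCast, hc]
  apply le_antisymm
  · rw [Ideal.span_le]
    rintro x (rfl | rfl | rfl | rfl) <;> rw [SetLike.mem_coe, Ideal.mem_span_singleton]
    · exact dvd_mul_right _ _
    · exact dvd_mul_right _ _
    · exact dvd_mul_left _ _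
    · exact dvd_mul_right _ _
  · rw [Ideal.span_singleton_le_iff_mem]
    obtain ⟨x, y, z, hxyz⟩ := hp
    have : (A : O) = x * (A * A) + (y * (A * q.σ ((k : O) + q.τ)) + (y * (((k : O) + q.τ) * A)
        + z * (A * C))) := by
      have := congrArg (Int.cast : ℤ → O) hxyz
      push_cast at this
      rw [map_add, map_intCast, q.σ_τ]
      linear_combination (-(A : O)) * this
    refine (congrArg (· ∈ _) this).mpr (Ideal.add_mem _ ?_ (Ideal.add_mem _ ?_ (Ideal.add_mem _ ?_ ?_))) <;>
      exact Ideal.mul_mem_left _ _ (Ideal.subset_span (by simp))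

lemma idl_shift {A k C : ℤ} (h : k ^ 2 + t * k + m = A * C) (r : ℤ) :
    q.idl A (k + A * r) = q.idl A k := by
  have h' : (k + A * r) ^ 2 + t * (k + A * r) + m
      = A * (C + 2 * k * r + A * r ^ 2 + t * r) := by linear_combination h
  ext x
  rw [q.mem_idl h', q.mem_idl h]
  rw [show q.re x - (k + A * r) * q.im x = q.re x - k * q.im x - A * (r * q.im x) by ring]
  exact dvd_sub_left (dvd_mul_right _ _) |>.trans Iff.rfl

lemma idl_swap {A k C : ℤ} (h : k ^ 2 + t * k + m = A * C) :
    Ideal.span {q.σ ((k : O) + q.τ)} * q.idl A k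
      = Ideal.span {(A : O)} * q.idl C (-k - t) := by
  have hc := q.mul_conj h
  rw [idl, idl, Ideal.span_mul_span', Ideal.span_mul_span']
  have e : q.σ ((k : O) + q.τ) * A = -(A * (((-k - t : ℤ) : O) + q.τ)) := by
    rw [map_add, map_intCast, q.σ_τ]; push_cast; ring
  simp only [Set.singleton_mul, Set.image_pair]
  rw [mul_comm (q.σ _) ((k : O) + q.τ), hc, e]
  apply le_antisymm <;> rw [Ideal.span_le]
  · rintro x (rfl | rfl)
    · exact neg_mem (Ideal.subset_span (by simp))
    · exact Ideal.subset_span (by simp)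
  · rintro x (rfl | rfl)
    · exact Ideal.subset_span (by simp)
    · rw [SetLike.mem_coe, ← neg_mem_iff]
      exact Ideal.subset_span (by simp)

lemma exists_idl (hd : t ^ 2 - 4 * m < 0) (J : Ideal O) (hJ : J ≠ ⊥) :
    ∃ c A k C : ℤ, 0 < c ∧ 0 < A ∧ k ^ 2 + t * k + m = A * C ∧
      J = Ideal.span {(c : O)} * q.idl A k := by
  obtain ⟨x, hxJ, hx0⟩ := Submodule.exists_mem_ne_zero_of_ne_bot hJ
  set Z : Ideal ℤ := J.comap (Int.castRingHom O) with hZ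
  obtain ⟨N, hN⟩ := (IsPrincipalIdealRing.principal Z).principal
  have memZ : ∀ u : ℤ, (u : O) ∈ J ↔ N ∣ u := by
    intro u
    rw [← Ideal.mem_span_singleton, ← Ideal.submodule_span_eq, ← hN]
    rfl
  set Y : Ideal ℤ :=
    { carrier := {v | ∃ y ∈ J, q.im y = v}
      add_mem' := by
        rintro _ _ ⟨y, hy, rfl⟩ ⟨z, hz, rfl⟩
        exact ⟨y + z, add_mem hy hz, q.im_add y z⟩
      zero_mem' := ⟨0, zero_mem _, q.im_zero⟩
      smul_mem' := by
        rintro a _ ⟨y, hy, rfl⟩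
        refine ⟨a * y, Ideal.mul_mem_left _ _ hy, ?_⟩
        rw [q.im_mul, q.re_intCast, q.im_intCast]; simp } with hY
  obtain ⟨c, hc⟩ := (IsPrincipalIdealRing.principal Y).principal
  have memY : ∀ y ∈ J, c ∣ q.im y := by
    intro y hy
    rw [← Ideal.mem_span_singleton, ← Ideal.submodule_span_eq, ← hc]
    exact ⟨y, hy, rfl⟩
  have hcY : c ∈ Y := by rw [hc]; exact Submodule.mem_span_singleton_self c
  obtain ⟨β, hβJ, hβc⟩ := hcY
  have hnm : ∀ y ∈ J, N ∣ q.nm y := by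
    intro y hy
    rw [← memZ, ← q.mul_σ]
    exact Ideal.mul_mem_right _ _ hy
  have hN0 : N ≠ 0 := by
    rintro rfl
    have := hnm x hxJ
    rw [zero_dvd_iff] at this
    exact (q.nm_pos hd hx0).ne' this
  have hNJ : (N : O) ∈ J := (memZ N).mpr dvd_rfl
  have hcN : c ∣ N := by
    have := memY _ (Ideal.mul_mem_right q.τ _ hNJ)
    rwa [q.im_mul, q.re_intCast, q.im_intCast, q.im_τ, q.re_τ, mul_one, zero_mul, zero_mul,
      mul_zero, add_zero, add_zero] at this
  have hc0 : c ≠ 0 := by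
    rintro rfl
    exact hN0 (zero_dvd_iff.mp hcN)
  have hcb : c ∣ q.re β := by
    have := memY _ (Ideal.mul_mem_right q.τ _ hβJ)
    rw [q.im_mul, q.im_τ, q.re_τ, hβc] at this
    have h2 : q.re β = (q.re β * 1 + c * 0 + t * (c * 1)) - c * t := by ring
    rw [h2]
    exact dvd_sub this (dvd_mul_right _ _)
  obtain ⟨k, hk⟩ := hcb
  obtain ⟨A, hA⟩ := hcN
  have hA0 : A ≠ 0 := by rintro rfl; simp [hN0] at hA
  have hβ : β = c * ((k : O) + q.τ) := by
    rw [q.eta β, hk, hβc]; push_cast; ring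
  obtain ⟨C, hC⟩ : A ∣ k ^ 2 + t * k + m := by
    have h1 : (c * (k ^ 2 + t * k + m) : ℤ) = q.nm β / c := by
      rw [nm, hk, hβc]
      rw [show (c * k) ^ 2 + t * (c * k * c) + m * c ^ 2 = c * (c * (k ^ 2 + t * k + m)) by ring,
        Int.mul_ediv_cancel_left _ hc0]
    have h2 : ((c * (k ^ 2 + t * k + m) : ℤ) : O) ∈ J := by
      have : ((c * (k ^ 2 + t * k + m) : ℤ) : O) = β * q.σ ((k : O) + q.τ) := by
        rw [hβ, mul_assoc, q.mul_σ, nm]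
        simp only [re_add, im_add, re_intCast, im_intCast, re_τ, im_τ]
        push_cast; ring
      rw [this]
      exact Ideal.mul_mem_right _ _ hβJ
    rw [memZ, hA] at h2
    exact Int.dvd_of_mul_dvd_mul_left hc0 h2
  have hJeq : J = Ideal.span {(c : O)} * q.idl A k := by
    apply le_antisymm
    · intro y hy
      obtain ⟨v, hv⟩ := memY y hy
      rw [Ideal.mem_span_singleton_mul]
      have h1 : y - v * β ∈ J := sub_mem hy (Ideal.mul_mem_left _ _ hβJ)
      have h2 : y - v * β = ((q.re y - v * (c * k) : ℤ) : O) := by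
        conv_lhs => rw [q.eta y, q.eta β, hk, hβc, hv]
        push_cast; ring
      rw [h2, memZ] at h1
      obtain ⟨u, hu⟩ := h1
      refine ⟨u * A + v * (k + q.τ), Ideal.mem_span_pair.mpr ⟨u, v, rfl⟩, ?_⟩
      have h3 : y = v * β + ((N * u : ℤ) : O) := by rw [← hu, ← h2]; ring
      rw [h3, hβ, hA]; push_cast; ring
    · rw [idl, Ideal.span_mul_span', Set.singleton_mul, Set.image_pair, Ideal.span_le]
      rintro y (rfl | rfl)
      · rw [SetLike.mem_coe, ← Int.cast_mul, ← hA]; exact hNJ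
      · rw [SetLike.mem_coe]; simp only [← hβ]; exact hβJ
  have e1 : Ideal.span {(c : O)} = Ideal.span {((|c| : ℤ) : O)} := by
    rcases abs_choice c with h | h <;> rw [h]
    rw [Int.cast_neg, Ideal.span_singleton_neg]
  have e2 : q.idl A k = q.idl |A| k := by
    rcases abs_choice A with h | h <;> rw [h]
    rw [idl, idl, Int.cast_neg]
    rw [Ideal.span_insert, Ideal.span_insert, Ideal.span_singleton_neg]
  refine ⟨|c|, |A|, k, SignType.sign A * C, abs_pos.mpr hc0, abs_pos.mpr hA0, ?_, ?_⟩
  · rw [hC, ← mul_assoc, mul_comm |A|, sign_mul_abs]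
  · rw [← e1, ← e2, hJeq]

end QuadBasis

namespace QuadBasis

variable {O : Type*} [CommRing O] {t m : ℤ} (q : QuadBasis O t m)

include q in
lemma idl_ne_bot {A : ℤ} (k : ℤ) (hA : A ≠ 0) : q.idl A k ≠ ⊥ := by
  intro h
  have : (A : O) ∈ q.idl A k := Ideal.subset_span (by simp)
  rw [h, Ideal.mem_bot] at this
  exact q.intCast_ne_zero hA this

/-- The first element of the cubic resolvent of a form with Hessian proportional to
`(A, 2k + t, C)`. -/
def wt (A k : ℤ) (f : Fin 4 → ℤ) : O := ((A * f 1 - (k + t) * f 0 : ℤ) : O) + (f 0 : O) * q.τ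

lemma wt_neg (A k : ℤ) (f : Fin 4 → ℤ) : q.wt A k (-f) = -q.wt A k f := by
  simp only [wt, Pi.neg_apply]; push_cast; ring

/-- The Hessian of `f` is `n` times the quadratic form `(A, 2k + t, C)`, of discriminant
`t² - 4m`. -/
structure HessEq (t m n : ℤ) (f : Fin 4 → ℤ) (A k C : ℤ) : Prop where
  pos : 0 < A
  norm : k ^ 2 + t * k + m = A * C
  eqA : hA f = n * A
  eqB : hB f = n * (2 * k + t)
  eqC : hC f = n * C

lemma HessEq.nm_wt {n : ℤ} {f : Fin 4 → ℤ} {A k C : ℤ} (hn : n ≠ 0)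
    (h : HessEq t m n f A k C) : q.nm (q.wt A k f) = n * A ^ 3 := by
  obtain ⟨-, h1, hA, hB, hC⟩ := h
  have e : q.nm (q.wt A k f) = A * (A * f 1 ^ 2 - (2 * k + t) * f 1 * f 0 + C * f 0 ^ 2) := by
    rw [nm, wt, re_mk, im_mk]; linear_combination (f 0 ^ 2) * h1
  have e2 : n * (A * f 1 ^ 2 - (2 * k + t) * f 1 * f 0 + C * f 0 ^ 2) = (n * A) ^ 2 := by
    have : n * (A * f 1 ^ 2 - (2 * k + t) * f 1 * f 0 + C * f 0 ^ 2)
      = DH.hA f * f 1 ^ 2 - DH.hB f * f 1 * f 0 + DH.hC f * f 0 ^ 2 := by rw [hA, hB, hC]; ring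
    rw [this, ← hA]; simp only [DH.hA, DH.hB, DH.hC]; ring
  apply mul_left_cancel₀ hn
  rw [e]; linear_combination A * e2

/-- The elements of the cubic resolvent. -/
def wts (A k C : ℤ) (f : Fin 4 → ℤ) : Fin 4 → O :=
  ![q.wt A k f, ((k * f 1 - C * f 0 : ℤ) : O) + (f 1 : O) * q.τ,
    ((k * f 2 - C * f 1 : ℤ) : O) + (f 2 : O) * q.τ, ((k * f 3 - C * f 2 : ℤ) : O) + (f 3 : O) * q.τ]

lemma HessEq.syz {n : ℤ} {f : Fin 4 → ℤ} {A k C : ℤ} (hn : n ≠ 0)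
    (h : HessEq t m n f A k C) : A * f 2 - (2 * k + t) * f 1 + C * f 0 = 0 ∧
      A * f 3 - (2 * k + t) * f 2 + C * f 1 = 0 := by
  have h1 := syzygy_left f
  have h2 := syzygy_right f
  rw [h.eqA, h.eqB, h.eqC] at h1 h2
  constructor <;> apply mul_left_cancel₀ hn <;> linarith

lemma HessEq.wts_mul {n : ℤ} {f : Fin 4 → ℤ} {A k C : ℤ} (hn : n ≠ 0)
    (h : HessEq t m n f A k C) :
    (A : O) * q.wts A k C f 1 = ((k : O) + q.τ) * q.wts A k C f 0 ∧
    (A : O) * q.wts A k C f 2 = ((k : O) + q.τ) * q.wts A k C f 1 ∧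
    (A : O) * q.wts A k C f 3 = ((k : O) + q.τ) * q.wts A k C f 2 := by
  obtain ⟨s1, s2⟩ := h.syz hn
  have hn := h.norm
  simp only [wts, wt, Matrix.cons_val]
  refine ⟨?_, ?_, ?_⟩ <;> rw [q.ext_iff] <;>
    simp only [re_mul, im_mul, re_add, im_add, re_intCast, im_intCast, re_τ, im_τ] <;>
    constructor
  · linear_combination f 0 * hn
  · ring
  · linear_combination k * s1 + f 1 * hn
  · linear_combination s1
  · linear_combination k * s2 + f 2 * hn
  · linear_combination s2

lemma HessEq.span_wts {n : ℤ} {f : Fin 4 → ℤ} {A k C : ℤ} (hn : n ≠ 0)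
    (h : HessEq t m n f A k C) :
    Ideal.span {(A : O) ^ 3} * Ideal.span (Set.range (q.wts A k C f))
      = Ideal.span {q.wt A k f} * q.idl A k ^ 3 := by
  obtain ⟨w1, w2, w3⟩ := h.wts_mul q hn
  have e0 : q.wt A k f = q.wts A k C f 0 := rfl
  have hr : Set.range (q.wts A k C f) = {q.wts A k C f 0, q.wts A k C f 1, q.wts A k C f 2,
      q.wts A k C f 3} := by
    ext x
    simp only [Set.mem_range, Fin.exists_fin_succ, Set.mem_insert_iff,
      Set.mem_singleton_iff]
    simp [eq_comm]
  rw [e0, hr, idl, span_pair_pow_three, Ideal.span_mul_span', Ideal.span_mul_span',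
    Set.singleton_mul, Set.singleton_mul]
  simp only [Set.image_insert_eq, Set.image_singleton]
  congr 2
  · ring
  congr 1
  · linear_combination (A : O) ^ 2 * w1
  congr 1
  · linear_combination (A : O) ^ 2 * w2 + ((k : O) + q.τ) * A * w1
  congr 1
  linear_combination (A : O) ^ 2 * w3 + ((k : O) + q.τ) * A * w2 + ((k : O) + q.τ) ^ 2 * w1

/-- The correspondence between binary cubic forms and pairs `(c, M)` with `c³ = [M]`. -/
def Rel [IsDedekindDomain O] (n : ℤ) (f : Fin 4 → ℤ) (c : ClassGroup O)
    (M : (Ideal O)⁰) : Prop :=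
  ∃ A k C, HessEq t m n f A k C ∧ (∃ h, ClassGroup.mk0 ⟨q.idl A k, h⟩ = c) ∧
    Ideal.span {(A : O) ^ 3} * M = Ideal.span {q.wt A k f} * q.idl A k ^ 3

variable [IsDedekindDomain O]

variable {q}

lemma HessEq.unique {n : ℤ} {f : Fin 4 → ℤ} {A k C A' k' C' : ℤ} (hn : n ≠ 0)
    (h : HessEq t m n f A k C) (h' : HessEq t m n f A' k' C') : A = A' ∧ k = k' ∧ C = C' := by
  refine ⟨?_, ?_, ?_⟩
  · exact mul_left_cancel₀ hn (h.eqA.symm.trans h'.eqA)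
  · have := mul_left_cancel₀ hn (h.eqB.symm.trans h'.eqB)
    linarith
  · exact mul_left_cancel₀ hn (h.eqC.symm.trans h'.eqC)

lemma Rel.unique {n : ℤ} {f : Fin 4 → ℤ} {c c' : ClassGroup O} {M M' : (Ideal O)⁰} (hn : n ≠ 0)
    (h : q.Rel n f c M) (h' : q.Rel n f c' M') : c = c' ∧ M = M' := by
  obtain ⟨A, k, C, h1, ⟨_, h2⟩, h3⟩ := h
  obtain ⟨A', k', C', h1', ⟨_, h2'⟩, h3'⟩ := h'
  obtain ⟨rfl, rfl, rfl⟩ := h1.unique hn h1'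
  refine ⟨h2.symm.trans h2', Subtype.ext ?_⟩
  exact (Ideal.span_singleton_mul_right_inj
    (pow_ne_zero 3 (q.intCast_ne_zero h1.pos.ne'))).mp (h3.trans h3'.symm)

lemma Rel.neg {n : ℤ} {f : Fin 4 → ℤ} {c : ClassGroup O} {M : (Ideal O)⁰}
    (h : q.Rel n f c M) : q.Rel n (-f) c M := by
  obtain ⟨A, k, C, h1, h2, h3⟩ := h
  refine ⟨A, k, C, ⟨h1.pos, h1.norm, ?_, ?_, ?_⟩, h2, ?_⟩
  · rw [hA_neg, h1.eqA]
  · rw [hB_neg, h1.eqB]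
  · rw [hC_neg, h1.eqC]
  · rw [wt_neg, Ideal.span_singleton_neg, h3]

end QuadBasis

namespace QuadBasis

variable {O : Type*} [CommRing O] [IsDedekindDomain O] {t m : ℤ} (q : QuadBasis O t m)

lemma exists_reduced (hd : t ^ 2 - 4 * m < 0) (c : ClassGroup O) :
    ∃ A k C : ℤ, 0 < A ∧ k ^ 2 + t * k + m = A * C ∧ -A < 2 * k + t ∧ 2 * k + t ≤ A ∧ A ≤ C ∧
      ∃ h, ClassGroup.mk0 ⟨q.idl A k, h⟩ = c := by
  classical
  let P : ℕ → Prop := fun a => 0 < a ∧ ∃ k C : ℤ, k ^ 2 + t * k + m = a * C ∧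
    ∃ h, ClassGroup.mk0 ⟨q.idl a k, h⟩ = c
  have hP : ∃ a, P a := by
    obtain ⟨J, rfl⟩ := ClassGroup.mk0_surjective c
    obtain ⟨e, A, k, C, he, hA, hC, hJ⟩ := q.exists_idl hd J (nonZeroDivisors.coe_ne_zero J)
    refine ⟨A.toNat, by omega, k, C, ?_, ?_⟩
    · rw [Int.toNat_of_nonneg hA.le, hC]
    · rw [Int.toNat_of_nonneg hA.le]
      refine ⟨mem_nonZeroDivisors_of_ne_zero (q.idl_ne_bot k hA.ne'), ?_⟩
      rw [ClassGroup.mk0_eq_mk0_iff]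
      refine ⟨e, 1, q.intCast_ne_zero he.ne', one_ne_zero, ?_⟩
      rw [Ideal.span_singleton_one, Ideal.one_eq_top.symm, one_mul]
      exact hJ.symm
  obtain ⟨ha, k, C, hC, h, hc⟩ := Nat.find_spec hP
  have hmin := fun b => Nat.find_min' hP (m := b)
  set A : ℤ := (Nat.find hP : ℤ) with hAdef
  have hA : 0 < A := Int.natCast_pos.mpr ha
  set r : ℤ := -((2 * k + t + A - 1) / (2 * A)) with hr
  have h2 : (0 : ℤ) < 2 * A := by linarith
  have e1 := Int.mul_ediv_add_emod (2 * k + t + A - 1) (2 * A)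
  have e2 := Int.emod_nonneg (2 * k + t + A - 1) h2.ne'
  have e3 := Int.emod_lt_of_pos (2 * k + t + A - 1) h2
  have hk1 : 2 * (k + A * r) + t = (2 * k + t + A - 1) % (2 * A) - A + 1 := by
    rw [hr]; linarith
  set k' := k + A * r with hk'
  set C' := C + 2 * k * r + A * r ^ 2 + t * r with hC'
  have hn : k' ^ 2 + t * k' + m = A * C' := by rw [hk', hC']; linear_combination hC
  have hi : q.idl A k' = q.idl A k := q.idl_shift hC r
  have hcl : ClassGroup.mk0 ⟨q.idl A k', hi ▸ h⟩ = c := by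
    rw [← hc]; congr 1; exact Subtype.ext hi
  refine ⟨A, k', C', hA, hn, by linarith, by linarith, ?_, hi ▸ h, hcl⟩
  have hC'0 : 0 < C' := by
    have : 0 < A * C' := by rw [← hn]; nlinarith [sq_nonneg (2 * k' + t)]
    exact pos_of_mul_pos_right this hA.le
  have hle : Nat.find hP ≤ C'.toNat := by
    apply hmin
    refine ⟨by omega, -k' - t, A, ?_, ?_⟩
    · rw [Int.toNat_of_nonneg hC'0.le]; linear_combination hn
    · rw [Int.toNat_of_nonneg hC'0.le]
      refine ⟨mem_nonZeroDivisors_of_ne_zero (q.idl_ne_bot _ hC'0.ne'), ?_⟩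
      rw [← hcl, ClassGroup.mk0_eq_mk0_iff]
      refine ⟨A, q.σ (k' + q.τ), q.intCast_ne_zero hA.ne', ?_, (q.idl_swap hn).symm⟩
      intro h0
      have := congrArg q.im h0
      rw [q.im_σ, q.im_add, q.im_intCast, q.im_τ, q.im_zero] at this
      norm_num at this
  omega

variable {q}

lemma HessEq.exists_rel {n : ℤ} (hn : 0 < n) {f : Fin 4 → ℤ} {A k C : ℤ}
    (h : HessEq t m n f A k C)
    (hp : ∃ x y z : ℤ, x * A + y * (2 * k + t) + z * C = 1) :
    ∃ c M, q.Rel n f c M ∧ (M : Ideal O) * (M : Ideal O).map q.σ = Ideal.span {(n : O)} ∧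
      c ^ 3 = ClassGroup.mk0 M := by
  have hA := q.intCast_ne_zero h.pos.ne'
  have hM := h.span_wts q hn.ne'
  set M := Ideal.span (Set.range (q.wts A k C f))
  have hw : q.wt A k f ≠ 0 := by
    intro h0
    have := h.nm_wt q hn.ne'
    rw [h0] at this
    have h1 : q.nm 0 = 0 := by simp [nm, re_zero, im_zero]
    have := pow_pos h.pos 3
    nlinarith
  have hI := q.idl_ne_bot k h.pos.ne'
  have hM0 : M ≠ ⊥ := by
    rintro h0
    rw [h0, Ideal.mul_bot, eq_comm, Ideal.mul_eq_bot] at hM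
    rcases hM with hM | hM
    · exact hw (by simpa using hM)
    · exact hI (pow_eq_zero_iff three_ne_zero |>.mp hM)
  refine ⟨ClassGroup.mk0 ⟨_, mem_nonZeroDivisors_of_ne_zero hI⟩,
    ⟨M, mem_nonZeroDivisors_of_ne_zero hM0⟩, ⟨A, k, C, h, ⟨_, rfl⟩, hM⟩, ?_, ?_⟩
  · have e := congrArg (fun J => J * J.map q.σ) hM
    simp only [Ideal.map_mul, Ideal.map_pow, Ideal.map_span, Set.image_singleton, map_pow,
      map_intCast] at e
    rw [mul_mul_mul_comm, mul_mul_mul_comm (Ideal.span {q.wt A k f}), ← mul_pow,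
      q.idl_mul_map h.norm hp, Ideal.span_singleton_mul_span_singleton,
      Ideal.span_singleton_mul_span_singleton, Ideal.span_singleton_pow, q.mul_σ,
      h.nm_wt q hn.ne', Ideal.span_singleton_mul_span_singleton] at e
    have e2 : (((n * A ^ 3 : ℤ) : O) * (A : O) ^ 3) = (A : O) ^ 3 * (A : O) ^ 3 * n := by
      push_cast; ring
    rw [e2, ← Ideal.span_singleton_mul_span_singleton _ (n : O)] at e
    exact (Ideal.span_singleton_mul_right_inj
      (mul_ne_zero (pow_ne_zero 3 hA) (pow_ne_zero 3 hA))).mp e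
  · rw [← map_pow, ClassGroup.mk0_eq_mk0_iff]
    exact ⟨_, _, hw, pow_ne_zero 3 hA, hM.symm⟩

end QuadBasis

namespace QuadBasis

variable {O : Type*} [CommRing O] [IsDedekindDomain O] {t m : ℤ} (q : QuadBasis O t m)

include q in
lemma eq_of_span_intCast_eq (hd : t ^ 2 - 4 * m < 0) {u v : ℤ} (hu : 0 < u) (hv : 0 < v)
    (h : Ideal.span {(u : O)} = Ideal.span {(v : O)}) : u = v := by
  obtain ⟨w, hw⟩ := Ideal.span_singleton_eq_span_singleton.mp h
  have h1 := congrArg q.nm hw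
  rw [nm_mul, nm_intCast, nm_intCast, q.nm_eq_one_of_isUnit hd w.isUnit w.ne_zero, mul_one] at h1
  nlinarith

lemma exists_rel_of_idl (hd : t ^ 2 - 4 * m < 0) {n : ℤ} (hn : 0 < n) (M : (Ideal O)⁰)
    (hM : (M : Ideal O) * (M : Ideal O).map q.σ = Ideal.span {(n : O)}) {A k C : ℤ}
    (hA : 0 < A) (hk : k ^ 2 + t * k + m = A * C)
    (hp : ∃ x y z : ℤ, x * A + y * (2 * k + t) + z * C = 1)
    (h : q.idl A k ∈ (Ideal O)⁰) (hc : ClassGroup.mk0 ⟨q.idl A k, h⟩ ^ 3 = ClassGroup.mk0 M) :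
    ∃ f, q.Rel n f (ClassGroup.mk0 ⟨q.idl A k, h⟩) M ∧ HessEq t m n f A k C := by
  rw [← map_pow, ClassGroup.mk0_eq_mk0_iff] at hc
  obtain ⟨x, y, hx, hy, hxy⟩ := hc
  have hA0 : (A : O) ≠ 0 := q.intCast_ne_zero hA.ne'
  replace hxy : Ideal.span {x} * q.idl A k ^ 3 = Ideal.span {y} * (M : Ideal O) := hxy
  have hmem : ∀ z ∈ q.idl A k ^ 3, ∃ w, x * z = y * w := by
    intro z hz
    have : x * z ∈ Ideal.span {y} * (M : Ideal O) := by
      rw [← hxy]; exact Ideal.mul_mem_mul (Ideal.mem_span_singleton_self x) hz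
    obtain ⟨w, -, hw⟩ := Ideal.mem_span_singleton_mul.mp this
    exact ⟨w, hw.symm⟩
  rw [idl, span_pair_pow_three] at hmem
  set β : O := (k : O) + q.τ with hβ
  obtain ⟨w0, h0⟩ := hmem _ (Ideal.subset_span (Set.mem_insert _ _))
  obtain ⟨w1, h1⟩ := hmem _ (Ideal.subset_span (Set.mem_insert_of_mem _ (Set.mem_insert _ _)))
  obtain ⟨w2, h2⟩ := hmem _ (Ideal.subset_span (Set.mem_insert_of_mem _
    (Set.mem_insert_of_mem _ (Set.mem_insert _ _))))
  obtain ⟨w3, h3⟩ := hmem _ (Ideal.subset_span (Set.mem_insert_of_mem _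
    (Set.mem_insert_of_mem _ (Set.mem_insert_of_mem _ rfl))))
  have r1 : (A : O) * w1 = β * w0 := by
    apply mul_left_cancel₀ hy; linear_combination β * h0 - A * h1
  have r2 : (A : O) * w2 = β * w1 := by
    apply mul_left_cancel₀ hy; linear_combination β * h1 - A * h2
  have r3 : (A : O) * w3 = β * w2 := by
    apply mul_left_cancel₀ hy; linear_combination β * h2 - A * h3
  rw [q.ext_iff] at r1 r2 r3
  simp only [hβ, re_mul, im_mul, re_add, im_add, re_intCast, im_intCast, re_τ, im_τ] at r1 r2 r3
  obtain ⟨f, hf0, hf1, hf2, hf3⟩ : ∃ f : Fin 4 → ℤ, f 0 = q.im w0 ∧ f 1 = q.im w1 ∧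
      f 2 = q.im w2 ∧ f 3 = q.im w3 := ⟨![q.im w0, q.im w1, q.im w2, q.im w3], rfl, rfl, rfl, rfl⟩
  rw [← hf0, ← hf1] at r1
  rw [← hf1, ← hf2] at r2
  rw [← hf2, ← hf3] at r3
  have e0 : q.re w0 = A * f 1 - (k + t) * f 0 := by linarith [r1.2]
  have e1 : q.re w1 = A * f 2 - (k + t) * f 1 := by linarith [r2.2]
  have e2 : q.re w2 = A * f 3 - (k + t) * f 2 := by linarith [r3.2]
  have s1 : A * f 2 - (2 * k + t) * f 1 + C * f 0 = 0 := by
    apply mul_left_cancel₀ hA.ne'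
    have := r1.1
    rw [e0, e1] at this
    linear_combination this - f 0 * hk
  have s2 : A * f 3 - (2 * k + t) * f 2 + C * f 1 = 0 := by
    apply mul_left_cancel₀ hA.ne'
    have := r2.1
    rw [e1, e2] at this
    linear_combination this - f 1 * hk
  have hwt : w0 = q.wt A k f := by
    rw [q.eta w0, e0, ← hf0, wt]
  have hid : Ideal.span {(A : O) ^ 3} * M = Ideal.span {q.wt A k f} * q.idl A k ^ 3 := by
    have hy' : Ideal.span {y} ≠ ⊥ := by simpa using hy
    apply mul_left_cancel₀ hy'
    calc Ideal.span {y} * (Ideal.span {(A : O) ^ 3} * M)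
        = Ideal.span {x * (A : O) ^ 3} * q.idl A k ^ 3 := by
          rw [mul_left_comm, ← hxy, ← mul_assoc, Ideal.span_singleton_mul_span_singleton,
            mul_comm x]
      _ = _ := by rw [h0, hwt, ← Ideal.span_singleton_mul_span_singleton, mul_assoc]
  have hwt0 : q.wt A k f ≠ 0 := by
    rw [← hwt]; rintro rfl
    rw [mul_zero] at h0
    exact mul_ne_zero hx (pow_ne_zero 3 hA0) h0
  have hnm : q.nm (q.wt A k f) = n * A ^ 3 := by
    refine q.eq_of_span_intCast_eq hd (q.nm_pos hd hwt0) (by positivity) ?_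
    have e := congrArg (fun J => J * J.map q.σ) hid
    simp only [Ideal.map_mul, Ideal.map_pow, Ideal.map_span, Set.image_singleton, map_pow,
      map_intCast] at e
    rw [mul_mul_mul_comm, mul_mul_mul_comm (Ideal.span {q.wt A k f}), ← mul_pow,
      q.idl_mul_map hk hp, Ideal.span_singleton_mul_span_singleton,
      Ideal.span_singleton_mul_span_singleton, Ideal.span_singleton_pow, q.mul_σ, hM,
      Ideal.span_singleton_mul_span_singleton, Ideal.span_singleton_mul_span_singleton] at e
    have e2 : (A : O) ^ 3 * (A : O) ^ 3 * n = (A : O) ^ 3 * ((n * A ^ 3 : ℤ) : O) := by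
      push_cast; ring
    rw [e2, mul_comm _ ((A : O) ^ 3), ← Ideal.span_singleton_mul_span_singleton,
      ← Ideal.span_singleton_mul_span_singleton _ (q.nm _ : O)] at e
    exact ((Ideal.span_singleton_mul_right_inj (pow_ne_zero 3 hA0)).mp e).symm
  have en : q.nm (q.wt A k f) = A * (A * f 1 ^ 2 - (2 * k + t) * f 1 * f 0 + C * f 0 ^ 2) := by
    rw [nm, wt, re_mk, im_mk]; linear_combination (f 0 ^ 2) * hk
  have en2 : A * f 1 ^ 2 - (2 * k + t) * f 1 * f 0 + C * f 0 ^ 2 = n * A ^ 2 := by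
    apply mul_left_cancel₀ hA.ne'; rw [← en, hnm]; ring
  have HA : DH.hA f = n * A := by
    apply mul_left_cancel₀ hA.ne'
    simp only [DH.hA]; linear_combination en2 - f 0 * s1
  have HB : DH.hB f = n * (2 * k + t) := by
    apply mul_left_cancel₀ hA.ne'
    simp only [DH.hA, DH.hB] at HA ⊢
    linear_combination f 1 * s1 - f 0 * s2 + (2 * k + t) * HA
  have HC : DH.hC f = n * C := by
    apply mul_left_cancel₀ hA.ne'
    simp only [DH.hA, DH.hC] at HA ⊢
    linear_combination f 2 * s1 - f 1 * s2 + C * HA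
  have hH : HessEq t m n f A k C := ⟨hA, hk, HA, HB, HC⟩
  exact ⟨f, ⟨A, k, C, hH, ⟨h, rfl⟩, hid⟩, hH⟩

/-- Rigidity: two strictly reduced forms with the same associated pair agree up to sign. -/
lemma eq_or_eq_neg_of_rel (hd : t ^ 2 - 4 * m < -4) {n : ℤ} (hn : 0 < n)
    (hprim : ∀ A B C : ℤ, B ^ 2 - 4 * A * C = t ^ 2 - 4 * m →
      ∃ x y z : ℤ, x * A + y * B + z * C = 1)
    {f f' : Fin 4 → ℤ} (hf : SRed f) (hf' : SRed f') {c : ClassGroup O} {M : (Ideal O)⁰}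
    (h : q.Rel n f c M) (h' : q.Rel n f' c M) : f' = f ∨ f' = -f := by
  obtain ⟨A, k, C, h1, ⟨g, h2⟩, h3⟩ := h
  obtain ⟨A', k', C', h1', ⟨g', h2'⟩, h3'⟩ := h'
  have hd0 : t ^ 2 - 4 * m < 0 := by linarith
  have hp := hprim A (2 * k + t) C (by linear_combination 4 * h1.norm)
  have hp' := hprim A' (2 * k' + t) C' (by linear_combination 4 * h1'.norm)
  obtain ⟨x, y, hx, hy, hxy⟩ := ClassGroup.mk0_eq_mk0_iff.mp (h2.trans h2'.symm)
  replace hxy : Ideal.span {x} * q.idl A k = Ideal.span {y} * q.idl A' k' := hxy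
  have hA := h1.pos
  have hA' := h1'.pos
  have hnx := q.nm_pos hd0 hx
  have hny := q.nm_pos hd0 hy
  have hN : q.nm x * A = q.nm y * A' := by
    refine q.eq_of_span_intCast_eq hd0 (by positivity) (by positivity) ?_
    have e := congrArg (fun J => J * J.map q.σ) hxy
    simp only [Ideal.map_mul, Ideal.map_span, Set.image_singleton] at e
    rw [mul_mul_mul_comm, mul_mul_mul_comm (Ideal.span {y}), 
      q.idl_mul_map h1.norm hp, q.idl_mul_map h1'.norm hp', Ideal.span_singleton_mul_span_singleton, q.mul_σ,
      Ideal.span_singleton_mul_span_singleton, Ideal.span_singleton_mul_span_singleton, q.mul_σ,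
      Ideal.span_singleton_mul_span_singleton] at e
    exact_mod_cast e
  -- coordinates of the generators of one ideal in terms of the other
  have key : ∀ z ∈ q.idl A k, ∃ u v : ℤ, x * z = y * (u * A' + v * (k' + q.τ)) := by
    intro z hz
    have : x * z ∈ Ideal.span {y} * q.idl A' k' := by
      rw [← hxy]; exact Ideal.mul_mem_mul (Ideal.mem_span_singleton_self x) hz
    obtain ⟨w, hw, e⟩ := Ideal.mem_span_singleton_mul.mp this
    obtain ⟨r, hr⟩ := (q.mem_idl h1'.norm).mp hw
    refine ⟨r, q.im w, ?_⟩
    have hre : (q.re w : O) = A' * r + k' * q.im w := by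
      rw [show q.re w = A' * r + k' * q.im w by linarith]; push_cast; rfl
    rw [← e]
    conv_lhs => rw [q.eta w, hre]
    ring
  obtain ⟨u0, v0, e0⟩ := key (A : O) (Ideal.subset_span (by simp))
  obtain ⟨u1, v1, e1⟩ := key ((k : O) + q.τ) (Ideal.subset_span (by simp))
  have nmc : ∀ u v : ℤ, q.nm (u * A' + v * (k' + q.τ)) =
      A' * (A' * u ^ 2 + (2 * k' + t) * u * v + C' * v ^ 2) := by
    intro u v
    simp only [nm, re_add, re_mul, im_add, im_mul, re_intCast, im_intCast, re_τ, im_τ]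
    linear_combination v ^ 2 * h1'.norm
  have hyA : q.nm y * A' ≠ 0 := by positivity
  have E0 : A = A' * u0 ^ 2 + (2 * k' + t) * u0 * v0 + C' * v0 ^ 2 := by
    have := congrArg q.nm e0
    rw [nm_mul, nm_mul, nmc, nm_intCast] at this
    apply mul_left_cancel₀ hyA
    linear_combination this - A * hN
  have nβ : q.nm ((k : O) + q.τ) = A * C := by
    rw [← h1.norm]; simp only [nm, re_add, im_add, re_intCast, im_intCast, re_τ, im_τ]; ring
  have E1 : C = A' * u1 ^ 2 + (2 * k' + t) * u1 * v1 + C' * v1 ^ 2 := by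
    have := congrArg q.nm e1
    rw [nm_mul, nm_mul, nmc, nβ] at this
    apply mul_left_cancel₀ hyA
    linear_combination this - C * hN
  have E2 : 2 * k + t = 2 * A' * u0 * u1 + (2 * k' + t) * (u0 * v1 + u1 * v0)
      + 2 * C' * v0 * v1 := by
    have h3 : x * ((A : O) + (k + q.τ)) = y * (((u0 + u1 : ℤ) : O) * A' +
        ((v0 + v1 : ℤ) : O) * (k' + q.τ)) := by push_cast; linear_combination e0 + e1
    have := congrArg q.nm h3
    have e4 : q.nm ((A : O) + (k + q.τ)) = A * (A + (2 * k + t) + C) := by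
      simp only [nm, re_add, im_add, re_intCast, im_intCast, re_τ, im_τ]
      linear_combination h1.norm
    rw [nm_mul, nm_mul, nmc, e4] at this
    apply mul_left_cancel₀ hyA
    linear_combination this - (A + (2 * k + t) + C) * hN - q.nm y * A' * E0 - q.nm y * A' * E1
  have hdet : u0 * v1 - u1 * v0 = 1 := by
    have h4 : (q.nm x : O) * (A * (k + q.τ)) = q.nm y *
        (q.σ (u0 * A' + v0 * (k' + q.τ)) * (u1 * A' + v1 * (k' + q.τ))) := by
      have h5 := congrArg q.σ e0
      rw [map_mul, map_mul q.σ y, map_intCast] at h5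
      rw [← q.mul_σ, ← q.mul_σ]
      linear_combination (q.σ x * A) * e1 + (y * (u1 * A' + v1 * (k' + q.τ))) * h5
    have h6 := congrArg q.im h4
    simp only [re_add, re_mul, im_add, im_mul, re_intCast, im_intCast, re_τ, im_τ, re_σ,
      im_σ] at h6
    apply mul_left_cancel₀ (mul_ne_zero hyA hA'.ne')
    linear_combination (-A') * h6 + A' * hN
  have red : ∀ {f : Fin 4 → ℤ} {A k C : ℤ}, SRed f → HessEq t m n f A k C →
      -A < 2 * k + t ∧ 2 * k + t ≤ A ∧ A < C := by
    rintro f A k C ⟨-, h1, h2, h3⟩ ⟨-, -, eA, eB, eC⟩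
    rw [eA, eB] at h1 h2
    rw [eA, eC] at h3
    exact ⟨lt_of_mul_lt_mul_left (by linarith) hn.le, le_of_mul_le_mul_left h2 hn,
      lt_of_mul_lt_mul_left h3 hn.le⟩
  obtain ⟨a1, a2, a3⟩ := red hf h1
  obtain ⟨b1, b2, b3⟩ := red hf' h1'
  have hg := eq_one_or_of_strictly_reduced !![u0, u1; v0, v1]
    (by rw [Matrix.det_fin_two_of]; linarith) hA' b1 b2 b3 hA a1 a2 a3
    (by simpa using E0) (by simpa using E2) (by simpa using E1)
  have hAk : A = A' ∧ 2 * k + t = 2 * k' + t ∧ C = C' := by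
    rcases hg with hg | hg <;>
    · have g00 := congrFun (congrFun hg 0) 0
      have g01 := congrFun (congrFun hg 0) 1
      have g10 := congrFun (congrFun hg 1) 0
      have g11 := congrFun (congrFun hg 1) 1
      simp at g00 g01 g10 g11
      rw [g00, g10] at E0
      rw [g00, g01, g10, g11] at E2
      rw [g01, g11] at E1
      exact ⟨by linarith, by linarith, by linarith⟩
  obtain ⟨rfl, hk, rfl⟩ := hAk
  obtain rfl : k = k' := by linarith
  have hω : Ideal.span {q.wt A k f} = Ideal.span {q.wt A k f'} := by
    have hI : q.idl A k ^ 3 ≠ ⊥ := pow_ne_zero 3 (q.idl_ne_bot k hA.ne')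
    exact mul_right_cancel₀ hI (h3.symm.trans h3')
  obtain ⟨w, hw⟩ := Ideal.span_singleton_eq_span_singleton.mp hω
  obtain ⟨s1, s2⟩ := h1.syz hn.ne'
  obtain ⟨s1', s2'⟩ := h1'.syz hn.ne'
  rcases q.eq_one_or_neg_one_of_isUnit hd w.isUnit w.ne_zero with hw1 | hw1
  · left
    rw [hw1, mul_one, q.ext_iff, wt, wt, re_mk, im_mk, re_mk, im_mk] at hw
    obtain ⟨r1, r0⟩ := hw
    have r1 : f 1 = f' 1 := by rw [r0] at r1; exact mul_left_cancel₀ hA.ne' (by linarith)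
    have r2 : f 2 = f' 2 := by
      rw [r0, r1] at s1; exact mul_left_cancel₀ hA.ne' (by linarith)
    have r3 : f 3 = f' 3 := by
      rw [r2, r1] at s2; exact mul_left_cancel₀ hA.ne' (by linarith)
    ext i; fin_cases i <;> simp [r0, r1, r2, r3]
  · right
    rw [hw1, mul_neg, mul_one, q.ext_iff, re_neg, im_neg, wt, wt, re_mk, im_mk, re_mk,
      im_mk] at hw
    obtain ⟨r1, r0⟩ := hw
    have r0 : f' 0 = -f 0 := by linarith
    have r1 : f' 1 = -f 1 := by rw [r0] at r1; exact mul_left_cancel₀ hA.ne' (by linarith)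
    have r2 : f' 2 = -f 2 := by
      rw [r0, r1] at s1'; exact mul_left_cancel₀ hA.ne' (by linarith)
    have r3 : f' 3 = -f 3 := by
      rw [r2, r1] at s2'; exact mul_left_cancel₀ hA.ne' (by linarith)
    ext i; fin_cases i <;> simp [r0, r1, r2, r3]

end QuadBasis

lemma WRed.abs_le_neg_disc {f : Fin 4 → ℤ} (h : WRed f) (i : Fin 4) : |f i| ≤ -disc f := by
  have hr := wRed_cast.mpr h
  have q0 := hr.sq_zero_le
  have q1 := hr.sq_one_le
  have q2 := hr.sq_two_le
  have q3 := hr.sq_three_le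
  have q4 := hr.three_mul_le
  simp only [hA_cast, hC_cast, disc_cast] at q0 q1 q2 q3 q4
  norm_cast at q0 q1 q2 q3 q4
  obtain ⟨h0, h1, h2⟩ := h
  have hX : 3 * hC f ≤ -disc f := by nlinarith
  have hX1 : 1 ≤ -disc f := by linarith
  apply abs_le_of_sq_le_sq _ (by linarith)
  fin_cases i <;> simp only [Fin.reduceFinMk, Fin.zero_eta, Fin.isValue, Fin.mk_one]
  · have : 3 * (f 0 ^ 2 * hA f) ≤ 4 * hA f ^ 2 := by
      nlinarith [mul_le_mul_of_nonneg_left h2 (sq_nonneg (f 0))]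
    nlinarith
  · nlinarith
  · nlinarith
  · nlinarith [sq_nonneg (f 3)]

lemma finite_wRed (Y : ℤ) : {f : Fin 4 → ℤ | WRed f ∧ -disc f ≤ Y}.Finite := by
  refine (Set.Finite.pi (t := fun _ : Fin 4 => Set.Icc (-Y) Y)
    (fun _ => Set.finite_Icc _ _)).subset ?_
  rintro f ⟨h, hY⟩ i -
  exact abs_le.mp ((h.abs_le_neg_disc i).trans hY)

/-- The forms whose Hessian is `n` times a form of discriminant `d`. -/
def HessDvd (n d : ℤ) (f : Fin 4 → ℤ) : Prop :=
  n ∣ hA f ∧ n ∣ hB f ∧ n ∣ hC f ∧ disc f = n ^ 2 * d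

/-- The half-open version of the reduction conditions. -/
def HRed (f : Fin 4 → ℤ) : Prop :=
  0 < hA f ∧ -hA f < hB f ∧ hB f ≤ hA f ∧ hA f ≤ hC f

lemma HRed.wRed {f : Fin 4 → ℤ} (h : HRed f) : WRed f :=
  ⟨h.1, abs_le.mpr ⟨h.2.1.le, h.2.2.1⟩, h.2.2.2⟩

lemma finite_hRed (n d : ℤ) : {f : Fin 4 → ℤ | HessDvd n d f ∧ HRed f}.Finite :=
  (finite_wRed (-(n ^ 2 * d))).subset fun f ⟨h, h'⟩ => ⟨h'.wRed, by rw [h.2.2.2]⟩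

lemma finite_sRed (n d : ℤ) : {f : Fin 4 → ℤ | HessDvd n d f ∧ SRed f}.Finite :=
  (finite_wRed (-(n ^ 2 * d))).subset fun f ⟨h, h'⟩ => ⟨h'.wRed, by rw [h.2.2.2]⟩

lemma HessDvd.exists_hessEq {n : ℤ} (hn : 0 < n) {t m : ℤ} {f : Fin 4 → ℤ}
    (h : HessDvd n (t ^ 2 - 4 * m) f) (hf : 0 < hA f) : ∃ A k C, QuadBasis.HessEq t m n f A k C := by
  obtain ⟨⟨A, eA⟩, ⟨B, eB⟩, ⟨C, eC⟩, hD⟩ := h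
  rw [disc, eA, eB, eC] at hD
  have hD' : B ^ 2 - 4 * A * C = t ^ 2 - 4 * m := by
    apply mul_left_cancel₀ (pow_ne_zero 2 hn.ne'); linarith
  obtain ⟨k, hk⟩ : ∃ k, B = 2 * k + t := by
    have h2 : (2 : ℤ) ∣ B ^ 2 - t ^ 2 := ⟨2 * (A * C) - 2 * m, by linarith⟩
    have h3 : Even (B ^ 2 - t ^ 2) := (even_iff_two_dvd).mpr h2
    have h4 : Even (B - t) := by
      rw [Int.even_sub] at h3 ⊢
      simpa [Int.even_pow] using h3
    obtain ⟨k, hk⟩ := h4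
    exact ⟨k, by linarith⟩
  subst hk
  refine ⟨A, k, C, ⟨?_, by linarith, eA, eB, eC⟩⟩
  rw [eA] at hf
  exact pos_of_mul_pos_right hf hn.le

namespace QuadBasis

variable {O : Type*} [CommRing O] [IsDedekindDomain O] {t m : ℤ} (q : QuadBasis O t m)

/-- Pairs of an ideal class `c` and an ideal `M` of norm `n` with `c³ = [M]`. -/
def pairs (n : ℤ) : Set (ClassGroup O × (Ideal O)⁰) :=
  {x | (x.2 : Ideal O) * (x.2 : Ideal O).map q.σ = Ideal.span {(n : O)} ∧
    x.1 ^ 3 = ClassGroup.mk0 x.2}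

variable (hprim : ∀ A B C : ℤ, B ^ 2 - 4 * A * C = t ^ 2 - 4 * m →
      ∃ x y z : ℤ, x * A + y * B + z * C = 1)

include hprim

lemma exists_form (hd : t ^ 2 - 4 * m < 0) {n : ℤ} (hn : 0 < n)
    {x : ClassGroup O × (Ideal O)⁰} (hx : x ∈ q.pairs n) :
    ∃ f, q.Rel n f x.1 x.2 ∧ HessDvd n (t ^ 2 - 4 * m) f ∧ HRed f := by
  obtain ⟨c, M⟩ := x
  obtain ⟨A, k, C, hA, hk, h1, h2, h3, h, rfl⟩ := q.exists_reduced hd c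
  obtain ⟨f, hf, hH⟩ := q.exists_rel_of_idl hd hn M hx.1 hA hk
    (hprim _ _ _ (by linear_combination 4 * hk)) h hx.2
  refine ⟨f, hf, ⟨⟨_, hH.eqA⟩, ⟨_, hH.eqB⟩, ⟨_, hH.eqC⟩, ?_⟩, ?_, ?_, ?_, ?_⟩
  · rw [disc, hH.eqA, hH.eqB, hH.eqC]; linear_combination 4 * n ^ 2 * hk
  · rw [hH.eqA]; positivity
  · rw [hH.eqA, hH.eqB]; nlinarith
  · rw [hH.eqA, hH.eqB]; exact mul_le_mul_of_nonneg_left h2 hn.le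
  · rw [hH.eqA, hH.eqC]; exact mul_le_mul_of_nonneg_left h3 hn.le

lemma exists_pair {n : ℤ} (hn : 0 < n) {f : Fin 4 → ℤ}
    (h : HessDvd n (t ^ 2 - 4 * m) f) (hf : 0 < hA f) :
    ∃ x ∈ q.pairs n, q.Rel n f x.1 x.2 := by
  obtain ⟨A, k, C, hH⟩ := h.exists_hessEq hn hf
  obtain ⟨c, M, h1, h2, h3⟩ := HessEq.exists_rel (q := q) hn hH
    (hprim _ _ _ (by linear_combination 4 * hH.norm))
  exact ⟨(c, M), ⟨h2, h3⟩, h1⟩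

lemma finite_pairs (hd : t ^ 2 - 4 * m < 0) {n : ℤ} (hn : 0 < n) : (q.pairs n).Finite := by
  choose! F hF using fun x (hx : x ∈ q.pairs n) => q.exists_form hprim hd hn hx
  refine Set.Finite.of_finite_image ((finite_hRed n (t ^ 2 - 4 * m)).subset
    (Set.image_subset_iff.mpr fun x hx => (hF x hx).2) : (F '' q.pairs n).Finite) ?_
  intro x hx y hy hxy
  have h1 := (hF x hx).1
  rw [hxy] at h1
  have := h1.unique hn.ne' (hF y hy).1
  exact Prod.ext this.1 this.2

lemma two_mul_card_pairs_le (hd : t ^ 2 - 4 * m < 0) {n : ℤ} (hn : 0 < n) :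
    2 * (q.pairs n).ncard ≤ {f : Fin 4 → ℤ | HessDvd n (t ^ 2 - 4 * m) f ∧ HRed f}.ncard := by
  choose! F hF using fun x (hx : x ∈ q.pairs n) => q.exists_form hprim hd hn hx
  have hfin := finite_hRed n (t ^ 2 - 4 * m)
  have hinj : Set.InjOn F (q.pairs n) := by
    intro x hx y hy hxy
    have h1 := (hF x hx).1
    rw [hxy] at h1
    have := h1.unique hn.ne' (hF y hy).1
    exact Prod.ext this.1 this.2
  have hinj' : Set.InjOn (fun x => -F x) (q.pairs n) := fun x hx y hy hxy =>
    hinj hx hy (neg_injective hxy)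
  have hdisj : Disjoint (F '' q.pairs n) ((fun x => -F x) '' q.pairs n) := by
    rw [Set.disjoint_left]
    rintro _ ⟨x, hx, rfl⟩ ⟨y, hy, hxy⟩
    have h1 := (hF x hx).1
    have h2 := (hF y hy).1.neg
    simp only at hxy
    rw [hxy] at h2
    have h3 := h1.unique hn.ne' h2
    obtain rfl : x = y := Prod.ext h3.1 h3.2
    have h4 : F x = 0 := by
      ext i; have := congrFun hxy i; simp only [Pi.neg_apply] at this; simp; omega
    have := (hF x hx).2.2.1
    rw [h4] at this
    simp [DH.hA] at this
  rw [two_mul]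
  nth_rewrite 1 [← hinj.ncard_image]
  rw [← hinj'.ncard_image, ← Set.ncard_union_eq hdisj (((q.finite_pairs hprim hd hn).image _))
    (((q.finite_pairs hprim hd hn).image _))]
  apply Set.ncard_le_ncard _ hfin
  rintro _ (⟨x, hx, rfl⟩ | ⟨x, hx, rfl⟩)
  · exact (hF x hx).2
  · have := (hF x hx).2
    simpa [HessDvd, HRed, hA_neg, hB_neg, hC_neg, disc_neg] using this

lemma card_le_two_mul_card_pairs (hd : t ^ 2 - 4 * m < -4) {n : ℤ} (hn : 0 < n) :
    {f : Fin 4 → ℤ | HessDvd n (t ^ 2 - 4 * m) f ∧ SRed f}.ncard ≤ 2 * (q.pairs n).ncard := by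
  classical
  have hd0 : t ^ 2 - 4 * m < 0 := by linarith
  have hfin := finite_sRed n (t ^ 2 - 4 * m)
  have hfp := q.finite_pairs hprim hd0 hn
  choose! G hG using fun f (hf : f ∈ {f : Fin 4 → ℤ | HessDvd n (t ^ 2 - 4 * m) f ∧ SRed f}) =>
    q.exists_pair hprim hn hf.1 hf.2.1
  rw [Set.ncard_eq_toFinset_card _ hfin, Set.ncard_eq_toFinset_card _ hfp]
  refine Finset.card_le_mul_card_image_of_maps_to (f := G) ?_ 2 ?_
  · intro f hf
    exact (hfp.mem_toFinset).mpr (hG f (hfin.mem_toFinset.mp hf)).1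
  · intro b _
    by_cases h : ∃ f0, f0 ∈ hfin.toFinset ∧ G f0 = b
    · obtain ⟨f0, hf0, rfl⟩ := h
      refine (Finset.card_le_card (t := {f0, -f0}) ?_).trans Finset.card_le_two
      intro f hf
      obtain ⟨hf, e⟩ := Finset.mem_filter.mp hf
      rw [hfin.mem_toFinset] at hf hf0
      have h1 := (hG f hf).2
      rw [e] at h1
      simpa using q.eq_or_eq_neg_of_rel hd hn hprim hf0.2 hf.2 (hG f0 hf0).2 h1
    · rw [Finset.filter_eq_empty_iff.mpr]
      · simp
      · intro f hf e; exact h ⟨f, hf, e⟩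

end QuadBasis

/-- Congruence description of fundamental discriminants. -/
def Fund (d : ℤ) : Prop :=
  (d % 4 = 1 ∨ d % 16 = 8 ∨ d % 16 = 12) ∧ ∀ p : ℕ, p.Prime → p ≠ 2 → ¬ (p : ℤ) ^ 2 ∣ d

lemma squarefree_of_forall_prime {d : ℤ} (h : ∀ p : ℕ, p.Prime → ¬ (p : ℤ) ^ 2 ∣ d) :
    Squarefree d := by
  rw [← Int.squarefree_natAbs, Nat.squarefree_iff_prime_squarefree]
  intro p hp hd
  apply h p hp
  rw [← Int.dvd_natAbs, pow_two]
  exact_mod_cast hd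

lemma not_sq_dvd_of_squarefree {d : ℤ} (h : Squarefree d) {p : ℕ} (hp : p.Prime) :
    ¬ (p : ℤ) ^ 2 ∣ d := by
  intro hd
  rw [pow_two] at hd
  exact (Nat.prime_iff_prime_int.mp hp).not_isUnit (h _ hd)

lemma isFundamentalDiscriminant_iff {d : ℤ} :
    IsFundamentalDiscriminant d ↔ d ≠ 1 ∧ Fund d := by
  refine and_congr_right fun _ => ⟨?_, ?_⟩
  · rintro (⟨h1, h2⟩ | ⟨m, rfl, h1, h2⟩)
    · exact ⟨Or.inl h1, fun p hp _ => not_sq_dvd_of_squarefree h2 hp⟩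
    · refine ⟨by omega, fun p hp hp2 hd => not_sq_dvd_of_squarefree h2 hp ?_⟩
      have hc : IsCoprime ((p : ℤ) ^ 2) 4 := by
        rw [show (4 : ℤ) = ((2 : ℕ) : ℤ) ^ 2 by norm_num]
        apply IsCoprime.pow
        exact Nat.isCoprime_iff_coprime.mpr ((Nat.coprime_primes hp Nat.prime_two).mpr hp2)
      exact hc.dvd_of_dvd_mul_left hd
  · rintro ⟨h1, h2⟩
    by_cases h3 : d % 4 = 1
    · left
      refine ⟨h3, squarefree_of_forall_prime fun p hp => ?_⟩
      by_cases hp2 : p = 2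
      · subst hp2; push_cast; omega
      · exact h2 p hp hp2
    · right
      refine ⟨d / 4, by omega, by omega, squarefree_of_forall_prime fun p hp => ?_⟩
      by_cases hp2 : p = 2
      · subst hp2; push_cast; omega
      · intro hd
        apply h2 p hp hp2
        rw [show d = d / 4 * 4 by omega]
        exact hd.mul_right _

lemma sq_emod_four (x : ℤ) : x ^ 2 % 4 = 0 ∨ x ^ 2 % 4 = 1 := by
  have h := Int.emod_emod_of_dvd x (by norm_num : (4 : ℤ) ∣ 4)
  have : x % 4 = 0 ∨ x % 4 = 1 ∨ x % 4 = 2 ∨ x % 4 = 3 := by omega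
  rcases this with h | h | h | h <;> simp [pow_two, Int.mul_emod, h]

/-- A prime whose square divides a discriminant-shaped value with even content contradicts
fundamentality. -/
lemma Fund.four_mul {d D : ℤ} (h : Fund d) (hd : d = 4 * D) (hD : D % 4 = 0 ∨ D % 4 = 1) :
    False := by
  have := h.1
  omega

lemma Fund.primitive {d : ℤ} (h : Fund d) {A B C : ℤ} (hd : B ^ 2 - 4 * A * C = d) :
    ∃ x y z : ℤ, x * A + y * B + z * C = 1 := by
  have hg : Int.gcd (Int.gcd A B) C = 1 := by
    by_contra hg
    obtain ⟨p, hp, hpg⟩ := Nat.exists_prime_and_dvd hg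
    have h0 : (p : ℤ) ∣ Int.gcd (Int.gcd A B) C := by exact_mod_cast hpg
    have h1 : (p : ℤ) ∣ Int.gcd A B := h0.trans (Int.gcd_dvd_left _ _)
    obtain ⟨C', rfl⟩ : (p : ℤ) ∣ C := h0.trans (Int.gcd_dvd_right _ _)
    obtain ⟨A', rfl⟩ : (p : ℤ) ∣ A := h1.trans (Int.gcd_dvd_left _ _)
    obtain ⟨B', rfl⟩ : (p : ℤ) ∣ B := h1.trans (Int.gcd_dvd_right _ _)
    have hd' : d = p ^ 2 * (B' ^ 2 - 4 * A' * C') := by rw [← hd]; ring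
    by_cases hp2 : p = 2
    · subst hp2
      refine h.four_mul (D := B' ^ 2 - 4 * A' * C') (by rw [hd']; norm_num) ?_
      have := sq_emod_four B'
      rw [mul_assoc]
      omega
    · exact h.2 p hp hp2 ⟨_, hd'⟩
  refine ⟨Int.gcdA (Int.gcd A B) C * Int.gcdA A B, Int.gcdA (Int.gcd A B) C * Int.gcdB A B,
    Int.gcdB (Int.gcd A B) C, ?_⟩
  have e1 := Int.gcd_eq_gcd_ab A B
  have e2 := Int.gcd_eq_gcd_ab (Int.gcd A B) C
  rw [hg] at e2
  push_cast at e2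
  linear_combination -e2 - Int.gcdA (Int.gcd A B) C * e1

/-- The reducible reduced form of fundamental discriminant `t² - 4m`. -/
def redForm (t m : ℤ) : Fin 4 → ℤ := ![0, 1, t, t ^ 2 - m]

lemma eq_redForm {t m : ℤ} (ht : t = 0 ∨ t = 1) (hF : Fund (t ^ 2 - 4 * m)) {f : Fin 4 → ℤ}
    (h : HessDvd 1 (t ^ 2 - 4 * m) f) (h' : HRed f) (h0 : f 0 = 0) :
    f = redForm t m ∨ f = -redForm t m := by
  obtain ⟨-, -, -, hD⟩ := h
  obtain ⟨h1, h2, h3, -⟩ := h'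
  simp only [disc, hA, hB, hC, h0] at hD h1 h2 h3
  have hd : t ^ 2 - 4 * m = f 1 ^ 2 * (4 * f 1 * f 3 - 3 * f 2 ^ 2) := by linarith
  have hb : f 1 = 1 ∨ f 1 = -1 := by
    suffices h : (f 1).natAbs = 1 by omega
    by_contra hb
    obtain ⟨p, hp, hpb⟩ := Nat.exists_prime_and_dvd hb
    obtain ⟨b, hb⟩ : (p : ℤ) ∣ f 1 := Int.natCast_dvd.mpr hpb
    by_cases hp2 : p = 2
    · subst hp2
      refine hF.four_mul (D := b ^ 2 * (8 * b * f 3 - 3 * f 2 ^ 2)) ?_ ?_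
      · rw [hd, hb]; push_cast; ring
      · have e : b ^ 2 * (8 * b * f 3 - 3 * f 2 ^ 2) = 4 * (2 * b ^ 3 * f 3 - (b * f 2) ^ 2)
          + (b * f 2) ^ 2 := by ring
        have := sq_emod_four (b * f 2)
        omega
    · refine hF.2 p hp hp2 ⟨b ^ 2 * (4 * f 1 * f 3 - 3 * f 2 ^ 2), ?_⟩
      rw [hd, hb]; ring
  have par : ∀ c : ℤ, c % 2 = c ^ 2 % 2 := by
    intro c
    rcases Int.emod_two_eq c with h | h <;> simp [pow_two, Int.mul_emod, h]
  have p1 := par t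
  have p2 := par (f 2)
  rcases hb with hb | hb <;> rw [hb] at h1 h2 h3 hd
  · left
    have ht2 : f 2 = t := by
      ring_nf at h2 h3 hd
      omega
    have hf3 : f 3 = t ^ 2 - m := by rw [ht2] at hd; linarith
    ext i; fin_cases i <;> simp [redForm, h0, hb, ht2, hf3]
  · right
    have ht2 : f 2 = -t := by
      ring_nf at h2 h3 hd
      omega
    have hf3 : f 3 = -(t ^ 2 - m) := by rw [ht2] at hd; linarith
    ext i; fin_cases i <;> simp [redForm, h0, hb, ht2, hf3]

lemma ncard_hRed_zero_le {t m : ℤ} (ht : t = 0 ∨ t = 1) (hF : Fund (t ^ 2 - 4 * m)) :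
    {f : Fin 4 → ℤ | (HessDvd 1 (t ^ 2 - 4 * m) f ∧ HRed f) ∧ f 0 = 0}.ncard ≤ 2 := by
  refine (Set.ncard_le_ncard (t := {redForm t m, -redForm t m}) ?_ (by simp)).trans
    ((Set.ncard_insert_le _ _).trans (by simp))
  rintro f ⟨⟨h, h'⟩, h0⟩
  exact eq_redForm ht hF h h' h0

lemma two_le_ncard_sRed_zero {t m : ℤ} (ht : t = 0 ∨ t = 1) (hd : t ^ 2 - 4 * m < -4) :
    2 ≤ {f : Fin 4 → ℤ | (HessDvd 1 (t ^ 2 - 4 * m) f ∧ SRed f) ∧ f 0 = 0}.ncard := by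
  have hne : redForm t m ≠ -redForm t m := by
    intro h
    have := congrFun h 1
    simp [redForm] at this
  refine (Set.ncard_pair hne).symm.le.trans ?_
  apply Set.ncard_le_ncard
  · have h1 : (HessDvd 1 (t ^ 2 - 4 * m) (redForm t m) ∧ SRed (redForm t m)) := by
      refine ⟨⟨one_dvd _, one_dvd _, one_dvd _, ?_⟩, ?_⟩
      · simp [disc, hA, hB, hC, redForm]
      · simp only [SRed, hA, hB, hC, redForm, Matrix.cons_val]
        rcases ht with rfl | rfl <;> refine ⟨?_, ?_, ?_, ?_⟩ <;> linarith
    rintro f (rfl | rfl)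
    · exact ⟨h1, by simp [redForm]⟩
    · refine ⟨?_, by simp [redForm]⟩
      simpa [HessDvd, SRed, hA_neg, hB_neg, hC_neg, disc_neg] using h1
  · exact (finite_sRed 1 (t ^ 2 - 4 * m)).subset fun f hf => hf.1

lemma zero_ne_of_hessDvd {n d : ℤ} (hn : 0 < n) (hsq : Squarefree n) {p : ℕ} (hp : p.Prime)
    (hpn : (p : ℤ) ∣ n) (hpd : ¬ (p : ℤ) ∣ d) {f : Fin 4 → ℤ} (h : HessDvd n d f) : f 0 ≠ 0 := by
  intro h0
  obtain ⟨h1, -, h3, hD⟩ := h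
  simp only [disc, hA, hB, hC, h0] at hD h1 h3
  obtain ⟨b, hb⟩ : n ∣ f 1 := by
    rw [← hsq.dvd_pow_iff_dvd two_ne_zero]; simpa using h1
  have hpp := Nat.prime_iff_prime_int.mp hp
  have hpc : (p : ℤ) ∣ f 2 := by
    apply hpp.dvd_of_dvd_pow (n := 2)
    have e : f 2 ^ 2 = (f 2 ^ 2 - f 1 * f 3) + n * (b * f 3) := by rw [hb]; ring
    rw [e]
    exact dvd_add (hpn.trans h3) (hpn.mul_right _)
  apply hpd
  have hd : d = b ^ 2 * (4 * f 1 * f 3 - 3 * f 2 ^ 2) := by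
    apply mul_left_cancel₀ (pow_ne_zero 2 hn.ne')
    rw [← hD, hb]; ring
  rw [hd]
  apply Dvd.dvd.mul_left
  apply dvd_sub
  · rw [mul_assoc]; exact ((hpn.trans ⟨b, hb⟩).mul_right _).mul_left _
  · exact (dvd_pow hpc two_ne_zero).mul_left _

section Group

variable {G : Type*} [CommGroup G] {ι : Type*} [Fintype ι] (g : ι → G)

lemma card_ker_powMonoidHom (G : Type*) [CommGroup G] [Finite G] (k : ℕ) :
    Nat.card (powMonoidHom k : G →* G).ker = (powMonoidHom k : G →* G).range.index := by
  have h1 := (powMonoidHom k : G →* G).ker.card_mul_index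
  rw [Subgroup.index_ker, mul_comm] at h1
  have h2 := (powMonoidHom k : G →* G).range.card_mul_index
  exact mul_left_cancel₀ Nat.card_pos.ne' (h1.trans h2.symm)

lemma pow_valMinAbs_add (x : G ⧸ (powMonoidHom 3 : G →* G).range) (a b : ZMod 3) :
    x ^ (a + b).valMinAbs = x ^ a.valMinAbs * x ^ b.valMinAbs := by
  have hx : x ^ 3 = 1 := by
    induction x using QuotientGroup.induction_on with
    | H y => exact (QuotientGroup.eq_one_iff (y ^ 3)).mpr ⟨y, rfl⟩
  rw [← zpow_add]
  have h : ((3 : ℕ) : ℤ) ∣ (a.valMinAbs + b.valMinAbs) - (a + b).valMinAbs := by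
    rw [← ZMod.intCast_zmod_eq_zero_iff_dvd _ 3]
    push_cast
    simp
  obtain ⟨k, hk⟩ := h
  rw [show a.valMinAbs + b.valMinAbs = (a + b).valMinAbs + ((3 : ℕ) : ℤ) * k by linarith,
    zpow_add, zpow_mul, zpow_natCast, hx, one_zpow, mul_one]

/-- The homomorphism `𝔽₃^ι → G / G³` attached to a family of elements of `G`. -/
noncomputable def relHom : (ι → Multiplicative (ZMod 3)) →* G ⧸ (powMonoidHom 3 : G →* G).range :=
  MonoidHom.mk' (fun e => ∏ i, (QuotientGroup.mk (g i) : G ⧸ (powMonoidHom 3 : G →* G).range) ^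
    (e i).toAdd.valMinAbs) fun a b => by
      rw [← Finset.prod_mul_distrib]
      exact Finset.prod_congr rfl fun i _ => pow_valMinAbs_add _ _ _

lemma relHom_eq_mk (e : ι → Multiplicative (ZMod 3)) :
    relHom g e = QuotientGroup.mk' _ (∏ i, g i ^ (e i).toAdd.valMinAbs) := by
  rw [map_prod]; rfl

lemma range_relHom : (relHom g).range =
    (Subgroup.closure (Set.range g)).map (QuotientGroup.mk' (powMonoidHom 3 : G →* G).range) := by
  apply le_antisymm
  · rintro _ ⟨e, rfl⟩
    rw [relHom_eq_mk]
    refine Subgroup.mem_map_of_mem _ (Subgroup.prod_mem _ fun i _ => Subgroup.zpow_mem _ ?_ _)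
    exact Subgroup.subset_closure ⟨i, rfl⟩
  · classical
    rw [Subgroup.map_le_iff_le_comap, Subgroup.closure_le]
    rintro _ ⟨i, rfl⟩
    refine ⟨Pi.mulSingle i (Multiplicative.ofAdd 1), ?_⟩
    rw [relHom_eq_mk]
    congr 1
    rw [Finset.prod_eq_single i]
    · simp [show (1 : ZMod 3).valMinAbs = 1 from rfl]
    · intro j _ hj
      rw [Pi.mulSingle_eq_of_ne hj]
      simp
    · simp

lemma three_pow_mul_card_torsion [Finite G] :
    3 ^ Fintype.card ι * Nat.card {x : G ⧸ Subgroup.closure (Set.range g) // x ^ 3 = 1} =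
      Nat.card {x : G × (ι → ZMod 3) // x.1 ^ 3 = ∏ i, g i ^ (x.2 i).valMinAbs} := by
  classical
  have := Fintype.ofFinite G
  set H := Subgroup.closure (Set.range g)
  set R := (powMonoidHom 3 : G →* G).range
  have e1 : Nat.card {x : G ⧸ H // x ^ 3 = 1} = (relHom g).range.index := by
    have : Nat.card {x : G ⧸ H // x ^ 3 = 1} = Nat.card (powMonoidHom 3 : G ⧸ H →* G ⧸ H).ker :=
      rfl
    rw [this, card_ker_powMonoidHom, range_relHom,
      ← Subgroup.index_comap_of_surjective _ (QuotientGroup.mk'_surjective R),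
      ← Subgroup.index_comap_of_surjective _ (QuotientGroup.mk'_surjective H),
      Subgroup.comap_map_eq, QuotientGroup.ker_mk']
    have h2 : (powMonoidHom 3 : G ⧸ H →* G ⧸ H).range = R.map (QuotientGroup.mk' H) := by
      ext x
      constructor
      · rintro ⟨y, rfl⟩
        obtain ⟨y, rfl⟩ := QuotientGroup.mk'_surjective H y
        exact ⟨y ^ 3, ⟨y, rfl⟩, by simp⟩
      · rintro ⟨_, ⟨y, rfl⟩, rfl⟩
        exact ⟨QuotientGroup.mk' H y, by simp⟩
    rw [h2, Subgroup.comap_map_eq, QuotientGroup.ker_mk', sup_comm]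
  have e2 : 3 ^ Fintype.card ι = Nat.card (relHom g).ker * Nat.card (relHom g).range := by
    have := (relHom g).ker.card_mul_index
    rw [Subgroup.index_ker] at this
    rw [this]
    simp [Nat.card_eq_fintype_card]
  have e3 : Nat.card {x : G × (ι → ZMod 3) // x.1 ^ 3 = ∏ i, g i ^ (x.2 i).valMinAbs} =
      Nat.card (relHom g).ker * Nat.card (powMonoidHom 3 : G →* G).ker := by
    rw [Nat.card_eq_fintype_card, Fintype.card_subtype, Nat.card_eq_fintype_card,
      Nat.card_eq_fintype_card]
    have hmem : ∀ e : ι → ZMod 3, (fun i => Multiplicative.ofAdd (e i)) ∈ (relHom g).ker ↔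
        ∏ i, g i ^ (e i).valMinAbs ∈ R := by
      intro e
      rw [MonoidHom.mem_ker, relHom_eq_mk]
      exact QuotientGroup.eq_one_iff _
    rw [Finset.card_eq_sum_card_fiberwise (f := fun x => x.2)
      (t := Finset.univ.filter fun e => (fun i => Multiplicative.ofAdd (e i)) ∈ (relHom g).ker)]
    · rw [Finset.sum_const_nat (m := Fintype.card (powMonoidHom 3 : G →* G).ker)]
      · congr 1
        rw [Fintype.card_subtype]
        exact Finset.card_bij (fun e _ i => Multiplicative.ofAdd (e i)) (by simp)
          (fun a _ b _ h => by
            ext i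
            exact Multiplicative.ofAdd.injective (congrFun h i))
          (fun b hb => ⟨fun i => (b i).toAdd, by simpa using hb, rfl⟩)
      · intro e he
        obtain ⟨y, hy⟩ := (hmem e).mp (Finset.mem_filter.mp he).2
        rw [Fintype.card_subtype]
        refine Finset.card_bij (fun x _ => x.1 * y⁻¹) ?_ ?_ ?_
        · rintro ⟨x, e'⟩ hx
          simp only [Finset.mem_filter, Finset.mem_univ, true_and] at hx ⊢
          obtain ⟨hx, rfl⟩ := hx
          rw [MonoidHom.mem_ker, powMonoidHom_apply, mul_pow, hx, ← hy, powMonoidHom_apply]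
          simp
        · rintro ⟨x, e'⟩ hx ⟨x', e''⟩ hx' h
          simp only [Finset.mem_filter, Finset.mem_univ, true_and] at hx hx' h
          rw [hx.2, hx'.2, mul_right_cancel h]
        · intro b hb
          simp only [Finset.mem_filter, Finset.mem_univ, true_and, MonoidHom.mem_ker,
            powMonoidHom_apply] at hb
          refine ⟨(b * y, e), ?_, by simp⟩
          simp only [Finset.mem_filter, Finset.mem_univ, true_and, and_true]
          rw [mul_pow, hb, one_mul, ← hy, powMonoidHom_apply]
    · intro x hx
      simp only [Finset.coe_filter, Finset.mem_univ, true_and, Set.mem_ofPred_eq] at hx ⊢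
      exact (hmem _).mpr ⟨x.1, by simpa using hx⟩
  rw [e1, e2, e3, mul_assoc, Subgroup.card_mul_index, card_ker_powMonoidHom]
  rfl

end Group

set_option linter.unusedSectionVars false

namespace QuadBasis

variable {O : Type*} [CommRing O] [IsDedekindDomain O] {t m : ℤ} (q : QuadBasis O t m)
  {ι : Type*} [Fintype ι] [DecidableEq ι]

/-- A family of distinct rational primes `p i` splitting as `P i * σ (P i)`. -/
structure SplitFamily (p : ι → ℕ) (P : ι → Ideal O) : Prop where
  prime : ∀ i, (p i).Prime
  inj : Function.Injective p
  isPrime : ∀ i, (P i).IsPrime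
  ne : ∀ i, P i ≠ (P i).map q.σ
  mul : ∀ i, P i * (P i).map q.σ = Ideal.span {(p i : O)}

/-- The prime above `p i` selected by an element of `𝔽₃` (or the unit ideal). -/
def choice (P : ι → Ideal O) (i : ι) (e : ZMod 3) : Ideal O :=
  if e = 0 then 1 else if e = 1 then P i else (P i).map q.σ

/-- The product of the selected primes. -/
def choiceProd (P : ι → Ideal O) (e : ι → ZMod 3) : Ideal O := ∏ i, q.choice P i (e i)

variable {q} {p : ι → ℕ} {P : ι → Ideal O}

lemma map_σ_map_σ (J : Ideal O) : (J.map q.σ).map q.σ = J := by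
  rw [Ideal.map_map]
  convert Ideal.map_id J
  ext x; simp [q.σ_σ]

namespace SplitFamily

variable (h : q.SplitFamily p P)

include h

lemma ne_bot (i : ι) : P i ≠ ⊥ := by
  intro h0
  have := h.mul i
  rw [h0, Ideal.bot_mul, eq_comm, Ideal.span_singleton_eq_bot] at this
  exact q.intCast_ne_zero (u := p i) (by exact_mod_cast (h.prime i).ne_zero) (by exact_mod_cast this)

lemma isPrime_map (i : ι) : ((P i).map q.σ).IsPrime := by
  have e : (P i).map q.σ = (P i).comap q.σ := by
    ext x
    constructor
    · intro hx
      rw [Ideal.mem_comap]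
      have := Ideal.mem_map_of_mem q.σ hx
      rwa [map_σ_map_σ] at this
    · intro hx
      have := Ideal.mem_map_of_mem q.σ (Ideal.mem_comap.mp hx)
      rwa [q.σ_σ] at this
  rw [e]
  have := h.isPrime i
  exact Ideal.comap_isPrime _ _

lemma prime_ideal (i : ι) : Prime (P i) := Ideal.prime_of_isPrime (h.ne_bot i) (h.isPrime i)

lemma map_ne_bot (i : ι) : (P i).map q.σ ≠ ⊥ := by
  intro h0
  apply h.ne_bot i
  rw [← map_σ_map_σ (q := q) (P i), h0, Ideal.map_bot]

lemma prime_map (i : ι) : Prime ((P i).map q.σ) :=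
  Ideal.prime_of_isPrime (h.map_ne_bot i) (h.isPrime_map i)

lemma mem_left (i : ι) : (p i : O) ∈ P i := by
  have : (p i : O) ∈ P i * (P i).map q.σ := by rw [h.mul]; exact Ideal.mem_span_singleton_self _
  exact Ideal.mul_le_left this

lemma mem_right (i : ι) : (p i : O) ∈ (P i).map q.σ := by
  have := Ideal.mem_map_of_mem q.σ (h.mem_left i)
  rwa [map_natCast] at this

lemma index_eq {i j : ι} {J : Ideal O} (hJ : J.IsPrime) (hi : (p i : O) ∈ J)
    (hj : (p j : O) ∈ J) : i = j := by
  by_contra hij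
  have hc := (Nat.coprime_primes (h.prime i) (h.prime j)).mpr fun e => hij (h.inj e)
  obtain ⟨u, v, huv⟩ := Nat.isCoprime_iff_coprime.mpr hc
  apply hJ.ne_top
  rw [Ideal.eq_top_iff_one]
  have e : (1 : O) = u * (p i : O) + v * (p j : O) := by exact_mod_cast congrArg (Int.cast (R := O)) huv.symm
  rw [e]
  exact J.add_mem (J.mul_mem_left _ hi) (J.mul_mem_left _ hj)

lemma choice_mul_map (i : ι) (e : ZMod 3) :
    q.choice P i e * (q.choice P i e).map q.σ = if e = 0 then 1 else Ideal.span {(p i : O)} := by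
  unfold choice
  split_ifs
  · rw [Ideal.one_eq_top, Ideal.map_top, Ideal.top_mul]
  · exact h.mul i
  · rw [map_σ_map_σ, mul_comm, h.mul i]

lemma choiceProd_mul_map (e : ι → ZMod 3) :
    q.choiceProd P e * (q.choiceProd P e).map q.σ =
      Ideal.span {((∏ i with e i ≠ 0, p i : ℕ) : O)} := by
  have e1 : (q.choiceProd P e).map q.σ = ∏ i, (q.choice P i (e i)).map q.σ :=
    map_prod (Ideal.mapHom q.σ) _ _
  rw [e1, choiceProd, ← Finset.prod_mul_distrib]
  simp_rw [h.choice_mul_map]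
  rw [Nat.cast_prod, ← Ideal.prod_span_singleton, Finset.prod_filter]
  refine Finset.prod_congr rfl fun i _ => ?_
  by_cases h0 : e i = 0 <;> simp [h0]

lemma left_dvd_iff (e : ι → ZMod 3) (i : ι) : P i ∣ q.choiceProd P e ↔ e i = 1 := by
  constructor
  · intro hd
    obtain ⟨j, -, hj⟩ := (h.prime_ideal i).exists_mem_finset_dvd hd
    have hle := Ideal.le_of_dvd hj
    rw [choice] at hj
    split_ifs at hj with h0 h1
    · exact absurd (isUnit_of_dvd_one hj) (h.prime_ideal i).not_isUnit
    · have : i = j := h.index_eq (h.isPrime i) (h.mem_left i) (Ideal.le_of_dvd hj (h.mem_left j))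
      rw [this, h1]
    · have : i = j := h.index_eq (h.isPrime i) (h.mem_left i) (Ideal.le_of_dvd hj (h.mem_right j))
      subst this
      exact absurd (associated_iff_eq.mp
        (((h.prime_ideal i).dvd_prime_iff_associated (h.prime_map i)).mp hj)) (h.ne i)
  · intro h1
    have : q.choice P i (e i) = P i := by simp [choice, h1]
    rw [← this]
    exact Finset.dvd_prod_of_mem _ (Finset.mem_univ i)

lemma conj : q.SplitFamily p fun i => (P i).map q.σ where
  prime := h.prime
  inj := h.inj
  isPrime := h.isPrime_map
  ne i := by rw [map_σ_map_σ]; exact (h.ne i).symm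
  mul i := by rw [map_σ_map_σ, mul_comm]; exact h.mul i

lemma right_dvd_iff (e : ι → ZMod 3) (i : ι) :
    (P i).map q.σ ∣ q.choiceProd P e ↔ e i = -1 := by
  have e1 : q.choiceProd P e = q.choiceProd (fun i => (P i).map q.σ) (-e) := by
    unfold choiceProd choice
    refine Finset.prod_congr rfl fun i _ => ?_
    rw [map_σ_map_σ, Pi.neg_apply]
    generalize e i = x
    fin_cases x
    · rfl
    · rfl
    · rfl
  rw [e1, h.conj.left_dvd_iff, Pi.neg_apply, neg_eq_iff_eq_neg]

lemma choiceProd_injective : Function.Injective (q.choiceProd P) := by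
  intro e e' he
  ext i : 1
  have h1 := h.left_dvd_iff e i
  have h2 := h.right_dvd_iff e i
  rw [he, h.left_dvd_iff e' i] at h1
  rw [he, h.right_dvd_iff e' i] at h2
  revert h1 h2
  generalize e i = x
  generalize e' i = y
  revert x y
  decide

lemma exists_choiceProd (U : Finset ι) : ∀ M : Ideal O,
    M * M.map q.σ = Ideal.span {((∏ i ∈ U, p i : ℕ) : O)} →
    ∃ e : ι → ZMod 3, (∀ i, i ∈ U ↔ e i ≠ 0) ∧ M = q.choiceProd P e := by
  induction U using Finset.induction_on with
  | empty =>
    intro M hM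
    refine ⟨0, by simp, ?_⟩
    rw [Finset.prod_empty, Nat.cast_one, Ideal.span_singleton_one, ← Ideal.one_eq_top] at hM
    rw [isUnit_iff_eq_one.mp (IsUnit.of_mul_eq_one _ hM)]
    simp [choiceProd, choice, ← Ideal.one_eq_top]
  | insert i U hi ih =>
    intro M hM
    have key : ∀ {P : ι → Ideal O} (_ : q.SplitFamily p P), P i ∣ M → ∃ M', M = P i * M' ∧
        M' * M'.map q.σ = Ideal.span {((∏ i ∈ U, p i : ℕ) : O)} := by
      rintro P h ⟨M', rfl⟩
      refine ⟨M', rfl, ?_⟩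
      rw [Finset.prod_insert hi, Nat.cast_mul, ← Ideal.span_singleton_mul_span_singleton,
        ← h.mul i, Ideal.map_mul, mul_mul_mul_comm] at hM
      exact mul_left_cancel₀ (mul_ne_zero (h.ne_bot i) (h.map_ne_bot i)) hM
    have hupd : ∀ (e : ι → ZMod 3) (x : ZMod 3), (∀ j, j ∈ U ↔ e j ≠ 0) → x ≠ 0 →
        (∀ j, j ∈ insert i U ↔ Function.update e i x j ≠ 0) ∧
        q.choice P i x * q.choiceProd P e = q.choiceProd P (Function.update e i x) := by
      intro e x he hx
      constructor
      · intro j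
        by_cases hj : j = i
        · subst hj; simp [hx]
        · simp [hj, he j]
      · have hei : e i = 0 := by
          by_contra h0; exact hi ((he i).mpr h0)
        unfold choiceProd
        rw [← Finset.mul_prod_erase _ _ (Finset.mem_univ i),
          ← Finset.mul_prod_erase _ _ (Finset.mem_univ i), Function.update_self, hei]
        have : q.choice P i 0 = 1 := by simp [choice]
        rw [this, one_mul]
        congr 1
        refine Finset.prod_congr rfl fun j hj => ?_
        rw [Function.update_of_ne (Finset.ne_of_mem_erase hj)]
    have hdvd : P i ∣ M * M.map q.σ := by
      rw [hM, Finset.prod_insert hi, Nat.cast_mul, ← Ideal.span_singleton_mul_span_singleton,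
        ← h.mul i]
      exact (dvd_mul_right _ _).mul_right _
    rcases (h.prime_ideal i).dvd_or_dvd hdvd with hd | hd
    · obtain ⟨M', rfl, hM'⟩ := key h hd
      obtain ⟨e, he, rfl⟩ := ih M' hM'
      obtain ⟨h1, h2⟩ := hupd e 1 he (by decide)
      exact ⟨_, h1, by rw [← h2]; simp [choice]⟩
    · have hd' : (P i).map q.σ ∣ M := by
        obtain ⟨J, hJ⟩ := hd
        refine ⟨J.map q.σ, ?_⟩
        rw [← Ideal.map_mul, ← hJ, map_σ_map_σ]
      obtain ⟨M', rfl, hM'⟩ := key h.conj hd'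
      obtain ⟨e, he, rfl⟩ := ih M' hM'
      obtain ⟨h1, h2⟩ := hupd e (-1) he (by decide)
      refine ⟨_, h1, ?_⟩
      rw [← h2, choice, if_neg (by decide), if_neg (by decide)]

lemma choice_ne_bot (i : ι) (e : ZMod 3) : q.choice P i e ≠ ⊥ := by
  unfold choice
  split_ifs
  · exact one_ne_zero
  · exact h.ne_bot i
  · exact h.map_ne_bot i

lemma choiceProd_mem (e : ι → ZMod 3) : q.choiceProd P e ∈ (Ideal O)⁰ :=
  mem_nonZeroDivisors_of_ne_zero (Finset.prod_ne_zero_iff.mpr fun i _ => h.choice_ne_bot i _)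

/-- The classes of the primes `P i`. -/
noncomputable def cls (i : ι) : ClassGroup O :=
  ClassGroup.mk0 ⟨P i, mem_nonZeroDivisors_of_ne_zero (h.ne_bot i)⟩

lemma mk0_map (i : ι) : ClassGroup.mk0 ⟨(P i).map q.σ,
    mem_nonZeroDivisors_of_ne_zero (h.map_ne_bot i)⟩ = (h.cls i)⁻¹ := by
  rw [eq_inv_iff_mul_eq_one, cls, ← map_mul, ClassGroup.mk0_eq_one_iff]
  refine ⟨(p i : O), ?_⟩
  show (P i).map q.σ * P i = _
  rw [mul_comm, h.mul]

lemma mk0_choiceProd (e : ι → ZMod 3) :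
    ClassGroup.mk0 ⟨q.choiceProd P e, h.choiceProd_mem e⟩ = ∏ i, h.cls i ^ (e i).valMinAbs := by
  have e1 : (⟨q.choiceProd P e, h.choiceProd_mem e⟩ : (Ideal O)⁰) =
      ∏ i, ⟨q.choice P i (e i), mem_nonZeroDivisors_of_ne_zero (h.choice_ne_bot i _)⟩ := by
    apply Subtype.ext
    rw [Submonoid.coe_finsetProd]
    rfl
  rw [e1, map_prod]
  refine Finset.prod_congr rfl fun i _ => ?_
  generalize e i = x
  fin_cases x
  · exact (map_one ClassGroup.mk0).trans (zpow_zero _).symm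
  · exact (zpow_one _).symm
  · exact (h.mk0_map i).trans (zpow_neg_one _).symm

lemma sum_card_pairs [Finite (ClassGroup O)] :
    ∑ U : Finset ι, (q.pairs ((∏ i ∈ U, p i : ℕ) : ℤ)).ncard =
      3 ^ Fintype.card ι *
        Nat.card {x : ClassGroup O ⧸ Subgroup.closure (Set.range h.cls) // x ^ 3 = 1} := by
  classical
  have := Fintype.ofFinite (ClassGroup O)
  rw [three_pow_mul_card_torsion, Nat.card_eq_fintype_card, Fintype.card_subtype,
    Finset.card_eq_sum_card_fiberwise (f := fun x => Finset.univ.filter fun i => x.2 i ≠ 0)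
      (t := Finset.univ) (by simp)]
  refine Finset.sum_congr rfl fun U _ => ?_
  rw [← Set.ncard_coe_finset]
  symm
  refine Set.ncard_congr (fun x _ => (x.1, ⟨q.choiceProd P x.2, h.choiceProd_mem x.2⟩)) ?_ ?_ ?_
  · rintro ⟨c, e⟩ hx
    simp only [Finset.coe_filter, Finset.mem_filter, Finset.mem_univ, true_and,
      Set.mem_ofPred_eq] at hx
    obtain ⟨h1, rfl⟩ := hx
    refine ⟨?_, ?_⟩
    · have := h.choiceProd_mul_map e
      exact_mod_cast this
    · rw [h.mk0_choiceProd]; exact h1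
  · rintro ⟨c, e⟩ ⟨c', e'⟩ _ _ heq
    simp only [Prod.mk.injEq, Subtype.mk.injEq] at heq ⊢
    exact ⟨heq.1, h.choiceProd_injective heq.2⟩
  · rintro ⟨c, M, hM⟩ ⟨h1, h2⟩
    obtain ⟨e, he, rfl⟩ := h.exists_choiceProd U M (by exact_mod_cast h1)
    refine ⟨(c, e), ?_, rfl⟩
    simp only [Finset.coe_filter, Finset.mem_filter, Finset.mem_univ, true_and,
      Set.mem_ofPred_eq]
    refine ⟨?_, ?_⟩
    · rw [← h.mk0_choiceProd]; exact h2
    · ext i; simp [he i]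

end SplitFamily

end QuadBasis

section RingOfIntegers

lemma exists_rat_of_mem_Kd {d : ℤ} {x : ℂ} (hx : x ∈ Kd d) : ∃ a b : ℚ, x = a + b * sqrtD d := by
  have hs := sqrtD_sq d
  refine IntermediateField.adjoin_induction ℚ (p := fun x _ => ∃ a b : ℚ, x = a + b * sqrtD d)
    ?_ ?_ ?_ ?_ ?_ hx
  · rintro _ rfl; exact ⟨0, 1, by simp⟩
  · intro y; exact ⟨y, 0, by simp⟩
  · rintro _ _ _ _ ⟨a, b, rfl⟩ ⟨a', b', rfl⟩
    exact ⟨a + a', b + b', by push_cast; ring⟩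
  · rintro _ _ ⟨a, b, rfl⟩
    by_cases h : (a : ℂ) + b * sqrtD d = 0
    · exact ⟨0, 0, by simp [h]⟩
    by_cases h' : (a : ℂ) - b * sqrtD d = 0
    · refine ⟨1 / (2 * a), 0, ?_⟩
      rw [← sub_eq_zero.mp h']
      push_cast
      rw [zero_mul, add_zero, one_div, two_mul]
    · refine ⟨a / (a ^ 2 - d * b ^ 2), -b / (a ^ 2 - d * b ^ 2), ?_⟩
      have h2 : (a : ℂ) ^ 2 - d * b ^ 2 ≠ 0 := by
        rw [← hs]
        intro h0
        exact mul_ne_zero h h' (by linear_combination h0)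
      rw [eq_comm]
      apply eq_inv_of_mul_eq_one_left
      push_cast
      field_simp
      linear_combination (-(b : ℂ) ^ 2) * hs
  · rintro _ _ _ _ ⟨a, b, rfl⟩ ⟨a', b', rfl⟩
    refine ⟨a * a' + d * (b * b'), a * b' + b * a', ?_⟩
    push_cast; linear_combination (b * b' : ℂ) * hs

lemma conj_sqrtD {d : ℤ} (hd : d < 0) : (starRingEnd ℂ) (sqrtD d) = -sqrtD d := by
  rw [sqrtD, if_neg (by omega)]
  simp

lemma sqrtD_ne_zero {d : ℤ} (hd : d < 0) : sqrtD d ≠ 0 := by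
  intro h
  have := sqrtD_sq d
  rw [h] at this
  norm_num at this
  have : d = 0 := by exact_mod_cast this.symm
  omega

lemma exists_int_of_isIntegral {q : ℚ} {x : ℂ} (hx : IsIntegral ℤ x) (h : x = q) :
    ∃ z : ℤ, q = z := by
  have h1 : IsIntegral ℤ (algebraMap ℚ ℂ q) := by rw [h] at hx; simpa using hx
  rw [isIntegral_algebraMap_iff (algebraMap ℚ ℂ).injective] at h1
  obtain ⟨z, hz⟩ := IsIntegrallyClosed.isIntegral_iff.mp h1
  exact ⟨z, by simpa using hz.symm⟩

/-- A rational number `s` with `d s²` integral becomes integral after doubling, when `d` is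
a fundamental discriminant. -/
lemma Fund.two_mul_int {d : ℤ} (hd : Fund d) {s : ℚ} {N : ℤ} (h : d * s ^ 2 = N) :
    ∃ w : ℤ, 2 * s = w := by
  have hden : (s.den : ℤ) ^ 2 ∣ d := by
    have h1 : d * s.num ^ 2 = (s.den : ℤ) ^ 2 * N := by
      have h2 : (s.den : ℚ) ≠ 0 := by exact_mod_cast s.den_nz
      have h3 : s = s.num / s.den := (Rat.num_div_den s).symm
      rw [h3] at h
      field_simp at h
      exact_mod_cast h
    have h2 : IsCoprime ((s.den : ℤ) ^ 2) (s.num ^ 2) := by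
      apply IsCoprime.pow
      rw [Int.isCoprime_iff_gcd_eq_one, Int.gcd_comm]
      exact s.reduced
    exact h2.dvd_of_dvd_mul_right ⟨N, by linarith⟩
  have h2 : (s.den : ℕ) ∣ 2 := by
    have key : ∀ p : ℕ, p.Prime → p ∣ s.den → p = 2 := by
      intro p hp hps
      by_contra h0
      exact hd.2 p hp h0 ((pow_dvd_pow_of_dvd (by exact_mod_cast hps) 2).trans hden)
    have h4 : ¬ 4 ∣ s.den := by
      intro h4
      have : ((4 : ℕ) : ℤ) ^ 2 ∣ d := (pow_dvd_pow_of_dvd (by exact_mod_cast h4) 2).trans hden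
      have h5 := hd.1
      norm_num at this
      omega
    rcases Nat.even_or_odd s.den with he | ho
    · obtain ⟨r, hr⟩ := even_iff_two_dvd.mp he
      have hr1 : r = 1 := by
        by_contra hr1
        obtain ⟨p, hp, hpr⟩ := Nat.exists_prime_and_dvd hr1
        obtain rfl := key p hp (hr ▸ hpr.mul_left 2)
        obtain ⟨r', rfl⟩ := hpr
        exact h4 ⟨r', by omega⟩
      rw [hr, hr1]; norm_num
    · have : s.den = 1 := by
        by_contra hr1
        obtain ⟨p, hp, hpr⟩ := Nat.exists_prime_and_dvd hr1
        obtain rfl := key p hp hpr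
        exact (Nat.not_even_iff_odd.mpr ho) (even_iff_two_dvd.mpr hpr)
      rw [this]; exact one_dvd _
  obtain ⟨e, he⟩ := h2
  refine ⟨s.num * e, ?_⟩
  have h2 : (s.den : ℚ) ≠ 0 := by exact_mod_cast s.den_nz
  have he' : (2 : ℚ) = s.den * e := by exact_mod_cast he
  rw [he']
  nth_rewrite 2 [← Rat.num_div_den s]
  push_cast
  field_simp

/-- The standard generator of the ring of integers. -/
noncomputable def tauC (t d : ℤ) : ℂ := (t + sqrtD d) / 2

lemma tauC_sq {t m d : ℤ} (h : d = t ^ 2 - 4 * m) : tauC t d ^ 2 = t * tauC t d - m := by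
  have := sqrtD_sq d
  have h' : (d : ℂ) = t ^ 2 - 4 * m := by exact_mod_cast h
  rw [tauC]; linear_combination (1 / 4 : ℂ) * this + (1 / 4 : ℂ) * h'

lemma conj_tauC {t d : ℤ} (hd : d < 0) : (starRingEnd ℂ) (tauC t d) = t - tauC t d := by
  rw [tauC, map_div₀, map_add, conj_sqrtD hd, Complex.conj_ofNat]
  simp
  ring

lemma exists_int_coords {t m d : ℤ} (ht : t = 0 ∨ t = 1) (hd : d = t ^ 2 - 4 * m) (hd0 : d < 0)
    (hF : Fund d) {x : ℂ} (hx : x ∈ Kd d) (hi : IsIntegral ℤ x) :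
    ∃ u v : ℤ, x = u + v * tauC t d := by
  obtain ⟨a, b, rfl⟩ := exists_rat_of_mem_Kd hx
  have hs := sqrtD_sq d
  have hc : IsIntegral ℤ ((starRingEnd ℂ) (a + b * sqrtD d)) :=
    hi.map (starRingEnd ℂ).toIntAlgHom
  have hconj : (starRingEnd ℂ) (a + b * sqrtD d) = a - b * sqrtD d := by
    rw [map_add, map_mul, conj_sqrtD hd0]
    simp; ring
  rw [hconj] at hc
  obtain ⟨r, hr⟩ := exists_int_of_isIntegral (q := 2 * a) (hi.add hc) (by push_cast; ring)
  obtain ⟨N, hN⟩ := exists_int_of_isIntegral (q := a ^ 2 - d * b ^ 2) (hi.mul hc)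
    (by push_cast; linear_combination (-(b : ℂ) ^ 2) * hs)
  have h1 : (d : ℚ) * (2 * b) ^ 2 = ((r ^ 2 - 4 * N : ℤ) : ℚ) := by
    push_cast; rw [← hr, ← hN]; ring
  obtain ⟨w, hw⟩ := hF.two_mul_int h1
  have h2 : d * w ^ 2 = 4 * r ^ 2 - 16 * N := by
    have : ((d * w ^ 2 : ℤ) : ℚ) = ((4 * r ^ 2 - 16 * N : ℤ) : ℚ) := by
      push_cast at h1 ⊢; rw [← hw]; linear_combination 4 * h1
    exact_mod_cast this
  have sq4 := sq_emod_four
  obtain ⟨s, hs2⟩ : ∃ s, w = 2 * s := by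
    rcases Int.even_or_odd' w with ⟨s, h | h⟩
    · exact ⟨s, h⟩
    · exfalso
      have hw1 : w ^ 2 = 4 * (s ^ 2 + s) + 1 := by rw [h]; ring
      rw [hw1] at h2
      have e : d * (4 * (s ^ 2 + s) + 1) = 4 * (d * (s ^ 2 + s)) + d := by ring
      rw [e] at h2
      have hd4 : d % 4 = 0 := by omega
      have hr4 := sq4 r
      obtain ⟨D, rfl⟩ : ∃ D, d = 4 * D := ⟨d / 4, by omega⟩
      have := hF.1
      have e2 : 4 * D * (s ^ 2 + s) = 4 * (D * (s ^ 2 + s)) := by ring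
      obtain ⟨k, hk⟩ : ∃ k, s ^ 2 + s = 2 * k := by
        have := Int.even_mul_succ_self s
        obtain ⟨k, hk⟩ := this
        exact ⟨k, by linarith⟩
      rw [e2, hk] at h2
      have e3 : D * (2 * k) = 2 * (D * k) := by ring
      rw [e3] at h2
      generalize D * k = z at h2
      generalize r ^ 2 = y at *
      omega
  have hb : b = s / 2 := by
    rw [hs2] at hw; push_cast at hw; linarith
  have ha : a = r / 2 := by linarith
  have h3 : d * s ^ 2 = r ^ 2 - 4 * N := by
    rw [hs2] at h2; linarith
  obtain ⟨u, hu⟩ : ∃ u, r = 2 * u + s * t := by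
    have par : ∀ c : ℤ, c ^ 2 % 2 = c % 2 := by
      intro c
      rcases Int.emod_two_eq c with h | h <;> simp [pow_two, Int.mul_emod, h]
    have p1 := par r
    have p2 := par s
    rcases ht with rfl | rfl
    · refine ⟨r / 2, ?_⟩
      have : d * s ^ 2 = 4 * (-(m * s ^ 2)) := by rw [hd]; ring
      omega
    · refine ⟨(r - s) / 2, ?_⟩
      have : d * s ^ 2 = s ^ 2 - 4 * (m * s ^ 2) := by rw [hd]; ring
      omega
  refine ⟨u, s, ?_⟩
  have hr' : (r : ℂ) = 2 * u + s * t := by exact_mod_cast hu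
  rw [ha, hb, tauC]; push_cast
  rw [hr']; ring

end RingOfIntegers

section Basis

variable {t m d : ℤ}

lemma sqrtD_mem (d : ℤ) : sqrtD d ∈ Kd d := IntermediateField.mem_adjoin_simple_self ℚ _

lemma tauC_mem (t d : ℤ) : tauC t d ∈ Kd d :=
  div_mem (add_mem (intCast_mem _ t) (sqrtD_mem d)) (ofNat_mem _ 2)

lemma isIntegral_tauC (hd : d = t ^ 2 - 4 * m) : IsIntegral ℤ (tauC t d) := by
  refine ⟨Polynomial.X ^ 2 + (Polynomial.C (-t) * Polynomial.X + Polynomial.C m), ?_, ?_⟩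
  · apply Polynomial.monic_X_pow_add
    exact lt_of_le_of_lt Polynomial.degree_linear_le (by norm_num)
  · have := tauC_sq hd
    rw [← Polynomial.aeval_def]
    simp [this]

/-- The embedding of the ring of integers into `ℂ`. -/
noncomputable def toC (d : ℤ) : Od d →+* ℂ :=
  (algebraMap (Kd d) ℂ).comp (algebraMap (Od d) (Kd d))

lemma toC_injective (d : ℤ) : Function.Injective (toC d) :=
  (algebraMap (Kd d) ℂ).injective.comp RingOfIntegers.coe_injective

lemma exists_toC {x : ℂ} (hx : x ∈ Kd d) (hi : IsIntegral ℤ x) : ∃ y : Od d, toC d y = x := by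
  have : IsIntegral ℤ (⟨x, hx⟩ : Kd d) :=
    (isIntegral_algebraMap_iff (algebraMap (Kd d) ℂ).injective).mp hi
  exact ⟨⟨⟨x, hx⟩, this⟩, rfl⟩

lemma exists_toC_coords (ht : t = 0 ∨ t = 1) (hd : d = t ^ 2 - 4 * m) (hd0 : d < 0)
    (hF : Fund d) (x : Od d) : ∃ u v : ℤ, toC d x = u + v * tauC t d :=
  exists_int_coords ht hd hd0 hF (algebraMap (Od d) (Kd d) x).2
    ((isIntegral_algebraMap_iff (algebraMap (Kd d) ℂ).injective).mpr x.2)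

lemma tauC_coords_unique (hd0 : d < 0) {u v u' v' : ℤ}
    (h : (u : ℂ) + v * tauC t d = u' + v' * tauC t d) : u = u' ∧ v = v' := by
  have h2 := congrArg (starRingEnd ℂ) h
  simp only [map_add, map_mul, conj_tauC hd0, map_intCast] at h2
  have h3 : ((v : ℂ) - v') * sqrtD d = 0 := by
    have e : sqrtD d = tauC t d - (t - tauC t d) := by rw [tauC]; ring
    rw [e]; linear_combination h - h2
  have h4 : (v : ℂ) = v' :=
    sub_eq_zero.mp ((mul_eq_zero.mp h3).resolve_right (sqrtD_ne_zero hd0))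
  rw [h4] at h
  exact ⟨by exact_mod_cast add_right_cancel h, by exact_mod_cast h4⟩

lemma nonempty_quadBasis (ht : t = 0 ∨ t = 1) (hd : d = t ^ 2 - 4 * m) (hd0 : d < 0)
    (hF : Fund d) : Nonempty (QuadBasis (Od d) t m) := by
  obtain ⟨τ, hτ⟩ := exists_toC (tauC_mem t d) (isIntegral_tauC hd)
  have hinj := toC_injective d
  have hco := exists_toC_coords ht hd hd0 hF
  have hconj : ∀ x : Od d, ∃ y : Od d, toC d y = (starRingEnd ℂ) (toC d x) := by
    intro x
    obtain ⟨u, v, h⟩ := hco x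
    refine ⟨u + v * (t - τ), ?_⟩
    rw [h]
    simp [conj_tauC hd0, hτ]
  choose s hs using hconj
  choose re im hri using hco
  have huv : ∀ u v : ℤ, toC d (u + v * τ) = u + v * tauC t d := by
    intro u v; simp [hτ]
  refine ⟨{ τ := τ
            σ := { toFun := s
                   map_one' := hinj (by simp [hs])
                   map_mul' := fun x y => hinj (by simp [hs])
                   map_zero' := hinj (by simp [hs])
                   map_add' := fun x y => hinj (by simp [hs]) }
            re := re
            im := im
            sq := hinj (by simpa [hτ, pow_two] using tauC_sq hd)
            σ_τ := hinj ?_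
            eta := fun x => hinj (by rw [huv]; exact hri x)
            re_mk := fun u v => (tauC_coords_unique hd0 ((hri _).symm.trans (huv u v))).1
            im_mk := fun u v => (tauC_coords_unique hd0 ((hri _).symm.trans (huv u v))).2 }⟩
  change toC d (s τ) = _
  rw [hs, hτ, conj_tauC hd0]
  simp [hτ]

end Basis

namespace QuadBasis

variable {O : Type*} [CommRing O] {t m : ℤ} (q : QuadBasis O t m)

/-- A root of the norm form modulo a prime gives a prime ideal. -/
lemma isPrime_idl {p : ℕ} (hp : p.Prime) {k : ℤ} (h : (p : ℤ) ∣ k ^ 2 + t * k + m) :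
    (q.idl p k).IsPrime := by
  obtain ⟨C, hC⟩ := h
  have hpZ := Nat.prime_iff_prime_int.mp hp
  constructor
  · rw [Ideal.ne_top_iff_one, q.mem_idl hC, q.re_one, q.im_one]
    intro h
    exact hpZ.not_isUnit (isUnit_of_dvd_one (by simpa using h))
  · intro x y hxy
    rw [q.mem_idl hC] at hxy ⊢
    rw [q.mem_idl hC]
    apply hpZ.dvd_or_dvd
    rw [q.re_mul, q.im_mul] at hxy
    have : (q.re x - k * q.im x) * (q.re y - k * q.im y) =
      (q.re x * q.re y - m * (q.im x * q.im y) - k * (q.re x * q.im y + q.im x * q.re y +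
        t * (q.im x * q.im y))) + p * (C * (q.im x * q.im y)) := by
      linear_combination (q.im x * q.im y) * hC
    rw [this]
    exact dvd_add hxy (dvd_mul_right _ _)

lemma map_idl {A k : ℤ} : (q.idl A k).map q.σ = q.idl A (-t - k) := by
  rw [idl, idl, Ideal.map_span, Set.image_pair, map_intCast, map_add, map_intCast, q.σ_τ]
  rw [show ((-t - k : ℤ) : O) + q.τ = -((k : O) + (t - q.τ)) by push_cast; ring]
  apply le_antisymm
  · rw [Ideal.span_le]
    rintro x (rfl | rfl)
    · exact Ideal.subset_span (by simp)
    · rw [← neg_neg ((k : O) + _)]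
      exact neg_mem (Ideal.subset_span (by simp))
  · rw [Ideal.span_le]
    rintro x (rfl | rfl)
    · exact Ideal.subset_span (by simp)
    · exact neg_mem (Ideal.subset_span (by simp))

/-- A prime `p` for which the norm form has two distinct roots splits. -/
lemma exists_split {p : ℕ} (hp : p.Prime) {k : ℤ} (h : (p : ℤ) ∣ k ^ 2 + t * k + m)
    (h2 : ¬ (p : ℤ) ∣ 2 * k + t)
    (hprim : ∀ A B C, B ^ 2 - 4 * A * C = t ^ 2 - 4 * m → ∃ x y z : ℤ, x * A + y * B + z * C = 1) :
    ∃ P : Ideal O, P.IsPrime ∧ P ≠ P.map q.σ ∧ P * P.map q.σ = Ideal.span {(p : O)} := by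
  refine ⟨q.idl p k, q.isPrime_idl hp h, ?_, ?_⟩
  · obtain ⟨C, hC⟩ := h
    intro he
    rw [q.map_idl] at he
    have h1 : ((k : O) + q.τ) ∈ q.idl p (-t - k) := he ▸ Ideal.subset_span (by simp)
    rw [q.mem_idl (C := C) (by linear_combination hC)] at h1
    have e1 : (k : O) + q.τ = (k : ℤ) + (1 : ℤ) * q.τ := by push_cast; ring
    rw [e1, q.re_mk, q.im_mk] at h1
    apply h2
    convert h1 using 1; ring
  · obtain ⟨C, hC⟩ := h
    have := q.idl_mul_map hC (hprim p (2 * k + t) C (by linear_combination 4 * hC))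
    simpa using this

include q in
lemma exists_root_of_split [IsDedekindDomain O] {p : ℕ} (hp : p.Prime) {P Q : Ideal O}
    (hPQ : P ≠ Q)
    (hP : P.IsPrime) (hQ : Q.IsPrime) (h : Ideal.span {(p : O)} = P * Q)
    (hprim : ∀ A B C, B ^ 2 - 4 * A * C = t ^ 2 - 4 * m → ∃ x y z : ℤ, x * A + y * B + z * C = 1) :
    ∃ k : ℤ, (p : ℤ) ∣ k ^ 2 + t * k + m ∧ ¬ (p : ℤ) ∣ 2 * k + t := by
  have hpZ := Nat.prime_iff_prime_int.mp hp
  have hp0 : (p : O) ≠ 0 := by exact_mod_cast q.intCast_ne_zero hpZ.ne_zero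
  have hpP : (p : O) ∈ P := by
    apply Ideal.mul_le_left (I := P) (J := Q)
    rw [← h]
    exact Ideal.mem_span_singleton_self _
  have hPQ0 : P * Q ≠ ⊥ := by
    rw [← h]; simpa using hp0
  have hPbot : P ≠ ⊥ := by rintro rfl; simp at hPQ0
  have hQbot : Q ≠ ⊥ := by rintro rfl; simp at hPQ0
  -- an element of `P` not divisible by `p`
  obtain ⟨x, hxP, hxp⟩ : ∃ x ∈ P, x ∉ Ideal.span {(p : O)} := by
    by_contra! hle
    have h1 : P ≤ P * Q := by rw [← h]; exact hle
    have h2 : P * Q = P * 1 := le_antisymm (by rw [mul_one]; exact Ideal.mul_le_left)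
      (by rw [mul_one]; exact h1)
    have h3 := mul_left_cancel₀ hPbot h2
    exact hQ.ne_top (by rw [h3, Ideal.one_eq_top])
  have hnm : (p : ℤ) ∣ q.nm x := by
    by_contra hn
    have hc : IsCoprime (p : ℤ) (q.nm x) := (Prime.coprime_iff_not_dvd hpZ).mpr hn
    obtain ⟨a, b, hab⟩ := hc
    have h1 : (q.nm x : O) ∈ P := by rw [← q.mul_σ]; exact Ideal.mul_mem_right _ _ hxP
    have : (1 : O) ∈ P := by
      have h3 : ((a * p + b * q.nm x : ℤ) : O) ∈ P := by
        push_cast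
        exact add_mem (Ideal.mul_mem_left _ _ hpP) (Ideal.mul_mem_left _ _ h1)
      rw [hab] at h3; simpa using h3
    exact hP.ne_top ((Ideal.eq_top_iff_one _).mpr this)
  have hv : ¬ (p : ℤ) ∣ q.im x := by
    intro hv
    have hu : (p : ℤ) ∣ q.re x := by
      have h1 : (p : ℤ) ∣ q.re x ^ 2 := by
        have e : q.re x ^ 2 = q.nm x - q.im x * (t * q.re x + m * q.im x) := by rw [nm]; ring
        rw [e]; exact dvd_sub hnm (hv.mul_right _)
      exact hpZ.dvd_of_dvd_pow h1
    obtain ⟨a, ha⟩ := hu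
    obtain ⟨b, hb⟩ := hv
    apply hxp
    rw [Ideal.mem_span_singleton]
    refine Dvd.intro ((a : O) + (b : O) * q.τ) ?_
    conv_rhs => rw [q.eta x, ha, hb]
    push_cast; ring
  obtain ⟨a, b, hab⟩ := (Prime.coprime_iff_not_dvd hpZ).mpr hv
  obtain ⟨k, hk⟩ : ∃ k, k = b * q.re x := ⟨_, rfl⟩
  have hroot : (p : ℤ) ∣ k ^ 2 + t * k + m := by
    have e : k ^ 2 + t * k + m = b ^ 2 * q.nm x + p * (a * (t * k + 2 * m - m * (a * p))) := by
      have e1 : b * q.im x = 1 - a * p := by linarith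
      rw [hk, nm]
      linear_combination (-(m * (b * q.im x + 1 - a * p)) - t * (b * q.re x)) * e1
    rw [e]; exact dvd_add (hnm.mul_left _) (dvd_mul_right _ _)
  refine Exists.intro k (And.intro hroot ?_)
  intro h2
  obtain ⟨C, hC⟩ := hroot
  have hmap := q.idl_mul_map hC (hprim p (2 * k + t) C (by linear_combination 4 * hC))
  have hpr := q.isPrime_idl hp ⟨C, hC⟩
  have hself : (q.idl p k).map q.σ = q.idl p k := by
    rw [q.map_idl]
    obtain ⟨e, he⟩ := h2
    have hC' : (-t - k) ^ 2 + t * (-t - k) + m = p * C := by linear_combination hC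
    ext y
    rw [q.mem_idl hC, q.mem_idl hC', show q.re y - (-t - k) * q.im y =
      q.re y - k * q.im y + p * (e * q.im y) by linear_combination (q.im y) * he]
    exact ⟨fun h => by simpa using dvd_sub h (dvd_mul_right (p : ℤ) (e * q.im y)), fun h => dvd_add h (dvd_mul_right _ _)⟩
  rw [hself] at hmap
  have hI : q.idl p k * q.idl p k = P * Q := by rw [hmap, ← h]; simp
  have hmax : ∀ R : Ideal O, R ≠ ⊥ → R.IsPrime → q.idl p k * q.idl p k ≤ R → q.idl p k = R := by
    intro R hR hRp hle
    have hle' : q.idl p k ≤ R := by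
      rcases hRp.mul_le.mp hle with h | h <;> exact h
    have hb : q.idl p k ≠ ⊥ := by
      intro hb; rw [hb] at hI; simp at hI; exact hPQ0 hI.symm
    exact (hpr.isMaximal hb).eq_of_le hRp.ne_top hle'
  exact hPQ ((hmax P hPbot hP (hI.le.trans Ideal.mul_le_left)).symm.trans
    (hmax Q hQbot hQ (hI.le.trans Ideal.mul_le_right)))

end QuadBasis

section Splitting

/-- The explicit criterion for `p` to split in the field of discriminant `d`. -/
def SplitCond (p : ℕ) (d : ℤ) : Prop :=
  if p = 2 then d % 8 = 1 else (∃ x : ℤ, (p : ℤ) ∣ x ^ 2 - d) ∧ ¬ (p : ℤ) ∣ d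

lemma SplitCond.not_dvd {p : ℕ} {d : ℤ} (h : SplitCond p d) : ¬ (p : ℤ) ∣ d := by
  unfold SplitCond at h
  split_ifs at h with h2
  · subst h2; push_cast; omega
  · exact h.2

lemma exists_root_iff_splitCond {t m d : ℤ} (ht : t = 0 ∨ t = 1) (hd : d = t ^ 2 - 4 * m) {p : ℕ}
    (hp : p.Prime) :
    (∃ k : ℤ, (p : ℤ) ∣ k ^ 2 + t * k + m ∧ ¬ (p : ℤ) ∣ 2 * k + t) ↔ SplitCond p d := by
  unfold SplitCond
  have hpZ := Nat.prime_iff_prime_int.mp hp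
  split_ifs with h2
  · subst h2
    constructor
    · rintro ⟨k, h1, h2⟩
      have hk := Int.even_mul_succ_self k
      obtain ⟨r, hr⟩ := hk
      push_cast at h1 h2
      rcases ht with rfl | rfl
      · exact absurd ⟨k, by ring⟩ h2
      · have : k ^ 2 + 1 * k + m = r + r + m := by linarith
        rw [this] at h1
        omega
    · intro h
      rcases ht with rfl | rfl
      · omega
      · exact ⟨0, by push_cast; omega, by norm_num⟩
  · have hodd : p % 2 = 1 := hp.eq_two_or_odd.resolve_left h2
    have hp2 : ¬ (p : ℤ) ∣ 2 := by
      intro h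
      have h3 : p ∣ 2 := by exact_mod_cast h
      exact h2 ((Nat.prime_dvd_prime_iff_eq hp Nat.prime_two).mp h3)
    constructor
    · rintro ⟨k, h1, h3⟩
      refine ⟨⟨2 * k + t, ?_⟩, ?_⟩
      · rw [hd, show (2 * k + t) ^ 2 - (t ^ 2 - 4 * m) = (k ^ 2 + t * k + m) * 4 by ring]
        exact h1.mul_right _
      · intro h4
        apply h3
        apply hpZ.dvd_of_dvd_pow (n := 2)
        rw [show (2 * k + t) ^ 2 = (k ^ 2 + t * k + m) * 4 + d by rw [hd]; ring]
        exact dvd_add (h1.mul_right _) h4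
    · rintro ⟨⟨x, hx⟩, h3⟩
      obtain ⟨e, he⟩ : ∃ e : ℤ, (p : ℤ) + 1 = 2 * e := ⟨((p : ℤ) + 1) / 2, by omega⟩
      have hk : 2 * ((x - t) * e) + t = x + p * (x - t) := by linear_combination -(x - t) * he
      refine ⟨(x - t) * e, ?_, ?_⟩
      · have h4 : (p : ℤ) ∣ 2 * (2 * (((x - t) * e) ^ 2 + t * ((x - t) * e) + m)) := by
          rw [show 2 * (2 * (((x - t) * e) ^ 2 + t * ((x - t) * e) + m)) =
            (2 * ((x - t) * e) + t) ^ 2 - d by rw [hd]; ring, hk,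
            show (x + p * (x - t)) ^ 2 - d = (x ^ 2 - d) +
              p * (2 * x * (x - t) + p * (x - t) ^ 2) by ring]
          exact dvd_add hx (dvd_mul_right _ _)
        exact ((hpZ.dvd_or_dvd (((hpZ.dvd_or_dvd h4).resolve_left hp2))).resolve_left hp2)
      · rw [hk]
        intro h5
        apply h3
        have h6 : (p : ℤ) ∣ x := by simpa using dvd_sub h5 (dvd_mul_right (p : ℤ) (x - t))
        have h7 := dvd_sub (h6.mul_left x) hx
        rwa [show x * x - (x ^ 2 - d) = d by ring] at h7

lemma Fund.exists_tm {d : ℤ} (h : Fund d) : ∃ t m : ℤ, (t = 0 ∨ t = 1) ∧ d = t ^ 2 - 4 * m := by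
  have := h.1
  rcases this with h | h | h
  · exact ⟨1, (1 - d) / 4, Or.inr rfl, by omega⟩
  · exact ⟨0, -d / 4, Or.inl rfl, by omega⟩
  · exact ⟨0, -d / 4, Or.inl rfl, by omega⟩

lemma splitsIn_iff {d : ℤ} (hF : Fund d) (hd : d < 0) {p : ℕ} (hp : p.Prime) :
    SplitsIn p d ↔ SplitCond p d := by
  obtain ⟨t, m, ht, hdt⟩ := hF.exists_tm
  rw [← exists_root_iff_splitCond ht hdt hp]
  obtain ⟨q⟩ := nonempty_quadBasis ht hdt hd hF
  have hprim : ∀ A B C, B ^ 2 - 4 * A * C = t ^ 2 - 4 * m →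
      ∃ x y z : ℤ, x * A + y * B + z * C = 1 := fun A B C h => hF.primitive (h.trans hdt.symm)
  constructor
  · rintro ⟨P, Q, hne, hP, hQ, h⟩
    exact q.exists_root_of_split hp hne hP hQ h hprim
  · rintro ⟨k, h1, h2⟩
    obtain ⟨P, hP, hne, hm⟩ := q.exists_split hp h1 h2 hprim
    obtain ⟨C, hC⟩ := h1
    refine ⟨P, P.map q.σ, hne, hP, ?_, hm.symm⟩
    have e : P.map q.σ = P.comap q.σ := by
      apply le_antisymm
      · rw [Ideal.map_le_iff_le_comap]
        intro x hx
        simpa [q.σ_σ] using hx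
      · intro x hx
        rw [← q.σ_σ x]
        exact Ideal.mem_map_of_mem _ hx
    rw [e]
    exact Ideal.comap_isPrime _ _

lemma sClassSubgroup_eq {d t m : ℤ} {S : Finset ℕ} {q : QuadBasis (Od d) t m}
    {P : S → Ideal (Od d)} (h : q.SplitFamily (fun p : S => (p : ℕ)) P) :
    SClassSubgroup S d = Subgroup.closure (Set.range h.cls) := by
  apply le_antisymm
  · rw [SClassSubgroup, Subgroup.closure_le]
    rintro c ⟨Q, hQ, ⟨p, hp, hpQ⟩, rfl⟩
    have h1 : P ⟨p, hp⟩ * (P ⟨p, hp⟩).map q.σ ≤ Q := by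
      rw [h.mul, Ideal.span_le]
      simpa using hpQ
    have hmem : h.cls ⟨p, hp⟩ ∈ Subgroup.closure (Set.range h.cls) :=
      Subgroup.subset_closure ⟨_, rfl⟩
    rcases hQ.mul_le.mp h1 with h2 | h2
    · have e := ((h.isPrime ⟨p, hp⟩).isMaximal (h.ne_bot _)).eq_of_le hQ.ne_top h2
      have : ClassGroup.mk0 Q = h.cls ⟨p, hp⟩ := by
        rw [QuadBasis.SplitFamily.cls]; congr 1; exact Subtype.ext e.symm
      rw [this]; exact hmem
    · have e := ((h.isPrime_map ⟨p, hp⟩).isMaximal (h.map_ne_bot _)).eq_of_le hQ.ne_top h2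
      have : ClassGroup.mk0 Q = (h.cls ⟨p, hp⟩)⁻¹ := by
        rw [← h.mk0_map]; congr 1; exact Subtype.ext e.symm
      rw [this]; exact inv_mem hmem
  · rw [Subgroup.closure_le]
    rintro _ ⟨⟨p, hp⟩, rfl⟩
    apply Subgroup.subset_closure
    exact ⟨_, h.isPrime _, ⟨p, hp, h.mem_left ⟨p, hp⟩⟩, rfl⟩

lemma card_clS {S : Finset ℕ} {d : ℤ} {H : Subgroup (ClassGroup (Od d))}
    (h : SClassSubgroup S d = H) : Nat.card {x : ClS S d // x ^ 3 = 1} =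
      Nat.card {x : ClassGroup (Od d) ⧸ H // x ^ 3 = 1} := by
  subst h; rfl

/-- The exact formula for the 3-torsion of the quotient class group through counts of pairs. -/
lemma exists_count {d : ℤ} (hF : Fund d) (hd : d < -4) (S : Finset ℕ) (hS : ∀ p ∈ S, p.Prime)
    (hsp : ∀ p ∈ S, SplitCond p d) : ∃ E : Finset ℕ → ℕ,
    ∑ U ∈ S.powerset, E U = 3 ^ S.card * Nat.card {x : ClS S d // x ^ 3 = 1} ∧
    ∀ U ∈ S.powerset, 2 * E U ≤ {f | HessDvd (∏ p ∈ U, (p : ℤ)) d f ∧ HRed f}.ncard ∧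
      {f | HessDvd (∏ p ∈ U, (p : ℤ)) d f ∧ SRed f}.ncard ≤ 2 * E U := by
  classical
  obtain ⟨t, m, ht, hdt⟩ := hF.exists_tm
  obtain ⟨q⟩ := nonempty_quadBasis ht hdt (by omega) hF
  have hprim : ∀ A B C, B ^ 2 - 4 * A * C = t ^ 2 - 4 * m →
      ∃ x y z : ℤ, x * A + y * B + z * C = 1 := fun A B C h => hF.primitive (h.trans hdt.symm)
  have hex : ∀ p : S, ∃ P : Ideal (Od d), P.IsPrime ∧ P ≠ P.map q.σ ∧
      P * P.map q.σ = Ideal.span {((p : ℕ) : Od d)} := by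
    rintro ⟨p, hp⟩
    obtain ⟨k, h1, h2⟩ := (exists_root_iff_splitCond ht hdt (hS p hp)).mpr (hsp p hp)
    exact q.exists_split (hS p hp) h1 h2 hprim
  choose P hP hne hmul using hex
  have h : q.SplitFamily (fun p : S => (p : ℕ)) P :=
    ⟨fun p => hS _ p.2, Subtype.val_injective, hP, hne, hmul⟩
  refine ⟨fun U => (q.pairs (∏ p ∈ U, (p : ℤ))).ncard, ?_, ?_⟩
  · rw [card_clS (sClassSubgroup_eq h)]
    have := h.sum_card_pairs
    rw [Fintype.card_coe] at this
    rw [← this]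
    symm
    refine Finset.sum_bij (fun U _ => U.map (Function.Embedding.subtype _)) ?_ ?_ ?_ ?_
    · intro U _
      rw [Finset.mem_powerset]
      intro p hp
      simp only [Finset.mem_map] at hp
      obtain ⟨x, -, rfl⟩ := hp
      exact x.2
    · intro U _ V _ h
      exact Finset.map_injective _ h
    · intro V hV
      refine ⟨V.subtype (· ∈ S), Finset.mem_univ _, ?_⟩
      exact Finset.subtype_map_of_mem fun x hx => Finset.mem_powerset.mp hV hx
    · intro U _
      rw [Finset.prod_map]
      simp
  · intro U hU
    have hn : 0 < ∏ p ∈ U, (p : ℤ) := Finset.prod_pos fun p hp => by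
      exact_mod_cast (hS p (Finset.mem_powerset.mp hU hp)).pos
    have h1 := q.two_mul_card_pairs_le hprim (by omega) hn
    have h2 := q.card_le_two_mul_card_pairs hprim (by omega) hn
    rw [← hdt] at h1 h2
    exact ⟨h1, h2⟩

lemma squarefree_prod {U : Finset ℕ} (hU : ∀ p ∈ U, p.Prime) : Squarefree (∏ p ∈ U, (p : ℤ)) := by
  have h : Squarefree (∏ p ∈ U, p) := by
    refine Finset.squarefree_prod_of_pairwise_isCoprime ?_ fun p hp => (hU p hp).squarefree
    intro p hp q hq hne
    exact Nat.coprime_iff_isRelPrime.mp ((Nat.coprime_primes (hU p hp) (hU q hq)).mpr hne)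
  have := Int.squarefree_natCast.mpr h
  push_cast at this
  exact this

/-- The forms counted for the divisor `n` and the discriminant `d`, with a reduction condition. -/
def forms (R : (Fin 4 → ℤ) → Prop) (n d : ℤ) : Set (Fin 4 → ℤ) :=
  {f | (HessDvd n d f ∧ R f) ∧ f 0 ≠ 0}

lemma ncard_split {R : (Fin 4 → ℤ) → Prop} {n d : ℤ} (h : {f | HessDvd n d f ∧ R f}.Finite) :
    {f | HessDvd n d f ∧ R f}.ncard =
      {f | (HessDvd n d f ∧ R f) ∧ f 0 = 0}.ncard + (forms R n d).ncard := by
  rw [← Set.ncard_union_eq (Set.disjoint_left.mpr fun f h1 h2 => h2.2 h1.2)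
    (h.subset fun f hf => hf.1) (h.subset fun f hf => hf.1)]
  congr 1
  ext f
  simp only [forms, Set.mem_union, Set.mem_ofPred_eq]
  tauto

lemma zero_forms_empty {d : ℤ} {U : Finset ℕ} (hU : ∀ p ∈ U, p.Prime)
    (hsp : ∀ p ∈ U, SplitCond p d) (hne : U ≠ ∅) (R : (Fin 4 → ℤ) → Prop) :
    {f | (HessDvd (∏ p ∈ U, (p : ℤ)) d f ∧ R f) ∧ f 0 = 0}.ncard = 0 := by
  obtain ⟨p, hp⟩ := Finset.nonempty_iff_ne_empty.mpr hne
  convert Set.ncard_empty (Fin 4 → ℤ)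
  ext f
  simp only [Set.mem_ofPred_eq, Set.mem_empty_iff_false, iff_false]
  rintro ⟨⟨h, -⟩, h0⟩
  exact zero_ne_of_hessDvd (Finset.prod_pos fun p hp => by exact_mod_cast (hU p hp).pos)
    (squarefree_prod hU) (hU p hp) (Finset.dvd_prod_of_mem _ hp) (hsp p hp).not_dvd h h0

theorem two_mul_card_torsion_le {d : ℤ} (hF : Fund d) (hd : d < -4) (S : Finset ℕ)
    (hS : ∀ p ∈ S, p.Prime) (hsp : ∀ p ∈ S, SplitCond p d) :
    2 * (3 ^ S.card * Nat.card {x : ClS S d // x ^ 3 = 1}) ≤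
      2 + ∑ U ∈ S.powerset, (forms HRed (∏ p ∈ U, (p : ℤ)) d).ncard := by
  obtain ⟨E, hE, h⟩ := exists_count hF hd S hS hsp
  rw [← hE, Finset.mul_sum, ← Finset.add_sum_erase _ _ (Finset.empty_mem_powerset S),
    ← Finset.add_sum_erase (S.powerset) (fun U => (forms HRed _ d).ncard)
      (Finset.empty_mem_powerset S), ← add_assoc]
  apply add_le_add
  · obtain ⟨t, m, ht, hdt⟩ := hF.exists_tm
    have h1 := (h ∅ (Finset.empty_mem_powerset S)).1
    rw [ncard_split (finite_hRed _ _)] at h1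
    have h2 := ncard_hRed_zero_le ht (hdt ▸ hF)
    rw [← hdt] at h2
    simp only [Finset.prod_empty] at h1 ⊢
    omega
  · refine Finset.sum_le_sum fun U hU => ?_
    rw [Finset.mem_erase] at hU
    have h1 := (h U hU.2).1
    have hs := Finset.mem_powerset.mp hU.2
    rw [ncard_split (finite_hRed _ _), zero_forms_empty (fun p hp => hS p (hs hp))
      (fun p hp => hsp p (hs hp)) hU.1, zero_add] at h1
    exact h1

theorem le_two_mul_card_torsion {d : ℤ} (hF : Fund d) (hd : d < -4) (S : Finset ℕ)
    (hS : ∀ p ∈ S, p.Prime) (hsp : ∀ p ∈ S, SplitCond p d) :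
    2 + ∑ U ∈ S.powerset, (forms SRed (∏ p ∈ U, (p : ℤ)) d).ncard ≤
      2 * (3 ^ S.card * Nat.card {x : ClS S d // x ^ 3 = 1}) := by
  obtain ⟨E, hE, h⟩ := exists_count hF hd S hS hsp
  rw [← hE, Finset.mul_sum, ← Finset.add_sum_erase _ _ (Finset.empty_mem_powerset S),
    ← Finset.add_sum_erase _ (fun U => 2 * E U) (Finset.empty_mem_powerset S), ← add_assoc]
  apply add_le_add
  · obtain ⟨t, m, ht, hdt⟩ := hF.exists_tm
    have h1 := (h ∅ (Finset.empty_mem_powerset S)).2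
    rw [ncard_split (finite_sRed _ _)] at h1
    have h2 := two_le_ncard_sRed_zero ht (hdt ▸ hd)
    rw [← hdt] at h2
    simp only [Finset.prod_empty] at h1 ⊢
    omega
  · refine Finset.sum_le_sum fun U hU => ?_
    rw [Finset.mem_erase] at hU
    have h1 := (h U hU.2).2
    rw [ncard_split (finite_sRed _ _)] at h1
    omega

end Splitting

section Lattice

open MeasureTheory Topology

/-- The zero set of a nonzero real polynomial is a null set. -/
lemma volume_zeros_eq_zero : ∀ {n : ℕ} (p : MvPolynomial (Fin n) ℝ), p ≠ 0 →
    volume {x : Fin n → ℝ | MvPolynomial.eval x p = 0} = 0 := by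
  intro n
  induction n with
  | zero =>
    intro p hp
    convert measure_empty (μ := (volume : Measure (Fin 0 → ℝ)))
    ext x
    simp only [Set.mem_ofPred_eq, Set.mem_empty_iff_false, iff_false]
    intro h
    apply hp
    rw [MvPolynomial.eq_C_of_isEmpty p] at h ⊢
    simp at h
    rw [h, map_zero]
  | succ n ih =>
    intro p hp
    set q := MvPolynomial.finSuccEquiv ℝ n p with hq
    have hq0 : q ≠ 0 := by
      rw [hq]
      simpa using hp
    obtain ⟨i, hi⟩ : ∃ i, q.coeff i ≠ 0 := by
      by_contra! h
      exact hq0 (Polynomial.ext (by simpa using h))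
    have hZ : MeasurableSet {x : Fin (n + 1) → ℝ | MvPolynomial.eval x p = 0} :=
      (isClosed_eq (MvPolynomial.continuous_eval p) continuous_const).measurableSet
    have hmp := (volume_preserving_piFinSuccAbove (fun _ : Fin (n + 1) => ℝ) 0).symm
    rw [← hmp.measure_preimage hZ.nullMeasurableSet]
    rw [Measure.volume_eq_prod, ← Measure.prod_swap,
      Measure.map_apply measurable_swap (hmp.measurable hZ)]
    rw [Measure.measure_prod_null (measurable_swap (hmp.measurable hZ))]
    have h1 : ∀ᵐ s : Fin n → ℝ, MvPolynomial.eval s (q.coeff i) ≠ 0 := by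
      rw [ae_iff]; simpa using ih _ hi
    filter_upwards [h1] with s hs
    have hr : Polynomial.map (MvPolynomial.eval s) q ≠ 0 := by
      intro h
      apply hs
      have := congrArg (fun r => Polynomial.coeff r i) h
      simpa using this
    refine measure_mono_null ?_ ((Polynomial.map (MvPolynomial.eval s) q).roots.toFinset.finite_toSet.measure_zero volume)
    intro y hy
    have hy' : MvPolynomial.eval (Fin.cons y s : Fin (n + 1) → ℝ) p = 0 := by
      simpa [MeasurableEquiv.piFinSuccAbove, Fin.insertNthEquiv] using hy
    rw [MvPolynomial.eval_eq_eval_mv_eval'] at hy'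
    simpa [hr] using hy'

variable {ι : Type*} [Fintype ι]

/-- Rounding to the lattice coset `r + mℤ^ι`, scaled by `T`. -/
noncomputable def latticeRound (m : ℕ) (r : ι → ℤ) (T : ℝ) (y : ι → ℝ) (i : ι) : ℝ :=
  ((r i + m * ⌊T * y i / m⌋ : ℤ) : ℝ) / T

lemma abs_latticeRound_sub {m : ℕ} (hm : 0 < m) (r : ι → ℤ) {T : ℝ} (hT : 0 < T) (y : ι → ℝ)
    (i : ι) : |latticeRound m r T y i - y i| ≤ (|(r i : ℝ)| + m) / T := by
  have hm' : (0 : ℝ) < m := by exact_mod_cast hm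
  have h1 := Int.floor_le (T * y i / m)
  have h2 := Int.lt_floor_add_one (T * y i / m)
  rw [le_div_iff₀ hm'] at h1
  rw [div_lt_iff₀ hm'] at h2
  have e : latticeRound m r T y i - y i = (r i + (m * ⌊T * y i / m⌋ - T * y i)) / T := by
    rw [latticeRound]; push_cast; field_simp; ring
  rw [e, abs_div, abs_of_pos hT]
  gcongr
  refine (abs_add_le _ _).trans ?_
  gcongr
  rw [abs_le]
  constructor <;> nlinarith

lemma tendsto_latticeRound {m : ℕ} (hm : 0 < m) (r : ι → ℤ) (y : ι → ℝ) :
    Tendsto (fun T => latticeRound m r T y) atTop (𝓝 y) := by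
  rw [tendsto_pi_nhds]
  intro i
  rw [tendsto_iff_norm_sub_tendsto_zero]
  have h : Tendsto (fun T : ℝ => (|(r i : ℝ)| + m) / T) atTop (𝓝 0) :=
    tendsto_const_nhds.div_atTop tendsto_id
  refine squeeze_zero' (Eventually.of_forall fun T => norm_nonneg _) ?_ h
  filter_upwards [eventually_gt_atTop 0] with T hT
  exact abs_latticeRound_sub hm r hT y i

/-- The points of the coset `r + mℤ^ι` in the dilate `T • R`. -/
def latticePts (m : ℕ) (r : ι → ℤ) (R : Set (ι → ℝ)) (T : ℝ) : Set (ι → ℤ) :=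
  {z | (∀ i, z i ≡ r i [ZMOD m]) ∧ (fun i => (z i : ℝ) / T) ∈ R}

lemma finite_intPts {R : Set (ι → ℝ)} (hR : Bornology.IsBounded R) {T : ℝ} (hT : 0 < T) :
    {z : ι → ℤ | (fun i => (z i : ℝ) / T) ∈ R}.Finite := by
  classical
  obtain ⟨C, hC⟩ := hR.exists_norm_le
  refine (Set.Finite.pi' fun _ => Set.finite_Icc (-⌈C * T⌉) ⌈C * T⌉).subset fun z hz i => ?_
  have h1 : |(z i : ℝ) / T| ≤ C := (norm_le_pi_norm (fun i => (z i : ℝ) / T) i).trans (hC _ hz)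
  rw [abs_div, abs_of_pos hT, div_le_iff₀ hT] at h1
  have h2 := abs_le.mp (h1.trans (Int.le_ceil _))
  exact ⟨by exact_mod_cast h2.1, by exact_mod_cast h2.2⟩

lemma volume_preimage_latticeRound {m : ℕ} (hm : 0 < m) (r : ι → ℤ) {R : Set (ι → ℝ)}
    (hR : Bornology.IsBounded R) {T : ℝ} (hT : 0 < T) :
    MeasurableSet (latticeRound m r T ⁻¹' R) ∧
    volume (latticeRound m r T ⁻¹' R) =
      ENNReal.ofReal ((latticePts m r R T).ncard * (m / T) ^ Fintype.card ι) := by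
  have hm' : (0 : ℝ) < m := by exact_mod_cast hm
  have hfin : (latticePts m r R T).Finite := (finite_intPts hR hT).subset fun z hz => hz.2
  set cell : (ι → ℤ) → Set (ι → ℝ) := fun z => Set.univ.pi fun i =>
    Set.Ico ((z i - r i : ℝ) / T) ((z i - r i + m : ℝ) / T) with hcell
  have hmem : ∀ z y, (∀ i, z i ≡ r i [ZMOD m]) → (y ∈ cell z ↔
      ∀ i, z i = r i + m * ⌊T * y i / m⌋) := by
    intro z y hz
    rw [hcell, Set.mem_univ_pi]
    refine forall_congr' fun i => ?_
    obtain ⟨w, hw⟩ := (hz i).symm.dvd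
    have e : z i = r i + m * w := by linarith
    have e' : (z i : ℝ) = r i + m * w := by exact_mod_cast e
    rw [e', Set.mem_Ico, e, div_le_iff₀ hT, lt_div_iff₀ hT]
    have h3 : (r i + m * w = r i + m * ⌊T * y i / m⌋) ↔ ⌊T * y i / m⌋ = w := by
      constructor
      · intro h
        have h4 : (m : ℤ) ≠ 0 := by exact_mod_cast hm.ne'
        exact (mul_left_cancel₀ h4 (add_left_cancel h)).symm
      · intro h; rw [h]
    rw [h3, Int.floor_eq_iff, le_div_iff₀ hm', div_lt_iff₀ hm']
    constructor <;> rintro ⟨h1, h2⟩ <;> constructor <;> nlinarith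
  have hunion : latticeRound m r T ⁻¹' R = ⋃ z ∈ hfin.toFinset, cell z := by
    ext y
    simp only [Set.mem_preimage, Set.mem_iUnion, Set.Finite.mem_toFinset, exists_prop]
    constructor
    · intro hy
      refine ⟨fun i => r i + m * ⌊T * y i / m⌋, ⟨fun i => ?_, hy⟩, ?_⟩
      · exact (Int.modEq_iff_dvd.mpr ⟨⌊T * y i / m⌋, by ring⟩).symm
      · rw [hmem]
        · simp
        · exact fun i => (Int.modEq_iff_dvd.mpr ⟨⌊T * y i / m⌋, by ring⟩).symm
    · rintro ⟨z, ⟨hz, hzR⟩, hy⟩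
      rw [hmem z y hz] at hy
      convert hzR using 1
      funext i
      rw [latticeRound, ← hy i]
  have hmeas : ∀ z, MeasurableSet (cell z) := fun z => MeasurableSet.univ_pi fun i => measurableSet_Ico
  have hvol : ∀ z, volume (cell z) = ENNReal.ofReal ((m / T) ^ Fintype.card ι) := by
    intro z
    rw [hcell, volume_pi_pi]
    simp only [Real.volume_Ico]
    rw [Finset.prod_congr rfl fun i _ => by
      rw [show ((z i : ℝ) - r i + m) / T - (z i - r i) / T = m / T by ring]]
    rw [Finset.prod_const, Finset.card_univ, ENNReal.ofReal_pow (by positivity)]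
  refine ⟨hunion ▸ Finset.measurableSet_biUnion _ fun z _ => hmeas z, ?_⟩
  rw [hunion, measure_biUnion_finset _ fun z _ => hmeas z]
  · rw [Finset.sum_congr rfl fun z _ => hvol z, Finset.sum_const, nsmul_eq_mul,
      ← Set.ncard_eq_toFinset_card _ hfin, ENNReal.ofReal_mul (by positivity), ENNReal.ofReal_natCast]
  · intro z hz z' hz' hne
    simp only [Set.Finite.coe_toFinset] at hz hz'
    refine Set.disjoint_left.mpr fun y hy hy' => hne ?_
    rw [hmem _ _ hz.1] at hy
    rw [hmem _ _ hz'.1] at hy'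
    funext i
    rw [hy i, hy' i]

/-- Asymptotic count of the points of a lattice coset in the dilates of a bounded set with
negligible boundary. -/
theorem tendsto_latticePts {m : ℕ} (hm : 0 < m) (r : ι → ℤ) {R : Set (ι → ℝ)}
    (hR : Bornology.IsBounded R) (hRm : MeasurableSet R) (hfr : volume (frontier R) = 0) :
    Tendsto (fun T : ℝ => ((latticePts m r R T).ncard : ℝ) / T ^ Fintype.card ι) atTop
      (𝓝 ((volume R).toReal / m ^ Fintype.card ι)) := by
  classical
  have hm' : (0 : ℝ) < m := by exact_mod_cast hm
  obtain ⟨C, hC⟩ := hR.exists_norm_le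
  set D : ℝ := C + (∑ i, |(r i : ℝ)| + m) with hD
  set As : ℝ → Set (ι → ℝ) := fun T => if 0 < T then latticeRound m r T ⁻¹' R else ∅ with hAs
  have key : Tendsto (fun T => volume (As T)) atTop (𝓝 (volume R)) := by
    refine tendsto_measure_of_ae_tendsto_indicator atTop hRm (B := Metric.closedBall 0 (max D 0)) ?_
      Metric.isClosed_closedBall.measurableSet measure_closedBall_lt_top.ne ?_ ?_
    · intro T
      simp only [hAs]
      split_ifs with hT
      · exact (volume_preimage_latticeRound hm r hR hT).1
      · exact MeasurableSet.empty
    · filter_upwards [eventually_ge_atTop 1] with T hT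
      have hT0 : 0 < T := by linarith
      simp only [hAs, if_pos hT0]
      intro y hy
      rw [mem_closedBall_zero_iff, pi_norm_le_iff_of_nonneg (le_max_right _ _)]
      intro i
      have h1 : |latticeRound m r T y i| ≤ C := (norm_le_pi_norm _ i).trans (hC _ hy)
      have h2 := abs_latticeRound_sub hm r hT0 y i
      have h3 : (|(r i : ℝ)| + m) / T ≤ ∑ i, |(r i : ℝ)| + m := by
        refine (div_le_self (by positivity) hT).trans ?_
        gcongr
        exact Finset.single_le_sum (f := fun i => |(r i : ℝ)|) (fun _ _ => abs_nonneg _)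
          (Finset.mem_univ i)
      refine le_trans ?_ (le_max_left _ _)
      rw [Real.norm_eq_abs]
      have h4 := abs_sub_abs_le_abs_sub (y i) (latticeRound m r T y i)
      rw [abs_sub_comm] at h4
      linarith
    · have h0 : ∀ᵐ y, y ∉ frontier R := by
        rw [ae_iff]; simpa using hfr
      filter_upwards [h0] with y hy
      have ht := tendsto_latticeRound hm r y
      by_cases hyi : y ∈ interior R
      · filter_upwards [ht (mem_interior_iff_mem_nhds.mp hyi), eventually_gt_atTop 0] with T h1 h2
        simp only [hAs, if_pos h2]
        exact ⟨fun _ => interior_subset hyi, fun _ => h1⟩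
      · have hyc : y ∈ interior Rᶜ := by
          rw [interior_compl, Set.mem_compl_iff]
          intro hcl
          exact hy ⟨hcl, hyi⟩
        filter_upwards [ht (mem_interior_iff_mem_nhds.mp hyc), eventually_gt_atTop 0] with T h1 h2
        simp only [hAs, if_pos h2]
        exact ⟨fun h => absurd h h1, fun h => absurd h (interior_subset hyc)⟩
  have hfin : volume R ≠ ⊤ := hR.measure_lt_top.ne
  have key2 := ((ENNReal.tendsto_toReal hfin).comp key).div_const ((m : ℝ) ^ Fintype.card ι)
  refine key2.congr' ?_
  filter_upwards [eventually_gt_atTop 0] with T hT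
  simp only [Function.comp, hAs, if_pos hT]
  rw [(volume_preimage_latticeRound hm r hR hT).2, ENNReal.toReal_ofReal (by positivity), div_pow]
  field_simp

end Lattice

section Volume

open MeasureTheory Topology

/-- Reduced real forms of discriminant greater than `-1` with nonzero leading coefficient. -/
def redBody : Set (Fin 4 → ℝ) := {f | WRed f ∧ -1 < disc f ∧ f 0 ≠ 0}

/-- The form with coefficients `Im (ω ρ ^ i)`, `ρ = p 0 + i p 1`, `ω = p 2 + i p 3`. -/
def imForm (p : Fin 4 → ℝ) : Fin 4 → ℝ :=
  ![p 3, p 2 * p 1 + p 3 * p 0, p 2 * (2 * p 0 * p 1) + p 3 * (p 0 ^ 2 - p 1 ^ 2),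
    p 2 * (3 * p 0 ^ 2 * p 1 - p 1 ^ 3) + p 3 * (p 0 ^ 3 - 3 * p 0 * p 1 ^ 2)]

def imFormJac (p : Fin 4 → ℝ) : Matrix (Fin 4) (Fin 4) ℝ :=
  !![0, 0, 0, 1;
     p 3, p 2, p 1, p 0;
     p 2 * (2 * p 1) + p 3 * (2 * p 0), p 2 * (2 * p 0) - p 3 * (2 * p 1), 2 * p 0 * p 1,
       p 0 ^ 2 - p 1 ^ 2;
     p 2 * (6 * p 0 * p 1) + p 3 * (3 * p 0 ^ 2 - 3 * p 1 ^ 2),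
       p 2 * (3 * p 0 ^ 2 - 3 * p 1 ^ 2) - p 3 * (6 * p 0 * p 1), 3 * p 0 ^ 2 * p 1 - p 1 ^ 3,
       p 0 ^ 3 - 3 * p 0 * p 1 ^ 2]

lemma det_imFormJac (p : Fin 4 → ℝ) :
    (imFormJac p).det = 4 * (p 2 ^ 2 + p 3 ^ 2) * p 1 ^ 4 := by
  rw [imFormJac]
  simp [Matrix.det_succ_row_zero, Fin.sum_univ_succ, Fin.succAbove]
  ring

lemma hasFDerivAt_imForm (p : Fin 4 → ℝ) :
    HasFDerivAt imForm (LinearMap.toContinuousLinearMap (Matrix.toLin' (imFormJac p))) p := by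
  have hc : ∀ i : Fin 4, HasFDerivAt (fun q : Fin 4 → ℝ => q i)
      (ContinuousLinearMap.proj (R := ℝ) (φ := fun _ : Fin 4 => ℝ) i) p := fun i => hasFDerivAt_apply i p
  have h0 := hc 0
  have h1 := hc 1
  have h2 := hc 2
  have h3 := hc 3
  rw [hasFDerivAt_pi']
  intro i
  fin_cases i
  · refine h3.congr_fderiv ?_
    ext v
    simp [imFormJac, Matrix.toLin'_apply, dotProduct, Fin.sum_univ_succ]
  · refine ((h2.mul h1).add (h3.mul h0)).congr_fderiv ?_
    ext v
    simp [imFormJac, Matrix.toLin'_apply, dotProduct, Fin.sum_univ_succ]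
    ring
  · refine ((h2.mul ((h0.const_mul 2).mul h1)).add (h3.mul ((h0.pow 2).sub (h1.pow 2)))).congr_fderiv ?_
    ext v
    simp [imFormJac, Matrix.toLin'_apply, dotProduct, Fin.sum_univ_succ]
    ring
  · refine ((h2.mul ((((h0.pow 2).const_mul 3).mul h1).sub (h1.pow 3))).add
      (h3.mul ((h0.pow 3).sub ((h0.const_mul 3).mul (h1.pow 2))))).congr_fderiv ?_
    ext v
    simp [imFormJac, Matrix.toLin'_apply, dotProduct, Fin.sum_univ_succ]
    ring

/-- The parameter domain of `imForm` corresponding to `redBody`. -/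
def imDom : Set (Fin 4 → ℝ) := {p | |2 * p 0| ≤ 1 ∧ 0 < p 1 ∧ 1 ≤ p 0 ^ 2 + p 1 ^ 2 ∧ p 3 ≠ 0 ∧
  4 * (p 2 ^ 2 + p 3 ^ 2) ^ 2 * p 1 ^ 6 < 1}

lemma hA_imForm (p : Fin 4 → ℝ) : hA (imForm p) = (p 2 ^ 2 + p 3 ^ 2) * p 1 ^ 2 := by
  simp [hA, imForm]; ring

lemma hB_imForm (p : Fin 4 → ℝ) : hB (imForm p) = 2 * p 0 * hA (imForm p) := by
  simp [hA, hB, imForm]; ring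

lemma hC_imForm (p : Fin 4 → ℝ) : hC (imForm p) = (p 0 ^ 2 + p 1 ^ 2) * hA (imForm p) := by
  simp [hA, hC, imForm]; ring

lemma disc_imForm (p : Fin 4 → ℝ) :
    disc (imForm p) = -(4 * (p 2 ^ 2 + p 3 ^ 2) ^ 2 * p 1 ^ 6) := by
  rw [disc, hB_imForm, hC_imForm, hA_imForm]; ring

lemma injOn_imForm : Set.InjOn imForm imDom := by
  intro p hp q hq h
  obtain ⟨-, hp1, -, hp3, -⟩ := hp
  obtain ⟨-, hq1, -, hq3, -⟩ := hq
  have hA0 : 0 < hA (imForm p) := by rw [hA_imForm]; positivity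
  have e0 : p 0 = q 0 := by
    have h1 := hB_imForm p
    have h2 := hB_imForm q
    rw [← h, h1] at h2
    have := mul_right_cancel₀ hA0.ne' h2
    linarith
  have e1 : p 1 = q 1 := by
    have h1 := hC_imForm p
    have h2 := hC_imForm q
    rw [← h, h1] at h2
    have := mul_right_cancel₀ hA0.ne' h2
    rw [e0] at this
    nlinarith
  have e3 : p 3 = q 3 := by simpa [imForm] using congrFun h 0
  have e2 : p 2 = q 2 := by
    have := congrFun h 1
    simp only [imForm, Matrix.cons_val_one, Matrix.cons_val_zero] at this
    rw [e0, e3, e1] at this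
    exact mul_right_cancel₀ hq1.ne' (by linarith)
  funext i
  fin_cases i <;> assumption

lemma image_imForm : imForm '' imDom = redBody := by
  ext f
  constructor
  · rintro ⟨p, ⟨h0, h1, h2, h3, h4⟩, rfl⟩
    have hA0 : 0 < hA (imForm p) := by rw [hA_imForm]; positivity
    refine ⟨⟨hA0, ?_, ?_⟩, ?_, ?_⟩
    · rw [hB_imForm, abs_mul, abs_of_pos hA0]; nlinarith
    · rw [hC_imForm]; nlinarith
    · rw [disc_imForm]; linarith
    · simpa [imForm] using h3
  · rintro ⟨hW, hd, hf0⟩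
    have hA0 := hW.1
    have hD := hW.disc_neg
    set x := hB f / (2 * hA f) with hx
    set y := √(-disc f) / (2 * hA f) with hy
    have hy0 : 0 < y := by
      have : 0 < √(-disc f) := Real.sqrt_pos.mpr (by linarith)
      positivity
    have hxB : hB f = 2 * x * hA f := by rw [hx]; field_simp
    have hy2 : y ^ 2 * (4 * hA f ^ 2) = -disc f := by
      rw [hy, div_pow, Real.sq_sqrt (by linarith)]; field_simp; norm_num
    have hxC : hC f = (x ^ 2 + y ^ 2) * hA f := by
      have h1 : disc f = hB f ^ 2 - 4 * hA f * hC f := rfl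
      rw [hxB, ← neg_inj, ← hy2] at h1
      have h2 : hA f * (hC f - (x ^ 2 + y ^ 2) * hA f) = 0 := by nlinarith
      rcases mul_eq_zero.mp h2 with h | h
      · exact absurd h hA0.ne'
      · linarith
    have s1 := syzygy_left f
    have s2 := syzygy_right f
    have e2 : f 2 = 2 * x * f 1 - (x ^ 2 + y ^ 2) * f 0 := by
      rw [hxB, hxC] at s1
      exact mul_left_cancel₀ hA0.ne' (by linarith)
    have e3 : f 3 = 2 * x * f 2 - (x ^ 2 + y ^ 2) * f 1 := by
      rw [hxB, hxC] at s2
      exact mul_left_cancel₀ hA0.ne' (by linarith)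
    set p : Fin 4 → ℝ := ![x, y, (f 1 - f 0 * x) / y, f 0] with hp
    have hpf : imForm p = f := by
      have e1 : (f 1 - f 0 * x) / y * y = f 1 - f 0 * x := div_mul_cancel₀ _ hy0.ne'
      have g1 : imForm p 1 = f 1 := by simp [imForm, hp, e1]
      have g2 : imForm p 2 = f 2 := by
        rw [e2]; simp [imForm, hp]; linear_combination 2 * x * e1
      funext i
      fin_cases i
      · simp [imForm, hp]
      · exact g1
      · exact g2
      · show imForm p 3 = f 3
        rw [e3, ← g2]
        simp [imForm, hp]
        linear_combination (-(x ^ 2 + y ^ 2)) * e1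
    refine ⟨p, ⟨?_, hy0, ?_, hf0, ?_⟩, hpf⟩
    · have := hW.2.1
      rw [hxB, abs_mul, abs_of_pos hA0] at this
      exact le_of_mul_le_mul_right (by simpa [hp] using this) hA0
    · have := hW.2.2
      rw [hxC] at this
      exact le_of_mul_le_mul_right (by simpa [hp] using this) hA0
    · have := disc_imForm p
      rw [hpf] at this
      linarith

lemma measurableSet_imDom : MeasurableSet imDom := by
  have h : imDom = {p | |2 * p 0| ≤ 1} ∩ ({p | 0 < p 1} ∩ ({p | 1 ≤ p 0 ^ 2 + p 1 ^ 2} ∩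
    ({p | p 3 = 0}ᶜ ∩ {p | 4 * (p 2 ^ 2 + p 3 ^ 2) ^ 2 * p 1 ^ 6 < 1}))) := rfl
  rw [h]
  refine (measurableSet_le (by fun_prop) (by fun_prop)).inter ((measurableSet_lt (by fun_prop)
    (by fun_prop)).inter ((measurableSet_le (by fun_prop) (by fun_prop)).inter
    ((measurableSet_eq_fun (by fun_prop) (by fun_prop)).compl.inter
    (measurableSet_lt (by fun_prop) (by fun_prop)))))

lemma volume_redBody_eq_lintegral : volume redBody =
    ∫⁻ p in imDom, ENNReal.ofReal (4 * (p 2 ^ 2 + p 3 ^ 2) * p 1 ^ 4) := by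
  rw [← image_imForm, ← lintegral_abs_det_fderiv_eq_addHaar_image volume measurableSet_imDom
    (fun p _ => (hasFDerivAt_imForm p).hasFDerivWithinAt) injOn_imForm]
  refine setLIntegral_congr_fun measurableSet_imDom fun p _ => ?_
  have : (LinearMap.toContinuousLinearMap (Matrix.toLin' (imFormJac p))).det =
      4 * (p 2 ^ 2 + p 3 ^ 2) * p 1 ^ 4 := by
    rw [LinearMap.det_toContinuousLinearMap, LinearMap.det_toLin', det_imFormJac]
  simp only [this]
  rw [abs_of_nonneg (by positivity)]

lemma measurable_fin_cons {n : ℕ} (a : ℝ) :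
    Measurable fun q : Fin n → ℝ => (Fin.cons a q : Fin (n + 1) → ℝ) := by
  rw [measurable_pi_iff]
  intro i
  refine Fin.cases ?_ (fun i => ?_) i
  · simp
  · simpa using measurable_pi_apply i

lemma lintegral_fin_cons {n : ℕ} (F : (Fin (n + 1) → ℝ) → ENNReal) (hF : Measurable F) :
    ∫⁻ p, F p = ∫⁻ a, ∫⁻ y : Fin n → ℝ, F (Fin.cons a y) := by
  have hmp := (volume_preserving_piFinSuccAbove (fun _ : Fin (n + 1) => ℝ) 0).symm
  rw [← hmp.lintegral_comp hF, Measure.volume_eq_prod, lintegral_prod]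
  · simp [MeasurableEquiv.piFinSuccAbove, Fin.insertNthEquiv]
  · exact (hF.comp hmp.measurable).aemeasurable

lemma lintegral_normSq_disc {k c : ℝ} (hk : 0 ≤ k) (hc : 0 < c) :
    ∫⁻ z : ℝ × ℝ, (if c * (z.1 ^ 2 + z.2 ^ 2) ^ 2 < 1 then
      ENNReal.ofReal (k * (z.1 ^ 2 + z.2 ^ 2)) else 0) = ENNReal.ofReal (Real.pi * k / (2 * c)) := by
  rw [← lintegral_comp_polarCoord_symm]
  set R : ℝ := √(√(1 / c)) with hR
  have hR0 : 0 < R := by rw [hR]; positivity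
  have hR4 : c * R ^ 4 = 1 := by
    rw [hR, show √(√(1 / c)) ^ 4 = (√(√(1 / c)) ^ 2) ^ 2 by ring, Real.sq_sqrt (by positivity),
      Real.sq_sqrt (by positivity)]
    field_simp
  have hpt : ∀ p : ℝ × ℝ, (polarCoord.symm p).1 ^ 2 + (polarCoord.symm p).2 ^ 2 = p.1 ^ 2 := by
    intro p
    simp only [polarCoord_symm_apply]
    linear_combination p.1 ^ 2 * Real.cos_sq_add_sin_sq p.2
  have hradial : ∫⁻ r in Set.Ioo 0 R, ENNReal.ofReal (k * r ^ 3) = ENNReal.ofReal (k / (4 * c)) := by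
    rw [← ofReal_integral_eq_lintegral_ofReal, ← integral_Ioc_eq_integral_Ioo,
      ← intervalIntegral.integral_of_le hR0.le]
    · simp only [intervalIntegral.integral_const_mul, integral_pow]
      congr 1
      field_simp
      norm_num
      linear_combination 4 * k * hR4
    · exact ((by fun_prop : Continuous fun r : ℝ => k * r ^ 3).integrableOn_Icc).mono_set Set.Ioo_subset_Icc_self
    · filter_upwards [ae_restrict_mem measurableSet_Ioo] with r hr
      have := hr.1
      positivity
  have hset : ∀ p ∈ polarCoord.target, ENNReal.ofReal p.1 •
      (if c * ((polarCoord.symm p).1 ^ 2 + (polarCoord.symm p).2 ^ 2) ^ 2 < 1 then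
      ENNReal.ofReal (k * ((polarCoord.symm p).1 ^ 2 + (polarCoord.symm p).2 ^ 2)) else 0) =
      (Set.Ioo 0 R).indicator (fun r => ENNReal.ofReal (k * r ^ 3)) p.1 * 1 := by
    intro p hp
    have hp0 : 0 < p.1 := hp.1
    rw [hpt, mul_one]
    have hiff : c * (p.1 ^ 2) ^ 2 < 1 ↔ p.1 ∈ Set.Ioo 0 R := by
      rw [← hR4, ← pow_mul, mul_lt_mul_iff_right₀ hc, pow_lt_pow_iff_left₀ hp0.le hR0.le (by norm_num)]
      simp [hp0]
    by_cases h : p.1 ∈ Set.Ioo 0 R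
    · rw [if_pos (hiff.mpr h), Set.indicator_of_mem h, smul_eq_mul, ← ENNReal.ofReal_mul hp0.le]
      congr 1; ring
    · rw [if_neg (fun h' => h (hiff.mp h')), Set.indicator_of_notMem h, smul_zero]
  rw [setLIntegral_congr_fun polarCoord.open_target.measurableSet hset, polarCoord_target,
    Measure.volume_eq_prod, ← Measure.prod_restrict,
    lintegral_prod_mul (g := fun _ => (1 : ENNReal))]
  · rw [setLIntegral_indicator measurableSet_Ioo, lintegral_one, Measure.restrict_apply_univ, Real.volume_Ioo,
      Set.inter_eq_left.mpr Set.Ioo_subset_Ioi_self, hradial, ← ENNReal.ofReal_mul (by positivity)]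
    congr 1
    field_simp
    ring
  · exact ((by fun_prop : Measurable fun r : ℝ => ENNReal.ofReal (k * r ^ 3)).indicator
      measurableSet_Ioo).aemeasurable
  · exact aemeasurable_const

lemma lintegral_Ici_inv_sq {a k : ℝ} (ha : 0 < a) (hk : 0 ≤ k) :
    ∫⁻ y in Set.Ici a, ENNReal.ofReal (k / y ^ 2) = ENNReal.ofReal (k / a) := by
  have hd : ∀ y ∈ Set.Ici a, HasDerivAt (fun y : ℝ => -(k / y)) (k / y ^ 2) y := by
    intro y hy
    have hy0 : y ≠ 0 := (ha.trans_le hy).ne'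
    have h := ((hasDerivAt_inv hy0).const_mul k).neg
    have e : -(k * -(y ^ 2)⁻¹) = k / y ^ 2 := by ring
    rw [e] at h
    exact h
  have hlim : Tendsto (fun y : ℝ => -(k / y)) atTop (𝓝 0) := by
    simpa using (tendsto_const_nhds (x := k) |>.div_atTop tendsto_id).neg
  have hnn : ∀ y ∈ Set.Ioi a, 0 ≤ k / y ^ 2 := fun y _ => by positivity
  rw [setLIntegral_congr Ioi_ae_eq_Ici.symm, ← ofReal_integral_eq_lintegral_ofReal,
    integral_Ioi_of_hasDerivAt_of_nonneg' hd hnn hlim]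
  · simp
  · exact integrableOn_Ioi_deriv_of_nonneg' hd hnn hlim
  · filter_upwards [ae_restrict_mem measurableSet_Ioi] with y hy using hnn y hy

lemma lintegral_arcsin {k : ℝ} (hk : 0 ≤ k) :
    ∫⁻ x in Set.Icc (-(1 / 2) : ℝ) (1 / 2), ENNReal.ofReal (k / √(1 - x ^ 2)) =
      ENNReal.ofReal (k * (Real.pi / 3)) := by
  have hne : ∀ x ∈ Set.Icc (-(1 / 2) : ℝ) (1 / 2), 0 < 1 - x ^ 2 := by
    intro x hx
    nlinarith [hx.1, hx.2]
  have hcont : ContinuousOn (fun x : ℝ => k / √(1 - x ^ 2)) (Set.Icc (-(1 / 2) : ℝ) (1 / 2)) := by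
    refine ContinuousOn.div (by fun_prop) (by fun_prop) fun x hx => ?_
    exact (Real.sqrt_pos.mpr (hne x hx)).ne'
  have h16 : Real.arcsin (1 / 2) = Real.pi / 6 := by
    rw [← Real.sin_pi_div_six, Real.arcsin_sin] <;> linarith [Real.pi_pos]
  rw [← ofReal_integral_eq_lintegral_ofReal, integral_Icc_eq_integral_Ioc,
    ← intervalIntegral.integral_of_le (by norm_num)]
  · rw [intervalIntegral.integral_eq_sub_of_hasDerivAt (f := fun x => k * Real.arcsin x)]
    · rw [Real.arcsin_neg, h16]
      congr 1; ring
    · intro x hx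
      rw [Set.uIcc_of_le (by norm_num)] at hx
      have := (Real.hasDerivAt_arcsin (x := x) (by intro h; rw [h] at hx; norm_num at hx)
        (by intro h; rw [h] at hx; norm_num at hx)).const_mul k
      rwa [← div_eq_mul_one_div] at this
    · refine ContinuousOn.intervalIntegrable ?_
      rwa [Set.uIcc_of_le (by norm_num)]
  · exact hcont.integrableOn_Icc
  · filter_upwards with x
    positivity

lemma lintegral_fin_two (F : (Fin 2 → ℝ) → ENNReal) (hF : Measurable F) :
    ∫⁻ p, F p = ∫⁻ z : ℝ × ℝ, F ![z.1, z.2] := by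
  have hmp := (volume_preserving_finTwoArrow ℝ).symm
  rw [← hmp.lintegral_comp hF]
  rfl

/-- The integrand of `volume_redBody_eq_lintegral`, up to a null set. -/
noncomputable def imDensity (p : Fin 4 → ℝ) : ENNReal :=
  if |2 * p 0| ≤ 1 ∧ 0 < p 1 ∧ 1 ≤ p 0 ^ 2 + p 1 ^ 2 then
    (if 4 * p 1 ^ 6 * (p 2 ^ 2 + p 3 ^ 2) ^ 2 < 1 then
      ENNReal.ofReal (4 * p 1 ^ 4 * (p 2 ^ 2 + p 3 ^ 2)) else 0) else 0

lemma measurable_imDensity : Measurable imDensity := by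
  have h1 : MeasurableSet {p : Fin 4 → ℝ | |2 * p 0| ≤ 1} :=
    measurableSet_le (by fun_prop) (by fun_prop)
  have h2 : MeasurableSet {p : Fin 4 → ℝ | 0 < p 1} :=
    measurableSet_lt (by fun_prop) (by fun_prop)
  have h3 : MeasurableSet {p : Fin 4 → ℝ | 1 ≤ p 0 ^ 2 + p 1 ^ 2} :=
    measurableSet_le (by fun_prop) (by fun_prop)
  exact Measurable.ite (h1.inter (h2.inter h3))
    (Measurable.ite (measurableSet_lt (by fun_prop) (by fun_prop))
    (by fun_prop) measurable_const) measurable_const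

lemma volume_redBody : volume redBody = ENNReal.ofReal (Real.pi ^ 2 / 6) := by
  classical
  have hnull : ∀ᵐ p : Fin 4 → ℝ, p 3 ≠ 0 := by
    rw [ae_iff]
    simpa using volume_zeros_eq_zero (MvPolynomial.X 3 : MvPolynomial (Fin 4) ℝ) (MvPolynomial.X_ne_zero 3)
  have h1 : volume redBody = ∫⁻ p, imDensity p := by
    rw [volume_redBody_eq_lintegral, ← lintegral_indicator measurableSet_imDom]
    refine lintegral_congr_ae ?_
    filter_upwards [hnull] with p hp
    rw [Set.indicator_apply, imDensity]
    by_cases h : |2 * p 0| ≤ 1 ∧ 0 < p 1 ∧ 1 ≤ p 0 ^ 2 + p 1 ^ 2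
    · rw [if_pos h]
      have : p ∈ imDom ↔ 4 * p 1 ^ 6 * (p 2 ^ 2 + p 3 ^ 2) ^ 2 < 1 := by
        rw [mul_right_comm]
        exact ⟨fun h' => h'.2.2.2.2, fun h' => ⟨h.1, h.2.1, h.2.2, hp, h'⟩⟩
      simp only [this, mul_right_comm]
    · rw [if_neg h, if_neg fun h' => h ⟨h'.1, h'.2.1, h'.2.2.1⟩]
  rw [h1, lintegral_fin_cons _ measurable_imDensity]
  have h2 : ∀ x : ℝ, ∫⁻ q : Fin 3 → ℝ, imDensity (Fin.cons x q) =
      (Set.Icc (-(1 / 2) : ℝ) (1 / 2)).indicator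
        (fun x => ENNReal.ofReal ((Real.pi / 2) / √(1 - x ^ 2))) x := by
    intro x
    rw [lintegral_fin_cons (fun q : Fin 3 → ℝ => imDensity (Fin.cons x q))
      (measurable_imDensity.comp (measurable_fin_cons x))]
    by_cases hx : x ∈ Set.Icc (-(1 / 2) : ℝ) (1 / 2)
    · have hx2 : 0 < 1 - x ^ 2 := by nlinarith [hx.1, hx.2]
      have hx1 : |2 * x| ≤ 1 := by rw [abs_le]; constructor <;> linarith [hx.1, hx.2]
      rw [Set.indicator_of_mem hx, ← lintegral_Ici_inv_sq (Real.sqrt_pos.mpr hx2) (by positivity),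
        ← lintegral_indicator measurableSet_Ici]
      refine lintegral_congr fun y => ?_
      rw [lintegral_fin_two (fun q : Fin 2 → ℝ => imDensity (Fin.cons x (Fin.cons y q)))
        (measurable_imDensity.comp ((measurable_fin_cons x).comp (measurable_fin_cons y)))]
      have hiff : (|2 * x| ≤ 1 ∧ 0 < y ∧ 1 ≤ x ^ 2 + y ^ 2) ↔ y ∈ Set.Ici (√(1 - x ^ 2)) := by
        rw [Set.mem_Ici]
        constructor
        · rintro ⟨-, h, h'⟩
          exact Real.sqrt_le_iff.mpr ⟨h.le, by linarith⟩
        · intro h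
          have := Real.sqrt_pos.mpr hx2
          exact ⟨hx1, by linarith, by linarith [(Real.sqrt_le_iff.mp h).2]⟩
      by_cases hy : y ∈ Set.Ici (√(1 - x ^ 2))
      · have hy0 := (hiff.mpr hy).2.1
        rw [Set.indicator_of_mem hy]
        have := lintegral_normSq_disc (k := 4 * y ^ 4) (c := 4 * y ^ 6) (by positivity) (by positivity)
        rw [show Real.pi * (4 * y ^ 4) / (2 * (4 * y ^ 6)) = Real.pi / 2 / y ^ 2 by field_simp] at this
        rw [← this]
        refine lintegral_congr fun z => ?_
        have h' := hiff.mpr hy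
        show imDensity ![x, y, z.1, z.2] = _
        simp only [imDensity, Matrix.cons_val_zero, Matrix.cons_val_one, Matrix.cons_val]
        exact if_pos h'
      · rw [Set.indicator_of_notMem hy]
        have : ∀ z : ℝ × ℝ, imDensity ![x, y, z.1, z.2] = 0 := by
          intro z
          rw [imDensity, if_neg]
          exact fun h => hy (hiff.mp h)
        exact (lintegral_congr this).trans lintegral_zero
    · rw [Set.indicator_of_notMem hx]
      have : ∀ y : ℝ, ∀ q : Fin 2 → ℝ, imDensity (Fin.cons x (Fin.cons y q)) = 0 := by
        intro y q
        rw [imDensity, if_neg]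
        rintro ⟨h, -⟩
        apply hx
        have h' : |2 * x| ≤ 1 := h
        rw [abs_le] at h'
        constructor <;> linarith [h'.1, h'.2]
      simp [this]
  rw [lintegral_congr h2, lintegral_indicator measurableSet_Icc, lintegral_arcsin (by positivity)]
  congr 1; ring

end Volume

section Truncation

open MeasureTheory Topology

/-- Measurable sets with negligible boundary. -/
def Nice {ι : Type*} [Fintype ι] (s : Set (ι → ℝ)) : Prop :=
  MeasurableSet s ∧ volume (frontier s) = 0

lemma Nice.inter {ι : Type*} [Fintype ι] {s t : Set (ι → ℝ)} (hs : Nice s) (ht : Nice t) :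
    Nice (s ∩ t) := by
  refine ⟨hs.1.inter ht.1, measure_mono_null (frontier_inter_subset s t) ?_⟩
  exact measure_union_null (measure_mono_null Set.inter_subset_left hs.2)
    (measure_mono_null Set.inter_subset_right ht.2)

lemma Nice.compl {ι : Type*} [Fintype ι] {s : Set (ι → ℝ)} (hs : Nice s) : Nice sᶜ :=
  ⟨hs.1.compl, by rw [frontier_compl]; exact hs.2⟩

lemma volume_eval_eq_zero {n : ℕ} {g : (Fin n → ℝ) → ℝ} (p : MvPolynomial (Fin n) ℝ)
    (hp : ∀ x, MvPolynomial.eval x p = g x) (x₀ : Fin n → ℝ) (h₀ : g x₀ ≠ 0) :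
    volume {x | g x = 0} = 0 := by
  have := volume_zeros_eq_zero p (by rintro rfl; exact h₀ (by simp [← hp]))
  simpa only [hp] using this

lemma nice_pos {n : ℕ} {g : (Fin n → ℝ) → ℝ} (p : MvPolynomial (Fin n) ℝ)
    (hp : ∀ x, MvPolynomial.eval x p = g x) (x₀ : Fin n → ℝ) (h₀ : g x₀ ≠ 0) :
    Nice {x | 0 < g x} := by
  have hc : Continuous g := by
    rw [show g = fun x => MvPolynomial.eval x p from funext fun x => (hp x).symm]
    exact MvPolynomial.continuous_eval p
  refine ⟨measurableSet_lt measurable_const hc.measurable, measure_mono_null ?_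
    (volume_eval_eq_zero p hp x₀ h₀)⟩
  intro x hx
  exact (frontier_lt_subset_eq continuous_const hc hx).symm

lemma nice_nonneg {n : ℕ} {g : (Fin n → ℝ) → ℝ} (p : MvPolynomial (Fin n) ℝ)
    (hp : ∀ x, MvPolynomial.eval x p = g x) (x₀ : Fin n → ℝ) (h₀ : g x₀ ≠ 0) :
    Nice {x | 0 ≤ g x} := by
  have h := (nice_pos (g := fun x => -g x) (-p) (fun x => by simp [hp]) x₀ (by simpa using h₀)).compl
  convert h using 1
  ext x
  simp

/-- The generic form. -/
noncomputable def genForm : Fin 4 → MvPolynomial (Fin 4) ℝ := fun i => MvPolynomial.X i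

lemma eval_hA (x : Fin 4 → ℝ) : MvPolynomial.eval x (hA genForm) = hA x := by
  simp [← hA_map, genForm]

lemma eval_hB (x : Fin 4 → ℝ) : MvPolynomial.eval x (hB genForm) = hB x := by
  simp [← hB_map, genForm]

lemma eval_hC (x : Fin 4 → ℝ) : MvPolynomial.eval x (hC genForm) = hC x := by
  simp [← hC_map, genForm]

lemma eval_disc (x : Fin 4 → ℝ) : MvPolynomial.eval x (disc genForm) = disc x := by
  simp [← disc_map, genForm]

/-- The part of `redBody` with `hC < K hA`. -/
def truncBody (K : ℝ) : Set (Fin 4 → ℝ) := {f | f ∈ redBody ∧ hC f < K * hA f}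

/-- The interior part of `truncBody`. -/
def strictBody (K : ℝ) : Set (Fin 4 → ℝ) := {f | f ∈ truncBody K ∧ |hB f| < hA f ∧ hA f < hC f}

lemma volume_hA_sub_hB : volume {f : Fin 4 → ℝ | hA f - hB f = 0} = 0 :=
  volume_eval_eq_zero (hA genForm - hB genForm) (fun x => by simp [eval_hA, eval_hB]) ![0, 1, 0, 0]
    (by simp [hA, hB])

lemma volume_hA_add_hB : volume {f : Fin 4 → ℝ | hA f + hB f = 0} = 0 :=
  volume_eval_eq_zero (hA genForm + hB genForm) (fun x => by simp [eval_hA, eval_hB]) ![0, 1, 0, 0]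
    (by simp [hA, hB])

lemma volume_hC_sub_hA : volume {f : Fin 4 → ℝ | hC f - hA f = 0} = 0 :=
  volume_eval_eq_zero (hC genForm - hA genForm) (fun x => by simp [eval_hA, eval_hC]) ![0, 1, 0, 0]
    (by simp [hA, hC])

lemma nice_lead : Nice {f : Fin 4 → ℝ | f 0 ≠ 0} := by
  have h1 := nice_pos (g := fun f : Fin 4 → ℝ => f 0 ^ 2) (MvPolynomial.X 0 ^ 2)
    (fun x => by simp) ![1, 0, 0, 0] (by simp)
  convert h1 using 1
  ext f
  exact (sq_pos_iff).symm

lemma nice_trunc (K : ℝ) : Nice {f : Fin 4 → ℝ | 0 < K * hA f - hC f} :=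
  nice_pos (g := fun f : Fin 4 → ℝ => K * hA f - hC f) (MvPolynomial.C K * hA genForm - hC genForm)
    (fun x => by simp [eval_hA, eval_hC]) ![0, 0, 1, 0] (by simp [hA, hC])

lemma nice_disc : Nice {f : Fin 4 → ℝ | 0 < disc f + 1} :=
  nice_pos (disc genForm + 1) (fun x => by simp [eval_disc]) 0 (by simp [disc, hA, hB, hC])

lemma nice_truncBody (K : ℝ) : Nice (truncBody K) := by
  have h1 : Nice {f : Fin 4 → ℝ | 0 < hA f} := nice_pos (hA genForm) eval_hA ![0, 1, 0, 0] (by simp [hA])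
  have h2 : Nice {f : Fin 4 → ℝ | 0 ≤ hA f - hB f} :=
    nice_nonneg (hA genForm - hB genForm) (fun x => by simp [eval_hA, eval_hB]) ![0, 1, 0, 0]
      (by simp [hA, hB])
  have h3 : Nice {f : Fin 4 → ℝ | 0 ≤ hA f + hB f} :=
    nice_nonneg (hA genForm + hB genForm) (fun x => by simp [eval_hA, eval_hB]) ![0, 1, 0, 0]
      (by simp [hA, hB])
  have h4 : Nice {f : Fin 4 → ℝ | 0 ≤ hC f - hA f} :=
    nice_nonneg (hC genForm - hA genForm) (fun x => by simp [eval_hA, eval_hC]) ![0, 1, 0, 0]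
      (by simp [hA, hC])
  convert (((((h1.inter h2).inter h3).inter h4).inter nice_disc).inter nice_lead).inter (nice_trunc K)
    using 1
  ext f
  simp only [truncBody, redBody, WRed, Set.mem_ofPred_eq, Set.mem_inter_iff, abs_le, sub_nonneg, sub_pos]
  constructor
  · rintro ⟨⟨⟨a, ⟨b, b'⟩, c⟩, d, e⟩, g⟩
    exact ⟨⟨⟨⟨⟨⟨a, b'⟩, by linarith⟩, c⟩, by linarith⟩, e⟩, g⟩
  · rintro ⟨⟨⟨⟨⟨⟨a, b'⟩, b⟩, c⟩, d⟩, e⟩, g⟩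
    exact ⟨⟨⟨a, ⟨by linarith, b'⟩, c⟩, by linarith, e⟩, g⟩

lemma nice_strictBody (K : ℝ) : Nice (strictBody K) := by
  have h2 : Nice {f : Fin 4 → ℝ | 0 < hA f - hB f} :=
    nice_pos (hA genForm - hB genForm) (fun x => by simp [eval_hA, eval_hB]) ![0, 1, 0, 0]
      (by simp [hA, hB])
  have h3 : Nice {f : Fin 4 → ℝ | 0 < hA f + hB f} :=
    nice_pos (hA genForm + hB genForm) (fun x => by simp [eval_hA, eval_hB]) ![0, 1, 0, 0]
      (by simp [hA, hB])
  have h4 : Nice {f : Fin 4 → ℝ | 0 < hC f - hA f} :=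
    nice_pos (hC genForm - hA genForm) (fun x => by simp [eval_hA, eval_hC]) ![0, 1, 0, 0]
      (by simp [hA, hC])
  convert (((nice_truncBody K).inter h2).inter h3).inter h4 using 1
  ext f
  simp only [strictBody, Set.mem_ofPred_eq, Set.mem_inter_iff, abs_lt, sub_pos]
  constructor
  · rintro ⟨a, ⟨b, b'⟩, c⟩
    exact ⟨⟨⟨a, b'⟩, by linarith⟩, c⟩
  · rintro ⟨⟨⟨a, b'⟩, b⟩, c⟩
    exact ⟨a, ⟨by linarith, b'⟩, c⟩

lemma isBounded_truncBody (K : ℝ) : Bornology.IsBounded (truncBody K) := by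
  refine (Metric.isBounded_closedBall (x := (0 : Fin 4 → ℝ)) (r := 2 * |K| + 2)).subset ?_
  rintro f ⟨⟨hW, hd, -⟩, hK⟩
  have hA0 := hW.1
  have hC0 := hW.hC_pos
  have hAC := hW.2.2
  have h3 := hW.three_mul_le
  have hA1 : hA f ≤ 1 := by nlinarith
  have hK0 : 0 < K := by by_contra h; nlinarith
  have hCK : hC f ≤ K := by nlinarith
  have hK1 : 1 ≤ K := by by_contra h; nlinarith
  rw [abs_of_pos hK0, mem_closedBall_zero_iff, pi_norm_le_iff_of_nonneg (by positivity)]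
  have q0 : f 0 ^ 2 ≤ 2 := by
    have := hW.sq_zero_le
    have h : f 0 ^ 2 * hC f ≤ 2 * hC f := by nlinarith
    exact le_of_mul_le_mul_right h hC0
  have q1 : f 1 ^ 2 ≤ 2 := by have := hW.sq_one_le; nlinarith
  have q2 : f 2 ^ 2 ≤ 2 * K := by have := hW.sq_two_le; nlinarith
  have q3 : f 3 ^ 2 ≤ 2 * K ^ 2 := by
    have := hW.sq_three_le
    have h1 : hC f ^ 2 ≤ K * (K * hA f) := by rw [sq]; gcongr
    have h : f 3 ^ 2 * hA f ≤ 2 * K ^ 2 * hA f := by nlinarith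
    exact le_of_mul_le_mul_right h hA0
  intro i
  rw [Real.norm_eq_abs]
  apply abs_le_of_sq_le_sq _ (by positivity)
  fin_cases i
  · show f 0 ^ 2 ≤ _; nlinarith
  · show f 1 ^ 2 ≤ _; nlinarith
  · show f 2 ^ 2 ≤ _; nlinarith
  · show f 3 ^ 2 ≤ _; nlinarith

lemma volume_strictBody (K : ℝ) : volume (strictBody K) = volume (truncBody K) := by
  refine measure_congr ?_
  have h1 : ∀ᵐ f : Fin 4 → ℝ, hA f - hB f ≠ 0 := by rw [ae_iff]; simpa using volume_hA_sub_hB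
  have h2 : ∀ᵐ f : Fin 4 → ℝ, hA f + hB f ≠ 0 := by rw [ae_iff]; simpa using volume_hA_add_hB
  have h3 : ∀ᵐ f : Fin 4 → ℝ, hC f - hA f ≠ 0 := by rw [ae_iff]; simpa using volume_hC_sub_hA
  filter_upwards [h1, h2, h3] with f h1 h2 h3
  refine propext ⟨fun h => h.1, fun h => ⟨h, ?_, ?_⟩⟩
  · refine lt_of_le_of_ne h.1.1.2.1 fun h' => ?_
    rcases abs_choice (hB f) with hc | hc <;> rw [hc] at h'
    · exact h1 (by linarith)
    · exact h2 (by linarith)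
  · exact lt_of_le_of_ne h.1.1.2.2 fun h' => h3 (by linarith)

lemma tendsto_volume_truncBody :
    Tendsto (fun J : ℕ => (volume (truncBody (16 ^ J))).toReal) atTop (𝓝 (Real.pi ^ 2 / 6)) := by
  have hmono : Monotone fun J : ℕ => truncBody (16 ^ J) := by
    intro i j hij f hf
    refine ⟨hf.1, hf.2.trans_le ?_⟩
    have := hf.1.1.1
    gcongr
    norm_num
  have hU : ⋃ J : ℕ, truncBody (16 ^ J) = redBody := by
    ext f
    simp only [Set.mem_iUnion]
    refine ⟨fun ⟨J, h⟩ => h.1, fun h => ?_⟩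
    obtain ⟨J, hJ⟩ := pow_unbounded_of_one_lt (hC f / hA f) (by norm_num : (1 : ℝ) < 16)
    exact ⟨J, h, (div_lt_iff₀ h.1.1).mp hJ⟩
  have h := tendsto_measure_iUnion_atTop (μ := volume) hmono
  rw [hU, volume_redBody] at h
  have := (ENNReal.tendsto_toReal ENNReal.ofReal_ne_top).comp h
  rwa [ENNReal.toReal_ofReal (by positivity)] at this

/-- Asymptotic count of lattice points in dilates subject to congruence conditions. -/
theorem tendsto_latticeMod {ι : Type*} [Fintype ι] {m : ℕ} (hm : 0 < m) (P : Set (ι → ZMod m))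
    {R : Set (ι → ℝ)} (hR : Bornology.IsBounded R) (hn : Nice R) :
    Tendsto (fun T : ℝ => (({z : ι → ℤ | (fun i => (z i : ZMod m)) ∈ P ∧
      (fun i => (z i : ℝ) / T) ∈ R}.ncard : ℕ) : ℝ) / T ^ Fintype.card ι) atTop
      (𝓝 ((volume R).toReal * (P.ncard / m ^ Fintype.card ι))) := by
  classical
  have : NeZero m := ⟨hm.ne'⟩
  set lift : (ι → ZMod m) → ι → ℤ := fun r i => ((r i).val : ℤ) with hlift
  have hPf : P.Finite := P.toFinite
  have key : Tendsto (fun T : ℝ => ∑ r ∈ hPf.toFinset,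
      ((latticePts m (lift r) R T).ncard : ℝ) / T ^ Fintype.card ι) atTop
      (𝓝 (∑ r ∈ hPf.toFinset, (volume R).toReal / m ^ Fintype.card ι)) :=
    tendsto_finsetSum _ fun r _ => tendsto_latticePts hm (lift r) hR hn.1 hn.2
  rw [Finset.sum_const, nsmul_eq_mul, ← Set.ncard_eq_toFinset_card P hPf] at key
  rw [mul_div_assoc', mul_comm, ← mul_div_assoc'] 
  refine key.congr' ?_
  filter_upwards [eventually_gt_atTop 0] with T hT
  rw [← Finset.sum_div]
  congr 1
  have hfin : {z : ι → ℤ | (fun i => (z i : ZMod m)) ∈ P ∧ (fun i => (z i : ℝ) / T) ∈ R}.Finite :=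
    (finite_intPts hR hT).subset fun z hz => hz.2
  rw [Set.ncard_eq_toFinset_card _ hfin,
    Finset.card_eq_sum_card_fiberwise (f := fun z : ι → ℤ => fun i => (z i : ZMod m)) (t := hPf.toFinset)]
  · push_cast
    refine Finset.sum_congr rfl fun r hr => ?_
    rw [← Set.ncard_coe_finset]
    congr 2
    ext z
    simp only [latticePts, Set.mem_ofPred_eq, Finset.coe_filter, Set.Finite.mem_toFinset]
    have hr' : r ∈ P := by simpa using hr
    have hz : (∀ i, z i ≡ lift r i [ZMOD m]) ↔ (fun i => (z i : ZMod m)) = r := by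
      rw [funext_iff]
      refine forall_congr' fun i => ?_
      rw [← ZMod.intCast_eq_intCast_iff]
      simp [hlift]
    rw [hz]
    constructor
    · rintro ⟨h, h'⟩
      exact ⟨⟨h ▸ hr', h'⟩, h⟩
    · rintro ⟨⟨-, h'⟩, h⟩
      exact ⟨h, h'⟩
  · intro z hz
    simp only [Set.Finite.coe_toFinset, Set.mem_ofPred_eq] at hz ⊢
    exact hz.1

end Truncation

section Cusp

open Topology

/-- Reduced integral forms with nonzero leading coefficient, discriminant greater than `-Y` and
`hC < K hA`. -/
def bodyZ (K Y : ℝ) : Set (Fin 4 → ℤ) :=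
  {f | WRed f ∧ (-disc f : ℝ) < Y ∧ f 0 ≠ 0 ∧ ((hC f : ℤ) : ℝ) < K * hA f}

/-- The strictly reduced forms in `bodyZ`. -/
def strictZ (K Y : ℝ) : Set (Fin 4 → ℤ) := {f | f ∈ bodyZ K Y ∧ |hB f| < hA f ∧ hA f < hC f}

lemma form_div (f : Fin 4 → ℤ) (T : ℝ) :
    (fun i => (f i : ℝ) / T) = T⁻¹ • fun i => (f i : ℝ) := by
  funext i; simp [div_eq_inv_mul]

lemma div_mem_truncBody {f : Fin 4 → ℤ} {K T : ℝ} (hT : 0 < T) :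
    (fun i => (f i : ℝ) / T) ∈ truncBody K ↔ f ∈ bodyZ K (T ^ 4) := by
  rw [form_div]
  simp only [truncBody, redBody, bodyZ, Set.mem_ofPred_eq, ← wRed_cast (f := f)]
  simp only [WRed, hA_smul, hB_smul, hC_smul, disc_smul, hA_cast, hB_cast, hC_cast, disc_cast]
  have h2 : 0 < T⁻¹ ^ 2 := by positivity
  rw [abs_mul, abs_of_pos h2, mul_pos_iff_of_pos_left h2, mul_le_mul_iff_right₀ h2,
    mul_le_mul_iff_right₀ h2, mul_left_comm K, mul_lt_mul_iff_right₀ h2]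
  have h3 : -1 < T⁻¹ ^ 4 * ((disc f : ℤ) : ℝ) ↔ -((disc f : ℤ) : ℝ) < T ^ 4 := by
    rw [neg_lt, ← mul_neg, inv_pow, inv_mul_lt_iff₀ (by positivity), mul_one]
  rw [h3]
  have h4 : (T⁻¹ • fun i => (f i : ℝ)) 0 ≠ 0 ↔ f 0 ≠ 0 := by
    simp [hT.ne']
  rw [h4]
  tauto

lemma div_mem_strictBody {f : Fin 4 → ℤ} {K T : ℝ} (hT : 0 < T) :
    (fun i => (f i : ℝ) / T) ∈ strictBody K ↔ f ∈ strictZ K (T ^ 4) := by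
  simp only [strictBody, strictZ, Set.mem_ofPred_eq, div_mem_truncBody hT]
  rw [form_div]
  simp only [hA_smul, hB_smul, hC_smul, hA_cast, hB_cast, hC_cast]
  have h2 : 0 < T⁻¹ ^ 2 := by positivity
  rw [abs_mul, abs_of_pos h2, mul_lt_mul_iff_right₀ h2, mul_lt_mul_iff_right₀ h2]
  norm_cast

lemma tendsto_fourth_root : Tendsto (fun Y : ℝ => √(√Y)) atTop atTop :=
  Real.tendsto_sqrt_atTop.comp Real.tendsto_sqrt_atTop

lemma fourth_root_pow {Y : ℝ} (hY : 0 ≤ Y) : √(√Y) ^ 4 = Y := by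
  rw [show √(√Y) ^ 4 = (√(√Y) ^ 2) ^ 2 by ring, Real.sq_sqrt (by positivity), Real.sq_sqrt hY]

lemma tendsto_bodyZ {m : ℕ} (hm : 0 < m) (P : Set (Fin 4 → ZMod m)) (K : ℝ) :
    Tendsto (fun Y : ℝ => (({f : Fin 4 → ℤ | (fun i => (f i : ZMod m)) ∈ P ∧
      f ∈ bodyZ K Y}.ncard : ℕ) : ℝ) / Y) atTop
      (𝓝 ((MeasureTheory.volume (truncBody K)).toReal * (P.ncard / m ^ 4))) := by
  have h := (tendsto_latticeMod hm P (isBounded_truncBody K) (nice_truncBody K)).comp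
    tendsto_fourth_root
  rw [Fintype.card_fin] at h
  refine h.congr' ?_
  filter_upwards [eventually_gt_atTop 0] with Y hY
  have hT : 0 < √(√Y) := by positivity
  simp only [Function.comp, div_mem_truncBody hT, fourth_root_pow hY.le]

lemma tendsto_strictZ {m : ℕ} (hm : 0 < m) (P : Set (Fin 4 → ZMod m)) (K : ℝ) :
    Tendsto (fun Y : ℝ => (({f : Fin 4 → ℤ | (fun i => (f i : ZMod m)) ∈ P ∧
      f ∈ strictZ K Y}.ncard : ℕ) : ℝ) / Y) atTop
      (𝓝 ((MeasureTheory.volume (truncBody K)).toReal * (P.ncard / m ^ 4))) := by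
  have hb : Bornology.IsBounded (strictBody K) := (isBounded_truncBody K).subset fun f hf => hf.1
  have h := (tendsto_latticeMod hm P hb (nice_strictBody K)).comp tendsto_fourth_root
  rw [Fintype.card_fin, volume_strictBody] at h
  refine h.congr' ?_
  filter_upwards [eventually_gt_atTop 0] with Y hY
  have hT : 0 < √(√Y) := by positivity
  simp only [Function.comp, div_mem_strictBody hT, fourth_root_pow hY.le]

/-- The substitution `x ↦ x + t y`. -/
def shear (t : ℤ) (f : Fin 4 → ℤ) : Fin 4 → ℤ :=
  ![f 0, f 1 + t * f 0, f 2 + 2 * t * f 1 + t ^ 2 * f 0,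
    f 3 + 3 * t * f 2 + 3 * t ^ 2 * f 1 + t ^ 3 * f 0]

lemma hA_shear (t : ℤ) (f : Fin 4 → ℤ) : hA (shear t f) = hA f := by
  simp [hA, shear]; ring

lemma hB_shear (t : ℤ) (f : Fin 4 → ℤ) : hB (shear t f) = hB f + 2 * t * hA f := by
  simp [hA, hB, shear]; ring

lemma shear_injective (t : ℤ) : Function.Injective (shear t) := by
  intro f g h
  have h0 : f 0 = g 0 := by simpa [shear] using congrFun h 0
  have h1 : f 1 = g 1 := by
    have := congrFun h 1
    simp only [shear, Matrix.cons_val_one, Matrix.cons_val_zero] at this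
    rw [h0] at this; linarith
  have h2 : f 2 = g 2 := by
    have := congrFun h 2
    simp only [shear, Matrix.cons_val] at this
    rw [h0, h1] at this; linarith
  have h3 : f 3 = g 3 := by
    have := congrFun h 3
    simp only [shear, Matrix.cons_val] at this
    rw [h0, h1, h2] at this; linarith
  funext i
  fin_cases i <;> assumption

/-- A layer of the cusp. -/
def cuspLayer (j : ℕ) (Y : ℝ) : Set (Fin 4 → ℤ) :=
  {f | WRed f ∧ (-disc f : ℝ) < Y ∧ f 0 ≠ 0 ∧ 16 ^ j * hA f ≤ hC f ∧ hC f < 16 ^ (j + 1) * hA f}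

lemma coeff_le_of_mem_cuspLayer {j : ℕ} {T : ℝ} (hT : 0 < T) {f : Fin 4 → ℤ}
    (hf : f ∈ cuspLayer j (T ^ 4)) :
    8 ^ j * |(f 0 : ℝ)| ≤ 2 * T ∧ 2 ^ j * |(f 1 : ℝ)| ≤ 2 * T ∧ |(f 2 : ℝ)| ≤ 8 * 2 ^ j * T ∧
      |(f 3 : ℝ)| ≤ 32 * 8 ^ j * T := by
  obtain ⟨hW, hd, -, hl, hu⟩ := hf
  rw [← wRed_cast] at hW
  set g : Fin 4 → ℝ := fun i => (f i : ℝ) with hg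
  have hd' : -disc g < T ^ 4 := by rw [hg, disc_cast]; exact hd
  have hl' : 16 ^ j * hA g ≤ hC g := by rw [hg, hA_cast, hC_cast]; exact_mod_cast hl
  have hu' : hC g ≤ 16 ^ (j + 1) * hA g := by rw [hg, hA_cast, hC_cast]; exact_mod_cast hu.le
  change 8 ^ j * |g 0| ≤ 2 * T ∧ 2 ^ j * |g 1| ≤ 2 * T ∧ |g 2| ≤ 8 * 2 ^ j * T ∧
      |g 3| ≤ 32 * 8 ^ j * T
  have hA0 := hW.1
  have hC0 := hW.hC_pos
  have h3 := hW.three_mul_le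
  set u : ℝ := 2 ^ j with hu2
  have hu0 : 0 < u := by positivity
  have e16 : (16 : ℝ) ^ j = u ^ 4 := by rw [hu2, ← pow_mul, mul_comm, pow_mul]; norm_num
  have e8 : (8 : ℝ) ^ j = u ^ 3 := by rw [hu2, ← pow_mul, mul_comm, pow_mul]; norm_num
  rw [pow_succ, e16] at hu'
  rw [e16] at hl'
  rw [e8]
  have hAT : u ^ 2 * hA g ≤ T ^ 2 := by
    refine abs_le_of_sq_le_sq' ?_ (by positivity) |>.2
    nlinarith
  have hCT : hC g ≤ 16 * u ^ 2 * T ^ 2 := by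
    have : 16 * u ^ 2 * (u ^ 2 * hA g) ≤ 16 * u ^ 2 * T ^ 2 := by gcongr
    linarith
  refine ⟨?_, ?_, ?_, ?_⟩
  · rw [← abs_of_pos (pow_pos hu0 3), ← abs_mul]
    refine abs_le_of_sq_le_sq ?_ (by positivity)
    have h := hW.sq_zero_le
    have h1 : 3 * (g 0 ^ 2 * (u ^ 4 * hA g)) ≤ 4 * hA g ^ 2 := by
      refine le_trans ?_ h
      gcongr
    have h2 : 3 * (g 0 ^ 2 * u ^ 4) ≤ 4 * hA g := by
      refine le_of_mul_le_mul_right ?_ hA0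
      linarith
    have h4 : u ^ 2 * (3 * (g 0 ^ 2 * u ^ 4)) ≤ u ^ 2 * (4 * hA g) := by gcongr
    nlinarith
  · rw [← abs_of_pos hu0, ← abs_mul]
    refine abs_le_of_sq_le_sq ?_ (by positivity)
    have h := hW.sq_one_le
    have h4 : u ^ 2 * (3 * g 1 ^ 2) ≤ u ^ 2 * (4 * hA g) := by gcongr
    nlinarith
  · refine abs_le_of_sq_le_sq ?_ (by positivity)
    have h := hW.sq_two_le
    nlinarith [mul_pos (pow_pos hu0 2) (pow_pos hT 2)]
  · refine abs_le_of_sq_le_sq ?_ (by positivity)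
    have h := hW.sq_three_le
    have h1 : 4 * hC g ^ 2 ≤ 4 * ((16 * u ^ 2 * T ^ 2) * (u ^ 4 * 16 * hA g)) := by
      rw [sq]; gcongr
    have h2 : 3 * g 3 ^ 2 ≤ 4 * ((16 * u ^ 2 * T ^ 2) * (u ^ 4 * 16)) := by
      refine le_of_mul_le_mul_right ?_ hA0
      linarith
    nlinarith [mul_pos (pow_pos hu0 6) (pow_pos hT 2)]

/-- The integers of absolute value at most `L`. -/
noncomputable def intIcc (L : ℝ) : Finset ℤ := Finset.Icc (-⌊L⌋) ⌊L⌋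

lemma mem_intIcc {L : ℝ} {z : ℤ} : z ∈ intIcc L ↔ |(z : ℝ)| ≤ L := by
  rw [intIcc, Finset.mem_Icc, abs_le, ← Int.le_floor, neg_le, neg_le (a := L), ← Int.cast_neg,
    Int.le_floor (z := -z)]

lemma card_intIcc_le {L : ℝ} (hL : 0 ≤ L) : ((intIcc L).card : ℝ) ≤ 2 * L + 1 := by
  have h0 : 0 ≤ ⌊L⌋ := Int.floor_nonneg.mpr hL
  have h1 : ((intIcc L).card : ℤ) = 2 * ⌊L⌋ + 1 := by
    rw [intIcc, Int.card_Icc]; omega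
  have h2 : ((intIcc L).card : ℝ) = 2 * ⌊L⌋ + 1 := by exact_mod_cast h1
  rw [h2]
  linarith [Int.floor_le L]

lemma card_intIcc_erase_le {L : ℝ} (hL : 0 ≤ L) : (((intIcc L).erase 0).card : ℝ) ≤ 2 * L := by
  have h0 : (0 : ℤ) ∈ intIcc L := by rw [mem_intIcc]; simpa
  have := card_intIcc_le hL
  rw [← Finset.card_erase_add_one h0] at this
  push_cast at this
  linarith

lemma finite_wRed_lt (Y : ℝ) : {f : Fin 4 → ℤ | WRed f ∧ (-disc f : ℝ) < Y}.Finite := by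
  refine (finite_wRed ⌈Y⌉).subset ?_
  rintro f ⟨h, h'⟩
  have : ((-disc f : ℤ) : ℝ) < ⌈Y⌉ := by push_cast; exact h'.trans_le (Int.le_ceil Y)
  exact ⟨h, by have h2 : -disc f < ⌈Y⌉ := by exact_mod_cast this
               linarith⟩

lemma ncard_cuspLayer_le (j : ℕ) {T : ℝ} (hT : 0 < T) :
    ((cuspLayer j (T ^ 4)).ncard : ℝ) * 4 ^ j ≤ 700000 * T ^ 4 := by
  classical
  have hfin : (cuspLayer j (T ^ 4)).Finite :=
    (finite_wRed_lt (T ^ 4)).subset fun f hf => ⟨hf.1, hf.2.1⟩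
  rcases (cuspLayer j (T ^ 4)).eq_empty_or_nonempty with he | ⟨f₀, hf₀⟩
  · rw [he]; simp; positivity
  set u : ℝ := 2 ^ j with hu2
  have hu0 : 0 < u := by positivity
  have hu1 : 1 ≤ u := one_le_pow₀ (by norm_num)
  have e8 : (8 : ℝ) ^ j = u ^ 3 := by rw [hu2, ← pow_mul, mul_comm, pow_mul]; norm_num
  have e4 : (4 : ℝ) ^ j = u ^ 2 := by rw [hu2, ← pow_mul, mul_comm, pow_mul]; norm_num
  have hbig : u ^ 3 ≤ 2 * T := by
    have h1 := (coeff_le_of_mem_cuspLayer hT hf₀).1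
    have h2 : (1 : ℝ) ≤ |(f₀ 0 : ℝ)| := by exact_mod_cast Int.one_le_abs hf₀.2.2.1
    rw [e8] at h1
    nlinarith [pow_pos hu0 3]
  set box : Finset (Fin 4 → ℤ) := Fintype.piFinset
    ![(intIcc (2 * T / u ^ 3)).erase 0, intIcc (6 * T / u), intIcc (24 * u * T),
      intIcc (120 * u ^ 3 * T)] with hbox
  have hcard : (hfin.toFinset ×ˢ Finset.range (4 ^ j)).card ≤ box.card := by
    refine Finset.card_le_card_of_injOn (fun q => shear (2 * q.2) q.1) ?_ ?_
    · rintro ⟨f, k⟩ hq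
      simp only [Finset.coe_product, Set.Finite.coe_toFinset, Finset.coe_range, Set.mem_prod,
        Set.mem_Iio] at hq
      obtain ⟨hf, hk⟩ := hq
      obtain ⟨b0, b1, b2, b3⟩ := coeff_le_of_mem_cuspLayer hT hf
      rw [e8] at b0 b3
      have hk' : (k : ℝ) ≤ u ^ 2 := by rw [← e4]; exact_mod_cast hk.le
      have hk0 : (0 : ℝ) ≤ k := by positivity
      have c0 : |(f 0 : ℝ)| ≤ 2 * T / u ^ 3 := by rw [le_div_iff₀ (by positivity)]; linarith
      have c1 : |(f 1 : ℝ)| ≤ 2 * T / u := by rw [le_div_iff₀ (by positivity)]; linarith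
      simp only [hbox, Finset.mem_coe, Fintype.mem_piFinset]
      intro i
      fin_cases i
      · simp only [Fin.zero_eta, Matrix.cons_val_zero, Finset.mem_erase, mem_intIcc, shear]
        exact ⟨hf.2.2.1, c0⟩
      · simp only [Fin.mk_one, Matrix.cons_val_one, Matrix.cons_val_zero, mem_intIcc, shear]
        push_cast
        calc |(f 1 : ℝ) + 2 * k * f 0| ≤ |(f 1 : ℝ)| + 2 * k * |(f 0 : ℝ)| := by
              refine (abs_add_le _ _).trans ?_
              rw [abs_mul, abs_of_nonneg (by positivity : (0 : ℝ) ≤ 2 * k)]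
          _ ≤ 2 * T / u + 2 * u ^ 2 * (2 * T / u ^ 3) := by gcongr
          _ = 6 * T / u := by field_simp; norm_num
      · simp only [Fin.reduceFinMk, Matrix.cons_val, mem_intIcc, shear]
        push_cast
        calc |(f 2 : ℝ) + 2 * (2 * k) * f 1 + (2 * k) ^ 2 * f 0|
            ≤ |(f 2 : ℝ)| + 2 * (2 * k) * |(f 1 : ℝ)| + (2 * k) ^ 2 * |(f 0 : ℝ)| := by
              refine (abs_add_three _ _ _).trans ?_
              rw [abs_mul (2 * (2 * (k : ℝ))), abs_mul ((2 * (k : ℝ)) ^ 2),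
                abs_of_nonneg (by positivity : (0 : ℝ) ≤ 2 * (2 * k)),
                abs_of_nonneg (by positivity : (0 : ℝ) ≤ (2 * k) ^ 2)]
          _ ≤ 8 * u * T + 2 * (2 * u ^ 2) * (2 * T / u) + (2 * u ^ 2) ^ 2 * (2 * T / u ^ 3) := by
              gcongr
          _ = 24 * u * T := by field_simp; norm_num
      · simp only [Fin.reduceFinMk, Matrix.cons_val, mem_intIcc, shear]
        push_cast
        calc |(f 3 : ℝ) + 3 * (2 * k) * f 2 + 3 * (2 * k) ^ 2 * f 1 + (2 * k) ^ 3 * f 0|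
            ≤ |(f 3 : ℝ)| + 3 * (2 * k) * |(f 2 : ℝ)| + 3 * (2 * k) ^ 2 * |(f 1 : ℝ)| +
              (2 * k) ^ 3 * |(f 0 : ℝ)| := by
              refine (abs_add_le _ _).trans (add_le_add ((abs_add_three _ _ _).trans ?_) ?_)
              · rw [abs_mul (3 * (2 * (k : ℝ))), abs_mul (3 * (2 * (k : ℝ)) ^ 2),
                  abs_of_nonneg (by positivity : (0 : ℝ) ≤ 3 * (2 * k)),
                  abs_of_nonneg (by positivity : (0 : ℝ) ≤ 3 * (2 * k) ^ 2)]
              · rw [abs_mul, abs_of_nonneg (by positivity : (0 : ℝ) ≤ (2 * k) ^ 3)]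
          _ ≤ 32 * u ^ 3 * T + 3 * (2 * u ^ 2) * (8 * u * T) + 3 * (2 * u ^ 2) ^ 2 * (2 * T / u) +
              (2 * u ^ 2) ^ 3 * (2 * T / u ^ 3) := by
              gcongr
          _ = 120 * u ^ 3 * T := by field_simp; norm_num
    · rintro ⟨f, k⟩ hq ⟨g, l⟩ hq' h
      simp only [Finset.coe_product, Set.Finite.coe_toFinset, Finset.coe_range, Set.mem_prod,
        Set.mem_Iio] at hq hq' h
      have hA := congrArg hA h
      have hB := congrArg hB h
      rw [hA_shear, hA_shear] at hA
      rw [hB_shear, hB_shear, ← hA] at hB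
      have hA0 := hq.1.1.1
      have h1 := abs_le.mp hq.1.1.2.1
      have h2 := abs_le.mp hq'.1.1.2.1
      rw [← hA] at h2
      have hkl : (k : ℤ) = l := by
        rcases lt_trichotomy (k : ℤ) l with hlt | heq | hlt
        · nlinarith
        · exact heq
        · nlinarith
      have hkl' : k = l := by exact_mod_cast hkl
      subst hkl'
      rw [shear_injective _ h]
  rw [Finset.card_product, Finset.card_range, ← Set.ncard_eq_toFinset_card _ hfin] at hcard
  have hT1 : 1 ≤ 2 * T / u ^ 3 := by rw [le_div_iff₀ (by positivity)]; linarith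
  have hT2 : 1 ≤ 2 * T / u := hT1.trans (by gcongr; exact le_self_pow₀ hu1 (by norm_num))
  have hT3 : 1 ≤ 2 * u * T := by nlinarith [one_le_pow₀ hu1 (n := 3)]
  have hT4 : 1 ≤ 2 * u ^ 3 * T := by nlinarith [one_le_pow₀ hu1 (n := 3)]
  have hbc : (box.card : ℝ) ≤ 700000 * T ^ 4 := by
    rw [hbox, Fintype.card_piFinset, Fin.prod_univ_four]
    simp only [Matrix.cons_val]
    push_cast
    have k0 := card_intIcc_erase_le (L := 2 * T / u ^ 3) (by positivity)
    have k1 := card_intIcc_le (L := 6 * T / u) (by positivity)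
    have k2 := card_intIcc_le (L := 24 * u * T) (by positivity)
    have k3 := card_intIcc_le (L := 120 * u ^ 3 * T) (by positivity)
    calc _ ≤ (2 * (2 * T / u ^ 3)) * (2 * (6 * T / u) + 2 * T / u) * (2 * (24 * u * T) + 2 * u * T) *
          (2 * (120 * u ^ 3 * T) + 2 * u ^ 3 * T) := by gcongr <;> linarith
      _ = 677600 * T ^ 4 := by field_simp; norm_num
      _ ≤ _ := by gcongr; norm_num
  refine le_trans ?_ hbc
  exact_mod_cast hcard

/-- The cuspidal part of the set of reduced forms is small. -/
theorem ncard_cusp_le (J : ℕ) {T : ℝ} (hT : 0 < T) :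
    (({f : Fin 4 → ℤ | WRed f ∧ (-disc f : ℝ) < T ^ 4 ∧ f 0 ≠ 0 ∧ 16 ^ J * hA f ≤ hC f}.ncard : ℕ) : ℝ) ≤
      1000000 * T ^ 4 / 4 ^ J := by
  classical
  obtain ⟨N, hN⟩ := pow_unbounded_of_one_lt (T ^ 4) (by norm_num : (1 : ℝ) < 16)
  have hfin : ∀ j, (cuspLayer j (T ^ 4)).Finite := fun j =>
    (finite_wRed_lt (T ^ 4)).subset fun f hf => ⟨hf.1, hf.2.1⟩
  have hsub : {f : Fin 4 → ℤ | WRed f ∧ (-disc f : ℝ) < T ^ 4 ∧ f 0 ≠ 0 ∧ 16 ^ J * hA f ≤ hC f} ⊆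
      ⋃ i ∈ Finset.range N, cuspLayer (J + i) (T ^ 4) := by
    rintro f ⟨hW, hd, h0, hJ⟩
    have hA0 := hW.1
    have hCN : hC f < 16 ^ N := by
      have h1 := (wRed_cast.mpr hW).three_mul_le
      rw [hA_cast, hC_cast, disc_cast] at h1
      have h2 : (1 : ℝ) ≤ hA f := by exact_mod_cast hA0
      have h3 : (0 : ℝ) < (hC f : ℤ) := by exact_mod_cast hA0.trans_le hW.2.2
      have h4 : ((hC f : ℤ) : ℝ) < 16 ^ N := by nlinarith
      exact_mod_cast h4
    have hex : ∃ j : ℕ, hC f < 16 ^ (J + j + 1) * hA f := ⟨N, by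
      have : (16 : ℤ) ^ N ≤ 16 ^ (J + N + 1) := pow_le_pow_right₀ (by norm_num) (by omega)
      exact hCN.trans_le (this.trans (le_mul_of_one_le_right (by positivity) hA0))⟩
    have hsp := Nat.find_spec hex
    have hmin : 16 ^ (J + Nat.find hex) * hA f ≤ hC f := by
      rcases Nat.eq_zero_or_pos (Nat.find hex) with h | h
      · rw [h]; exact hJ
      · have := Nat.find_min hex (m := Nat.find hex - 1) (by omega)
        rw [show J + (Nat.find hex - 1) + 1 = J + Nat.find hex by omega] at this
        exact not_lt.mp this
    simp only [Set.mem_iUnion, Finset.mem_range]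
    refine ⟨Nat.find hex, ?_, hW, hd, h0, hmin, hsp⟩
    by_contra hge
    have : (16 : ℤ) ^ N ≤ 16 ^ (J + Nat.find hex) := pow_le_pow_right₀ (by norm_num) (by omega)
    exact (hCN.trans_le (this.trans (le_mul_of_one_le_right (by positivity) hA0))).not_ge hmin
  have hle : ∀ i, ((cuspLayer (J + i) (T ^ 4)).ncard : ℝ) ≤ 700000 * T ^ 4 / 4 ^ J * (1 / 4) ^ i := by
    intro i
    have := ncard_cuspLayer_le (J + i) hT
    rw [← le_div_iff₀ (by positivity)] at this
    refine this.trans (le_of_eq ?_)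
    rw [pow_add, one_div, inv_pow]
    field_simp
  have hgeom : ∑ i ∈ Finset.range N, (1 / 4 : ℝ) ^ i ≤ 4 / 3 := by
    rw [geom_sum_eq (by norm_num)]
    have : (0 : ℝ) ≤ (1 / 4) ^ N := by positivity
    rw [div_le_iff_of_neg (by norm_num)]
    linarith
  calc _ ≤ (((⋃ i ∈ Finset.range N, cuspLayer (J + i) (T ^ 4)).ncard : ℕ) : ℝ) := by
        exact_mod_cast Set.ncard_le_ncard hsub
          (Set.Finite.biUnion (Finset.finite_toSet _) fun i _ => hfin _)
    _ ≤ ∑ i ∈ Finset.range N, ((cuspLayer (J + i) (T ^ 4)).ncard : ℝ) := by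
        exact_mod_cast Finset.set_ncard_biUnion_le _ _
    _ ≤ ∑ i ∈ Finset.range N, 700000 * T ^ 4 / 4 ^ J * (1 / 4) ^ i := Finset.sum_le_sum fun i _ => hle i
    _ = 700000 * T ^ 4 / 4 ^ J * ∑ i ∈ Finset.range N, (1 / 4 : ℝ) ^ i := by rw [Finset.mul_sum]
    _ ≤ 700000 * T ^ 4 / 4 ^ J * (4 / 3) := by gcongr
    _ ≤ 1000000 * T ^ 4 / 4 ^ J := by
        rw [div_mul_eq_mul_div]
        have := pow_pos hT 4
        exact div_le_div_of_nonneg_right (by linarith) (by positivity)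

end Cusp

section AllForms

lemma sum_range_inv_sq_le (N : ℕ) : ∑ n ∈ Finset.range N, (1 : ℝ) / ((n : ℝ) + 1) ^ 2 ≤ 2 := by
  have h : ∀ N : ℕ, ∑ n ∈ Finset.range (N + 1), (1 : ℝ) / ((n : ℝ) + 1) ^ 2 ≤ (2 : ℝ) - 1 / ((N : ℝ) + 1) := by
    intro N
    induction N with
    | zero => norm_num
    | succ N ih =>
      rw [Finset.sum_range_succ]
      have h2 : (1 : ℝ) / (N + 1) - 1 / (N + 2) = 1 / ((N + 1) * (N + 2)) := by field_simp; ring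
      have h3 : (1 : ℝ) / ((N + 2) ^ 2) ≤ 1 / ((N + 1) * (N + 2)) :=
        one_div_le_one_div_of_le (by positivity) (by nlinarith [N.cast_nonneg (α := ℝ)])
      have e : ((N + 1 : ℕ) : ℝ) + 1 = N + 2 := by push_cast; ring
      rw [e]
      rw [← h2] at h3
      linarith
  rcases N with - | N
  · simp
  · have h0 : (0 : ℝ) ≤ 1 / ((N : ℝ) + 1) := by positivity
    linarith [h N]

lemma bounds_of_lead_zero {f : Fin 4 → ℤ} {Y : ℝ} (hW : WRed f) (hd : (-disc f : ℝ) < Y)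
    (h0 : f 0 = 0) : f 1 ≠ 0 ∧ |f 2| ≤ |f 1| ∧ |(f 3 : ℝ)| ≤ Y / |(f 1 : ℝ)| ^ 3 ∧
      1 ≤ Y / |(f 1 : ℝ)| ^ 3 := by
  have hA : hA f = f 1 ^ 2 := by simp [hA, h0]
  have hB : hB f = f 1 * f 2 := by simp [hB, h0]
  have hC : hC f = f 2 ^ 2 - f 1 * f 3 := rfl
  have hAC := hW.2.2
  have h3 := (wRed_cast.mpr hW).three_mul_le
  rw [hA_cast, hC_cast, disc_cast] at h3
  have hA0 := hW.1
  rw [hA] at hA0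
  have hb : f 1 ≠ 0 := by rintro h; simp [h] at hA0
  have hb1 : (1 : ℝ) ≤ |(f 1 : ℝ)| := by exact_mod_cast Int.one_le_abs hb
  have hb0 : 0 < |(f 1 : ℝ)| := by linarith
  have hc : |f 2| ≤ |f 1| := by
    have := hW.2.1
    rw [hA, hB, abs_mul, ← sq_abs, sq] at this
    exact le_of_mul_le_mul_left this (abs_pos.mpr hb)
  have hc' : |(f 2 : ℝ)| ≤ |(f 1 : ℝ)| := by exact_mod_cast hc
  have hc2 : (f 2 : ℝ) ^ 2 ≤ (f 1 : ℝ) ^ 2 := sq_le_sq.mpr hc'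
  have hAC' : (f 1 : ℝ) ^ 2 ≤ (f 2 : ℝ) ^ 2 - f 1 * f 3 := by
    rw [hA, hC] at hAC; exact_mod_cast hAC
  rw [hA, hC] at h3
  push_cast at h3
  have h4 : 3 * ((f 1 : ℝ) ^ 2 * (f 1 : ℝ) ^ 2) ≤ Y := by
    have : (f 1 : ℝ) ^ 2 * (f 1 : ℝ) ^ 2 ≤ (f 1 : ℝ) ^ 2 * ((f 2 : ℝ) ^ 2 - f 1 * f 3) := by gcongr
    linarith
  have hsq : (f 1 : ℝ) ^ 2 = |(f 1 : ℝ)| ^ 2 := (sq_abs _).symm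
  refine ⟨hb, hc, ?_, ?_⟩
  · rw [le_div_iff₀ (by positivity)]
    have h5 : |(f 3 : ℝ)| * |(f 1 : ℝ)| ≤ (f 1 : ℝ) ^ 2 + ((f 2 : ℝ) ^ 2 - f 1 * f 3) := by
      rw [← abs_mul, abs_le]
      constructor <;> nlinarith [sq_nonneg (f 2 : ℝ)]
    have h6 : |(f 3 : ℝ)| * |(f 1 : ℝ)| ^ 3 = (f 1 : ℝ) ^ 2 * (|(f 3 : ℝ)| * |(f 1 : ℝ)|) := by
      rw [hsq]; ring
    rw [h6]
    have h7 : (f 1 : ℝ) ^ 2 * (|(f 3 : ℝ)| * |(f 1 : ℝ)|) ≤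
        (f 1 : ℝ) ^ 2 * ((f 1 : ℝ) ^ 2 + ((f 2 : ℝ) ^ 2 - f 1 * f 3)) := by gcongr
    rw [mul_add] at h7
    have h8 : 0 ≤ (f 1 : ℝ) ^ 2 * (f 1 : ℝ) ^ 2 := by positivity
    linarith
  · rw [le_div_iff₀ (by positivity)]
    rw [hsq] at h4
    have : |(f 1 : ℝ)| ^ 3 ≤ |(f 1 : ℝ)| ^ 3 * |(f 1 : ℝ)| := le_mul_of_one_le_right (by positivity) hb1
    nlinarith [pow_pos hb0 4]

lemma ncard_lead_zero_le {Y : ℝ} (hY : 0 < Y) :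
    (({f : Fin 4 → ℤ | WRed f ∧ (-disc f : ℝ) < Y ∧ f 0 = 0}.ncard : ℕ) : ℝ) ≤ 36 * Y := by
  classical
  set box : ℕ → Finset (Fin 4 → ℤ) := fun n => if 1 ≤ Y / ((n : ℝ) + 1) ^ 3 then Fintype.piFinset
    ![{0}, {(n : ℤ) + 1, -((n : ℤ) + 1)}, intIcc ((n : ℝ) + 1), intIcc (Y / ((n : ℝ) + 1) ^ 3)] else ∅
    with hbox
  obtain ⟨N, hN⟩ := exists_nat_gt Y
  have hsub : {f : Fin 4 → ℤ | WRed f ∧ (-disc f : ℝ) < Y ∧ f 0 = 0} ⊆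
      ((Finset.range N).biUnion box : Finset (Fin 4 → ℤ)) := by
    rintro f ⟨hW, hd, h0⟩
    obtain ⟨hb, hc, hd3, h1⟩ := bounds_of_lead_zero hW hd h0
    have hb1 := Int.one_le_abs hb
    obtain ⟨n, hn⟩ : ∃ n : ℕ, |f 1| = n + 1 := ⟨(|f 1| - 1).toNat, by omega⟩
    have hn' : |(f 1 : ℝ)| = (n : ℝ) + 1 := by exact_mod_cast hn
    rw [hn'] at hd3 h1
    rw [hn] at hc
    simp only [Finset.coe_biUnion, Set.mem_iUnion, Finset.mem_coe, Finset.mem_range]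
    refine ⟨n, ?_, ?_⟩
    · have h2 : ((n : ℝ) + 1) ^ 3 ≤ Y := by
        rwa [le_div_iff₀ (by positivity), one_mul] at h1
      have h3 : (n : ℝ) + 1 ≤ ((n : ℝ) + 1) ^ 3 := le_self_pow₀ (by linarith [n.cast_nonneg (α := ℝ)]) (by norm_num)
      have : (n : ℝ) < N := by linarith
      exact_mod_cast this
    · simp only [hbox, if_pos h1, Fintype.mem_piFinset]
      intro i
      fin_cases i
      · simpa using h0
      · simp only [Fin.mk_one, Matrix.cons_val_one, Matrix.cons_val_zero, Finset.mem_insert,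
          Finset.mem_singleton]
        exact (abs_eq (by positivity)).mp hn
      · simp only [Fin.reduceFinMk, Matrix.cons_val, mem_intIcc]
        exact_mod_cast hc
      · simpa only [Fin.reduceFinMk, Matrix.cons_val, mem_intIcc] using hd3
  have hcard : ∀ n, ((box n).card : ℝ) ≤ 18 * Y * (1 / ((n : ℝ) + 1) ^ 2) := by
    intro n
    simp only [hbox]
    split_ifs with h1
    · rw [Fintype.card_piFinset, Fin.prod_univ_four]
      simp only [Matrix.cons_val, Finset.card_singleton]
      push_cast
      have k1 : ((({(n : ℤ) + 1, -((n : ℤ) + 1)} : Finset ℤ).card : ℕ) : ℝ) ≤ 2 := by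
        exact_mod_cast Finset.card_le_two
      have k2 := card_intIcc_le (L := (n : ℝ) + 1) (by positivity)
      have k3 := card_intIcc_le (L := Y / ((n : ℝ) + 1) ^ 3) (by positivity)
      have hn : (0 : ℝ) ≤ n := n.cast_nonneg
      calc _ ≤ 1 * 2 * (3 * ((n : ℝ) + 1)) * (3 * (Y / ((n : ℝ) + 1) ^ 3)) := by
            gcongr <;> linarith
        _ = _ := by field_simp; norm_num
    · simp; positivity
  calc _ ≤ (((Finset.range N).biUnion box).card : ℝ) := by
        rw [← Set.ncard_coe_finset]
        exact_mod_cast Set.ncard_le_ncard hsub (Finset.finite_toSet _)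
    _ ≤ ∑ n ∈ Finset.range N, ((box n).card : ℝ) := by exact_mod_cast Finset.card_biUnion_le
    _ ≤ ∑ n ∈ Finset.range N, 18 * Y * (1 / ((n : ℝ) + 1) ^ 2) := Finset.sum_le_sum fun n _ => hcard n
    _ = 18 * Y * ∑ n ∈ Finset.range N, 1 / ((n : ℝ) + 1) ^ 2 := by rw [Finset.mul_sum]
    _ ≤ 18 * Y * 2 := by gcongr; exact sum_range_inv_sq_le N
    _ = 36 * Y := by ring

/-- The number of reduced forms of discriminant greater than `-Y` is `O(Y)`. -/
theorem ncard_wRed_lt_le {Y : ℝ} (hY : 0 < Y) :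
    (({f : Fin 4 → ℤ | WRed f ∧ (-disc f : ℝ) < Y}.ncard : ℕ) : ℝ) ≤ 1000036 * Y := by
  have hT : 0 < √(√Y) := by positivity
  have h1 := ncard_cusp_le 0 hT
  rw [fourth_root_pow hY.le] at h1
  have e : 1000000 * Y / 4 ^ 0 = 1000000 * Y := by norm_num
  rw [e] at h1
  have h2 := ncard_lead_zero_le hY
  have hsub : {f : Fin 4 → ℤ | WRed f ∧ (-disc f : ℝ) < Y} ⊆
      {f : Fin 4 → ℤ | WRed f ∧ (-disc f : ℝ) < Y ∧ f 0 ≠ 0 ∧ 16 ^ 0 * hA f ≤ hC f} ∪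
      {f : Fin 4 → ℤ | WRed f ∧ (-disc f : ℝ) < Y ∧ f 0 = 0} := by
    rintro f ⟨hW, hd⟩
    by_cases h0 : f 0 = 0
    · exact Or.inr ⟨hW, hd, h0⟩
    · exact Or.inl ⟨hW, hd, h0, by simpa using hW.2.2⟩
  have hfin := finite_wRed_lt Y
  have h3 := (Set.ncard_le_ncard hsub ((hfin.subset fun f hf => ⟨hf.1, hf.2.1⟩).union
    (hfin.subset fun f hf => ⟨hf.1, hf.2.1⟩))).trans (Set.ncard_union_le _ _)
  have h4 : (({f : Fin 4 → ℤ | WRed f ∧ (-disc f : ℝ) < Y}.ncard : ℕ) : ℝ) ≤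
      ({f : Fin 4 → ℤ | WRed f ∧ (-disc f : ℝ) < Y ∧ f 0 ≠ 0 ∧ 16 ^ 0 * hA f ≤ hC f}.ncard : ℕ) +
      ({f : Fin 4 → ℤ | WRed f ∧ (-disc f : ℝ) < Y ∧ f 0 = 0}.ncard : ℕ) := by exact_mod_cast h3
  linarith

end AllForms

section StrongTail

/-- The integers of absolute value at most `L` in a residue class. -/
noncomputable def residueIcc (p : ℕ) (L : ℝ) (v : ℤ) : Finset ℤ :=
  (intIcc L).filter fun x => x ≡ v [ZMOD p]

lemma card_residueIcc_le {p : ℕ} (hp : 0 < p) {L : ℝ} (hL : 0 ≤ L) (v : ℤ) :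
    ((residueIcc p L v).card : ℝ) ≤ (2 * L + 1) / p + 1 := by
  have hp' : (0 : ℤ) < p := by exact_mod_cast hp
  have e : residueIcc p L v = {x ∈ Finset.Ioc (-⌊L⌋ - 1) ⌊L⌋ | x ≡ v [ZMOD p]} := by
    ext x
    simp only [residueIcc, intIcc, Finset.mem_filter, Finset.mem_Icc, Finset.mem_Ioc]
    constructor <;> rintro ⟨⟨h1, h2⟩, h3⟩ <;> exact ⟨⟨by omega, by omega⟩, h3⟩
  have h := Int.Ioc_filter_modEq_card (-⌊L⌋ - 1) ⌊L⌋ hp' v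
  rw [← e] at h
  have h0 : (0 : ℤ) ≤ ⌊L⌋ := Int.floor_nonneg.mpr hL
  have hL' := Int.floor_le L
  have hp0 : (0 : ℝ) < p := by exact_mod_cast hp
  have h1 : ((residueIcc p L v).card : ℚ) ≤ (2 * (⌊L⌋ : ℚ) + 1) / p + 1 := by
    have h2 : ((residueIcc p L v).card : ℚ) = ((((residueIcc p L v).card : ℕ) : ℤ) : ℚ) := by
      norm_cast
    rw [h2, h]
    push_cast
    refine max_le ?_ ?_
    · have k1 := Int.floor_le (((⌊L⌋ : ℤ) - (v : ℚ)) / (p : ℚ))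
      have k2 := Int.lt_floor_add_one (((-(⌊L⌋ : ℤ) - 1 : ℚ) - (v : ℚ)) / (p : ℚ))
      have k3 : (((⌊L⌋ : ℤ) - (v : ℚ)) / (p : ℚ)) - (((-(⌊L⌋ : ℤ) - 1 : ℚ) - (v : ℚ)) / (p : ℚ)) =
        (2 * (⌊L⌋ : ℚ) + 1) / p := by ring
      linarith
    · have : (0 : ℚ) ≤ (⌊L⌋ : ℚ) := by exact_mod_cast h0
      positivity
  have h3 : ((residueIcc p L v).card : ℝ) ≤ (2 * (⌊L⌋ : ℝ) + 1) / p + 1 := by exact_mod_cast h1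
  refine h3.trans ?_
  gcongr

lemma exists_inverse_mod {p : ℕ} (hp : p.Prime) :
    ∃ inv : ℤ → ℤ, ∀ a, ¬ (p : ℤ) ∣ a → a * inv a ≡ 1 [ZMOD p] := by
  have h : ∀ a : ℤ, ∃ b, ¬ (p : ℤ) ∣ a → a * b ≡ 1 [ZMOD p] := by
    intro a
    by_cases ha : (p : ℤ) ∣ a
    · exact ⟨0, fun h => absurd ha h⟩
    · obtain ⟨u, v, h⟩ := ((Nat.prime_iff_prime_int.mp hp).coprime_iff_not_dvd).mpr ha
      refine ⟨v, fun _ => (Int.modEq_iff_dvd.mpr ⟨u, ?_⟩)⟩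
      linarith
  choose inv hinv using h
  exact ⟨inv, hinv⟩

/-- The Hessian of `f` vanishes modulo `p`. -/
def HessZero (p : ℕ) (f : Fin 4 → ℤ) : Prop :=
  (p : ℤ) ∣ hA f ∧ (p : ℤ) ∣ hB f ∧ (p : ℤ) ∣ hC f

lemma modEq_of_mul_modEq {p a b x y : ℤ} (h : a * b ≡ 1 [ZMOD p]) (hxy : a * x ≡ y [ZMOD p]) :
    x ≡ b * y [ZMOD p] := by
  have h1 : b * (a * x) ≡ b * y [ZMOD p] := hxy.mul_left b
  have h2 : a * b * x ≡ 1 * x [ZMOD p] := h.mul_right x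
  rw [one_mul] at h2
  refine h2.symm.trans ?_
  rwa [show a * b * x = b * (a * x) by ring]

lemma HessZero.two {p : ℕ} {f : Fin 4 → ℤ} (h : HessZero p f) :
    f 0 * f 2 ≡ f 1 ^ 2 [ZMOD p] := Int.modEq_iff_dvd.mpr h.1

lemma HessZero.three {p : ℕ} {f : Fin 4 → ℤ} (h : HessZero p f) :
    f 0 * f 3 ≡ f 1 * f 2 [ZMOD p] := Int.modEq_iff_dvd.mpr h.2.1

lemma ncard_hessZero_box_le {p : ℕ} (hp : p.Prime) {L : ℝ} (hL : p ≤ L) :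
    (({f : Fin 4 → ℤ | (∀ i, |(f i : ℝ)| ≤ L) ∧ HessZero p f}.ncard : ℕ) : ℝ) ≤
      336 * L ^ 4 * ((p : ℝ) ^ 2)⁻¹ := by
  classical
  obtain ⟨inv, hinv⟩ := exists_inverse_mod hp
  have hp1 : (1 : ℝ) ≤ p := by exact_mod_cast hp.one_lt.le
  have hL1 : 1 ≤ L := hp1.trans hL
  have hL0 : 0 ≤ L := by linarith
  set U : Finset (Fin 4 → ℤ) := (intIcc L ×ˢ intIcc L).biUnion fun x => Fintype.piFinset
    ![{x.1}, {x.2}, residueIcc p L (inv x.1 * x.2 ^ 2),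
      residueIcc p L (inv x.1 * (x.2 * (inv x.1 * x.2 ^ 2)))] with hU
  set V : Finset (Fin 4 → ℤ) := Fintype.piFinset
    ![residueIcc p L 0, residueIcc p L 0, residueIcc p L 0, intIcc L] with hV
  have hpi : Prime (p : ℤ) := Nat.prime_iff_prime_int.mp hp
  have hsub : {f : Fin 4 → ℤ | (∀ i, |(f i : ℝ)| ≤ L) ∧ HessZero p f} ⊆ ((U ∪ V : Finset _) : Set _) := by
    rintro f ⟨hf, hz⟩
    rw [Finset.coe_union]
    by_cases ha : (p : ℤ) ∣ f 0
    · right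
      have hb : (p : ℤ) ∣ f 1 := by
        refine hpi.dvd_of_dvd_pow (n := 2) ?_
        have := dvd_add hz.1 (ha.mul_right (f 2))
        rwa [hA, sub_add_cancel] at this
      have hc : (p : ℤ) ∣ f 2 := by
        refine hpi.dvd_of_dvd_pow (n := 2) ?_
        have := dvd_add hz.2.2 (hb.mul_right (f 3))
        rwa [hC, sub_add_cancel] at this
      rw [Finset.mem_coe, hV, Fintype.mem_piFinset]
      intro i
      fin_cases i
      all_goals simp only [Fin.zero_eta, Fin.mk_one, Fin.reduceFinMk, Matrix.cons_val, residueIcc, Finset.mem_filter, mem_intIcc]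
      · exact ⟨hf 0, Int.modEq_zero_iff_dvd.mpr ha⟩
      · exact ⟨hf 1, Int.modEq_zero_iff_dvd.mpr hb⟩
      · exact ⟨hf 2, Int.modEq_zero_iff_dvd.mpr hc⟩
      · exact hf 3
    · left
      have h2 := modEq_of_mul_modEq (hinv _ ha) hz.two
      have h3 := modEq_of_mul_modEq (hinv _ ha) (hz.three.trans (h2.mul_left _))
      rw [Finset.mem_coe, hU, Finset.mem_biUnion]
      refine ⟨(f 0, f 1), Finset.mem_product.mpr ⟨mem_intIcc.mpr (hf 0), mem_intIcc.mpr (hf 1)⟩, ?_⟩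
      rw [Fintype.mem_piFinset]
      intro i
      fin_cases i
      all_goals simp only [Fin.zero_eta, Fin.mk_one, Fin.reduceFinMk, Matrix.cons_val, residueIcc, Finset.mem_filter, mem_intIcc, Finset.mem_singleton]
      · exact ⟨hf 2, h2⟩
      · exact ⟨hf 3, h3⟩
  have hI : ((intIcc L).card : ℝ) ≤ 3 * L := (card_intIcc_le hL0).trans (by linarith)
  have hR : ∀ v, ((residueIcc p L v).card : ℝ) ≤ 4 * L / p := by
    intro v
    refine (card_residueIcc_le hp.pos hL0 v).trans ?_
    rw [div_add_one (by positivity)]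
    gcongr
    linarith
  have hUc : (U.card : ℝ) ≤ 144 * L ^ 4 * ((p : ℝ) ^ 2)⁻¹ := by
    calc (U.card : ℝ) ≤ ∑ x ∈ intIcc L ×ˢ intIcc L, (4 * L / p) * (4 * L / p) := by
          refine (Nat.cast_le.mpr Finset.card_biUnion_le).trans ?_
          push_cast
          refine Finset.sum_le_sum fun x _ => ?_
          rw [Fintype.card_piFinset, Fin.prod_univ_four]
          simp only [Matrix.cons_val, Finset.card_singleton]
          push_cast
          simp only [one_mul]
          gcongr <;> exact hR _
      _ = (intIcc L).card * (intIcc L).card * ((4 * L / p) * (4 * L / p)) := by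
          rw [Finset.sum_const, Finset.card_product, nsmul_eq_mul]; push_cast; ring
      _ ≤ (3 * L) * (3 * L) * ((4 * L / p) * (4 * L / p)) := by gcongr
      _ = _ := by field_simp; norm_num
  have hVc : (V.card : ℝ) ≤ 192 * L ^ 4 * ((p : ℝ) ^ 2)⁻¹ := by
    rw [hV, Fintype.card_piFinset, Fin.prod_univ_four]
    simp only [Matrix.cons_val]
    push_cast
    calc _ ≤ (4 * L / p) * (4 * L / p) * (4 * L / p) * (3 * L) := by
          gcongr <;> exact hR _
      _ = 192 * L ^ 4 * ((p : ℝ) ^ 2)⁻¹ * (1 / p) := by field_simp; norm_num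
      _ ≤ 192 * L ^ 4 * ((p : ℝ) ^ 2)⁻¹ * 1 := by
          gcongr
          exact (div_le_one (by positivity)).mpr hp1
      _ = _ := mul_one _
  have h1 : (({f : Fin 4 → ℤ | (∀ i, |(f i : ℝ)| ≤ L) ∧ HessZero p f}.ncard : ℕ) : ℝ) ≤ U.card + V.card := by
    have := (Set.ncard_le_ncard hsub (Finset.finite_toSet _)).trans
      ((Set.ncard_coe_finset _).le.trans (Finset.card_union_le U V))
    exact_mod_cast this
  linarith

lemma card_le_two_of_prime_dvd {L : ℝ} (hL : 2 ≤ L) {A : ℤ} (hA0 : A ≠ 0) (hA2 : |(A : ℝ)| ≤ 2 * L ^ 2)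
    (P : Finset ℕ) (hP : ∀ p ∈ P, p.Prime ∧ L < p ∧ (p : ℤ) ∣ A) : P.card ≤ 2 := by
  by_contra! h
  have h1 : ∏ p ∈ P, p ∣ A.natAbs :=
    Finset.prod_primes_dvd _ (fun p hp => (hP p hp).1.prime)
      fun p hp => Int.natCast_dvd.mp (hP p hp).2.2
  have h2 : ∏ p ∈ P, p ≤ A.natAbs := Nat.le_of_dvd (Int.natAbs_pos.mpr hA0) h1
  have h3 : L ^ P.card ≤ ∏ p ∈ P, (p : ℝ) := by
    rw [← Finset.prod_const]
    exact Finset.prod_le_prod (fun _ _ => by linarith) fun p hp => (hP p hp).2.1.le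
  have h4 : L ^ 3 ≤ L ^ P.card := pow_le_pow_right₀ (by linarith) h
  have h5 : (∏ p ∈ P, (p : ℝ)) ≤ |(A : ℝ)| := by
    have h2' : ((∏ p ∈ P, p : ℕ) : ℤ) ≤ |A| := by
      rw [Int.abs_eq_natAbs]; exact_mod_cast h2
    have h2'' : (((∏ p ∈ P, p : ℕ) : ℤ) : ℝ) ≤ ((|A| : ℤ) : ℝ) := Int.cast_le.mpr h2'
    push_cast at h2''
    exact h2''
  obtain ⟨p, hp⟩ : P.Nonempty := Finset.card_pos.mp (by omega)
  have h6 : L ^ 3 < ∏ p ∈ P, (p : ℝ) := by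
    refine h4.trans_lt ?_
    rw [← Finset.prod_const]
    exact Finset.prod_lt_prod_of_nonempty (fun _ _ => by linarith) (fun p hp => (hP p hp).2.1) ⟨p, hp⟩
  nlinarith [sq_nonneg L]

lemma ncard_hessZero_large_le {L : ℝ} (hL : 2 ≤ L) :
    (({f : Fin 4 → ℤ | (∀ i, |(f i : ℝ)| ≤ L) ∧ f 0 ≠ 0 ∧ hA f ≠ 0 ∧
      ∃ p : ℕ, p.Prime ∧ L < p ∧ HessZero p f}.ncard : ℕ) : ℝ) ≤ 216 * L ^ 3 := by
  classical
  have h' : ∀ p : ℕ, ∃ inv : ℤ → ℤ, p.Prime → ∀ a, ¬ (p : ℤ) ∣ a → a * inv a ≡ 1 [ZMOD p] := by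
    intro p
    by_cases hp : p.Prime
    · obtain ⟨i, hi⟩ := exists_inverse_mod hp
      exact ⟨i, fun _ => hi⟩
    · exact ⟨0, fun h => absurd h hp⟩
  choose inv hinv using h'
  have hL0 : 0 ≤ L := by linarith
  set B := ((intIcc L).erase 0 ×ˢ intIcc L ×ˢ intIcc L).filter
    fun x => x.2.1 ^ 2 - x.1 * x.2.2 ≠ 0 with hBdef
  set P : ℤ × ℤ × ℤ → Finset ℕ := fun x =>
    (x.2.1 ^ 2 - x.1 * x.2.2).natAbs.primeFactors.filter fun p => L < p with hP
  set W : Finset (Fin 4 → ℤ) := B.biUnion fun x => (P x).biUnion fun p => Fintype.piFinset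
    ![{x.1}, {x.2.1}, {x.2.2}, residueIcc p L (inv p x.1 * (x.2.1 * x.2.2))] with hW
  have hsub : {f : Fin 4 → ℤ | (∀ i, |(f i : ℝ)| ≤ L) ∧ f 0 ≠ 0 ∧ hA f ≠ 0 ∧
      ∃ p : ℕ, p.Prime ∧ L < p ∧ HessZero p f} ⊆ (W : Set _) := by
    rintro f ⟨hf, h0, hA0, p, hp, hLp, hz⟩
    have ha : ¬ (p : ℤ) ∣ f 0 := by
      intro h
      have h1 := Int.le_of_dvd (abs_pos.mpr h0) ((dvd_abs _ _).mpr h)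
      have h2 : (p : ℝ) ≤ |(f 0 : ℝ)| := by exact_mod_cast h1
      linarith [hf 0]
    have h3 := modEq_of_mul_modEq (hinv p hp _ ha) hz.three
    rw [Finset.mem_coe, hW, Finset.mem_biUnion]
    refine ⟨(f 0, f 1, f 2), ?_, ?_⟩
    · rw [hBdef, Finset.mem_filter]
      exact ⟨Finset.mem_product.mpr ⟨Finset.mem_erase.mpr ⟨h0, mem_intIcc.mpr (hf 0)⟩,
        Finset.mem_product.mpr ⟨mem_intIcc.mpr (hf 1), mem_intIcc.mpr (hf 2)⟩⟩, hA0⟩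
    · rw [Finset.mem_biUnion]
      refine ⟨p, ?_, ?_⟩
      · rw [hP, Finset.mem_filter, Nat.mem_primeFactors]
        exact ⟨⟨hp, Int.natCast_dvd.mp hz.1, Int.natAbs_ne_zero.mpr hA0⟩, hLp⟩
      · rw [Fintype.mem_piFinset]
        intro i
        fin_cases i
        all_goals simp only [Fin.zero_eta, Fin.mk_one, Fin.reduceFinMk, Matrix.cons_val, residueIcc, Finset.mem_filter, mem_intIcc, Finset.mem_singleton]
        exact ⟨hf 3, h3⟩
  have hI : ((intIcc L).card : ℝ) ≤ 3 * L := (card_intIcc_le hL0).trans (by linarith)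
  have hE : ((((intIcc L).erase 0).card : ℕ) : ℝ) ≤ 3 * L := (card_intIcc_erase_le hL0).trans (by linarith)
  have hBc : (B.card : ℝ) ≤ (3 * L) * ((3 * L) * (3 * L)) := by
    refine (Nat.cast_le.mpr (Finset.card_filter_le _ _)).trans ?_
    rw [Finset.card_product, Finset.card_product]
    push_cast
    gcongr
  have hWc : (W.card : ℝ) ≤ B.card * 8 := by
    refine (Nat.cast_le.mpr Finset.card_biUnion_le).trans ?_
    rw [← nsmul_eq_mul, ← Finset.sum_const]
    push_cast
    refine Finset.sum_le_sum fun x hx => ?_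
    rw [hBdef, Finset.mem_filter, Finset.mem_product, Finset.mem_product, Finset.mem_erase, mem_intIcc,
      mem_intIcc, mem_intIcc] at hx
    obtain ⟨⟨⟨-, hx1⟩, hx2, hx3⟩, hx0⟩ := hx
    have hPc : (P x).card ≤ 2 := by
      refine card_le_two_of_prime_dvd hL hx0 ?_ _ fun p hp => ?_
      · push_cast
        refine (abs_sub _ _).trans ?_
        rw [abs_pow, abs_mul]
        nlinarith [abs_nonneg (x.1 : ℝ), abs_nonneg (x.2.1 : ℝ), abs_nonneg (x.2.2 : ℝ)]
      · rw [hP, Finset.mem_filter, Nat.mem_primeFactors] at hp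
        exact ⟨hp.1.1, hp.2, Int.natCast_dvd.mpr hp.1.2.1⟩
    refine (Nat.cast_le.mpr Finset.card_biUnion_le).trans ?_
    push_cast
    calc _ ≤ ∑ p ∈ P x, (4 : ℝ) := by
          refine Finset.sum_le_sum fun p hp => ?_
          rw [hP, Finset.mem_filter, Nat.mem_primeFactors] at hp
          rw [Fintype.card_piFinset, Fin.prod_univ_four]
          simp only [Matrix.cons_val, Finset.card_singleton]
          push_cast
          simp only [one_mul]
          refine (card_residueIcc_le hp.1.1.pos hL0 _).trans ?_
          have hp0 : (0 : ℝ) < p := by linarith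
          have : (2 * L + 1) / p ≤ 3 := by rw [div_le_iff₀ hp0]; linarith
          linarith
      _ ≤ 8 := by
          rw [Finset.sum_const, nsmul_eq_mul]
          have : ((P x).card : ℝ) ≤ 2 := by exact_mod_cast hPc
          linarith
  have h1 : (({f : Fin 4 → ℤ | (∀ i, |(f i : ℝ)| ≤ L) ∧ f 0 ≠ 0 ∧ hA f ≠ 0 ∧
      ∃ p : ℕ, p.Prime ∧ L < p ∧ HessZero p f}.ncard : ℕ) : ℝ) ≤ W.card := by
    have := (Set.ncard_le_ncard hsub (Finset.finite_toSet _)).trans (Set.ncard_coe_finset _).le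
    exact_mod_cast this
  calc _ ≤ _ := h1
    _ ≤ _ := hWc
    _ ≤ (3 * L) * ((3 * L) * (3 * L)) * 8 := by gcongr
    _ = _ := by ring

/-- Forms in a box whose Hessian vanishes modulo some large prime. -/
lemma ncard_hessZero_le {L : ℝ} (hL : 2 ≤ L) {M : ℕ} (hM : 0 < M) :
    (({f : Fin 4 → ℤ | (∀ i, |(f i : ℝ)| ≤ L) ∧ f 0 ≠ 0 ∧ hA f ≠ 0 ∧
      ∃ p : ℕ, p.Prime ∧ M < p ∧ HessZero p f}.ncard : ℕ) : ℝ) ≤ 336 * L ^ 4 / M + 216 * L ^ 3 := by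
  classical
  set I : Finset ℕ := (Finset.Ioc M (max M ⌊L⌋₊)).filter fun p : ℕ => p.Prime ∧ (p : ℝ) ≤ L with hI
  have hbf : ∀ (Q : (Fin 4 → ℤ) → Prop), {f : Fin 4 → ℤ | (∀ i, |(f i : ℝ)| ≤ L) ∧ Q f}.Finite := by
    intro Q
    refine (Finset.finite_toSet (Fintype.piFinset fun _ : Fin 4 => intIcc L)).subset ?_
    rintro f ⟨hf, -⟩
    exact Finset.mem_coe.mpr (Fintype.mem_piFinset.mpr fun i => mem_intIcc.mpr (hf i))
  have hsub : {f : Fin 4 → ℤ | (∀ i, |(f i : ℝ)| ≤ L) ∧ f 0 ≠ 0 ∧ hA f ≠ 0 ∧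
      ∃ p : ℕ, p.Prime ∧ M < p ∧ HessZero p f} ⊆
      (⋃ p ∈ I, {f : Fin 4 → ℤ | (∀ i, |(f i : ℝ)| ≤ L) ∧ HessZero p f}) ∪
      {f : Fin 4 → ℤ | (∀ i, |(f i : ℝ)| ≤ L) ∧ f 0 ≠ 0 ∧ hA f ≠ 0 ∧
      ∃ p : ℕ, p.Prime ∧ L < p ∧ HessZero p f} := by
    rintro f ⟨hf, h0, hA0, p, hp, hMp, hz⟩
    by_cases hpL : (p : ℝ) ≤ L
    · left
      refine Set.mem_iUnion₂.mpr ⟨p, ?_, hf, hz⟩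
      rw [hI, Finset.mem_filter, Finset.mem_Ioc]
      exact ⟨⟨hMp, le_max_of_le_right (Nat.le_floor hpL)⟩, hp, hpL⟩
    · exact Or.inr ⟨hf, h0, hA0, p, hp, not_le.mp hpL, hz⟩
  have h1 := (Set.ncard_le_ncard hsub ((I.finite_toSet.biUnion fun p _ => hbf _).union (hbf _))).trans
    (Set.ncard_union_le _ _)
  have h2 := Finset.set_ncard_biUnion_le I fun p => {f : Fin 4 → ℤ | (∀ i, |(f i : ℝ)| ≤ L) ∧ HessZero p f}
  have h3 : (∑ p ∈ I, (({f : Fin 4 → ℤ | (∀ i, |(f i : ℝ)| ≤ L) ∧ HessZero p f}.ncard : ℕ) : ℝ)) ≤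
      336 * L ^ 4 / M := by
    calc _ ≤ ∑ p ∈ I, 336 * L ^ 4 * ((p : ℝ) ^ 2)⁻¹ := by
          refine Finset.sum_le_sum fun p hp => ?_
          rw [hI, Finset.mem_filter] at hp
          exact ncard_hessZero_box_le hp.2.1 hp.2.2
      _ ≤ ∑ p ∈ Finset.Ioc M (max M ⌊L⌋₊), 336 * L ^ 4 * ((p : ℝ) ^ 2)⁻¹ :=
          Finset.sum_le_sum_of_subset_of_nonneg (Finset.filter_subset _ _) fun _ _ _ => by positivity
      _ = 336 * L ^ 4 * ∑ p ∈ Finset.Ioc M (max M ⌊L⌋₊), ((p : ℝ) ^ 2)⁻¹ := by rw [Finset.mul_sum]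
      _ ≤ 336 * L ^ 4 * (M : ℝ)⁻¹ := by
          gcongr
          refine (sum_Ioc_inv_sq_le_sub hM.ne' (le_max_left _ _)).trans (sub_le_self _ (by positivity))
      _ = _ := by rw [div_eq_mul_inv]
  have h4 := ncard_hessZero_large_le hL
  have h5 : (({f : Fin 4 → ℤ | (∀ i, |(f i : ℝ)| ≤ L) ∧ f 0 ≠ 0 ∧ hA f ≠ 0 ∧
      ∃ p : ℕ, p.Prime ∧ M < p ∧ HessZero p f}.ncard : ℕ) : ℝ) ≤
      (∑ p ∈ I, (({f : Fin 4 → ℤ | (∀ i, |(f i : ℝ)| ≤ L) ∧ HessZero p f}.ncard : ℕ) : ℝ)) +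
      (({f : Fin 4 → ℤ | (∀ i, |(f i : ℝ)| ≤ L) ∧ f 0 ≠ 0 ∧ hA f ≠ 0 ∧
      ∃ p : ℕ, p.Prime ∧ L < p ∧ HessZero p f}.ncard : ℕ) : ℝ) := by
    exact_mod_cast h1.trans (Nat.add_le_add_right h2 _)
  linarith

end StrongTail

section WeakTail

variable {p : ℕ}

/-- A form whose discriminant is divisible by `p ^ 2` and whose Hessian is nonzero modulo `p` has a
translate whose last two coefficients are divisible by `p` and `p ^ 2`. -/
lemma exists_act_dvd (hp : p.Prime) (hp2 : p ≠ 2) {f : Fin 4 → ℤ} (hd : (p : ℤ) ^ 2 ∣ disc f)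
    (hz : ¬ HessZero p f) : ∃ g : Matrix (Fin 2) (Fin 2) ℤ, g.det = 1 ∧
      (p : ℤ) ∣ act g f 2 ∧ (p : ℤ) ^ 2 ∣ act g f 3 := by
  have hpi : Prime (p : ℤ) := Nat.prime_iff_prime_int.mp hp
  have hp2' : ¬ (p : ℤ) ∣ 2 := by
    intro h
    exact hp2 ((Nat.prime_dvd_prime_iff_eq hp Nat.prime_two).mp (by exact_mod_cast h))
  have hp4 : ¬ (p : ℤ) ∣ 4 := by
    intro h
    rw [show (4 : ℤ) = 2 * 2 by norm_num] at h
    rcases hpi.dvd_or_dvd h with h | h <;> exact hp2' h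
  have key : ∀ f : Fin 4 → ℤ, (p : ℤ) ^ 2 ∣ disc f → ¬ (p : ℤ) ∣ hA f → (p : ℤ) ∣ hB f →
      (p : ℤ) ∣ f 2 ∧ (p : ℤ) ^ 2 ∣ f 3 := by
    intro f hd hA0 hB0
    have hC2 : (p : ℤ) ^ 2 ∣ hC f := by
      have h1 : (p : ℤ) ^ 2 ∣ 4 * hA f * hC f := by
        have := dvd_sub (pow_dvd_pow_of_dvd hB0 2) hd
        rwa [disc, sub_sub_cancel] at this
      refine (IsCoprime.pow_left ?_).dvd_of_dvd_mul_left h1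
      refine (hpi.coprime_iff_not_dvd).mpr fun h => ?_
      rcases hpi.dvd_or_dvd h with h | h
      exacts [hp4 h, hA0 h]
    have hC1 : (p : ℤ) ∣ hC f := (dvd_pow_self _ two_ne_zero).trans hC2
    have h2 : (p : ℤ) ∣ f 2 := by
      refine (hpi.dvd_or_dvd (?_ : (p : ℤ) ∣ hA f * f 2)).resolve_left hA0
      have e : hA f * f 2 = hB f * f 1 - hC f * f 0 := by linarith [syzygy_left f]
      rw [e]
      exact dvd_sub (hB0.mul_right _) (hC1.mul_right _)
    refine ⟨h2, ?_⟩
    refine (IsCoprime.pow_left ((hpi.coprime_iff_not_dvd).mpr hA0)).dvd_of_dvd_mul_left ?_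
    have e : hA f * f 3 = hB f * f 2 - hC f * f 1 := by linarith [syzygy_right f]
    rw [e]
    exact dvd_sub (by rw [sq]; exact mul_dvd_mul hB0 h2) (hC2.mul_right _)
  suffices h : ∃ g : Matrix (Fin 2) (Fin 2) ℤ, g.det = 1 ∧ ¬ (p : ℤ) ∣ hA (act g f) ∧
      (p : ℤ) ∣ hB (act g f) by
    obtain ⟨g, h1, h2, h3⟩ := h
    exact ⟨g, h1, key _ (by rwa [disc_act, h1, one_pow, one_mul]) h2 h3⟩
  by_cases hA0 : (p : ℤ) ∣ hA f
  · have hB0 : (p : ℤ) ∣ hB f := by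
      refine hpi.dvd_of_dvd_pow (n := 2) ?_
      have := dvd_add ((dvd_pow_self _ two_ne_zero).trans hd) ((hA0.mul_left 4).mul_right (hC f))
      rwa [disc, sub_add_cancel] at this
    refine ⟨!![0, -1; 1, 0], by simp [Matrix.det_fin_two], ?_, ?_⟩
    · rw [hA_act]
      simpa [Matrix.det_fin_two] using fun h => hz ⟨hA0, hB0, h⟩
    · rw [hB_act]
      simpa [Matrix.det_fin_two] using hB0
  · obtain ⟨inv, hinv⟩ := exists_inverse_mod hp
    have hA2 : ¬ (p : ℤ) ∣ 2 * hA f := fun h => (hpi.dvd_or_dvd h).elim hp2' hA0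
    refine ⟨!![1, -(inv (2 * hA f) * hB f); 0, 1], by simp [Matrix.det_fin_two], ?_, ?_⟩
    · rw [hA_act]
      simpa [Matrix.det_fin_two] using hA0
    · rw [hB_act]
      have h1 := (Int.modEq_iff_dvd.mp (hinv _ hA2)).mul_right (hB f)
      have e : (1 - 2 * hA f * inv (2 * hA f)) * hB f =
        2 * hA f * (-(inv (2 * hA f) * hB f)) + hB f := by ring
      rw [e] at h1
      simpa [Matrix.det_fin_two] using h1

/-- The integral form `f` is obtained from `h` by a substitution of determinant `p`. -/
def Covers (p : ℕ) (h f : Fin 4 → ℤ) (M : Matrix (Fin 2) (Fin 2) ℤ) : Prop :=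
  M.det = p ∧ (p : ℤ) • f = act M h

lemma exists_covers (hp : p.Prime) (hp2 : p ≠ 2) {f : Fin 4 → ℤ} (hf : disc f < 0)
    (hd : (p : ℤ) ^ 2 ∣ disc f) (hz : ¬ HessZero p f) :
    ∃ h M, WRed h ∧ disc f = p ^ 2 * disc h ∧ Covers p h f M := by
  obtain ⟨γ, hγ, h2, h3⟩ := exists_act_dvd hp hp2 hd hz
  obtain ⟨c, hc⟩ := h2
  obtain ⟨d, hd'⟩ := h3
  have hp0 : (p : ℤ) ≠ 0 := by exact_mod_cast hp.ne_zero
  set g : Fin 4 → ℤ := ![p * act γ f 0, act γ f 1, c, d] with hg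
  have hN : (p : ℤ) • act γ f = act !![1, 0; 0, (p : ℤ)] g := by
    funext i
    fin_cases i
    · simp [act.eq_def !![1, 0; 0, (p : ℤ)], hg]
    · simp [act.eq_def !![1, 0; 0, (p : ℤ)], hg, mul_comm]
    · simp only [Fin.reduceFinMk, Pi.smul_apply, smul_eq_mul, hc]
      simp [act.eq_def !![1, 0; 0, (p : ℤ)], hg]; ring
    · simp only [Fin.reduceFinMk, Pi.smul_apply, smul_eq_mul, hd']
      simp [act.eq_def !![1, 0; 0, (p : ℤ)], hg]; ring
  have hdisc : disc f = p ^ 2 * disc g := by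
    have h1 := congrArg disc hN
    rw [disc_smul, disc_act, disc_act, hγ, one_pow, one_mul, Matrix.det_fin_two_of] at h1
    have e : (p : ℤ) ^ 4 * disc f = p ^ 4 * (p ^ 2 * disc g) := by rw [h1]; ring
    exact mul_left_cancel₀ (pow_ne_zero 4 hp0) e
  have hdg : disc g < 0 := by
    by_contra! h0
    have : 0 ≤ (p : ℤ) ^ 2 * disc g := by positivity
    linarith
  obtain ⟨δ, hδ, hW⟩ := exists_act_wRed g hdg
  have inv_mul : ∀ γ : Matrix (Fin 2) (Fin 2) ℤ, γ.det = 1 → γ * γ.adjugate = 1 := by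
    intro γ h; rw [Matrix.mul_adjugate, h, one_smul]
  refine ⟨act δ g, δ.adjugate * !![1, 0; 0, (p : ℤ)] * γ.adjugate, hW, ?_, ?_, ?_⟩
  · rw [disc_act, hδ, one_pow, one_mul, hdisc]
  · rw [Matrix.det_mul, Matrix.det_mul, Matrix.det_adjugate, Matrix.det_adjugate, hγ, hδ,
      Matrix.det_fin_two_of]
    simp
  · rw [act_mul, act_mul, ← act_mul δ, inv_mul δ hδ, act_one, ← hN, act_smul, ← act_mul,
      inv_mul γ hγ, act_one]

/-- The image of `M` modulo `p` is the line through `(r, 1)`, or `(1, 0)` in case of `none`. -/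
def LineOf (p : ℕ) (M : Matrix (Fin 2) (Fin 2) ℤ) : Option (ZMod p) → Prop
  | none => (p : ℤ) ∣ M 1 0 ∧ (p : ℤ) ∣ M 1 1
  | some r => ((M 0 0 : ℤ) : ZMod p) = r * (M 1 0 : ℤ) ∧ ((M 0 1 : ℤ) : ZMod p) = r * (M 1 1 : ℤ)

lemma LineOf.eq_mul {M M' : Matrix (Fin 2) (Fin 2) ℤ} (hp : p.Prime) (hM : M.det = p)
    (hM' : M'.det = p) {ρ : Option (ZMod p)} (h : LineOf p M ρ) (h' : LineOf p M' ρ) :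
    ∃ γ : Matrix (Fin 2) (Fin 2) ℤ, γ.det = 1 ∧ M' = M * γ := by
  have hp0 : (p : ℤ) ≠ 0 := by exact_mod_cast hp.ne_zero
  have hdvd : ∀ i j, (p : ℤ) ∣ (M.adjugate * M') i j := by
    rw [Matrix.adjugate_fin_two]
    cases ρ with
    | none =>
      obtain ⟨h1, h2⟩ := h
      obtain ⟨h3, h4⟩ := h'
      intro i j
      fin_cases i <;> fin_cases j <;> simp only [Fin.zero_eta, Fin.mk_one, Matrix.mul_apply, Fin.sum_univ_two, Matrix.of_apply, Matrix.cons_val_zero, Matrix.cons_val_one, Matrix.cons_val',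
          Matrix.cons_val_fin_one]
      · exact dvd_add (h2.mul_right _) (h3.mul_left _)
      · exact dvd_add (h2.mul_right _) (h4.mul_left _)
      · exact dvd_add ((dvd_neg.mpr h1).mul_right _) (h3.mul_left _)
      · exact dvd_add ((dvd_neg.mpr h1).mul_right _) (h4.mul_left _)
    | some r =>
      obtain ⟨h1, h2⟩ := h
      obtain ⟨h3, h4⟩ := h'
      intro i j
      refine (ZMod.intCast_zmod_eq_zero_iff_dvd _ _).mp ?_
      fin_cases i <;> fin_cases j <;> simp only [Fin.zero_eta, Fin.mk_one, Matrix.mul_apply, Fin.sum_univ_two, Matrix.of_apply, Matrix.cons_val_zero, Matrix.cons_val_one, Matrix.cons_val',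
          Matrix.cons_val_fin_one] <;> push_cast <;> simp only [h1, h2, h3, h4] <;> ring
  choose γ hγ using hdvd
  have hmul : M.adjugate * M' = (p : ℤ) • Matrix.of γ := by
    ext i j
    rw [hγ]; simp
  refine ⟨Matrix.of γ, ?_, ?_⟩
  · have h1 := congrArg Matrix.det hmul
    rw [Matrix.det_mul, Matrix.det_adjugate, hM, hM', Matrix.det_smul] at h1
    simp only [Fintype.card_fin] at h1
    have e : (p : ℤ) ^ 2 * (Matrix.of γ).det = p ^ 2 * 1 := by rw [← h1]; ring
    exact mul_left_cancel₀ (pow_ne_zero 2 hp0) e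
  · have h1 : M * (M.adjugate * M') = (p : ℤ) • M' := by
      rw [← mul_assoc, Matrix.mul_adjugate, hM, smul_mul_assoc, one_mul]
    rw [hmul, mul_smul_comm] at h1
    ext i j
    have := congrFun (congrFun h1 i) j
    simp only [Matrix.smul_apply, smul_eq_mul] at this
    exact (mul_left_cancel₀ hp0 this).symm

/-- The value of the cubic form at `(r, 1)`. -/
def evalAt {R : Type*} [CommRing R] (f : Fin 4 → R) (r : R) : R :=
  f 0 * r ^ 3 + 3 * f 1 * r ^ 2 + 3 * f 2 * r + f 3

lemma exists_lineOf (hp : p.Prime) {h f : Fin 4 → ℤ} {M : Matrix (Fin 2) (Fin 2) ℤ}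
    (hc : Covers p h f M) :
    ∃ ρ, LineOf p M ρ ∧ ∀ r ∈ ρ, evalAt (fun i => (h i : ZMod p)) r = 0 := by
  have := Fact.mk hp
  obtain ⟨hM, hf⟩ := hc
  by_cases h0 : (p : ℤ) ∣ M 1 0 ∧ (p : ℤ) ∣ M 1 1
  · exact ⟨none, h0, by simp⟩
  have hdet : ((M 0 0 : ℤ) : ZMod p) * (M 1 1 : ℤ) = (M 0 1 : ℤ) * (M 1 0 : ℤ) := by
    have := congrArg (Int.cast : ℤ → ZMod p) hM
    rw [Matrix.det_fin_two] at this
    push_cast at this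
    rw [ZMod.natCast_self, sub_eq_zero] at this
    exact this
  have e0 : act M h 0 = (p : ℤ) * f 0 := by rw [← hf]; simp
  have e3 : act M h 3 = (p : ℤ) * f 3 := by rw [← hf]; simp
  replace e0 := congrArg (Int.cast : ℤ → ZMod p) e0
  replace e3 := congrArg (Int.cast : ℤ → ZMod p) e3
  simp only [act, Matrix.cons_val] at e0 e3
  push_cast at e0 e3
  rw [ZMod.natCast_self, zero_mul] at e0 e3
  by_cases h1 : (p : ℤ) ∣ M 1 1
  · have h2 : ¬ (p : ℤ) ∣ M 1 0 := fun h => h0 ⟨h, h1⟩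
    have u : ((M 1 0 : ℤ) : ZMod p) ≠ 0 := fun h => h2 ((ZMod.intCast_zmod_eq_zero_iff_dvd _ _).mp h)
    have hr : ((M 0 0 : ℤ) : ZMod p) = (M 0 0 : ℤ) / (M 1 0 : ℤ) * (M 1 0 : ℤ) := by field_simp
    set r : ZMod p := (M 0 0 : ℤ) / (M 1 0 : ℤ) with hrdef
    refine ⟨some r, ⟨hr, ?_⟩, ?_⟩
    · refine mul_right_cancel₀ u ?_
      rw [← hdet, hr]; ring
    · intro r' hr'
      obtain rfl : r = r' := by simpa using hr'
      refine (mul_eq_zero.mp (?_ : _ * ((M 1 0 : ℤ) : ZMod p) ^ 3 = 0)).resolve_right (pow_ne_zero 3 u)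
      rw [← e0, hr, evalAt]; ring
  · have u : ((M 1 1 : ℤ) : ZMod p) ≠ 0 := fun h => h1 ((ZMod.intCast_zmod_eq_zero_iff_dvd _ _).mp h)
    have hr : ((M 0 1 : ℤ) : ZMod p) = (M 0 1 : ℤ) / (M 1 1 : ℤ) * (M 1 1 : ℤ) := by field_simp
    set r : ZMod p := (M 0 1 : ℤ) / (M 1 1 : ℤ) with hrdef
    refine ⟨some r, ⟨?_, hr⟩, ?_⟩
    · refine mul_right_cancel₀ u ?_
      rw [hdet, hr]; ring
    · intro r' hr'
      obtain rfl : r = r' := by simpa using hr'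
      refine (mul_eq_zero.mp (?_ : _ * ((M 1 1 : ℤ) : ZMod p) ^ 3 = 0)).resolve_right (pow_ne_zero 3 u)
      rw [← e3, hr, evalAt]; ring

lemma card_roots_evalAt_le [Fact p.Prime] (hp3 : p ≠ 3) {h : Fin 4 → ZMod p} (h0 : h ≠ 0) :
    (Finset.univ.filter fun r => evalAt h r = 0).card ≤ 3 := by
  classical
  have h3 : (3 : ZMod p) ≠ 0 := by
    intro e
    have : ((3 : ℕ) : ZMod p) = 0 := by exact_mod_cast e
    rw [ZMod.natCast_eq_zero_iff] at this
    exact hp3 ((Nat.prime_dvd_prime_iff_eq Fact.out Nat.prime_three).mp this)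
  open Polynomial in
  set P : (ZMod p)[X] := C (h 0) * X ^ 3 + C (3 * h 1) * X ^ 2 + C (3 * h 2) * X + C (h 3) with hP
  have hev : ∀ r, P.eval r = evalAt h r := by
    intro r; simp [hP, evalAt]
  have hP0 : P ≠ 0 := by
    intro e
    apply h0
    have c0 := congrArg (fun Q => Polynomial.coeff Q 3) e
    have c1 := congrArg (fun Q => Polynomial.coeff Q 2) e
    have c2 := congrArg (fun Q => Polynomial.coeff Q 1) e
    have c3 := congrArg (fun Q => Polynomial.coeff Q 0) e
    simp only [hP, Polynomial.coeff_add, Polynomial.coeff_C_mul, Polynomial.coeff_X,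
      Polynomial.coeff_C, Polynomial.coeff_X_pow, Polynomial.coeff_zero] at c0 c1 c2 c3
    norm_num [h3] at c0 c1 c2 c3
    funext i
    fin_cases i <;> simp [*]
  have hsub : (Finset.univ.filter fun r => evalAt h r = 0) ⊆ P.roots.toFinset := by
    intro r hr
    rw [Multiset.mem_toFinset, Polynomial.mem_roots hP0, Polynomial.IsRoot, hev]
    exact (Finset.mem_filter.mp hr).2
  calc _ ≤ _ := Finset.card_le_card hsub
    _ ≤ _ := Multiset.toFinset_card_le _
    _ ≤ P.natDegree := P.card_roots'
    _ ≤ 3 := by rw [hP]; exact Polynomial.natDegree_cubic_le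

lemma ncard_covers_le (hp : p.Prime) (hp3 : p ≠ 3) (h : Fin 4 → ℤ) :
    {f : Fin 4 → ℤ | SRed f ∧ ¬ HessZero p f ∧ ∃ M, Covers p h f M}.Finite ∧
    {f : Fin 4 → ℤ | SRed f ∧ ¬ HessZero p f ∧ ∃ M, Covers p h f M}.ncard ≤ 8 := by
  classical
  have := Fact.mk hp
  have hp0 : (p : ℤ) ≠ 0 := by exact_mod_cast hp.ne_zero
  rcases Set.eq_empty_or_nonempty {f : Fin 4 → ℤ | SRed f ∧ ¬ HessZero p f ∧ ∃ M, Covers p h f M}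
    with he | ⟨f₀, hf₀⟩
  · rw [he]; simp
  have hh : (fun i => (h i : ZMod p)) ≠ 0 := by
    intro e
    obtain ⟨-, hz, M, hM, hf⟩ := hf₀
    have hdvd : ∀ i, (p : ℤ) ∣ h i := fun i =>
      (ZMod.intCast_zmod_eq_zero_iff_dvd _ _).mp (congrFun e i)
    choose k hk using hdvd
    have e1 : h = (p : ℤ) • k := funext hk
    rw [e1, act_smul] at hf
    have e2 : f₀ = act M k := smul_right_injective _ hp0 hf
    apply hz
    rw [e2, HessZero, hA_act, hB_act, hC_act, hM]
    have : (p : ℤ) ∣ (p : ℤ) ^ 2 := dvd_pow_self _ two_ne_zero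
    exact ⟨this.mul_right _, this.mul_right _, this.mul_right _⟩
  set P : Finset (Option (ZMod p)) :=
    insert none ((Finset.univ.filter fun r => evalAt (fun i => (h i : ZMod p)) r = 0).image some) with hP
  have hPc : P.card ≤ 4 := by
    refine (Finset.card_insert_le _ _).trans ?_
    have := Finset.card_image_le (s := Finset.univ.filter fun r => evalAt (fun i => (h i : ZMod p)) r = 0)
      (f := some)
    have := card_roots_evalAt_le hp3 hh
    omega
  set Sρ : Option (ZMod p) → Set (Fin 4 → ℤ) :=
    fun ρ => {f | SRed f ∧ ∃ M, Covers p h f M ∧ LineOf p M ρ} with hS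
  have hsub : {f : Fin 4 → ℤ | SRed f ∧ ¬ HessZero p f ∧ ∃ M, Covers p h f M} ⊆ ⋃ ρ ∈ P, Sρ ρ := by
    rintro f ⟨hf, -, M, hM⟩
    obtain ⟨ρ, h1, h2⟩ := exists_lineOf hp hM
    refine Set.mem_iUnion₂.mpr ⟨ρ, ?_, hf, M, hM, h1⟩
    rw [hP, Finset.mem_insert]
    cases ρ with
    | none => exact Or.inl rfl
    | some r =>
      right
      rw [Finset.mem_image]
      exact ⟨r, Finset.mem_filter.mpr ⟨Finset.mem_univ _, h2 r rfl⟩, rfl⟩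
  have hone : ∀ ρ, (Sρ ρ).Finite ∧ (Sρ ρ).ncard ≤ 2 := by
    intro ρ
    rcases (Sρ ρ).eq_empty_or_nonempty with he | ⟨f, hf, M, hM, hl⟩
    · rw [he]; simp
    have hss : Sρ ρ ⊆ ({f, -f} : Finset (Fin 4 → ℤ)) := by
      rintro f' ⟨hf', M', hM', hl'⟩
      obtain ⟨γ, hγ, rfl⟩ := LineOf.eq_mul hp hM.1 hM'.1 hl hl'
      have e : (p : ℤ) • f' = (p : ℤ) • act γ f := by
        rw [hM'.2, act_mul, ← hM.2, act_smul]
      have := eq_or_eq_neg_of_act hf hf' γ hγ (smul_right_injective _ hp0 e)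
      simpa using this
    refine ⟨(Finset.finite_toSet _).subset hss, ?_⟩
    refine (Set.ncard_le_ncard hss (Finset.finite_toSet _)).trans ?_
    rw [Set.ncard_coe_finset]
    exact Finset.card_le_two
  have hfin : (⋃ ρ ∈ P, Sρ ρ).Finite := P.finite_toSet.biUnion fun ρ _ => (hone ρ).1
  refine ⟨hfin.subset hsub, ?_⟩
  calc _ ≤ _ := Set.ncard_le_ncard hsub hfin
    _ ≤ _ := Finset.set_ncard_biUnion_le P Sρ
    _ ≤ ∑ ρ ∈ P, 2 := Finset.sum_le_sum fun ρ _ => (hone ρ).2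
    _ ≤ 8 := by rw [Finset.sum_const, smul_eq_mul]; omega

/-- Strictly reduced forms with discriminant divisible by `p ^ 2` and Hessian nonzero modulo `p`. -/
theorem ncard_weak_le (hp : p.Prime) (hp2 : p ≠ 2) (hp3 : p ≠ 3) {Y : ℝ} (hY : 0 < Y) :
    (({f : Fin 4 → ℤ | SRed f ∧ (-disc f : ℝ) < Y ∧ (p : ℤ) ^ 2 ∣ disc f ∧ ¬ HessZero p f}.ncard : ℕ) : ℝ) ≤
      8000288 * Y * ((p : ℝ) ^ 2)⁻¹ := by
  classical
  have hp0 : (0 : ℝ) < p := by exact_mod_cast hp.pos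
  set H := (finite_wRed_lt (Y / (p : ℝ) ^ 2)).toFinset with hH
  set Sh : (Fin 4 → ℤ) → Set (Fin 4 → ℤ) :=
    fun h => {f : Fin 4 → ℤ | SRed f ∧ ¬ HessZero p f ∧ ∃ M, Covers p h f M} with hSh
  have hsub : {f : Fin 4 → ℤ | SRed f ∧ (-disc f : ℝ) < Y ∧ (p : ℤ) ^ 2 ∣ disc f ∧ ¬ HessZero p f} ⊆
      ⋃ h ∈ H, Sh h := by
    rintro f ⟨hf, hfY, hd, hz⟩
    have hneg : disc f < 0 := by
      have := (wRed_cast.mpr hf.wRed).disc_neg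
      rw [disc_cast] at this
      exact_mod_cast this
    obtain ⟨h, M, hW, hdh, hM⟩ := exists_covers hp hp2 hneg hd hz
    refine Set.mem_iUnion₂.mpr ⟨h, ?_, hf, hz, M, hM⟩
    rw [hH, Set.Finite.mem_toFinset]
    refine ⟨hW, ?_⟩
    rw [lt_div_iff₀ (by positivity)]
    rw [hdh] at hfY
    push_cast at hfY
    linarith
  have hfin : (⋃ h ∈ H, Sh h).Finite := H.finite_toSet.biUnion fun h _ => (ncard_covers_le hp hp3 h).1
  have h1 : {f : Fin 4 → ℤ | SRed f ∧ (-disc f : ℝ) < Y ∧ (p : ℤ) ^ 2 ∣ disc f ∧ ¬ HessZero p f}.ncard ≤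
      H.card * 8 := by
    calc _ ≤ _ := Set.ncard_le_ncard hsub hfin
      _ ≤ _ := Finset.set_ncard_biUnion_le H Sh
      _ ≤ ∑ h ∈ H, 8 := Finset.sum_le_sum fun h _ => (ncard_covers_le hp hp3 h).2
      _ = _ := by rw [Finset.sum_const, smul_eq_mul]
  have h2 := ncard_wRed_lt_le (Y := Y / (p : ℝ) ^ 2) (by positivity)
  rw [Set.ncard_eq_toFinset_card _ (finite_wRed_lt _)] at h2
  have h3 : (({f : Fin 4 → ℤ | SRed f ∧ (-disc f : ℝ) < Y ∧ (p : ℤ) ^ 2 ∣ disc f ∧ ¬ HessZero p f}.ncard : ℕ) : ℝ) ≤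
      H.card * 8 := by exact_mod_cast h1
  calc _ ≤ _ := h3
    _ ≤ 1000036 * (Y / (p : ℝ) ^ 2) * 8 := by gcongr
    _ = _ := by rw [div_eq_mul_inv]; ring

end WeakTail

section Tail

lemma ncard_weak_tail_le {M : ℕ} (hM : 3 ≤ M) {Y : ℝ} (hY : 0 < Y) :
    (({f : Fin 4 → ℤ | SRed f ∧ (-disc f : ℝ) < Y ∧
      ∃ p : ℕ, p.Prime ∧ M < p ∧ (p : ℤ) ^ 2 ∣ disc f ∧ ¬ HessZero p f}.ncard : ℕ) : ℝ) ≤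
      8000288 * Y / M := by
  classical
  set I := (Finset.Ioc M (max M ⌊Y⌋₊)).filter Nat.Prime with hI
  set A : ℕ → Set (Fin 4 → ℤ) := fun p =>
    {f : Fin 4 → ℤ | SRed f ∧ (-disc f : ℝ) < Y ∧ (p : ℤ) ^ 2 ∣ disc f ∧ ¬ HessZero p f} with hA
  have hsub : {f : Fin 4 → ℤ | SRed f ∧ (-disc f : ℝ) < Y ∧
      ∃ p : ℕ, p.Prime ∧ M < p ∧ (p : ℤ) ^ 2 ∣ disc f ∧ ¬ HessZero p f} ⊆ ⋃ p ∈ I, A p := by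
    rintro f ⟨hf, hfY, p, hp, hMp, hd, hz⟩
    refine Set.mem_iUnion₂.mpr ⟨p, ?_, hf, hfY, hd, hz⟩
    rw [hI, Finset.mem_filter, Finset.mem_Ioc]
    refine ⟨⟨hMp, le_max_of_le_right (Nat.le_floor ?_)⟩, hp⟩
    have hneg : disc f < 0 := by
      have := (wRed_cast.mpr hf.wRed).disc_neg
      rw [disc_cast] at this
      exact_mod_cast this
    have h1 : (p : ℤ) ^ 2 ≤ -disc f := Int.le_of_dvd (by linarith) ((dvd_neg).mpr hd)
    have h2 : (p : ℝ) ^ 2 ≤ -disc f := by exact_mod_cast h1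
    have h3 : (1 : ℝ) ≤ p := by exact_mod_cast hp.one_lt.le
    nlinarith
  have hAf : ∀ p, (A p).Finite := fun p =>
    (finite_wRed_lt Y).subset fun f hf => ⟨hf.1.wRed, hf.2.1⟩
  have h1 := (Set.ncard_le_ncard hsub (I.finite_toSet.biUnion fun p _ => hAf p)).trans
    (Finset.set_ncard_biUnion_le I A)
  have h2 : (({f : Fin 4 → ℤ | SRed f ∧ (-disc f : ℝ) < Y ∧
      ∃ p : ℕ, p.Prime ∧ M < p ∧ (p : ℤ) ^ 2 ∣ disc f ∧ ¬ HessZero p f}.ncard : ℕ) : ℝ) ≤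
      ∑ p ∈ I, ((A p).ncard : ℝ) := by exact_mod_cast h1
  calc _ ≤ _ := h2
    _ ≤ ∑ p ∈ I, 8000288 * Y * ((p : ℝ) ^ 2)⁻¹ := by
        refine Finset.sum_le_sum fun p hp => ?_
        rw [hI, Finset.mem_filter, Finset.mem_Ioc] at hp
        exact ncard_weak_le hp.2 (by omega) (by omega) hY
    _ ≤ ∑ p ∈ Finset.Ioc M (max M ⌊Y⌋₊), 8000288 * Y * ((p : ℝ) ^ 2)⁻¹ :=
        Finset.sum_le_sum_of_subset_of_nonneg (Finset.filter_subset _ _) fun _ _ _ => by positivity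
    _ = 8000288 * Y * ∑ p ∈ Finset.Ioc M (max M ⌊Y⌋₊), ((p : ℝ) ^ 2)⁻¹ := by rw [Finset.mul_sum]
    _ ≤ 8000288 * Y * (M : ℝ)⁻¹ := by
        gcongr
        exact (sum_Ioc_inv_sq_le_sub (by omega) (le_max_left _ _)).trans
          (sub_le_self _ (by positivity))
    _ = _ := by rw [div_eq_mul_inv]

/-- The uniformity estimate: few reduced forms have discriminant divisible by the square of a large
prime. -/
theorem ncard_tail_le {ε : ℝ} (hε : 0 < ε) : ∀ᶠ M : ℕ in atTop, ∀ᶠ Y : ℝ in atTop,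
    (({f : Fin 4 → ℤ | SRed f ∧ (-disc f : ℝ) < Y ∧ f 0 ≠ 0 ∧
      ∃ p : ℕ, p.Prime ∧ M < p ∧ (p : ℤ) ^ 2 ∣ disc f}.ncard : ℕ) : ℝ) ≤ ε * Y := by
  obtain ⟨J, hJ⟩ : ∃ J : ℕ, (1000000 : ℝ) / 4 ^ J ≤ ε / 4 := by
    obtain ⟨J, hJ⟩ := pow_unbounded_of_one_lt (4000000 / ε) (by norm_num : (1 : ℝ) < 4)
    refine ⟨J, ?_⟩
    rw [div_le_iff₀ (by positivity)]
    rw [div_lt_iff₀ hε] at hJ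
    linarith
  obtain ⟨R₀, hR₀⟩ := (isBounded_truncBody (16 ^ J)).exists_norm_le
  set R := max R₀ 1 with hRdef
  have hR1 : 1 ≤ R := le_max_right _ _
  have hR : ∀ x ∈ truncBody (16 ^ J), ‖x‖ ≤ R := fun x hx => (hR₀ x hx).trans (le_max_left _ _)
  have lim : ∀ c : ℝ, ∀ᶠ M : ℕ in atTop, c / M ≤ ε / 4 := fun c =>
    (tendsto_const_div_atTop_nhds_zero_nat c).eventually_le_const (by positivity)
  filter_upwards [eventually_ge_atTop 3, lim 8000288, lim (336 * R ^ 4)] with M hM3 hM1 hM2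
  filter_upwards [eventually_gt_atTop 0, tendsto_fourth_root.eventually_ge_atTop 2,
    tendsto_fourth_root.eventually_ge_atTop (864 * R ^ 3 / ε)] with Y hY hT2 hTε
  set T := √(√Y) with hTdef
  have hT0 : 0 < T := by linarith
  have hT4 : T ^ 4 = Y := fourth_root_pow hY.le
  have hL : 2 ≤ R * T := by nlinarith
  have h1 := ncard_weak_tail_le hM3 hY
  have h2 := ncard_cusp_le J hT0
  rw [hT4] at h2
  have h3 := ncard_hessZero_le hL (M := M) (by omega)
  set S₁ := {f : Fin 4 → ℤ | SRed f ∧ (-disc f : ℝ) < Y ∧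
      ∃ p : ℕ, p.Prime ∧ M < p ∧ (p : ℤ) ^ 2 ∣ disc f ∧ ¬ HessZero p f} with hS₁
  set S₂ := {f : Fin 4 → ℤ | WRed f ∧ (-disc f : ℝ) < Y ∧ f 0 ≠ 0 ∧ 16 ^ J * hA f ≤ hC f} with hS₂
  set S₃ := {f : Fin 4 → ℤ | (∀ i, |(f i : ℝ)| ≤ R * T) ∧ f 0 ≠ 0 ∧ hA f ≠ 0 ∧
      ∃ p : ℕ, p.Prime ∧ M < p ∧ HessZero p f} with hS₃
  set S₀ := {f : Fin 4 → ℤ | SRed f ∧ (-disc f : ℝ) < Y ∧ f 0 ≠ 0 ∧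
      ∃ p : ℕ, p.Prime ∧ M < p ∧ (p : ℤ) ^ 2 ∣ disc f} with hS₀
  have hsub : S₀ ⊆ S₁ ∪ S₂ ∪ S₃ := by
    rintro f ⟨hf, hfY, h0, p, hp, hMp, hd⟩
    by_cases hz : HessZero p f
    · by_cases hc : 16 ^ J * hA f ≤ hC f
      · exact Or.inl (Or.inr ⟨hf.wRed, hfY, h0, hc⟩)
      · refine Or.inr ⟨fun i => ?_, h0, hf.1.ne', p, hp, hMp, hz⟩
        have hb : f ∈ bodyZ (16 ^ J) (T ^ 4) := by
          rw [hT4]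
          exact ⟨hf.wRed, hfY, h0, by exact_mod_cast not_le.mp hc⟩
        have h4 := (norm_le_pi_norm _ i).trans (hR _ ((div_mem_truncBody hT0).mpr hb))
        rwa [Real.norm_eq_abs, abs_div, abs_of_pos hT0, div_le_iff₀ hT0] at h4
    · exact Or.inl (Or.inl ⟨hf, hfY, p, hp, hMp, hd, hz⟩)
  have hfin := finite_wRed_lt Y
  have hS₃f : S₃.Finite := by
    refine (Finset.finite_toSet (Fintype.piFinset fun _ : Fin 4 => intIcc (R * T))).subset ?_
    rintro f ⟨hf, -⟩
    exact Finset.mem_coe.mpr (Fintype.mem_piFinset.mpr fun i => mem_intIcc.mpr (hf i))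
  have h4 : S₀.ncard ≤ S₁.ncard + S₂.ncard + S₃.ncard := by
    refine (Set.ncard_le_ncard hsub (((hfin.subset fun f hf => ⟨hf.1.wRed, hf.2.1⟩).union
      (hfin.subset fun f hf => ⟨hf.1, hf.2.1⟩)).union hS₃f)).trans ?_
    exact (Set.ncard_union_le _ _).trans (Nat.add_le_add_right (Set.ncard_union_le _ _) _)
  have h5 : (S₀.ncard : ℝ) ≤ S₁.ncard + S₂.ncard + S₃.ncard := by exact_mod_cast h4
  have b1 : (S₁.ncard : ℝ) ≤ ε / 4 * Y := by
    calc _ ≤ _ := h1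
      _ = 8000288 / M * Y := by ring
      _ ≤ _ := by gcongr
  have b2 : (S₂.ncard : ℝ) ≤ ε / 4 * Y := by
    calc _ ≤ _ := h2
      _ = 1000000 / 4 ^ J * Y := by ring
      _ ≤ _ := by gcongr
  have b3 : (S₃.ncard : ℝ) ≤ ε / 4 * Y + ε / 4 * Y := by
    calc _ ≤ _ := h3
      _ = 336 * R ^ 4 / M * T ^ 4 + 216 * R ^ 3 * T ^ 3 := by ring
      _ ≤ ε / 4 * T ^ 4 + (ε / 4 * T) * T ^ 3 := by
          rw [div_le_iff₀ hε] at hTε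
          have : 216 * R ^ 3 ≤ ε / 4 * T := by linarith
          gcongr
      _ = _ := by rw [← hT4]; ring
  linarith

end Tail

/-! ### Congruence densities -/

section Density

variable {ι : Type*} [Fintype ι]

/-- `Q` is determined modulo `m` and holds for a proportion `δ` of the residue classes. -/
def HasDensity (m : ℕ) (Q : (ι → ℤ) → Prop) (δ : ℝ) : Prop :=
  0 < m ∧ ∃ P : Set (ι → ZMod m), (∀ f, Q f ↔ (fun i => (f i : ZMod m)) ∈ P) ∧
    (P.ncard : ℝ) = δ * (m : ℝ) ^ Fintype.card ι

lemma HasDensity.congr {m : ℕ} {Q Q' : (ι → ℤ) → Prop} {δ : ℝ} (h : HasDensity m Q δ)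
    (hQ : ∀ f, Q' f ↔ Q f) : HasDensity m Q' δ := by
  obtain ⟨h0, P, h1, h2⟩ := h
  exact ⟨h0, P, fun f => (hQ f).trans (h1 f), h2⟩

lemma card_zmod_pi {m : ℕ} (hm : 0 < m) :
    (Nat.card (ι → ZMod m) : ℝ) = (m : ℝ) ^ Fintype.card ι := by
  have : NeZero m := ⟨hm.ne'⟩
  classical
  rw [Nat.card_eq_fintype_card, Fintype.card_fun, ZMod.card]
  push_cast
  rfl

lemma HasDensity.not {m : ℕ} {Q : (ι → ℤ) → Prop} {δ : ℝ} (h : HasDensity m Q δ) :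
    HasDensity m (fun f => ¬ Q f) (1 - δ) := by
  obtain ⟨h0, P, h1, h2⟩ := h
  have : NeZero m := ⟨h0.ne'⟩
  refine ⟨h0, Pᶜ, fun f => not_congr (h1 f), ?_⟩
  have := Set.ncard_add_ncard_compl P
  have h3 : (P.ncard : ℝ) + (Pᶜ.ncard : ℝ) = Nat.card (ι → ZMod m) := by exact_mod_cast this
  rw [card_zmod_pi h0] at h3
  linarith

lemma HasDensity.or {m : ℕ} {Q Q' : (ι → ℤ) → Prop} {δ δ' : ℝ} (h : HasDensity m Q δ)
    (h' : HasDensity m Q' δ') (hd : ∀ f, Q f → ¬ Q' f) :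
    HasDensity m (fun f => Q f ∨ Q' f) (δ + δ') := by
  obtain ⟨h0, P, h1, h2⟩ := h
  obtain ⟨-, P', h1', h2'⟩ := h'
  have : NeZero m := ⟨h0.ne'⟩
  refine ⟨h0, P ∪ P', fun f => or_congr (h1 f) (h1' f), ?_⟩
  rw [Set.ncard_union_eq, Nat.cast_add, h2, h2', add_mul]
  rw [Set.disjoint_left]
  intro x hx hx'
  have e : (fun i => (((x i).cast : ℤ) : ZMod m)) = x := funext fun i => ZMod.intCast_zmod_cast _
  refine hd (fun i => (x i).cast) ?_ ?_
  · rw [h1, e]; exact hx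
  · rw [h1', e]; exact hx'

lemma ncard_preimage_mul_card {G H : Type*} [AddGroup G] [AddGroup H] [Finite G] [Finite H]
    (φ : G →+ H) (hφ : Function.Surjective φ) (P : Set H) :
    (φ ⁻¹' P).ncard * Nat.card H = P.ncard * Nat.card G := by
  classical
  have := Fintype.ofFinite G
  have := Fintype.ofFinite H
  set c := (Finset.univ.filter fun g : G => φ g = 0).card with hc
  have key : ∀ P : Set H, (φ ⁻¹' P).ncard = P.ncard * c := by
    intro P
    rw [Set.ncard_eq_toFinset_card' P, Set.ncard_eq_toFinset_card' (φ ⁻¹' P),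
      Finset.card_eq_sum_card_fiberwise (f := φ) (t := P.toFinset)]
    · rw [Finset.sum_const_nat]
      intro h hh
      obtain ⟨g, rfl⟩ := hφ h
      rw [hc]
      refine Finset.card_bij' (fun x _ => x - g) (fun x _ => x + g) ?_ ?_ ?_ ?_
      · intro x hx
        simp only [Finset.mem_filter] at hx ⊢
        simp [hx.2]
      · intro x hx
        simp only [Finset.mem_filter, Set.mem_toFinset, Set.mem_preimage] at hx hh ⊢
        simp [hx.2, hh]
      · intros; simp
      · intros; simp
    · intro x hx
      simpa using hx
  have h1 := key Set.univ
  rw [Set.preimage_univ, Set.ncard_univ, Set.ncard_univ] at h1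
  rw [key, h1]; ring

lemma HasDensity.mul_modulus {m : ℕ} {Q : (ι → ℤ) → Prop} {δ : ℝ} (h : HasDensity m Q δ) {k : ℕ}
    (hk : 0 < k) : HasDensity (m * k) Q δ := by
  obtain ⟨h0, P, h1, h2⟩ := h
  have : NeZero m := ⟨h0.ne'⟩
  have hmk : 0 < m * k := Nat.mul_pos h0 hk
  have : NeZero (m * k) := ⟨hmk.ne'⟩
  set φ : (ι → ZMod (m * k)) →+ (ι → ZMod m) :=
    ((ZMod.castHom (Dvd.intro k rfl) (ZMod m)).toAddMonoidHom.compLeft ι) with hφ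
  have hs : Function.Surjective φ := by
    intro y
    choose x hx using fun i => ZMod.castHom_surjective (Dvd.intro k rfl : m ∣ m * k) (y i)
    exact ⟨x, funext hx⟩
  refine ⟨hmk, φ ⁻¹' P, fun f => ?_, ?_⟩
  · rw [h1, Set.mem_preimage]
    have : φ (fun i => (f i : ZMod (m * k))) = fun i => (f i : ZMod m) := by
      funext i
      exact map_intCast (ZMod.castHom (Dvd.intro k rfl) (ZMod m)) (f i)
    rw [this]
  · have h3 := ncard_preimage_mul_card φ hs P
    have h4 : ((φ ⁻¹' P).ncard : ℝ) * Nat.card (ι → ZMod m) =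
      P.ncard * Nat.card (ι → ZMod (m * k)) := by exact_mod_cast h3
    rw [card_zmod_pi h0, card_zmod_pi hmk, h2] at h4
    have : (m : ℝ) ^ Fintype.card ι ≠ 0 := by positivity
    apply mul_right_cancel₀ this
    linarith

lemma HasDensity.and {m m' : ℕ} {Q Q' : (ι → ℤ) → Prop} {δ δ' : ℝ} (h : HasDensity m Q δ)
    (h' : HasDensity m' Q' δ') (hc : m.Coprime m') :
    HasDensity (m * m') (fun f => Q f ∧ Q' f) (δ * δ') := by
  obtain ⟨h0, P, h1, h2⟩ := h
  obtain ⟨h0', P', h1', h2'⟩ := h'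
  have hmk : 0 < m * m' := Nat.mul_pos h0 h0'
  set e : (ι → ZMod (m * m')) ≃ (ι → ZMod m) × (ι → ZMod m') :=
    ((Equiv.refl ι).arrowCongr (ZMod.chineseRemainder hc).toEquiv).trans
      (Equiv.arrowProdEquivProdArrow ι _ _) with he
  refine ⟨hmk, e ⁻¹' (P ×ˢ P'), fun f => ?_, ?_⟩
  · beta_reduce
    rw [Set.mem_preimage, h1, h1', Set.mem_prod]
    have e1 : e (fun i => (f i : ZMod (m * m'))) =
        (fun i => (f i : ZMod m), fun i => (f i : ZMod m')) := by
      have : ∀ i, ZMod.chineseRemainder hc (f i : ZMod (m * m')) =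
        ((f i : ZMod m), (f i : ZMod m')) := fun i => by
          rw [map_intCast]; rfl
      refine Prod.ext (funext fun i => ?_) (funext fun i => ?_)
      · exact congrArg Prod.fst (this i)
      · exact congrArg Prod.snd (this i)
    rw [e1]
  · rw [Set.ncard_preimage_of_injective_subset_range e.injective (by simp), Set.ncard_prod]
    push_cast
    rw [h2, h2']
    ring

lemma HasDensity.true : HasDensity 1 (fun _ : ι → ℤ => True) 1 := by
  refine ⟨one_pos, Set.univ, fun f => by simp, ?_⟩
  rw [Set.ncard_univ, card_zmod_pi one_pos, one_mul]

lemma HasDensity.prod (T : Finset ℕ) (m : ℕ → ℕ) (hm : ∀ p ∈ T, ∀ q ∈ T, p ≠ q → (m p).Coprime (m q))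
    {Q : ℕ → (ι → ℤ) → Prop} {δ : ℕ → ℝ} (h : ∀ p ∈ T, HasDensity (m p) (Q p) (δ p)) :
    HasDensity (∏ p ∈ T, m p) (fun f => ∀ p ∈ T, Q p f) (∏ p ∈ T, δ p) := by
  classical
  induction T using Finset.induction_on with
  | empty => exact HasDensity.true.congr fun f => by simp
  | insert p T hp ih =>
    rw [Finset.prod_insert hp, Finset.prod_insert hp]
    refine ((h p (Finset.mem_insert_self _ _)).and (ih (fun q hq r hr => hm q
      (Finset.mem_insert_of_mem hq) r (Finset.mem_insert_of_mem hr))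
      fun q hq => h q (Finset.mem_insert_of_mem hq)) ?_).congr fun f => by simp
    refine Nat.Coprime.prod_right fun q hq => ?_
    exact hm p (Finset.mem_insert_self _ _) q (Finset.mem_insert_of_mem hq)
      (by rintro rfl; exact hp hq)

/-- Hensel lifting: a nondegenerate zero modulo `p` lifts to a proportion `1 / p` of zeros modulo
`p²`. -/
lemma HasDensity.lift {p : ℕ} (hp : p.Prime) {G D : (ι → ℤ) → ℤ} {Q : (ι → ℤ) → Prop} (v : ι → ℤ)
    (hG : ∀ f s, s ^ 2 ∣ G (fun i => f i + s * v i) - G f - s * D f)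
    (hGp : ∀ (m : ℕ) (f g : ι → ℤ), (∀ i, f i ≡ g i [ZMOD m]) → G f ≡ G g [ZMOD m])
    (hD : ∀ f, (p : ℤ) ∣ G f → Q f → ¬ (p : ℤ) ∣ D f) {δ : ℝ}
    (hQ : ∀ f g : ι → ℤ, (∀ i, f i ≡ g i [ZMOD p]) → (Q f ↔ Q g))
    (hA : HasDensity p (fun f => (p : ℤ) ∣ G f ∧ Q f) δ) :
    HasDensity (p * p) (fun f => ((p : ℤ) ^ 2 ∣ G f) ∧ Q f) (δ / p) := by
  classical
  obtain ⟨hpp, P, hP, hPc⟩ := hA.mul_modulus hp.pos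
  have : NeZero (p * p) := ⟨hpp.ne'⟩
  have : NeZero p := ⟨hp.ne_zero⟩
  set L : (ι → ZMod (p * p)) → ι → ℤ := fun x i => ((x i).cast : ℤ) with hL
  have hLc : ∀ x i, ((L x i : ℤ) : ZMod (p * p)) = x i := fun x i => ZMod.intCast_zmod_cast _
  have hmod : ∀ f g : ι → ℤ, (∀ i, (f i : ZMod (p * p)) = g i) →
      ((p : ℤ) ∣ G f ↔ (p : ℤ) ∣ G g) ∧ ((p : ℤ) ^ 2 ∣ G f ↔ (p : ℤ) ^ 2 ∣ G g) ∧ (Q f ↔ Q g) := by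
    intro f g h
    have h1 : ∀ i, f i ≡ g i [ZMOD ((p * p : ℕ) : ℤ)] := fun i =>
      (ZMod.intCast_eq_intCast_iff _ _ _).mp (h i)
    have h2 := hGp _ f g h1
    have h3 : G f ≡ G g [ZMOD p] := h2.of_mul_right p |> fun h => by simpa using h
    have h4 : ∀ i, f i ≡ g i [ZMOD p] := fun i => by
      have := h1 i
      push_cast at this
      exact this.of_mul_right _
    refine ⟨?_, ?_, ?_⟩
    · exact h3.dvd_iff
    · push_cast at h2; rw [← pow_two] at h2
      exact h2.dvd_iff
    · exact hQ f g h4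
  set N : Set (ι → ZMod (p * p)) := {x | ((p : ℤ) ^ 2 ∣ G (L x)) ∧ Q (L x)} with hN
  refine ⟨hpp, N, fun f => ?_, ?_⟩
  · obtain ⟨-, h2, h3⟩ := hmod f (L fun i => (f i : ZMod (p * p))) fun i => (hLc (fun i => (f i : ZMod (p * p))) i).symm
    beta_reduce
    rw [hN, Set.mem_ofPred_eq, h2, h3]
  · have hPm : ∀ x, x ∈ P ↔ (p : ℤ) ∣ G (L x) ∧ Q (L x) := fun x => by
      have := hP (L x)
      simp only [hLc] at this
      exact this.symm
    have hE : ∀ (x : ι → ZMod (p * p)) (t : ZMod p),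
        (fun i => x i + ((p * (t.cast : ℤ) * v i : ℤ) : ZMod (p * p))) ∈ N ↔
        x ∈ P ∧ (p : ℤ) ^ 2 ∣ G (L x) + p * t.cast * D (L x) := by
      intro x t
      set s : ℤ := p * (t.cast : ℤ) with hs
      obtain ⟨-, h2, h3⟩ := hmod (L fun i => x i + ((s * v i : ℤ) : ZMod (p * p)))
        (fun i => L x i + s * v i) fun i => by
          rw [hLc (fun i => x i + ((s * v i : ℤ) : ZMod (p * p)))]; push_cast; rw [hLc]
      rw [hN, Set.mem_ofPred_eq, h2, h3, hPm]
      have h4 : Q (fun i => L x i + s * v i) ↔ Q (L x) := by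
        refine hQ _ _ fun i => Int.modEq_iff_dvd.mpr ⟨-(t.cast * v i), ?_⟩
        rw [hs]; ring
      have h5 : (p : ℤ) ^ 2 ∣ G (fun i => L x i + s * v i) ↔
          (p : ℤ) ^ 2 ∣ G (L x) + s * D (L x) := by
        have h6 := (pow_dvd_pow_of_dvd (Dvd.intro _ hs.symm : (p : ℤ) ∣ s) 2).trans (hG (L x) s)
        have h7 := dvd_sub_comm.mp (show (p : ℤ) ^ 2 ∣ G (fun i => L x i + s * v i) -
          (G (L x) + s * D (L x)) by rwa [sub_add_eq_sub_sub])
        constructor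
        · intro h; simpa using dvd_add h h7
        · intro h; have := dvd_sub h h7; simpa using this
      rw [h4, h5]
      constructor
      · rintro ⟨h, h'⟩
        refine ⟨⟨?_, h'⟩, h⟩
        have h8 : (p : ℤ) ∣ G (L x) + s * D (L x) := (dvd_pow_self _ two_ne_zero).trans h
        exact (dvd_add_left (Dvd.dvd.mul_right (Dvd.intro _ hs.symm) _)).mp h8
      · rintro ⟨⟨-, h'⟩, h⟩
        exact ⟨h, h'⟩
    have hone : ∀ x ∈ P, (Finset.univ.filter fun t : ZMod p =>
        (fun i => x i + ((p * (t.cast : ℤ) * v i : ℤ) : ZMod (p * p))) ∈ N).card = 1 := by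
      intro x hx
      obtain ⟨⟨k, hk⟩, hq⟩ := (hPm x).mp hx
      have hd := hD (L x) ⟨k, hk⟩ hq
      have : Fact p.Prime := ⟨hp⟩
      have hd' : (D (L x) : ZMod p) ≠ 0 := fun h => hd ((ZMod.intCast_zmod_eq_zero_iff_dvd _ _).mp h)
      rw [Finset.card_eq_one]
      refine ⟨-k / D (L x), ?_⟩
      ext t
      simp only [Finset.mem_filter, Finset.mem_univ, true_and, Finset.mem_singleton]
      rw [hE, hk, show (p : ℤ) * k + p * t.cast * D (L x) = p * (k + t.cast * D (L x)) by ring, pow_two,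
        mul_dvd_mul_iff_left (by exact_mod_cast hp.ne_zero), ← ZMod.intCast_zmod_eq_zero_iff_dvd]
      push_cast
      rw [eq_div_iff hd']
      constructor
      · rintro ⟨-, h⟩; linear_combination h
      · intro h; exact ⟨hx, by linear_combination h⟩
    have hcount := Finset.sum_card_bipartiteAbove_eq_sum_card_bipartiteBelow
      (s := P.toFinset) (t := (Finset.univ : Finset (ZMod p)))
      (fun x t => (fun i => x i + ((p * (t.cast : ℤ) * v i : ℤ) : ZMod (p * p))) ∈ N)
    have h1 : ∑ x ∈ P.toFinset, (Finset.bipartiteAbove (fun x (t : ZMod p) =>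
        (fun i => x i + ((p * (t.cast : ℤ) * v i : ℤ) : ZMod (p * p))) ∈ N) Finset.univ x).card =
        P.ncard := by
      rw [Set.ncard_eq_toFinset_card', Finset.card_eq_sum_ones]
      refine Finset.sum_congr rfl fun x hx => ?_
      exact hone x (by simpa using hx)
    have h2 : ∀ t : ZMod p, (Finset.bipartiteBelow (fun x (t : ZMod p) =>
        (fun i => x i + ((p * (t.cast : ℤ) * v i : ℤ) : ZMod (p * p))) ∈ N) P.toFinset t).card =
        N.ncard := by
      intro t
      rw [Set.ncard_eq_toFinset_card']
      refine Finset.card_bij'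
        (fun x _ i => x i + ((p * (t.cast : ℤ) * v i : ℤ) : ZMod (p * p)))
        (fun x _ i => x i - ((p * (t.cast : ℤ) * v i : ℤ) : ZMod (p * p))) ?_ ?_ ?_ ?_
      · intro x hx
        simpa [Finset.bipartiteBelow] using (Finset.mem_filter.mp hx).2
      · intro x hx
        have hx' : x ∈ N := by simpa using hx
        have e : (fun i => (x i - ((p * (t.cast : ℤ) * v i : ℤ) : ZMod (p * p))) +
          ((p * (t.cast : ℤ) * v i : ℤ) : ZMod (p * p))) = x := by simp
        have h3 := (hE (fun i => x i - ((p * (t.cast : ℤ) * v i : ℤ) : ZMod (p * p))) t).mp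
          (by rw [e]; exact hx')
        refine Finset.mem_filter.mpr ⟨by simpa using h3.1, ?_⟩
        beta_reduce
        rw [e]; exact hx'
      · intros; simp
      · intros; simp
    rw [h1, Finset.sum_congr rfl fun t _ => h2 t, Finset.sum_const, Finset.card_univ, ZMod.card,
      smul_eq_mul] at hcount
    have h3 : (P.ncard : ℝ) = p * N.ncard := by exact_mod_cast hcount
    have : (p : ℝ) ≠ 0 := by exact_mod_cast hp.ne_zero
    rw [h3] at hPc
    field_simp
    linarith

end Density

/-! ### Counting cubic forms over a finite field -/

section FieldCount

variable {F : Type*} [Field F]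

/-- The middle covariant of the form at `(1, 0)`. -/
def cov {R : Type*} [CommRing R] (f : Fin 4 → R) : R := 2 * hA f * f 1 - f 0 * hB f

/-- The form with leading coefficients `a, b`, first Hessian coefficient `A` and covariant `w`. -/
def formOf (x : F × F × F × F) : Fin 4 → F :=
  ![x.1, x.2.1, (x.2.1 ^ 2 - x.2.2.1) / x.1,
    (x.2.1 * ((x.2.1 ^ 2 - x.2.2.1) / x.1) - (2 * x.2.2.1 * x.2.1 - x.2.2.2) / x.1) / x.1]

lemma hA_formOf {x : F × F × F × F} (hx : x.1 ≠ 0) : hA (formOf x) = x.2.2.1 := by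
  simp [formOf, hA]
  field_simp
  ring

lemma cov_formOf {x : F × F × F × F} (hx : x.1 ≠ 0) : cov (formOf x) = x.2.2.2 := by
  rw [cov, hA_formOf hx]
  simp [formOf, hB]
  field_simp
  ring

lemma formOf_surj {f : Fin 4 → F} (hf : f 0 ≠ 0) : formOf (f 0, f 1, hA f, cov f) = f := by
  ext i
  fin_cases i
  · simp [formOf]
  · simp [formOf]
  · simp only [formOf, hA]
    simp
    field_simp
  · simp only [formOf, hA, cov, hB]
    simp
    field_simp
    ring

lemma ncard_compl_zero [Finite F] : ((({0} : Set F)ᶜ).ncard : ℝ) = Nat.card F - 1 := by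
  have h := Set.ncard_add_ncard_compl ({0} : Set F)
  rw [Set.ncard_singleton] at h
  have : (1 : ℝ) + (({0} : Set F)ᶜ).ncard = Nat.card F := by exact_mod_cast h
  linarith

lemma ncard_lead_ne [Finite F] (T : Set (F × F)) :
    ({f : Fin 4 → F | f 0 ≠ 0 ∧ (hA f, cov f) ∈ T}.ncard : ℝ) =
      (Nat.card F - 1) * (Nat.card F * T.ncard) := by
  have e : {f : Fin 4 → F | f 0 ≠ 0 ∧ (hA f, cov f) ∈ T} =
      formOf '' (({0} : Set F)ᶜ ×ˢ (Set.univ : Set F) ×ˢ T) := by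
    ext f
    simp only [Set.mem_ofPred_eq, Set.mem_image, Set.mem_prod, Set.mem_compl_iff,
      Set.mem_singleton_iff, Set.mem_univ, true_and]
    constructor
    · rintro ⟨h, h'⟩
      exact ⟨_, ⟨h, h'⟩, formOf_surj h⟩
    · rintro ⟨x, ⟨h, h'⟩, rfl⟩
      refine ⟨by simpa [formOf] using h, ?_⟩
      rw [hA_formOf h, cov_formOf h]
      exact h'
  rw [e, Set.InjOn.ncard_image, Set.ncard_prod, Set.ncard_prod, Set.ncard_univ]
  · push_cast
    rw [ncard_compl_zero]
  · rintro x ⟨hx, -⟩ y ⟨hy, -⟩ h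
    have h1 := congrFun h 0
    have h2 := congrFun h 1
    have h3 := hA_formOf hx
    have h4 := cov_formOf hx
    rw [h] at h3 h4
    rw [hA_formOf hy] at h3
    rw [cov_formOf hy] at h4
    simp only [formOf, Matrix.cons_val_zero, Matrix.cons_val_one] at h1 h2
    exact Prod.ext h1 (Prod.ext h2 (Prod.ext h3.symm h4.symm))

/-- The forms with vanishing leading coefficient. -/
lemma ncard_lead_eq [Finite F] (T : Set (F × F × F)) :
    {f : Fin 4 → F | f 0 = 0 ∧ (f 1, f 2, f 3) ∈ T}.ncard = T.ncard := by
  have e : {f : Fin 4 → F | f 0 = 0 ∧ (f 1, f 2, f 3) ∈ T} =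
      (fun x : F × F × F => (![0, x.1, x.2.1, x.2.2] : Fin 4 → F)) '' T := by
    ext f
    simp only [Set.mem_ofPred_eq, Set.mem_image]
    constructor
    · rintro ⟨h, h'⟩
      refine ⟨_, h', ?_⟩
      ext i
      fin_cases i <;> simp [h]
    · rintro ⟨x, h', rfl⟩
      exact ⟨by simp, by simpa using h'⟩
  rw [e, Set.ncard_image_of_injective]
  intro x y h
  have h1 := congrFun h 1
  have h2 := congrFun h 2
  have h3 := congrFun h 3
  simp at h1 h2 h3
  exact Prod.ext h1 (Prod.ext h2 h3)

lemma hess_zero_iff {f : Fin 4 → F} (hf : f 0 ≠ 0) :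
    (hA f = 0 ∧ hB f = 0 ∧ hC f = 0) ↔ (hA f, cov f) ∈ ({(0, 0)} : Set (F × F)) := by
  rw [Set.mem_singleton_iff, Prod.mk.injEq, cov]
  constructor
  · rintro ⟨h1, h2, -⟩
    simp [h1, h2]
  · rintro ⟨h1, h2⟩
    have h3 : hB f = 0 := by simpa [h1, hf] using h2
    have h4 := syzygy_left f
    rw [h1, h3] at h4
    exact ⟨h1, h3, by simpa [hf] using h4⟩

lemma hess_zero_iff' {f : Fin 4 → F} (hf : f 0 = 0) :
    (hA f = 0 ∧ hB f = 0 ∧ hC f = 0) ↔ f 1 = 0 ∧ f 2 = 0 := by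
  simp only [hA, hB, hC, hf]
  constructor
  · rintro ⟨h1, -, h3⟩
    have h : f 1 = 0 := by simpa using h1
    exact ⟨h, by simpa [h] using h3⟩
  · rintro ⟨h1, h2⟩
    simp [h1, h2]

lemma ncard_hess_zero_ne [Finite F] :
    ({f : Fin 4 → F | f 0 ≠ 0 ∧ hA f = 0 ∧ hB f = 0 ∧ hC f = 0}.ncard : ℝ) =
      (Nat.card F - 1) * Nat.card F := by
  have e : {f : Fin 4 → F | f 0 ≠ 0 ∧ hA f = 0 ∧ hB f = 0 ∧ hC f = 0} =
      {f | f 0 ≠ 0 ∧ (hA f, cov f) ∈ ({(0, 0)} : Set (F × F))} := by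
    ext f
    exact and_congr_right hess_zero_iff
  rw [e, ncard_lead_ne, Set.ncard_singleton]
  simp

lemma ncard_hess_zero_eq [Finite F] :
    ({f : Fin 4 → F | (f 0 = 0 ∧ f 3 ≠ 0) ∧ hA f = 0 ∧ hB f = 0 ∧ hC f = 0}.ncard : ℝ) =
      Nat.card F - 1 := by
  have e : {f : Fin 4 → F | (f 0 = 0 ∧ f 3 ≠ 0) ∧ hA f = 0 ∧ hB f = 0 ∧ hC f = 0} =
      {f | f 0 = 0 ∧ (f 1, f 2, f 3) ∈ ({0} : Set F) ×ˢ ({0} : Set F) ×ˢ ({0} : Set F)ᶜ} := by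
    ext f
    simp only [Set.mem_ofPred_eq, Set.mem_prod, Set.mem_singleton_iff, Set.mem_compl_iff]
    constructor
    · rintro ⟨⟨h, h'⟩, h''⟩
      have := (hess_zero_iff' h).mp h''
      exact ⟨h, this.1, this.2, h'⟩
    · rintro ⟨h, h1, h2, h3⟩
      exact ⟨⟨h, h3⟩, (hess_zero_iff' h).mpr ⟨h1, h2⟩⟩
  rw [e, ncard_lead_eq, Set.ncard_prod, Set.ncard_prod]
  push_cast
  rw [ncard_compl_zero]
  simp

lemma disc_lead_ne {f : Fin 4 → F} : disc f * f 0 ^ 2 = cov f ^ 2 - 4 * hA f ^ 3 := by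
  rw [cov, ← syzygy_cubic f]; ring

lemma disc_lead_eq {f : Fin 4 → F} (hf : f 0 = 0) :
    disc f = f 1 ^ 2 * (4 * f 1 * f 3 - 3 * f 2 ^ 2) := by
  simp only [disc, hA, hB, hC, hf]; ring

lemma ncard_cusp_ne [Finite F] (h2 : (2 : F) ≠ 0) :
    ({x : F × F | x.1 ≠ 0 ∧ x.2 ^ 2 = 4 * x.1 ^ 3}.ncard : ℝ) = Nat.card F - 1 := by
  have e : {x : F × F | x.1 ≠ 0 ∧ x.2 ^ 2 = 4 * x.1 ^ 3} =
      (fun t : F => (t ^ 2, 2 * t ^ 3)) '' ({0} : Set F)ᶜ := by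
    ext ⟨A, w⟩
    simp only [Set.mem_ofPred_eq, Set.mem_image, Set.mem_compl_iff, Set.mem_singleton_iff,
      Prod.mk.injEq]
    constructor
    · rintro ⟨h, h'⟩
      have hw : w ≠ 0 := by
        rintro rfl
        have : (2 : F) * 2 * A ^ 3 = 0 := by linear_combination -h'
        simp [h2, h] at this
      refine ⟨w / (2 * A), by simp [h2, h, hw], ?_, ?_⟩
      · field_simp; linear_combination h'
      · field_simp; linear_combination h'
    · rintro ⟨t, ht, rfl, rfl⟩
      exact ⟨pow_ne_zero 2 ht, by ring⟩
  rw [e, Set.InjOn.ncard_image, ncard_compl_zero]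
  intro s hs t ht h
  simp only [Prod.mk.injEq] at h
  obtain ⟨h, h'⟩ := h
  have h3 : s ^ 3 = t ^ 3 := mul_left_cancel₀ h2 h'
  have hs2 : s ^ 2 ≠ 0 := pow_ne_zero 2 hs
  apply mul_left_cancel₀ hs2
  linear_combination h3 - t * h

lemma ncard_disc_zero [Finite F] (h2 : (2 : F) ≠ 0) :
    ({f : Fin 4 → F | disc f = 0 ∧ hA f ≠ 0}.ncard : ℝ) = Nat.card F ^ 2 * (Nat.card F - 1) := by
  have e : {f : Fin 4 → F | disc f = 0 ∧ hA f ≠ 0} =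
      {f | f 0 ≠ 0 ∧ (hA f, cov f) ∈ {x : F × F | x.1 ≠ 0 ∧ x.2 ^ 2 = 4 * x.1 ^ 3}} ∪
      {f | f 0 = 0 ∧ (f 1, f 2, f 3) ∈ (fun x : F × F => (x.1, x.2, 3 * x.2 ^ 2 / (4 * x.1))) ''
        (({0} : Set F)ᶜ ×ˢ (Set.univ : Set F))} := by
    have h4 : (4 : F) ≠ 0 := by
      rw [show (4 : F) = 2 * 2 by norm_num]; exact mul_ne_zero h2 h2
    ext f
    simp only [Set.mem_ofPred_eq, Set.mem_union, Set.mem_image, Set.mem_prod, Set.mem_compl_iff,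
      Set.mem_singleton_iff, Set.mem_univ, and_true, Prod.exists, Prod.mk.injEq]
    by_cases hf : f 0 = 0
    · have hA' : hA f = f 1 ^ 2 := by simp [hA, hf]
      simp only [hf, ne_eq, not_true_eq_false, false_and, true_and, false_or, hA', disc_lead_eq hf]
      constructor
      · rintro ⟨h, h'⟩
        refine ⟨f 1, f 2, fun h0 => h' (by simp [h0]), rfl, rfl, ?_⟩
        have h1 : f 1 ≠ 0 := fun h0 => h' (by simp [h0])
        rw [mul_eq_zero, or_iff_right h'] at h
        field_simp
        linear_combination -h
      · rintro ⟨b, c, hb, rfl, rfl, h⟩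
        rw [← h]
        refine ⟨?_, pow_ne_zero 2 hb⟩
        field_simp
        ring
    · simp only [hf, ne_eq, not_false_eq_true, true_and, false_and, or_false]
      have := disc_lead_ne (f := f)
      constructor
      · rintro ⟨h, h'⟩
        refine ⟨h', ?_⟩
        rw [h] at this
        linear_combination -this
      · rintro ⟨h, h'⟩
        refine ⟨?_, h⟩
        rw [h', sub_self, mul_eq_zero] at this
        exact this.resolve_right (pow_ne_zero 2 hf)
  rw [e, Set.ncard_union_eq, Nat.cast_add, ncard_lead_ne, ncard_lead_eq, ncard_cusp_ne h2,
    Set.ncard_image_of_injective, Set.ncard_prod, Set.ncard_univ]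
  · push_cast
    rw [ncard_compl_zero]
    ring
  · rintro ⟨x, y⟩ ⟨x', y'⟩ h
    simp only [Prod.mk.injEq] at h
    exact Prod.ext h.1 h.2.1
  · rw [Set.disjoint_left]
    rintro f ⟨h, -⟩ ⟨h', -⟩
    exact h h'

lemma ncard_disc_zero' [Finite F] :
    ({f : Fin 4 → F | disc f = 0 ∧ hA f = 0 ∧ hC f ≠ 0}.ncard : ℝ) =
      Nat.card F * (Nat.card F - 1) := by
  have e : {f : Fin 4 → F | disc f = 0 ∧ hA f = 0 ∧ hC f ≠ 0} =
      {f | f 0 = 0 ∧ (f 1, f 2, f 3) ∈ ({0} : Set F) ×ˢ (({0} : Set F)ᶜ ×ˢ (Set.univ : Set F))} := by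
    ext f
    simp only [Set.mem_ofPred_eq, Set.mem_prod, Set.mem_singleton_iff, Set.mem_compl_iff,
      Set.mem_univ, and_true]
    constructor
    · rintro ⟨h, h1, h3⟩
      have hB0 : hB f = 0 := by simpa [disc, h1] using h
      have h4 := syzygy_left f
      have h5 := syzygy_right f
      rw [h1, hB0] at h4 h5
      have h6 : f 0 = 0 := by simpa [h3] using h4
      have h7 : f 1 = 0 := by simpa [h3] using h5
      exact ⟨h6, h7, fun h8 => h3 (by simp [hC, h7, h8])⟩
    · rintro ⟨h0, h1, h2⟩
      refine ⟨by simp [disc, hA, hB, h0, h1], by simp [hA, h0, h1], ?_⟩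
      simpa [hC, h1] using h2
  rw [e, ncard_lead_eq, Set.ncard_prod, Set.ncard_prod, Set.ncard_univ]
  push_cast
  rw [ncard_compl_zero]
  simp [mul_comm]

/-- Counting nonzero square values of a function. -/
lemma two_mul_ncard_sq [Finite F] {α : Type*} [Finite α] (h2 : (2 : F) ≠ 0) (g : α → F) :
    2 * {x | ∃ e, e ≠ 0 ∧ g x = e ^ 2}.ncard = {y : α × F | y.2 ≠ 0 ∧ g y.1 = y.2 ^ 2}.ncard := by
  classical
  have := Fintype.ofFinite F
  have := Fintype.ofFinite α
  rw [Set.ncard_eq_toFinset_card', Set.ncard_eq_toFinset_card',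
    Finset.card_eq_sum_card_fiberwise (f := Prod.fst)
      (t := {x | ∃ e, e ≠ 0 ∧ g x = e ^ 2}.toFinset), mul_comm, Finset.sum_const_nat]
  · intro x hx
    simp only [Set.mem_toFinset, Set.mem_ofPred_eq] at hx
    obtain ⟨e, he, hxe⟩ := hx
    have : (Finset.filter (fun y : α × F => y.1 = x)
        {y : α × F | y.2 ≠ 0 ∧ g y.1 = y.2 ^ 2}.toFinset) = {(x, e), (x, -e)} := by
      ext ⟨y, e'⟩
      simp only [Finset.mem_filter, Set.mem_toFinset, Set.mem_ofPred_eq, Finset.mem_insert,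
        Finset.mem_singleton, Prod.mk.injEq]
      constructor
      · rintro ⟨⟨h, h'⟩, rfl⟩
        rw [hxe] at h'
        rcases sq_eq_sq_iff_eq_or_eq_neg.mp h' with h3 | h3
        · exact Or.inl ⟨rfl, h3.symm⟩
        · exact Or.inr ⟨rfl, by rw [h3, neg_neg]⟩
      · rintro (⟨rfl, rfl⟩ | ⟨rfl, rfl⟩)
        · exact ⟨⟨he, hxe⟩, rfl⟩
        · exact ⟨⟨neg_ne_zero.mpr he, by rw [hxe]; ring⟩, rfl⟩
    rw [this, Finset.card_pair]
    intro h
    have h3 : e = -e := (Prod.mk.inj h).2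
    have h4 : 2 * e = 0 := by linear_combination h3
    simp [h2, he] at h4
  · rintro ⟨y, e⟩ hy
    simp only [Set.coe_toFinset, Set.mem_ofPred_eq] at hy ⊢
    exact ⟨e, hy⟩

lemma two_mul_ncard_nonzero_sq [Finite F] (h2 : (2 : F) ≠ 0) :
    2 * ({x : F | ∃ e, e ≠ 0 ∧ x = e ^ 2}.ncard : ℝ) = Nat.card F - 1 := by
  have h := two_mul_ncard_sq h2 (id : F → F)
  have e : {y : F × F | y.2 ≠ 0 ∧ id y.1 = y.2 ^ 2} = (fun t : F => (t ^ 2, t)) '' ({0} : Set F)ᶜ := by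
    ext ⟨x, t⟩
    simp only [Set.mem_ofPred_eq, Set.mem_image, Set.mem_compl_iff, Set.mem_singleton_iff,
      Prod.mk.injEq, id]
    constructor
    · rintro ⟨h, rfl⟩; exact ⟨t, h, rfl, rfl⟩
    · rintro ⟨t, h, rfl, rfl⟩; exact ⟨h, rfl⟩
  rw [e, Set.ncard_image_of_injective _ fun s t h => (Prod.mk.inj h).2] at h
  rw [← ncard_compl_zero, ← h]
  push_cast
  rfl

lemma two_mul_ncard_cusp_sq [Finite F] (h2 : (2 : F) ≠ 0) :
    2 * ({x : F × F | ∃ e, e ≠ 0 ∧ x.2 ^ 2 - 4 * x.1 ^ 3 = e ^ 2}.ncard : ℝ) =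
      Nat.card F * (Nat.card F - 1) := by
  have h := two_mul_ncard_sq h2 (fun x : F × F => x.2 ^ 2 - 4 * x.1 ^ 3)
  set E := {y : (F × F) × F | y.1.2 ^ 2 - 4 * y.1.1 ^ 3 = y.2 ^ 2} with hE
  set E0 := {y : (F × F) × F | y.2 = 0 ∧ y.1.2 ^ 2 - 4 * y.1.1 ^ 3 = y.2 ^ 2} with hE0
  set E1 := {y : (F × F) × F | y.2 ≠ 0 ∧ y.1.2 ^ 2 - 4 * y.1.1 ^ 3 = y.2 ^ 2} with hE1
  have h4 : (4 : F) ≠ 0 := by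
    rw [show (4 : F) = 2 * 2 by norm_num]; exact mul_ne_zero h2 h2
  have k1 : E.ncard = E0.ncard + E1.ncard := by
    rw [← Set.ncard_union_eq]
    · congr 1
      ext y
      simp only [hE, hE0, hE1, Set.mem_union, Set.mem_ofPred_eq]
      tauto
    · rw [Set.disjoint_left]; rintro y ⟨h, -⟩ ⟨h', -⟩; exact h' h
  have k0 : (E0.ncard : ℝ) = Nat.card F := by
    have e : E0 = insert ((0, 0), 0) ((fun x : F × F => (x, (0 : F))) ''
        {x : F × F | x.1 ≠ 0 ∧ x.2 ^ 2 = 4 * x.1 ^ 3}) := by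
      ext ⟨⟨A, w⟩, e⟩
      simp only [hE0, Set.mem_ofPred_eq, Set.mem_insert_iff, Set.mem_image, Prod.mk.injEq,
        Prod.exists]
      constructor
      · rintro ⟨rfl, h⟩
        by_cases hA0 : A = 0
        · left
          subst hA0
          exact ⟨⟨rfl, by simpa using h⟩, rfl⟩
        · exact Or.inr ⟨A, w, ⟨hA0, by linear_combination h⟩, ⟨rfl, rfl⟩, rfl⟩
      · rintro (⟨⟨rfl, rfl⟩, rfl⟩ | ⟨A, w, ⟨-, h⟩, ⟨rfl, rfl⟩, rfl⟩)
        · simp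
        · exact ⟨rfl, by linear_combination h⟩
    rw [e, Set.ncard_insert_of_notMem, Set.ncard_image_of_injective _ fun s t h => (Prod.mk.inj h).1]
    · push_cast
      rw [ncard_cusp_ne h2]; ring
    · rintro ⟨x, ⟨hx, -⟩, h⟩
      exact hx (congrArg (fun y : (F × F) × F => y.1.1) h)
  have k2 : (E.ncard : ℝ) = Nat.card F ^ 2 := by
    have e : E = (fun x : F × F => ((x.1, (x.2 + 4 * x.1 ^ 3 / x.2) / 2),
        (x.2 - 4 * x.1 ^ 3 / x.2) / 2)) '' (Set.univ ×ˢ ({0} : Set F)ᶜ) ∪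
        (fun v : F => (((0 : F), v), -v)) '' Set.univ := by
      ext ⟨⟨A, w⟩, e⟩
      simp only [hE, Set.mem_ofPred_eq, Set.mem_union, Set.mem_image, Prod.mk.injEq,
        Prod.exists, Set.mem_prod, Set.mem_univ, true_and, Set.mem_compl_iff,
        Set.mem_singleton_iff]
      constructor
      · intro h
        have hf : (w + e) * (w - e) = 4 * A ^ 3 := by linear_combination h
        by_cases hu : w + e = 0
        · right
          have : A = 0 := by simpa [hu, h4] using hf.symm
          exact ⟨w, ⟨this.symm, rfl⟩, by linear_combination -hu⟩
        · left
          refine ⟨A, w + e, hu, ⟨rfl, ?_⟩, ?_⟩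
          · rw [← hf]; field_simp; ring
          · rw [← hf]; field_simp; ring
      · rintro (⟨A, u, hu, ⟨rfl, rfl⟩, rfl⟩ | ⟨v, ⟨rfl, rfl⟩, rfl⟩)
        · field_simp; ring
        · ring
    rw [e, Set.ncard_union_eq, Nat.cast_add, Set.InjOn.ncard_image,
      Set.ncard_image_of_injective, Set.ncard_prod, Set.ncard_univ]
    · push_cast
      rw [ncard_compl_zero]; ring
    · intro s t h
      exact (Prod.mk.inj (Prod.mk.inj h).1).2
    · rintro ⟨A, u⟩ hu ⟨A', u'⟩ hu' h
      simp only [Prod.mk.injEq] at h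
      obtain ⟨⟨rfl, h1⟩, h3⟩ := h
      have : u = u' := by
        have e1 : ∀ z y : F, (z + y) / 2 + (z - y) / 2 = z := fun z y => by field_simp; ring
        rw [← e1 u (4 * A ^ 3 / u), h1, h3, e1]
      rw [this]
    · rw [Set.disjoint_left]
      rintro _ ⟨⟨A, u⟩, hu, rfl⟩ ⟨v, -, h⟩
      simp only [Prod.mk.injEq] at h
      obtain ⟨⟨rfl, h1⟩, h3⟩ := h
      apply hu.2
      have h5 : u / 2 + u / 2 = 0 := by
        simp at h1 h3
        linear_combination -h1 - h3
      have e1 : u / 2 + u / 2 = u := by field_simp; ring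
      exact e1.symm.trans h5
  have k3 : (E.ncard : ℝ) = E0.ncard + E1.ncard := by exact_mod_cast k1
  have k4 : 2 * ({x : F × F | ∃ e, e ≠ 0 ∧ x.2 ^ 2 - 4 * x.1 ^ 3 = e ^ 2}.ncard : ℝ) = E1.ncard := by
    exact_mod_cast h
  rw [k4]
  rw [k2, k0] at k3
  linear_combination -k3

lemma two_mul_ncard_disc_sq [Finite F] (h2 : (2 : F) ≠ 0) :
    2 * ({f : Fin 4 → F | ∃ e, e ≠ 0 ∧ disc f = e ^ 2}.ncard : ℝ) =
      (Nat.card F - 1) ^ 2 * Nat.card F * (Nat.card F + 1) := by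
  have h4 : (4 : F) ≠ 0 := by
    rw [show (4 : F) = 2 * 2 by norm_num]; exact mul_ne_zero h2 h2
  have e : {f : Fin 4 → F | ∃ e, e ≠ 0 ∧ disc f = e ^ 2} =
      {f | f 0 ≠ 0 ∧ (hA f, cov f) ∈ {x : F × F | ∃ e, e ≠ 0 ∧ x.2 ^ 2 - 4 * x.1 ^ 3 = e ^ 2}} ∪
      {f | f 0 = 0 ∧ (f 1, f 2, f 3) ∈ (fun x : F × F × F =>
        (x.1, x.2.1, (x.2.2 + 3 * x.2.1 ^ 2) / (4 * x.1))) ''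
        (({0} : Set F)ᶜ ×ˢ ((Set.univ : Set F) ×ˢ {x : F | ∃ e, e ≠ 0 ∧ x = e ^ 2}))} := by
    ext f
    simp only [Set.mem_ofPred_eq, Set.mem_union, Set.mem_image, Set.mem_prod, Set.mem_compl_iff,
      Set.mem_singleton_iff, Set.mem_univ, true_and, Prod.exists, Prod.mk.injEq]
    by_cases hf : f 0 = 0
    · simp only [hf, ne_eq, not_true_eq_false, false_and, true_and, false_or, disc_lead_eq hf]
      constructor
      · rintro ⟨e, he, h⟩
        have h1 : f 1 ≠ 0 := by
          intro h0
          rw [h0] at h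
          exact he (by simpa using h.symm)
        refine ⟨f 1, f 2, (e / f 1) ^ 2, ⟨h1, e / f 1, div_ne_zero he h1, rfl⟩, rfl, rfl, ?_⟩
        rw [div_pow, ← h]
        field_simp
        ring
      · rintro ⟨b, c, x, ⟨hb, e, he, rfl⟩, rfl, rfl, h⟩
        refine ⟨f 1 * e, mul_ne_zero hb he, ?_⟩
        rw [← h]
        field_simp
        ring
    · simp only [hf, ne_eq, not_false_eq_true, true_and, false_and, or_false]
      rw [← disc_lead_ne]
      constructor
      · rintro ⟨e, he, h⟩
        exact ⟨e * f 0, mul_ne_zero he hf, by rw [h]; ring⟩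
      · rintro ⟨e, he, h⟩
        refine ⟨e / f 0, div_ne_zero he hf, ?_⟩
        rw [div_pow, ← h]
        field_simp
  have h3 := two_mul_ncard_cusp_sq h2
  have h5 := two_mul_ncard_nonzero_sq h2
  rw [e, Set.ncard_union_eq, Nat.cast_add, ncard_lead_ne, ncard_lead_eq,
    Set.InjOn.ncard_image, Set.ncard_prod, Set.ncard_prod, Set.ncard_univ]
  · push_cast
    rw [ncard_compl_zero]
    linear_combination (Nat.card F - 1 : ℝ) * Nat.card F * h3 + (Nat.card F - 1 : ℝ) * Nat.card F * h5
  · rintro ⟨b, c, x⟩ ⟨hb, -⟩ ⟨b', c', x'⟩ - h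
    simp only [Prod.mk.injEq] at h
    obtain ⟨rfl, rfl, h⟩ := h
    have hb' : b ≠ 0 := hb
    field_simp at h
    have : x = x' := by linear_combination h
    rw [this]
  · rw [Set.disjoint_left]
    rintro f ⟨h, -⟩ ⟨h', -⟩
    exact h h'

end FieldCount

/-! ### Local densities of cubic forms -/

section Local

/-- The covariant of the form at `(0, 1)`. -/
def cov' {R : Type*} [CommRing R] (f : Fin 4 → R) : R := 2 * hC f * f 2 - f 3 * hB f

lemma cov_cast {R : Type*} [CommRing R] (f : Fin 4 → ℤ) :
    cov (fun i => (f i : R)) = ((cov f : ℤ) : R) := by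
  simp only [cov, hA_cast, hB_cast]; push_cast; rfl

lemma cov'_cast {R : Type*} [CommRing R] (f : Fin 4 → ℤ) :
    cov' (fun i => (f i : R)) = ((cov' f : ℤ) : R) := by
  simp only [cov', hC_cast, hB_cast]; push_cast; rfl

lemma modEq_of_cast {G : (Fin 4 → ℤ) → ℤ} {G' : ∀ m : ℕ, (Fin 4 → ZMod m) → ZMod m}
    (h : ∀ m f, G' m (fun i => (f i : ZMod m)) = ((G f : ℤ) : ZMod m)) {m : ℕ} {f g : Fin 4 → ℤ}
    (hfg : ∀ i, f i ≡ g i [ZMOD m]) : G f ≡ G g [ZMOD m] := by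
  rw [← ZMod.intCast_eq_intCast_iff, ← h, ← h]
  congr 1
  funext i
  exact (ZMod.intCast_eq_intCast_iff _ _ _).mpr (hfg i)

variable {p : ℕ}

lemma hessZero_iff_cast {f : Fin 4 → ℤ} : HessZero p f ↔ hA (fun i => (f i : ZMod p)) = 0 ∧
    hB (fun i => (f i : ZMod p)) = 0 ∧ hC (fun i => (f i : ZMod p)) = 0 := by
  simp only [HessZero, hA_cast, hB_cast, hC_cast, ZMod.intCast_zmod_eq_zero_iff_dvd]

lemma HasDensity.congr_density {ι : Type*} [Fintype ι] {m m' : ℕ} {Q : (ι → ℤ) → Prop} {δ δ' : ℝ}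
    (h : HasDensity m Q δ) (hm : m = m') (hδ : δ = δ') : HasDensity m' Q δ' := by
  rwa [← hm, ← hδ]

lemma hasDensity_hess_ne (hp : p.Prime) :
    HasDensity p (fun f : Fin 4 → ℤ => ¬ (p : ℤ) ∣ f 0 ∧ HessZero p f) ((p - 1) / p ^ 3) := by
  have : Fact p.Prime := ⟨hp⟩
  refine ⟨hp.pos, _, fun f => ?_, (ncard_hess_zero_ne (F := ZMod p)).trans ?_⟩
  · beta_reduce
    rw [hessZero_iff_cast, ← ZMod.intCast_zmod_eq_zero_iff_dvd]
    rfl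
  · have : (p : ℝ) ≠ 0 := by exact_mod_cast hp.ne_zero
    rw [Nat.card_zmod, Fintype.card_fin]
    field_simp

lemma hasDensity_hess_eq (hp : p.Prime) :
    HasDensity p (fun f : Fin 4 → ℤ => ((p : ℤ) ∣ f 0 ∧ ¬ (p : ℤ) ∣ f 3) ∧ HessZero p f)
      ((p - 1) / p ^ 4) := by
  have : Fact p.Prime := ⟨hp⟩
  refine ⟨hp.pos, _, fun f => ?_, (ncard_hess_zero_eq (F := ZMod p)).trans ?_⟩
  · beta_reduce
    rw [hessZero_iff_cast, ← ZMod.intCast_zmod_eq_zero_iff_dvd, ← ZMod.intCast_zmod_eq_zero_iff_dvd]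
    rfl
  · have : (p : ℝ) ≠ 0 := by exact_mod_cast hp.ne_zero
    rw [Nat.card_zmod, Fintype.card_fin]
    field_simp

lemma hasDensity_zero (hp : p.Prime) :
    HasDensity p (fun f : Fin 4 → ℤ => ∀ i, (p : ℤ) ∣ f i) (1 / p ^ 4) := by
  refine ⟨hp.pos, {0}, fun f => ?_, ?_⟩
  · simp only [Set.mem_singleton_iff, funext_iff, Pi.zero_apply, ZMod.intCast_zmod_eq_zero_iff_dvd]
  · have : (p : ℝ) ≠ 0 := by exact_mod_cast hp.ne_zero
    rw [Set.ncard_singleton, Fintype.card_fin]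
    field_simp
    simp

lemma hessZero_split (hp : p.Prime) (f : Fin 4 → ℤ) : HessZero p f ↔
    ((¬ (p : ℤ) ∣ f 0 ∧ HessZero p f) ∨ (((p : ℤ) ∣ f 0 ∧ ¬ (p : ℤ) ∣ f 3) ∧ HessZero p f)) ∨
      ∀ i, (p : ℤ) ∣ f i := by
  have : Fact p.Prime := ⟨hp⟩
  constructor
  · intro h
    by_cases h0 : (p : ℤ) ∣ f 0
    · by_cases h3 : (p : ℤ) ∣ f 3
      · right
        have h0' := h0
        rw [← ZMod.intCast_zmod_eq_zero_iff_dvd] at h0'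
        have h1 := (hess_zero_iff' (f := fun i => (f i : ZMod p)) h0').mp (hessZero_iff_cast.mp h)
        simp only [ZMod.intCast_zmod_eq_zero_iff_dvd] at h1
        intro i
        fin_cases i
        exacts [h0, h1.1, h1.2, h3]
      · exact Or.inl (Or.inr ⟨⟨h0, h3⟩, h⟩)
    · exact Or.inl (Or.inl ⟨h0, h⟩)
  · rintro ((h | h) | h)
    · exact h.2
    · exact h.2
    · exact ⟨dvd_sub ((h 1).trans (dvd_pow_self _ two_ne_zero)) ((h 0).mul_right _),
        dvd_sub ((h 1).mul_right _) ((h 0).mul_right _),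
        dvd_sub ((h 2).trans (dvd_pow_self _ two_ne_zero)) ((h 1).mul_right _)⟩

lemma hasDensity_hess (hp : p.Prime) :
    HasDensity p (fun f : Fin 4 → ℤ => HessZero p f) (1 / p ^ 2) := by
  refine ((((hasDensity_hess_ne hp).or (hasDensity_hess_eq hp) ?_).or (hasDensity_zero hp) ?_).congr
    (hessZero_split hp)).congr_density rfl ?_
  · rintro f ⟨h, -⟩ ⟨⟨h', -⟩, -⟩
    exact h h'
  · rintro f (⟨h, -⟩ | ⟨⟨-, h⟩, -⟩) h'
    · exact h (h' _)
    · exact h (h' _)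
  · have : (p : ℝ) ≠ 0 := by exact_mod_cast hp.ne_zero
    field_simp
    ring

lemma two_ne_zero_zmod (hp : p.Prime) (h2 : p ≠ 2) : (2 : ZMod p) ≠ 0 := by
  intro h
  have h1 : ((2 : ℕ) : ZMod p) = 0 := by exact_mod_cast h
  rw [ZMod.natCast_eq_zero_iff] at h1
  exact h2 ((Nat.prime_dvd_prime_iff_eq hp Nat.prime_two).mp h1)

lemma hasDensity_disc_mod (hp : p.Prime) (h2 : p ≠ 2) :
    HasDensity p (fun f : Fin 4 → ℤ => (p : ℤ) ∣ disc f ∧ ¬ (p : ℤ) ∣ hA f) ((p - 1) / p ^ 2) := by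
  have : Fact p.Prime := ⟨hp⟩
  refine ⟨hp.pos, _, fun f => ?_, (ncard_disc_zero (two_ne_zero_zmod hp h2)).trans ?_⟩
  · beta_reduce
    rw [Set.mem_ofPred_eq, disc_cast, hA_cast, ne_eq, ZMod.intCast_zmod_eq_zero_iff_dvd,
      ZMod.intCast_zmod_eq_zero_iff_dvd]
  · have : (p : ℝ) ≠ 0 := by exact_mod_cast hp.ne_zero
    rw [Nat.card_zmod, Fintype.card_fin]
    field_simp

lemma hasDensity_disc_mod' (hp : p.Prime) :
    HasDensity p (fun f : Fin 4 → ℤ => (p : ℤ) ∣ disc f ∧ (p : ℤ) ∣ hA f ∧ ¬ (p : ℤ) ∣ hC f)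
      ((p - 1) / p ^ 3) := by
  have : Fact p.Prime := ⟨hp⟩
  refine ⟨hp.pos, _, fun f => ?_, (ncard_disc_zero' (F := ZMod p)).trans ?_⟩
  · beta_reduce
    rw [Set.mem_ofPred_eq, disc_cast, hA_cast, hC_cast, ne_eq, ZMod.intCast_zmod_eq_zero_iff_dvd,
      ZMod.intCast_zmod_eq_zero_iff_dvd, ZMod.intCast_zmod_eq_zero_iff_dvd]
  · have : (p : ℝ) ≠ 0 := by exact_mod_cast hp.ne_zero
    rw [Nat.card_zmod, Fintype.card_fin]
    field_simp

lemma not_dvd_two_mul (hp : p.Prime) (h2 : p ≠ 2) {x y : ℤ} (hy : ¬ (p : ℤ) ∣ y)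
    (h : (p : ℤ) ∣ x ^ 2 - 4 * y ^ 3) : ¬ (p : ℤ) ∣ 2 * x := by
  have hp' := Nat.prime_iff_prime_int.mp hp
  have h2' : ¬ (p : ℤ) ∣ 2 := fun h => h2 ((Nat.prime_dvd_prime_iff_eq hp Nat.prime_two).mp
    (by exact_mod_cast h))
  intro hx
  have hx' := (hp'.dvd_or_dvd hx).resolve_left h2'
  have h3 : (p : ℤ) ∣ 2 * 2 * y ^ 3 := by
    rw [show 2 * 2 * y ^ 3 = x ^ 2 - (x ^ 2 - 4 * y ^ 3) by ring]
    exact dvd_sub (hx'.trans (dvd_pow_self x two_ne_zero)) h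
  rcases hp'.dvd_or_dvd h3 with h4 | h4
  · rcases hp'.dvd_or_dvd h4 with h5 | h5 <;> exact h2' h5
  · exact hy (hp'.dvd_of_dvd_pow h4)

lemma disc_modEq {m : ℕ} {f g : Fin 4 → ℤ} (hfg : ∀ i, f i ≡ g i [ZMOD m]) :
    disc f ≡ disc g [ZMOD m] := modEq_of_cast (G' := fun _ => disc) (fun _ => disc_cast) hfg

lemma hA_modEq {m : ℕ} {f g : Fin 4 → ℤ} (hfg : ∀ i, f i ≡ g i [ZMOD m]) :
    hA f ≡ hA g [ZMOD m] := modEq_of_cast (G' := fun _ => hA) (fun _ => hA_cast) hfg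

lemma hB_modEq {m : ℕ} {f g : Fin 4 → ℤ} (hfg : ∀ i, f i ≡ g i [ZMOD m]) :
    hB f ≡ hB g [ZMOD m] := modEq_of_cast (G' := fun _ => hB) (fun _ => hB_cast) hfg

lemma hC_modEq {m : ℕ} {f g : Fin 4 → ℤ} (hfg : ∀ i, f i ≡ g i [ZMOD m]) :
    hC f ≡ hC g [ZMOD m] := modEq_of_cast (G' := fun _ => hC) (fun _ => hC_cast) hfg

lemma hessZero_congr {f g : Fin 4 → ℤ} (hfg : ∀ i, f i ≡ g i [ZMOD p]) :
    HessZero p f ↔ HessZero p g :=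
  and_congr (hA_modEq hfg).dvd_iff (and_congr (hB_modEq hfg).dvd_iff (hC_modEq hfg).dvd_iff)

lemma hasDensity_disc_sq (hp : p.Prime) (h2 : p ≠ 2) :
    HasDensity (p * p) (fun f : Fin 4 → ℤ => (p : ℤ) ^ 2 ∣ disc f ∧ ¬ (p : ℤ) ∣ hA f)
      ((p - 1) / p ^ 2 / p) := by
  refine HasDensity.lift hp (D := fun f => 2 * cov f) ![0, 0, 0, 1] (fun f s => ?_)
    (fun m f g h => disc_modEq h) (fun f h h' => ?_) (fun f g h => not_congr (hA_modEq h).dvd_iff)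
    (hasDensity_disc_mod hp h2)
  · refine ⟨f 0 ^ 2, ?_⟩
    simp [disc, hA, hB, hC, cov]
    ring
  · refine not_dvd_two_mul hp h2 h' ?_
    have := syzygy_cubic f
    rw [cov, ← this, sub_sub_cancel]
    exact h.mul_right _

lemma hasDensity_disc_sq' (hp : p.Prime) (h2 : p ≠ 2) :
    HasDensity (p * p) (fun f : Fin 4 → ℤ => (p : ℤ) ^ 2 ∣ disc f ∧
      (p : ℤ) ∣ hA f ∧ ¬ (p : ℤ) ∣ hC f) ((p - 1) / p ^ 3 / p) := by
  refine HasDensity.lift hp (D := fun f => 2 * cov' f) ![1, 0, 0, 0] (fun f s => ?_)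
    (fun m f g h => disc_modEq h) (fun f h h' => ?_)
    (fun f g h => and_congr (hA_modEq h).dvd_iff (not_congr (hC_modEq h).dvd_iff))
    (hasDensity_disc_mod' hp)
  · refine ⟨f 3 ^ 2, ?_⟩
    simp [disc, hA, hB, hC, cov']
    ring
  · refine not_dvd_two_mul hp h2 h'.2 ?_
    have := syzygy_cubic' f
    rw [cov', ← this, sub_sub_cancel]
    exact h.mul_right _

lemma HessZero.sq_dvd_disc {f : Fin 4 → ℤ} (h : HessZero p f) : (p : ℤ) ^ 2 ∣ disc f := by
  obtain ⟨⟨a, ha⟩, ⟨b, hb⟩, ⟨c, hc⟩⟩ := h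
  rw [disc, ha, hb, hc]
  exact ⟨b ^ 2 - 4 * a * c, by ring⟩

/-- The density of forms with discriminant not divisible by `p²`. -/
lemma hasDensity_not_sq_dvd (hp : p.Prime) (h2 : p ≠ 2) :
    HasDensity (p * p) (fun f : Fin 4 → ℤ => ¬ (p : ℤ) ^ 2 ∣ disc f) ((1 - 1 / p ^ 2) ^ 2) := by
  have hp' := Nat.prime_iff_prime_int.mp hp
  refine HasDensity.congr_density (HasDensity.not (((((hasDensity_hess hp).mul_modulus hp.pos).or
    (hasDensity_disc_sq hp h2) ?_).or (hasDensity_disc_sq' hp h2) ?_).congr ?_)) rfl ?_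
  · intro f h h'
    exact h'.2 h.1
  · rintro f (h | h) h'
    · exact h'.2.2 h.2.2
    · exact h.2 h'.2.1
  · intro f
    constructor
    · intro h
      by_cases hA0 : (p : ℤ) ∣ hA f
      · by_cases hC0 : (p : ℤ) ∣ hC f
        · refine Or.inl (Or.inl ⟨hA0, hp'.dvd_of_dvd_pow (n := 2) ?_, hC0⟩)
          have : hB f ^ 2 = disc f + hA f * (4 * hC f) := by rw [disc]; ring
          rw [this]
          exact dvd_add ((dvd_pow_self _ two_ne_zero).trans h) (hA0.mul_right _)
        · exact Or.inr ⟨h, hA0, hC0⟩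
      · exact Or.inl (Or.inr ⟨h, hA0⟩)
    · rintro ((h | h) | h)
      · exact h.sq_dvd_disc
      · exact h.1
      · exact h.1
  · have : (p : ℝ) ≠ 0 := by exact_mod_cast hp.ne_zero
    field_simp
    ring

lemma cube_dvd_iff (hp : p.Prime) {w a A D : ℤ} (h : w ^ 2 - D * a ^ 2 = 4 * A ^ 3)
    (ha : ¬ (p : ℤ) ∣ a) (hA0 : (p : ℤ) ∣ A) : (p : ℤ) ^ 3 ∣ D ↔ (p : ℤ) ^ 2 ∣ w := by
  have hp' := Nat.prime_iff_prime_int.mp hp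
  have h1 : (p : ℤ) ^ 3 ∣ 4 * A ^ 3 := (pow_dvd_pow_of_dvd hA0 3).mul_left 4
  have h2 : (p : ℤ) ^ 3 ∣ D ↔ (p : ℤ) ^ 3 ∣ w ^ 2 := by
    constructor
    · intro hD
      have : w ^ 2 = D * a ^ 2 + 4 * A ^ 3 := by linarith
      rw [this]
      exact dvd_add (hD.mul_right _) h1
    · intro hw
      have h3 : (p : ℤ) ^ 3 ∣ D * a ^ 2 := by
        have : D * a ^ 2 = w ^ 2 - 4 * A ^ 3 := by linarith
        rw [this]
        exact dvd_sub hw h1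
      exact (IsCoprime.pow ((hp'.coprime_iff_not_dvd).mpr ha)).dvd_of_dvd_mul_right h3
  rw [h2]
  constructor
  · intro h
    obtain ⟨v, rfl⟩ := hp'.dvd_of_dvd_pow ((dvd_pow_self (p : ℤ) three_ne_zero).trans h)
    rw [mul_pow, pow_succ, mul_dvd_mul_iff_left (pow_ne_zero 2 hp'.ne_zero)] at h
    rw [pow_two]
    exact mul_dvd_mul_left _ (hp'.dvd_of_dvd_pow h)
  · intro h
    exact (pow_dvd_pow (p : ℤ) (by norm_num : 3 ≤ 2 * 2)).trans
      (by rw [pow_mul]; exact pow_dvd_pow_of_dvd h 2)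

lemma hasDensity_cov (hp : p.Prime) :
    HasDensity (p * p) (fun f : Fin 4 → ℤ => (p : ℤ) ^ 2 ∣ cov f ∧
      (¬ (p : ℤ) ∣ f 0 ∧ HessZero p f)) ((p - 1) / p ^ 3 / p) := by
  have hp' := Nat.prime_iff_prime_int.mp hp
  refine HasDensity.lift hp (D := fun f => f 0 ^ 2) ![0, 0, 0, 1] (fun f s => ?_)
    (fun m f g h => modEq_of_cast (G' := fun _ => cov) (fun _ => cov_cast) h) (fun f h h' => ?_)
    (fun f g h => and_congr (not_congr (h 0).dvd_iff) (hessZero_congr h))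
    ((hasDensity_hess_ne hp).congr fun f => ?_)
  · refine ⟨0, ?_⟩
    simp [hA, hB, cov]
    ring
  · exact fun h3 => h'.1 (hp'.dvd_of_dvd_pow h3)
  · refine and_iff_right_of_imp fun h => ?_
    exact dvd_sub ((h.2.1.mul_left 2).mul_right _) (h.2.2.1.mul_left _)

lemma hasDensity_cov' (hp : p.Prime) :
    HasDensity (p * p) (fun f : Fin 4 → ℤ => (p : ℤ) ^ 2 ∣ cov' f ∧
      (((p : ℤ) ∣ f 0 ∧ ¬ (p : ℤ) ∣ f 3) ∧ HessZero p f)) ((p - 1) / p ^ 4 / p) := by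
  have hp' := Nat.prime_iff_prime_int.mp hp
  refine HasDensity.lift hp (D := fun f => f 3 ^ 2) ![1, 0, 0, 0] (fun f s => ?_)
    (fun m f g h => modEq_of_cast (G' := fun _ => cov') (fun _ => cov'_cast) h) (fun f h h' => ?_)
    (fun f g h => and_congr (and_congr (h 0).dvd_iff (not_congr (h 3).dvd_iff)) (hessZero_congr h))
    ((hasDensity_hess_eq hp).congr fun f => ?_)
  · refine ⟨0, ?_⟩
    simp [hC, hB, cov']
    ring
  · exact fun h3 => h'.1.2 (hp'.dvd_of_dvd_pow h3)
  · refine and_iff_right_of_imp fun h => ?_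
    exact dvd_sub ((h.2.2.2.mul_left 2).mul_right _) (h.2.2.1.mul_left _)

lemma hasDensity_hess_cube (hp : p.Prime) :
    HasDensity (p * p) (fun f : Fin 4 → ℤ => HessZero p f ∧ (p : ℤ) ^ 3 ∣ disc f)
      ((p ^ 2 + p - 1) / p ^ 5) := by
  refine HasDensity.congr_density ((((hasDensity_cov hp).or (hasDensity_cov' hp) ?_).or
    ((hasDensity_zero hp).mul_modulus hp.pos) ?_).congr fun f => ?_) rfl ?_
  · rintro f ⟨-, h, -⟩ ⟨-, ⟨h', -⟩, -⟩
    exact h h'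
  · rintro f (⟨-, h, -⟩ | ⟨-, ⟨-, h⟩, -⟩) h'
    · exact h (h' _)
    · exact h (h' _)
  · constructor
    · rintro ⟨h, hD⟩
      rcases (hessZero_split hp f).mp h with (h1 | h1) | h1
      · exact Or.inl (Or.inl ⟨(cube_dvd_iff hp (syzygy_cubic f) h1.1 h.1).mp hD, h1⟩)
      · exact Or.inl (Or.inr ⟨(cube_dvd_iff hp (syzygy_cubic' f) h1.1.2 h.2.2).mp hD, h1⟩)
      · exact Or.inr h1
    · rintro ((⟨h, h1⟩ | ⟨h, h1⟩) | h)
      · exact ⟨h1.2, (cube_dvd_iff hp (syzygy_cubic f) h1.1 h1.2.1).mpr h⟩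
      · exact ⟨h1.2, (cube_dvd_iff hp (syzygy_cubic' f) h1.1.2 h1.2.2.2).mpr h⟩
      · refine ⟨(hessZero_split hp f).mpr (Or.inr h), ?_⟩
        choose g hg using h
        have : disc f = (p : ℤ) ^ 4 * disc g := by
          simp only [disc, hA, hB, hC, hg]; ring
        rw [this]
        exact (pow_dvd_pow _ (by norm_num)).mul_right _
  · have : (p : ℝ) ≠ 0 := by exact_mod_cast hp.ne_zero
    field_simp
    ring

/-- The density of forms whose Hessian is exactly divisible by `p`. -/
lemma hasDensity_hess_not_cube (hp : p.Prime) :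
    HasDensity (p * p) (fun f : Fin 4 → ℤ => HessZero p f ∧ ¬ (p : ℤ) ^ 3 ∣ disc f)
      ((p - 1) ^ 2 * (p + 1) / p ^ 5) := by
  refine HasDensity.congr_density ((((hasDensity_hess hp).mul_modulus hp.pos).not.or
    (hasDensity_hess_cube hp) fun f h h' => h h'.1).not.congr fun f => ?_) rfl ?_
  · tauto
  · have : (p : ℝ) ≠ 0 := by exact_mod_cast hp.ne_zero
    field_simp
    ring

lemma hasDensity_splitCond (hp : p.Prime) (h2 : p ≠ 2) :
    HasDensity p (fun f : Fin 4 → ℤ => SplitCond p (disc f)) ((p - 1) ^ 2 * (p + 1) / (2 * p ^ 3)) := by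
  have : Fact p.Prime := ⟨hp⟩
  refine ⟨hp.pos, {f | ∃ e, e ≠ 0 ∧ disc f = e ^ 2}, fun f => ?_, ?_⟩
  · beta_reduce
    rw [SplitCond, if_neg h2, Set.mem_ofPred_eq, disc_cast, ← ZMod.intCast_zmod_eq_zero_iff_dvd]
    constructor
    · rintro ⟨⟨x, hx⟩, h⟩
      rw [← ZMod.intCast_zmod_eq_zero_iff_dvd] at hx
      push_cast at hx
      refine ⟨x, fun h0 => h ?_, by linear_combination -hx⟩
      rw [h0] at hx
      linear_combination -hx
    · rintro ⟨e, he, h⟩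
      refine ⟨⟨(e.cast : ℤ), ?_⟩, by rw [h]; exact pow_ne_zero 2 he⟩
      rw [← ZMod.intCast_zmod_eq_zero_iff_dvd]
      push_cast
      rw [h]; simp
  · have : (p : ℝ) ≠ 0 := by exact_mod_cast hp.ne_zero
    have h := two_mul_ncard_disc_sq (two_ne_zero_zmod hp h2)
    rw [Nat.card_zmod] at h
    rw [Fintype.card_fin]
    field_simp
    linear_combination h

lemma hasDensity_splitCond_two :
    HasDensity 2 (fun f : Fin 4 → ℤ => SplitCond 2 (disc f)) (3 / 16) := by
  refine ⟨two_pos, {f | hB f = 1 ∧ hA f * hC f = 0}, fun f => ?_, ?_⟩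
  · beta_reduce
    rw [SplitCond, if_pos rfl, Set.mem_ofPred_eq, hA_cast, hB_cast, hC_cast, disc]
    generalize hA f = A
    generalize hB f = B
    generalize hC f = C
    rw [show ((A : ZMod 2) * C = 0) ↔ (2 : ℤ) ∣ A * C by
      rw [← Int.cast_mul]; exact ZMod.intCast_zmod_eq_zero_iff_dvd _ 2,
      show ((B : ZMod 2) = 1) ↔ (2 : ℤ) ∣ B - 1 by
      rw [← sub_eq_zero, ← Int.cast_one, ← Int.cast_sub]; exact ZMod.intCast_zmod_eq_zero_iff_dvd _ 2]
    rw [show B ^ 2 - 4 * A * C = B ^ 2 - 4 * (A * C) by ring]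
    generalize A * C = D
    rcases Int.even_or_odd' B with ⟨k, rfl | rfl⟩
    · rw [show (2 * k) ^ 2 - 4 * D = 4 * (k ^ 2 - D) by ring]
      omega
    · obtain ⟨l, hl⟩ := Int.even_mul_succ_self k
      rw [show (2 * k + 1) ^ 2 - 4 * D = 4 * (k * (k + 1)) + 1 - 4 * D by ring, hl]
      omega
  · rw [Set.ncard_eq_toFinset_card', Fintype.card_fin]
    rw [show Finset.card {f : Fin 4 → ZMod 2 | hB f = 1 ∧ hA f * hC f = 0}.toFinset = 3 by
      decide +kernel]
    norm_num

lemma hasDensity_two :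
    HasDensity 4 (fun f : Fin 4 → ℤ => disc f % 4 = 1 ∨ disc f % 16 = 8 ∨ disc f % 16 = 12)
      (9 / 16) := by
  refine ⟨by norm_num, {f | (hB f = 1 ∨ hB f = 3) ∨ (hB f = 0 ∧ (hA f * hC f = 1 ∨ hA f * hC f = 2))
    ∨ (hB f = 2 ∧ (hA f * hC f = 2 ∨ hA f * hC f = 3))}, fun f => ?_, ?_⟩
  · beta_reduce
    rw [Set.mem_ofPred_eq, hA_cast, hB_cast, hC_cast, disc]
    generalize hA f = A
    generalize hB f = B
    generalize hC f = C
    rw [show B ^ 2 - 4 * A * C = B ^ 2 - 4 * (A * C) by ring, ← Int.cast_mul]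
    generalize A * C = D
    have key : ∀ (x y : ℤ), ((x : ZMod 4) = (y : ZMod 4)) ↔ (4 : ℤ) ∣ x - y := by
      intro x y
      rw [← sub_eq_zero, ← Int.cast_sub]
      exact ZMod.intCast_zmod_eq_zero_iff_dvd _ 4
    have k0 := key B 0
    have k1 := key B 1
    have k2 := key B 2
    have k3 := key B 3
    have l1 := key D 1
    have l2 := key D 2
    have l3 := key D 3
    push_cast at k0 k1 k2 k3 l1 l2 l3
    rw [k0, k1, k2, k3, l1, l2, l3]
    obtain ⟨k, r, hr, hr', rfl⟩ : ∃ k r : ℤ, 0 ≤ r ∧ r < 4 ∧ B = 4 * k + r :=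
      ⟨B / 4, B % 4, by omega, by omega, by omega⟩
    interval_cases r
    · rw [show (4 * k + 0) ^ 2 - 4 * D = 16 * k ^ 2 - 4 * D by ring]
      omega
    · rw [show (4 * k + 1) ^ 2 - 4 * D = 4 * (4 * k ^ 2 + 2 * k - D) + 1 by ring]
      omega
    · rw [show (4 * k + 2) ^ 2 - 4 * D = 16 * (k ^ 2 + k) + 4 - 4 * D by ring]
      omega
    · rw [show (4 * k + 3) ^ 2 - 4 * D = 4 * (4 * k ^ 2 + 6 * k + 2 - D) + 1 by ring]
      omega
  · rw [Set.ncard_eq_toFinset_card', Fintype.card_fin]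
    rw [show Finset.card {f : Fin 4 → ZMod 4 | (hB f = 1 ∨ hB f = 3) ∨
      (hB f = 0 ∧ (hA f * hC f = 1 ∨ hA f * hC f = 2)) ∨
      (hB f = 2 ∧ (hA f * hC f = 2 ∨ hA f * hC f = 3))}.toFinset = 144 by decide +kernel]
    norm_num

end Local

/-! ### Local description of the forms attached to fundamental discriminants -/

lemma sq_emod_eight {x : ℤ} (hx : Odd x) : x ^ 2 % 8 = 1 := by
  have h : x % 8 = 1 ∨ x % 8 = 3 ∨ x % 8 = 5 ∨ x % 8 = 7 := by
    have := Int.odd_iff.mp hx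
    omega
  rw [pow_two, Int.mul_emod]
  rcases h with h | h | h | h <;> simp [h]

lemma splitCond_of_zero {p : ℕ} (hp : p.Prime) {A B C x y : ℤ}
    (hxy : ¬ ((p : ℤ) ∣ x ∧ (p : ℤ) ∣ y)) (h : (p : ℤ) ∣ A * x ^ 2 - B * x * y + C * y ^ 2)
    (hd : ¬ (p : ℤ) ∣ B ^ 2 - 4 * A * C) : SplitCond p (B ^ 2 - 4 * A * C) := by
  have hpZ := Nat.prime_iff_prime_int.mp hp
  unfold SplitCond
  split_ifs with h2
  · subst h2
    push_cast at h hd hxy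
    have hB : B % 2 = 1 := by
      by_contra hB
      refine hd (dvd_sub ?_ ⟨2 * A * C, by ring⟩)
      exact dvd_pow (by omega) two_ne_zero
    have hAC : (2 : ℤ) ∣ A * C := by
      by_contra hAC
      have hA : A % 2 = 1 := by
        by_contra hA
        exact hAC (dvd_mul_of_dvd_left (by omega) _)
      have hC : C % 2 = 1 := by
        by_contra hC
        exact hAC (dvd_mul_of_dvd_right (by omega) _)
      have h' : (A * x ^ 2 - B * x * y + C * y ^ 2) % 2 = 0 := Int.emod_eq_zero_of_dvd h
      have hcong : A * x ^ 2 - B * x * y + C * y ^ 2 ≡ x ^ 2 - x * y + y ^ 2 [ZMOD 2] := by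
        have a1 : A ≡ 1 [ZMOD 2] := hA
        have b1 : B ≡ 1 [ZMOD 2] := hB
        have c1 : C ≡ 1 [ZMOD 2] := hC
        have := ((a1.mul_right (x ^ 2)).sub ((b1.mul_right x).mul_right y)).add
          (c1.mul_right (y ^ 2))
        simpa using this
      rw [hcong.eq] at h'
      rcases Int.even_or_odd' x with ⟨u, rfl | rfl⟩ <;> rcases Int.even_or_odd' y with ⟨v, rfl | rfl⟩
      · exact hxy ⟨⟨u, rfl⟩, ⟨v, rfl⟩⟩
      all_goals
        ring_nf at h'
        omega
    obtain ⟨k, hk⟩ := hAC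
    have hB2 : B ^ 2 % 8 = 1 := sq_emod_eight (Int.odd_iff.mpr hB)
    have : B ^ 2 - 4 * A * C = B ^ 2 - 8 * k := by rw [mul_assoc, hk]; ring
    omega
  · refine ⟨?_, hd⟩
    by_cases hy : (p : ℤ) ∣ y
    · have hx : ¬ (p : ℤ) ∣ x := fun hx => hxy ⟨hx, hy⟩
      have h3 : (p : ℤ) ∣ A * x ^ 2 := by
        have : A * x ^ 2 = (A * x ^ 2 - B * x * y + C * y ^ 2) + (B * x - C * y) * y := by ring
        rw [this]
        exact dvd_add h (dvd_mul_of_dvd_right hy _)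
      have hA : (p : ℤ) ∣ A :=
        (hpZ.dvd_or_dvd h3).resolve_right fun h => hx (hpZ.dvd_of_dvd_pow h)
      refine ⟨B, ?_⟩
      have : B ^ 2 - (B ^ 2 - 4 * A * C) = A * (4 * C) := by ring
      rw [this]
      exact dvd_mul_of_dvd_left hA _
    · obtain ⟨inv, hinv⟩ := exists_inverse_mod hp
      have hi := (Int.modEq_iff_dvd.mp (hinv y hy))
      obtain ⟨k, hk⟩ := hi
      obtain ⟨l, hl⟩ := h
      have hyi : y * inv y = 1 - p * k := by linarith
      refine ⟨(2 * A * x - B * y) * inv y, ?_⟩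
      have e : ((2 * A * x - B * y) * inv y) ^ 2 - (B ^ 2 - 4 * A * C) =
          4 * A * (A * x ^ 2 - B * x * y + C * y ^ 2) * inv y ^ 2 +
          (B ^ 2 - 4 * A * C) * ((y * inv y) ^ 2 - 1) := by ring
      rw [e, hl, hyi]
      exact ⟨4 * A * l * inv y ^ 2 + (B ^ 2 - 4 * A * C) * (-2 * k + p * k ^ 2), by ring⟩

lemma splitCond_of_syzygy {p : ℕ} (hp : p.Prime) {A B C : ℤ} {f : Fin 4 → ℤ}
    (h1 : A * f 2 - B * f 1 + C * f 0 = 0) (h2 : A * f 3 - B * f 2 + C * f 1 = 0)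
    (hz : HessZero p f) (hf : ¬ ∀ i, (p : ℤ) ∣ f i) (hd : ¬ (p : ℤ) ∣ B ^ 2 - 4 * A * C) :
    SplitCond p (B ^ 2 - 4 * A * C) := by
  have hpZ := Nat.prime_iff_prime_int.mp hp
  obtain ⟨zA, zB, zC⟩ := hz
  simp only [hA, hB, hC] at zA zB zC
  by_cases ha : (p : ℤ) ∣ f 0
  · have hb : (p : ℤ) ∣ f 1 := by
      refine hpZ.dvd_of_dvd_pow (n := 2) ?_
      have := dvd_add zA (dvd_mul_of_dvd_left ha (f 2))
      simpa using this
    have hc : (p : ℤ) ∣ f 2 := by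
      refine hpZ.dvd_of_dvd_pow (n := 2) ?_
      have := dvd_add zC (dvd_mul_of_dvd_left hb (f 3))
      simpa using this
    have hdd : ¬ (p : ℤ) ∣ f 3 := by
      intro hdd
      refine hf fun i => ?_
      fin_cases i <;> assumption
    have h3 : (p : ℤ) ∣ A * f 3 := by
      have : A * f 3 = B * f 2 - C * f 1 := by linarith
      rw [this]
      exact dvd_sub (dvd_mul_of_dvd_right hc _) (dvd_mul_of_dvd_right hb _)
    have hA : (p : ℤ) ∣ A := (hpZ.dvd_or_dvd h3).resolve_right hdd
    refine splitCond_of_zero hp (x := 1) (y := 0) ?_ ?_ hd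
    · exact fun h => hpZ.not_dvd_one h.1
    · simpa using hA
  · refine splitCond_of_zero hp (x := f 1) (y := f 0) (fun h => ha h.2) ?_ hd
    have : A * f 1 ^ 2 - B * f 1 * f 0 + C * f 0 ^ 2 = A * (f 1 ^ 2 - f 0 * f 2) := by
      linear_combination f 0 * h1
    rw [this]
    exact dvd_mul_of_dvd_right zA _

/-- The local condition at two on fundamental discriminants. -/
def TwoCond (d : ℤ) : Prop := d % 4 = 1 ∨ d % 16 = 8 ∨ d % 16 = 12

/-- The local condition at `p` on fundamental discriminants that are split at the primes
of `S`. -/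
def LocD (S : Finset ℕ) (p : ℕ) (d : ℤ) : Prop :=
  if p ∈ S then SplitCond p d else if p = 2 then TwoCond d else ¬ (p : ℤ) ^ 2 ∣ d

/-- The local condition at `p` on the forms attached to these discriminants. -/
def Loc (S U : Finset ℕ) (p : ℕ) (f : Fin 4 → ℤ) : Prop :=
  if p ∈ U then HessZero p f ∧ ¬ (p : ℤ) ^ 3 ∣ disc f else LocD S p (disc f)

lemma SplitCond.twoCond {d : ℤ} (h : SplitCond 2 d) : TwoCond d := by
  simp only [SplitCond, if_true] at h
  left
  omega

lemma fund_and_split_iff {S : Finset ℕ} (hS : ∀ p ∈ S, p.Prime) {d : ℤ} :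
    (Fund d ∧ ∀ p ∈ S, SplitCond p d) ↔ ∀ p : ℕ, p.Prime → LocD S p d := by
  constructor
  · rintro ⟨⟨h2, hF⟩, hsp⟩ p hp
    unfold LocD
    split_ifs with h h'
    · exact hsp p h
    · exact h2
    · exact hF p hp h'
  · intro h
    have hsp : ∀ p ∈ S, SplitCond p d := fun p hp => by
      have := h p (hS p hp)
      rwa [LocD, if_pos hp] at this
    refine ⟨⟨?_, fun p hp h2 hdvd => ?_⟩, hsp⟩
    · have := h 2 Nat.prime_two
      unfold LocD at this
      split_ifs at this with h' h''
      · exact this.twoCond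
      · exact this
      · exact absurd rfl h''
    · have := h p hp
      unfold LocD at this
      rw [if_neg h2] at this
      split_ifs at this with h'
      · exact this.not_dvd ((dvd_pow_self _ two_ne_zero).trans hdvd)
      · exact this hdvd

lemma locD_sq_mul {S : Finset ℕ} {p : ℕ} (hp : p.Prime) {n d : ℤ} (hn : ¬ (p : ℤ) ∣ n) :
    LocD S p (n ^ 2 * d) ↔ LocD S p d := by
  have hpZ := Nat.prime_iff_prime_int.mp hp
  have hsq : p = 2 → n ^ 2 % 8 = 1 := by
    rintro rfl
    exact sq_emod_eight (Int.odd_iff.mpr (by push_cast at hn; omega))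
  have hdvd : (p : ℤ) ∣ n ^ 2 * d ↔ (p : ℤ) ∣ d :=
    ⟨fun h => (hpZ.dvd_or_dvd h).resolve_left fun h => hn (hpZ.dvd_of_dvd_pow h),
      fun h => dvd_mul_of_dvd_right h _⟩
  unfold LocD
  split_ifs with h h2
  · unfold SplitCond
    split_ifs with h2
    · obtain h2 := hsq h2
      rw [Int.mul_emod, h2]
      simp
    · rw [hdvd]
      refine and_congr_left fun _ => ?_
      obtain ⟨inv, hinv⟩ := exists_inverse_mod hp
      obtain ⟨k, hk⟩ := Int.modEq_iff_dvd.mp (hinv n hn)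
      have hni : n * inv n = 1 - p * k := by linarith
      constructor
      · rintro ⟨x, l, hl⟩
        refine ⟨x * inv n, ?_⟩
        have : (x * inv n) ^ 2 - d = (x ^ 2 - n ^ 2 * d) * inv n ^ 2 + d * ((n * inv n) ^ 2 - 1) := by
          ring
        rw [this, hl, hni]
        exact ⟨l * inv n ^ 2 + d * (-2 * k + p * k ^ 2), by ring⟩
      · rintro ⟨x, hx⟩
        refine ⟨n * x, ?_⟩
        have : (n * x) ^ 2 - n ^ 2 * d = n ^ 2 * (x ^ 2 - d) := by ring
        rw [this]
        exact dvd_mul_of_dvd_right hx _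
  · have h2 := hsq h2
    unfold TwoCond
    have e : n ^ 2 * d = d + 8 * (n ^ 2 / 8 * d) := by
      have := Int.emod_add_mul_ediv (n ^ 2) 8
      rw [h2] at this
      linear_combination -d * this
    have e2 : d % 2 = 1 ∨ ∃ k, d = 2 * k := by
      rcases Int.emod_two_eq_zero_or_one d with h | h
      · right; exact ⟨d / 2, by omega⟩
      · left; exact h
    rcases e2 with h | ⟨k, hk⟩
    · omega
    · have : n ^ 2 / 8 * d = 2 * (n ^ 2 / 8 * k) := by rw [hk]; ring
      omega
  · refine not_congr ⟨fun h => ?_, fun h => dvd_mul_of_dvd_right h _⟩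
    have hc : IsCoprime ((p : ℤ) ^ 2) (n ^ 2) := by
      refine IsCoprime.pow ?_
      exact (hpZ.coprime_iff_not_dvd).mpr hn
    exact hc.dvd_of_dvd_mul_left h

lemma exists_mul_of_mem {U : Finset ℕ} (hU : ∀ p ∈ U, p.Prime) {p : ℕ} (hp : p ∈ U) :
    ∃ m : ℤ, ∏ q ∈ U, (q : ℤ) = p * m ∧ ¬ (p : ℤ) ∣ m := by
  refine ⟨∏ q ∈ U.erase p, (q : ℤ), (Finset.mul_prod_erase U _ hp).symm, fun h => ?_⟩
  obtain ⟨q, hq, hpq⟩ := ((Nat.prime_iff_prime_int.mp (hU p hp)).dvd_finsetProd_iff _).mp h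
  have := (Nat.prime_dvd_prime_iff_eq (hU p hp) (hU q (Finset.mem_of_mem_erase hq))).mp
    (by exact_mod_cast hpq)
  exact (Finset.ne_of_mem_erase hq) this.symm

lemma not_dvd_of_notMem {U : Finset ℕ} (hU : ∀ p ∈ U, p.Prime) {p : ℕ} (hp : p.Prime)
    (h : p ∉ U) : ¬ (p : ℤ) ∣ ∏ q ∈ U, (q : ℤ) := by
  intro hd
  obtain ⟨q, hq, hpq⟩ := ((Nat.prime_iff_prime_int.mp hp).dvd_finsetProd_iff _).mp hd
  have := (Nat.prime_dvd_prime_iff_eq hp (hU q hq)).mp (by exact_mod_cast hpq)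
  exact h (this ▸ hq)

lemma prod_dvd_of_forall {U : Finset ℕ} (hU : ∀ p ∈ U, p.Prime) {z : ℤ}
    (h : ∀ p ∈ U, (p : ℤ) ∣ z) : ∏ q ∈ U, (q : ℤ) ∣ z := by
  refine Finset.prod_dvd_of_coprime (fun p hp q hq hpq => ?_) h
  exact Nat.isCoprime_iff_coprime.mpr ((Nat.coprime_primes (hU p hp) (hU q hq)).mpr hpq)

/-- The forms attached to the fundamental discriminants that are split at `S` are described by
local conditions. -/
theorem exists_hessDvd_iff {S U : Finset ℕ} (hS : ∀ p ∈ S, p.Prime) (hUS : U ⊆ S)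
    {f : Fin 4 → ℤ} :
    (∃ d, HessDvd (∏ p ∈ U, (p : ℤ)) d f ∧ Fund d ∧ ∀ p ∈ S, SplitCond p d) ↔
      ∀ p : ℕ, p.Prime → Loc S U p f := by
  have hU : ∀ p ∈ U, p.Prime := fun p hp => hS p (hUS hp)
  have hn0 : ∏ p ∈ U, (p : ℤ) ≠ 0 :=
    Finset.prod_ne_zero_iff.mpr fun p hp => by exact_mod_cast (hU p hp).ne_zero
  constructor
  · rintro ⟨d, ⟨dA, dB, dC, hdisc⟩, hd⟩ p hp
    have hpZ := Nat.prime_iff_prime_int.mp hp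
    unfold Loc
    split_ifs with h
    · have hpn : (p : ℤ) ∣ ∏ p ∈ U, (p : ℤ) := Finset.dvd_prod_of_mem _ h
      refine ⟨⟨hpn.trans dA, hpn.trans dB, hpn.trans dC⟩, fun h3 => ?_⟩
      obtain ⟨m, hm, hpm⟩ := exists_mul_of_mem hU h
      rw [hdisc, hm] at h3
      have h4 : (p : ℤ) ∣ m ^ 2 * d := by
        refine (mul_dvd_mul_iff_left (pow_ne_zero 2 hpZ.ne_zero)).mp (?_ : (p : ℤ) ^ 2 * p ∣ _)
        convert h3 using 1 <;> ring
      rcases hpZ.dvd_or_dvd h4 with h5 | h5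
      · exact hpm (hpZ.dvd_of_dvd_pow h5)
      · exact (hd.2 p (hUS h)).not_dvd h5
    · rw [hdisc, locD_sq_mul hp (not_dvd_of_notMem hU hp h)]
      exact (fund_and_split_iff hS).mp hd p hp
  · intro h
    have hz : ∀ p ∈ U, HessZero p f ∧ ¬ (p : ℤ) ^ 3 ∣ disc f := fun p hp => by
      have := h p (hU p hp)
      rwa [Loc, if_pos hp] at this
    obtain ⟨A, hA'⟩ := prod_dvd_of_forall hU fun p hp => (hz p hp).1.1
    obtain ⟨B, hB'⟩ := prod_dvd_of_forall hU fun p hp => (hz p hp).1.2.1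
    obtain ⟨C, hC'⟩ := prod_dvd_of_forall hU fun p hp => (hz p hp).1.2.2
    have hdisc : disc f = (∏ p ∈ U, (p : ℤ)) ^ 2 * (B ^ 2 - 4 * A * C) := by
      rw [disc, hA', hB', hC']; ring
    have s1 : A * f 2 - B * f 1 + C * f 0 = 0 := by
      have := syzygy_left f
      rw [hA', hB', hC'] at this
      refine (mul_eq_zero.mp (?_ : (∏ p ∈ U, (p : ℤ)) * _ = 0)).resolve_left hn0
      linear_combination this
    have s2 : A * f 3 - B * f 2 + C * f 1 = 0 := by
      have := syzygy_right f
      rw [hA', hB', hC'] at this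
      refine (mul_eq_zero.mp (?_ : (∏ p ∈ U, (p : ℤ)) * _ = 0)).resolve_left hn0
      linear_combination this
    refine ⟨B ^ 2 - 4 * A * C, ⟨⟨A, hA'⟩, ⟨B, hB'⟩, ⟨C, hC'⟩, hdisc⟩, ?_⟩
    rw [fund_and_split_iff hS]
    intro p hp
    have hpZ := Nat.prime_iff_prime_int.mp hp
    by_cases hpU : p ∈ U
    · rw [LocD, if_pos (hUS hpU)]
      refine splitCond_of_syzygy hp s1 s2 (hz p hpU).1 (fun hf => (hz p hpU).2 ?_)
        fun hd => (hz p hpU).2 ?_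
      · choose g hg using hf
        have e : f = fun i => (p : ℤ) * g i := funext hg
        refine ⟨p * disc g, ?_⟩
        rw [e]
        simp only [disc, hA, hB, hC]
        ring
      · rw [hdisc, pow_succ]
        exact mul_dvd_mul (pow_dvd_pow_of_dvd (Finset.dvd_prod_of_mem _ hpU) 2) hd
    · have := h p hp
      rw [Loc, if_neg hpU, hdisc, locD_sq_mul hp (not_dvd_of_notMem hU hp hpU)] at this
      exact this

/-! ### The local densities -/

lemma hasDensity_of_set {m : ℕ} (hm : 0 < m) {Q : ℤ → Prop} (P : Set (ZMod m))
    (hQ : ∀ d : ℤ, Q d ↔ (d : ZMod m) ∈ P) {δ : ℝ} (hδ : (P.ncard : ℝ) = δ * m) :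
    HasDensity m (fun x : Fin 1 → ℤ => Q (x 0)) δ := by
  refine ⟨hm, {x | x 0 ∈ P}, fun x => hQ _, ?_⟩
  have e : {x : Fin 1 → ZMod m | x 0 ∈ P} = (fun t _ => t) '' P := by
    ext x
    constructor
    · intro h
      exact ⟨x 0, h, funext fun i => by rw [Subsingleton.elim i 0]⟩
    · rintro ⟨t, ht, rfl⟩
      exact ht
  rw [e, Set.ncard_image_of_injective _ (fun s t h => congrFun h 0), hδ]
  simp

lemma hasDensity_int_not_sq_dvd {p : ℕ} (hp : p.Prime) :
    HasDensity (p * p) (fun x : Fin 1 → ℤ => ¬ (p : ℤ) ^ 2 ∣ x 0) (1 - 1 / (p : ℝ) ^ 2) := by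
  have h := hasDensity_of_set (Q := fun d => (p : ℤ) ^ 2 ∣ d) (δ := 1 / (p : ℝ) ^ 2)
    (Nat.mul_pos hp.pos hp.pos) {0} (fun d => ?_) ?_
  · exact h.not
  · rw [Set.mem_singleton_iff, ZMod.intCast_zmod_eq_zero_iff_dvd]
    push_cast
    rw [pow_two]
  · have : (p : ℝ) ≠ 0 := by exact_mod_cast hp.ne_zero
    rw [Set.ncard_singleton]
    push_cast
    field_simp

lemma hasDensity_int_splitCond {p : ℕ} (hp : p.Prime) (h2 : p ≠ 2) :
    HasDensity p (fun x : Fin 1 → ℤ => SplitCond p (x 0)) ((p - 1) / (2 * p)) := by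
  have : Fact p.Prime := ⟨hp⟩
  refine hasDensity_of_set (Q := SplitCond p) hp.pos {x | ∃ e, e ≠ 0 ∧ x = e ^ 2} (fun d => ?_) ?_
  · rw [SplitCond, if_neg h2, Set.mem_ofPred_eq, ← ZMod.intCast_zmod_eq_zero_iff_dvd]
    constructor
    · rintro ⟨⟨x, hx⟩, h⟩
      rw [← ZMod.intCast_zmod_eq_zero_iff_dvd] at hx
      push_cast at hx
      refine ⟨x, fun h0 => h ?_, by linear_combination -hx⟩
      rw [h0] at hx
      linear_combination -hx
    · rintro ⟨e, he, h⟩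
      refine ⟨⟨(e.cast : ℤ), ?_⟩, by rw [h]; exact pow_ne_zero 2 he⟩
      rw [← ZMod.intCast_zmod_eq_zero_iff_dvd]
      push_cast
      rw [h]; simp
  · have : (p : ℝ) ≠ 0 := by exact_mod_cast hp.ne_zero
    have h := two_mul_ncard_nonzero_sq (two_ne_zero_zmod hp h2)
    rw [Nat.card_zmod] at h
    field_simp
    linear_combination h

lemma hasDensity_int_splitCond_two :
    HasDensity 8 (fun x : Fin 1 → ℤ => SplitCond 2 (x 0)) (1 / 8) := by
  refine hasDensity_of_set (Q := SplitCond 2) (by norm_num) {x | x.val = 1} (fun d => ?_) ?_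
  · rw [SplitCond, if_pos rfl, Set.mem_ofPred_eq]
    have := ZMod.val_intCast (n := 8) d
    push_cast at this
    omega
  · rw [Set.ncard_eq_toFinset_card']
    rw [show Finset.card {x : ZMod 8 | x.val = 1}.toFinset = 1 by decide +kernel]
    norm_num

lemma hasDensity_int_two :
    HasDensity 16 (fun x : Fin 1 → ℤ => TwoCond (x 0)) (3 / 8) := by
  refine hasDensity_of_set (Q := TwoCond) (by norm_num)
    {x | x.val % 4 = 1 ∨ x.val = 8 ∨ x.val = 12} (fun d => ?_) ?_
  · rw [TwoCond, Set.mem_ofPred_eq]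
    have := ZMod.val_intCast (n := 16) d
    push_cast at this
    omega
  · rw [Set.ncard_eq_toFinset_card']
    rw [show Finset.card {x : ZMod 16 | x.val % 4 = 1 ∨ x.val = 8 ∨ x.val = 12}.toFinset = 6 by
      decide +kernel]
    norm_num

/-- The density of the discriminants satisfying the local condition at `p`. -/
noncomputable def discDensity (S : Finset ℕ) (p : ℕ) : ℝ :=
  if p ∈ S then (if p = 2 then 1 / 8 else (p - 1) / (2 * p)) else
    if p = 2 then 3 / 8 else 1 - 1 / (p : ℝ) ^ 2

/-- The density of the forms satisfying the local condition at `p`. -/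
noncomputable def formDensity (S U : Finset ℕ) (p : ℕ) : ℝ :=
  (1 - 1 / (p : ℝ) ^ 2) * discDensity S p * (if p ∈ U then 2 / (p : ℝ) ^ 2 else 1) *
    (if p = 2 then 2 else 1)

lemma hasDensity_locD {p : ℕ} (hp : p.Prime) (S : Finset ℕ) :
    HasDensity (p ^ 4) (fun x : Fin 1 → ℤ => LocD S p (x 0)) (discDensity S p) := by
  unfold LocD discDensity
  have hpos := hp.pos
  split_ifs with h h2 h2
  · subst h2
    exact hasDensity_int_splitCond_two.mul_modulus two_pos
  · exact ((hasDensity_int_splitCond hp h2).mul_modulus (pow_pos hpos 3)).congr_density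
      (by ring) rfl
  · subst h2
    exact hasDensity_int_two
  · exact ((hasDensity_int_not_sq_dvd hp).mul_modulus (pow_pos hpos 2)).congr_density
      (by ring) rfl

lemma hasDensity_loc {p : ℕ} (hp : p.Prime) {S U : Finset ℕ} (hUS : U ⊆ S) :
    HasDensity (p ^ 4) (fun f : Fin 4 → ℤ => Loc S U p f) (formDensity S U p) := by
  unfold Loc LocD formDensity discDensity
  have hpos := hp.pos
  have hp0 : (p : ℝ) ≠ 0 := by exact_mod_cast hp.ne_zero
  by_cases hU : p ∈ U
  · simp only [if_pos hU, if_pos (hUS hU)]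
    refine ((hasDensity_hess_not_cube hp).mul_modulus (pow_pos hpos 2)).congr_density
      (by ring) ?_
    split_ifs with h2
    · subst h2; norm_num
    · field_simp
      ring
  · simp only [if_neg hU]
    split_ifs with h h2 h2
    · subst h2
      exact (hasDensity_splitCond_two.mul_modulus (k := 8) (by norm_num)).congr_density
        (by norm_num) (by norm_num)
    · refine ((hasDensity_splitCond hp h2).mul_modulus (pow_pos hpos 3)).congr_density
        (by ring) ?_
      field_simp
      ring
    · subst h2
      exact (hasDensity_two.mul_modulus (k := 4) (by norm_num)).congr_density
        (by norm_num) (by norm_num)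
    · exact ((hasDensity_not_sq_dvd hp h2).mul_modulus (pow_pos hpos 2)).congr_density
        (by ring) (by ring)

/-! ### The sieve -/

section Sieve

open Topology

lemma tendsto_of_sieve {w : ℝ → ℝ} {u v : ℕ → ℝ → ℝ} {L : ℕ → ℝ} {c : ℝ}
    (hu : ∀ M, Tendsto (u M) atTop (𝓝 (L M))) (hv : ∀ M, Tendsto (v M) atTop (𝓝 (L M)))
    (hL : Tendsto L atTop (𝓝 c))
    (hwu : ∀ ε : ℝ, 0 < ε → ∀ᶠ M : ℕ in atTop, ∀ᶠ Y : ℝ in atTop, w Y ≤ u M Y + ε)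
    (hwv : ∀ ε : ℝ, 0 < ε → ∀ᶠ M : ℕ in atTop, ∀ᶠ Y : ℝ in atTop, v M Y - ε ≤ w Y) :
    Tendsto w atTop (𝓝 c) := by
  refine tendsto_order.mpr ⟨fun a ha => ?_, fun a ha => ?_⟩
  · obtain ⟨M, hM1, hM2⟩ := ((hwv ((c - a) / 2) (by linarith)).and
      (hL.eventually_const_lt (show (c + a) / 2 < c by linarith))).exists
    filter_upwards [hM1, (hv M).eventually_const_lt hM2] with Y h1 h2
    linarith
  · obtain ⟨M, hM1, hM2⟩ := ((hwu ((a - c) / 2) (by linarith)).and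
      (hL.eventually_lt_const (show c < (c + a) / 2 by linarith))).exists
    filter_upwards [hM1, (hu M).eventually_lt_const hM2] with Y h1 h2
    linarith

lemma tendsto_bodyZ_density {m : ℕ} {Q : (Fin 4 → ℤ) → Prop} {δ : ℝ} (h : HasDensity m Q δ) (K : ℝ) :
    Tendsto (fun Y : ℝ => (({f : Fin 4 → ℤ | Q f ∧ f ∈ bodyZ K Y}.ncard : ℕ) : ℝ) / Y) atTop
      (𝓝 ((MeasureTheory.volume (truncBody K)).toReal * δ)) ∧
    Tendsto (fun Y : ℝ => (({f : Fin 4 → ℤ | Q f ∧ f ∈ strictZ K Y}.ncard : ℕ) : ℝ) / Y) atTop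
      (𝓝 ((MeasureTheory.volume (truncBody K)).toReal * δ)) := by
  obtain ⟨hm, P, hQ, hP⟩ := h
  have h1 := tendsto_bodyZ hm P K
  have h2 := tendsto_strictZ hm P K
  have e : (P.ncard : ℝ) / (m : ℝ) ^ 4 = δ := by
    have : (m : ℝ) ≠ 0 := by exact_mod_cast hm.ne'
    rw [hP, Fintype.card_fin]
    field_simp
  rw [e] at h1 h2
  simp only [hQ]
  exact ⟨h1, h2⟩

lemma coprime_fourth_powers {T : Finset ℕ} (hT : ∀ p ∈ T, p.Prime) :
    ∀ p ∈ T, ∀ q ∈ T, p ≠ q → (p ^ 4).Coprime (q ^ 4) := fun p hp q hq h =>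
  Nat.Coprime.pow 4 4 ((Nat.coprime_primes (hT p hp) (hT q hq)).mpr h)

lemma Loc.of_gt {S U : Finset ℕ} (hUS : U ⊆ S) {M p : ℕ} (hM : ∀ q ∈ S, q ≤ M) (h2 : 2 ≤ M)
    (hp : M < p) {f : Fin 4 → ℤ} (h : ¬ Loc S U p f) : (p : ℤ) ^ 2 ∣ disc f := by
  have hpS : p ∉ S := fun h => absurd (hM p h) (by omega)
  rw [Loc, if_neg fun h => hpS (hUS h), LocD, if_neg hpS, if_neg (by omega)] at h
  exact not_not.mp h

/-- The number of reduced forms that satisfy all local conditions. -/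
theorem tendsto_ncard_loc {S U : Finset ℕ} (hUS : U ⊆ S) {R : (Fin 4 → ℤ) → Prop}
    (hR1 : ∀ f, SRed f → R f) (hR2 : ∀ f, R f → WRed f) {c : ℝ}
    (hc : Tendsto (fun M : ℕ => ∏ p ∈ (M + 1).primesBelow, formDensity S U p) atTop (𝓝 c)) :
    Tendsto (fun Y : ℝ => (({f : Fin 4 → ℤ | R f ∧ f 0 ≠ 0 ∧ (-disc f : ℝ) < Y ∧
      ∀ p : ℕ, p.Prime → Loc S U p f}.ncard : ℕ) : ℝ) / Y) atTop (𝓝 (Real.pi ^ 2 / 6 * c)) := by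
  have hprime : ∀ M : ℕ, ∀ p ∈ (M + 1).primesBelow, p.Prime := fun M p hp =>
    Nat.prime_of_mem_primesBelow hp
  have hden := fun M : ℕ => HasDensity.prod (M + 1).primesBelow (fun p => p ^ 4)
    (coprime_fourth_powers (hprime M)) (fun p hp => hasDensity_loc (hprime M p hp) hUS)
  refine tendsto_of_sieve (fun M => (tendsto_bodyZ_density (hden M) (16 ^ M)).1)
    (fun M => (tendsto_bodyZ_density (hden M) (16 ^ M)).2)
    (tendsto_volume_truncBody.mul hc) (fun ε hε => ?_) (fun ε hε => ?_)
  · obtain ⟨J, hJ⟩ := pow_unbounded_of_one_lt (1000000 / ε) (by norm_num : (1 : ℝ) < 4)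
    filter_upwards [eventually_ge_atTop J] with M hM
    filter_upwards [eventually_gt_atTop 0] with Y hY
    have hT0 : 0 < √(√Y) := Real.sqrt_pos.mpr (Real.sqrt_pos.mpr hY)
    have hcusp := ncard_cusp_le M hT0
    rw [fourth_root_pow hY.le] at hcusp
    set W := {f : Fin 4 → ℤ | R f ∧ f 0 ≠ 0 ∧ (-disc f : ℝ) < Y ∧ ∀ p : ℕ, p.Prime → Loc S U p f}
    set V := {f : Fin 4 → ℤ | (∀ p ∈ (M + 1).primesBelow, Loc S U p f) ∧ f ∈ bodyZ (16 ^ M) Y}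
    set C := {f : Fin 4 → ℤ | WRed f ∧ (-disc f : ℝ) < Y ∧ f 0 ≠ 0 ∧ 16 ^ M * hA f ≤ hC f}
    have hfin := finite_wRed_lt Y
    have hsub : W ⊆ V ∪ C := by
      rintro f ⟨h1, h2, h3, h4⟩
      by_cases h : 16 ^ M * hA f ≤ hC f
      · exact Or.inr ⟨hR2 f h1, h3, h2, h⟩
      · exact Or.inl ⟨fun p hp => h4 p (hprime M p hp), hR2 f h1, h3, h2,
          by exact_mod_cast not_le.mp h⟩
    have hle : W.ncard ≤ V.ncard + C.ncard :=
      (Set.ncard_le_ncard hsub ((hfin.subset fun f hf => ⟨hf.2.1, hf.2.2.1⟩).union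
        (hfin.subset fun f hf => ⟨hf.1, hf.2.1⟩))).trans (Set.ncard_union_le _ _)
    have hle' : (W.ncard : ℝ) ≤ V.ncard + C.ncard := by exact_mod_cast hle
    have h4 : (1000000 : ℝ) / 4 ^ M ≤ ε := by
      rw [div_le_iff₀ (by positivity)]
      rw [div_lt_iff₀ hε] at hJ
      have : (4 : ℝ) ^ J ≤ 4 ^ M := pow_le_pow_right₀ (by norm_num) hM
      nlinarith
    rw [div_le_iff₀ hY, add_mul, div_mul_cancel₀ _ hY.ne']
    have : 1000000 * Y / 4 ^ M ≤ ε * Y := by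
      rw [mul_div_right_comm]
      exact mul_le_mul_of_nonneg_right h4 hY.le
    linarith
  · filter_upwards [ncard_tail_le hε, eventually_ge_atTop 2, eventually_ge_atTop (S.sup id)]
      with M hM h2M hSM
    filter_upwards [eventually_gt_atTop 0, hM] with Y hY htail
    set W := {f : Fin 4 → ℤ | R f ∧ f 0 ≠ 0 ∧ (-disc f : ℝ) < Y ∧ ∀ p : ℕ, p.Prime → Loc S U p f}
    set V := {f : Fin 4 → ℤ | (∀ p ∈ (M + 1).primesBelow, Loc S U p f) ∧ f ∈ strictZ (16 ^ M) Y}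
    set C := {f : Fin 4 → ℤ | SRed f ∧ (-disc f : ℝ) < Y ∧ f 0 ≠ 0 ∧
      ∃ p : ℕ, p.Prime ∧ M < p ∧ (p : ℤ) ^ 2 ∣ disc f}
    have hfin := finite_wRed_lt Y
    have hsub : V ⊆ W ∪ C := by
      rintro f ⟨h1, ⟨h2, h3, h4, -⟩, h5, h6⟩
      have hs : SRed f := ⟨h2.1, (abs_lt.mp h5).1, (abs_lt.mp h5).2.le, h6⟩
      by_cases h : ∀ p : ℕ, p.Prime → Loc S U p f
      · exact Or.inl ⟨hR1 f hs, h4, h3, h⟩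
      · push Not at h
        obtain ⟨p, hp, hpf⟩ := h
        have hMp : M < p := by
          by_contra hMp
          exact hpf (h1 p (Nat.mem_primesBelow.mpr ⟨by omega, hp⟩))
        exact Or.inr ⟨hs, h3, h4, p, hp, hMp, Loc.of_gt hUS
          (fun q hq => (Finset.le_sup (f := id) hq).trans hSM) h2M hMp hpf⟩
    have hle : V.ncard ≤ W.ncard + C.ncard :=
      (Set.ncard_le_ncard hsub ((hfin.subset fun f hf => ⟨hR2 f hf.1, hf.2.2.1⟩).union
        (hfin.subset fun f hf => ⟨hf.1.wRed, hf.2.1⟩))).trans (Set.ncard_union_le _ _)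
    have hle' : (V.ncard : ℝ) ≤ W.ncard + C.ncard := by exact_mod_cast hle
    rw [le_div_iff₀ hY, sub_mul, div_mul_cancel₀ _ hY.ne']
    linarith

end Sieve

section Products

open Topology

lemma tendsto_prod_primesBelow_zeta :
    Tendsto (fun M : ℕ => ∏ p ∈ (M + 1).primesBelow, (1 - 1 / (p : ℝ) ^ 2)) atTop
      (𝓝 (6 / Real.pi ^ 2)) := by
  have h := riemannZeta_eulerProduct (s := 2) (by norm_num)
  rw [riemannZeta_two] at h
  have h1 := (Complex.continuous_re.tendsto _).comp (h.comp (tendsto_add_atTop_nat 1))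
  have e : ((Real.pi : ℂ) ^ 2 / 6).re = Real.pi ^ 2 / 6 := by
    rw [show ((Real.pi : ℂ) ^ 2 / 6) = ((Real.pi ^ 2 / 6 : ℝ) : ℂ) by push_cast; rfl]
    exact Complex.ofReal_re _
  rw [e] at h1
  have h2 := h1.inv₀ (by positivity)
  rw [inv_div] at h2
  refine h2.congr fun M => ?_
  simp only [Function.comp_apply]
  rw [show (∏ p ∈ (M + 1).primesBelow, (1 - (p : ℂ) ^ (-2 : ℂ))⁻¹) =
    ((∏ p ∈ (M + 1).primesBelow, (1 - 1 / (p : ℝ) ^ 2)⁻¹ : ℝ) : ℂ) by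
      push_cast
      refine Finset.prod_congr rfl fun p _ => ?_
      rw [Complex.cpow_neg, one_div]
      norm_cast, Complex.ofReal_re, Finset.prod_inv_distrib, inv_inv]

lemma eventually_prod_primesBelow {T : Finset ℕ} (hT : ∀ p ∈ T, p.Prime) {g : ℕ → ℝ}
    (hg : ∀ p, p ∉ T → g p = 1) :
    ∀ᶠ M : ℕ in atTop, ∏ p ∈ (M + 1).primesBelow, g p = ∏ p ∈ T, g p := by
  filter_upwards [eventually_ge_atTop (T.sup id)] with M hM
  symm
  refine Finset.prod_subset (fun p hp => ?_) fun p _ hp => hg p hp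
  have := (Finset.le_sup (f := id) hp).trans hM
  exact Nat.mem_primesBelow.mpr ⟨Nat.lt_succ_of_le this, hT p hp⟩

lemma one_sub_inv_sq_pos {p : ℕ} (hp : p.Prime) : (0 : ℝ) < 1 - 1 / (p : ℝ) ^ 2 := by
  have h2 : (2 : ℝ) ≤ p := by exact_mod_cast hp.two_le
  rw [sub_pos, div_lt_one (by positivity)]
  nlinarith

lemma discDensity_pos {p : ℕ} (hp : p.Prime) (S : Finset ℕ) : 0 < discDensity S p := by
  have h2 : (2 : ℝ) ≤ p := by exact_mod_cast hp.two_le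
  unfold discDensity
  split_ifs
  · norm_num
  · exact div_pos (by linarith) (by linarith)
  · norm_num
  · exact one_sub_inv_sq_pos hp

lemma exists_tendsto_discDensity {S : Finset ℕ} (hS : ∀ p ∈ S, p.Prime) : ∃ δ : ℝ, 0 < δ ∧
    Tendsto (fun M : ℕ => ∏ p ∈ (M + 1).primesBelow, discDensity S p) atTop (𝓝 δ) := by
  set g : ℕ → ℝ := fun p => if p ∈ insert 2 S then discDensity S p / (1 - 1 / (p : ℝ) ^ 2) else 1
    with hg
  have hT : ∀ p ∈ insert 2 S, p.Prime := by
    intro p hp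
    rcases Finset.mem_insert.mp hp with rfl | hp
    · exact Nat.prime_two
    · exact hS p hp
  have hpos : 0 < ∏ p ∈ insert 2 S, g p := Finset.prod_pos fun p hp => by
    rw [hg]
    beta_reduce
    rw [if_pos hp]
    exact div_pos (discDensity_pos (hT p hp) S) (one_sub_inv_sq_pos (hT p hp))
  refine ⟨6 / Real.pi ^ 2 * ∏ p ∈ insert 2 S, g p, by positivity, ?_⟩
  refine (tendsto_prod_primesBelow_zeta.mul_const _).congr' ?_
  filter_upwards [eventually_prod_primesBelow hT (g := g) fun p hp => if_neg hp] with M hM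
  rw [← hM, ← Finset.prod_mul_distrib]
  refine Finset.prod_congr rfl fun p hp => ?_
  rw [hg]
  beta_reduce
  have h0 := one_sub_inv_sq_pos (Nat.prime_of_mem_primesBelow hp)
  split_ifs with h
  · rw [mul_div_cancel₀ _ h0.ne']
  · rw [Finset.mem_insert, not_or] at h
    rw [discDensity, if_neg h.2, if_neg h.1, mul_one]

lemma tendsto_formDensity {S U : Finset ℕ} (hU : ∀ p ∈ U, p.Prime) {δ : ℝ}
    (h : Tendsto (fun M : ℕ => ∏ p ∈ (M + 1).primesBelow, discDensity S p) atTop (𝓝 δ)) :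
    Tendsto (fun M : ℕ => ∏ p ∈ (M + 1).primesBelow, formDensity S U p) atTop
      (𝓝 (6 / Real.pi ^ 2 * δ * (∏ p ∈ U, 2 / (p : ℝ) ^ 2) * 2)) := by
  refine (((tendsto_prod_primesBelow_zeta.mul h).mul_const _).mul_const _).congr' ?_
  filter_upwards [eventually_prod_primesBelow hU (g := fun p => if p ∈ U then 2 / (p : ℝ) ^ 2 else 1)
    fun p hp => if_neg hp, eventually_prod_primesBelow (T := {2}) (by simp [Nat.prime_two])
    (g := fun p => if p = 2 then 2 else 1) fun p hp => if_neg (by simpa using hp)] with M h1 h2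
  simp only [Finset.prod_singleton, if_true] at h2
  rw [Finset.prod_congr rfl fun p hp => if_pos hp] at h1
  simp only [formDensity, Finset.prod_mul_distrib]
  rw [h1, h2]

end Products

section Discriminants

open Topology MeasureTheory

/-- The interval in which the discriminants are counted. -/
def unitRegion : Set (Fin 1 → ℝ) := Set.univ.pi fun _ => Set.Ioo (-1) 0

lemma mem_unitRegion {x : Fin 1 → ℝ} : x ∈ unitRegion ↔ -1 < x 0 ∧ x 0 < 0 := by
  simp [unitRegion, Set.mem_pi]

lemma nice_unitRegion : Nice unitRegion := by
  have h1 := nice_pos (g := fun x : Fin 1 → ℝ => x 0 + 1) (MvPolynomial.X 0 + 1) (fun x => by simp)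
    0 (by simp)
  have h2 := nice_pos (g := fun x : Fin 1 → ℝ => -x 0) (-MvPolynomial.X 0) (fun x => by simp)
    1 (by simp)
  convert h1.inter h2 using 1
  ext x
  rw [mem_unitRegion]
  simp only [Set.mem_inter_iff, Set.mem_ofPred_eq]
  constructor <;> rintro ⟨h, h'⟩ <;> constructor <;> linarith

lemma volume_unitRegion : (volume unitRegion).toReal = 1 := by
  rw [unitRegion, Real.volume_pi_Ioo]
  simp

lemma tendsto_disc_density {m : ℕ} {Q : (Fin 1 → ℤ) → Prop} {δ : ℝ} (h : HasDensity m Q δ) :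
    Tendsto (fun X : ℝ => (({x : Fin 1 → ℤ | Q x ∧ x 0 < 0 ∧ -X < (x 0 : ℝ)}.ncard : ℕ) : ℝ) / X)
      atTop (𝓝 δ) := by
  obtain ⟨hm, P, hQ, hP⟩ := h
  have hb : Bornology.IsBounded unitRegion :=
    Bornology.IsBounded.pi fun _ => Metric.isBounded_Ioo _ _
  have h1 := tendsto_latticeMod hm P hb nice_unitRegion
  have e : (P.ncard : ℝ) / (m : ℝ) ^ Fintype.card (Fin 1) = δ := by
    have : (m : ℝ) ≠ 0 := by exact_mod_cast hm.ne'
    rw [hP]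
    field_simp
  rw [e, volume_unitRegion, one_mul] at h1
  refine h1.congr' ?_
  filter_upwards [eventually_gt_atTop 0] with X hX
  rw [Fintype.card_fin, pow_one]
  congr 3
  ext x
  simp only [Set.mem_ofPred_eq, hQ, mem_unitRegion, lt_div_iff₀ hX, div_lt_iff₀ hX]
  refine and_congr_right fun _ => ?_
  rw [zero_mul, neg_one_mul, Int.cast_lt_zero, and_comm]

lemma finite_neg_gt (X : ℝ) : {x : Fin 1 → ℤ | x 0 < 0 ∧ -X < (x 0 : ℝ)}.Finite := by
  refine (Set.Finite.image (fun t _ => t) (Set.finite_Icc (-⌈X⌉) 0)).subset ?_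
  rintro x ⟨h1, h2⟩
  refine ⟨x 0, ⟨?_, h1.le⟩, funext fun i => by rw [Subsingleton.elim i 0]⟩
  have : ((-⌈X⌉ : ℤ) : ℝ) < x 0 := by
    push_cast
    linarith [Int.le_ceil X]
  exact_mod_cast this.le

lemma ncard_sq_dvd_le {X : ℝ} (hX : 0 < X) {p : ℕ} (hp : 0 < p) :
    (({x : Fin 1 → ℤ | (x 0 < 0 ∧ -X < (x 0 : ℝ)) ∧ (p : ℤ) ^ 2 ∣ x 0}.ncard : ℕ) : ℝ) ≤
      X * ((p : ℝ) ^ 2)⁻¹ := by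
  have hp0 : (0 : ℝ) < (p : ℝ) ^ 2 := by positivity
  have hsub : {x : Fin 1 → ℤ | (x 0 < 0 ∧ -X < (x 0 : ℝ)) ∧ (p : ℤ) ^ 2 ∣ x 0} ⊆
      ((fun (k : ℕ) (_ : Fin 1) => -((p : ℤ) ^ 2 * k)) '' (Finset.Icc 1 ⌊X / p ^ 2⌋₊ : Finset ℕ)) := by
    rintro x ⟨⟨h1, h2⟩, k, hk⟩
    have hk0 : k < 0 := by
      by_contra h
      have : 0 ≤ (p : ℤ) ^ 2 * k := mul_nonneg (by positivity) (not_lt.mp h)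
      omega
    obtain ⟨l, rfl⟩ : ∃ l : ℕ, k = -l := ⟨k.natAbs, by omega⟩
    refine ⟨l, ?_, funext fun i => by rw [Subsingleton.elim i 0, hk]; ring⟩
    rw [Finset.mem_coe, Finset.mem_Icc]
    refine ⟨by omega, Nat.le_floor ?_⟩
    rw [le_div_iff₀ hp0]
    rw [hk] at h2
    push_cast at h2
    linarith
  have h := (Set.ncard_le_ncard hsub (Set.toFinite _)).trans (Set.ncard_image_le (Set.toFinite _))
  rw [Set.ncard_coe_finset, Nat.card_Icc, Nat.add_sub_cancel] at h
  refine (Nat.cast_le.mpr h).trans ((Nat.floor_le (by positivity)).trans ?_)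
  rw [div_eq_mul_inv]

lemma ncard_disc_tail_le {X : ℝ} (hX : 0 < X) {M : ℕ} (hM : 0 < M) :
    (({x : Fin 1 → ℤ | (x 0 < 0 ∧ -X < (x 0 : ℝ)) ∧ ∃ p : ℕ, M < p ∧ (p : ℤ) ^ 2 ∣ x 0}.ncard : ℕ) : ℝ)
      ≤ X * (M : ℝ)⁻¹ := by
  classical
  set N := max M ⌊X⌋₊
  have hsub : {x : Fin 1 → ℤ | (x 0 < 0 ∧ -X < (x 0 : ℝ)) ∧ ∃ p : ℕ, M < p ∧ (p : ℤ) ^ 2 ∣ x 0} ⊆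
      ⋃ p ∈ Finset.Ioc M N, {x : Fin 1 → ℤ | (x 0 < 0 ∧ -X < (x 0 : ℝ)) ∧ (p : ℤ) ^ 2 ∣ x 0} := by
    rintro x ⟨h, p, hp, hd⟩
    refine Set.mem_biUnion (x := p) ?_ ⟨h, hd⟩
    rw [Finset.mem_coe, Finset.mem_Ioc]
    refine ⟨hp, le_max_of_le_right (Nat.le_floor ?_)⟩
    have h1 : (p : ℤ) ^ 2 ≤ -x 0 := Int.le_of_dvd (by linarith [h.1]) (dvd_neg.mpr hd)
    have h2 : (p : ℤ) ≤ -x 0 := by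
      have : (1 : ℤ) ≤ p := by exact_mod_cast (by omega : 1 ≤ p)
      nlinarith
    have h3 : (p : ℝ) ≤ -(x 0 : ℝ) := by exact_mod_cast h2
    linarith [h.2]
  have hle := (Set.ncard_le_ncard hsub (Set.Finite.biUnion (Finset.finite_toSet _) fun p _ =>
    (finite_neg_gt X).subset fun x hx => hx.1)).trans (Finset.set_ncard_biUnion_le _ _)
  refine (Nat.cast_le.mpr hle).trans ?_
  push_cast
  refine (Finset.sum_le_sum fun p hp => ncard_sq_dvd_le hX
    (lt_trans hM (Finset.mem_Ioc.mp hp).1)).trans ?_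
  rw [← Finset.mul_sum]
  refine mul_le_mul_of_nonneg_left ((sum_Ioc_inv_sq_le_sub hM.ne' (le_max_left _ _)).trans ?_) hX.le
  have : (0 : ℝ) ≤ (N : ℝ)⁻¹ := by positivity
  linarith

lemma LocD.of_gt {S : Finset ℕ} {M p : ℕ} (hM : ∀ q ∈ S, q ≤ M) (h2 : 2 ≤ M)
    (hp : M < p) {d : ℤ} (h : ¬ LocD S p d) : (p : ℤ) ^ 2 ∣ d := by
  have hpS : p ∉ S := fun h => absurd (hM p h) (by omega)
  rw [LocD, if_neg hpS, if_neg (by omega)] at h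
  exact not_not.mp h

/-- The discriminants in the family up to `X`. -/
def famD (S : Finset ℕ) (X : ℝ) : Set ℤ :=
  {d | (d < 0 ∧ -X < (d : ℝ)) ∧ ∀ p : ℕ, p.Prime → LocD S p d}

lemma finite_famD (S : Finset ℕ) (X : ℝ) : (famD S X).Finite :=
  ((finite_neg_gt X).image fun x => x 0).subset fun d hd => ⟨fun _ => d, hd.1, rfl⟩

/-- The number of discriminants in the family. -/
theorem tendsto_ncard_famD {S : Finset ℕ} {δ : ℝ}
    (hc : Tendsto (fun M : ℕ => ∏ p ∈ (M + 1).primesBelow, discDensity S p) atTop (𝓝 δ)) :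
    Tendsto (fun X : ℝ => ((famD S X).ncard : ℝ) / X) atTop (𝓝 δ) := by
  have hprime : ∀ M : ℕ, ∀ p ∈ (M + 1).primesBelow, p.Prime := fun M p hp =>
    Nat.prime_of_mem_primesBelow hp
  have hden := fun M : ℕ => HasDensity.prod (M + 1).primesBelow (fun p => p ^ 4)
    (coprime_fourth_powers (hprime M)) (fun p hp => hasDensity_locD (hprime M p hp) S)
  have e : ∀ X : ℝ, (famD S X).ncard =
      {x : Fin 1 → ℤ | (x 0 < 0 ∧ -X < (x 0 : ℝ)) ∧ ∀ p : ℕ, p.Prime → LocD S p (x 0)}.ncard := by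
    intro X
    rw [← Set.ncard_image_of_injective (famD S X) (f := fun (d : ℤ) (_ : Fin 1) => d)
      (fun s t h => congrFun h 0)]
    congr 1
    ext x
    constructor
    · rintro ⟨d, hd, rfl⟩
      exact hd
    · intro hx
      exact ⟨x 0, hx, funext fun i => by rw [Subsingleton.elim i 0]⟩
  simp only [e]
  refine tendsto_of_sieve (fun M => tendsto_disc_density (hden M))
    (fun M => tendsto_disc_density (hden M)) hc (fun ε hε => ?_) (fun ε hε => ?_)
  · refine Eventually.of_forall fun M => ?_
    filter_upwards [eventually_gt_atTop 0] with X hX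
    have hsub : {x : Fin 1 → ℤ | (x 0 < 0 ∧ -X < (x 0 : ℝ)) ∧ ∀ p : ℕ, p.Prime → LocD S p (x 0)} ⊆
        {x | (∀ p ∈ (M + 1).primesBelow, LocD S p (x 0)) ∧ x 0 < 0 ∧ -X < (x 0 : ℝ)} :=
      fun x hx => ⟨fun p hp => hx.2 p (hprime M p hp), hx.1⟩
    have hle := Nat.cast_le (α := ℝ).mpr
      (Set.ncard_le_ncard hsub ((finite_neg_gt X).subset fun x hx => hx.2))
    have := div_le_div_of_nonneg_right hle hX.le
    linarith
  · have hlim : ∀ᶠ M : ℕ in atTop, (M : ℝ)⁻¹ ≤ ε :=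
      tendsto_inv_atTop_nhds_zero_nat.eventually_le_const hε
    filter_upwards [hlim, eventually_ge_atTop 2, eventually_ge_atTop (S.sup id)] with M hM h2M hSM
    filter_upwards [eventually_gt_atTop 0] with X hX
    have htail := ncard_disc_tail_le hX (M := M) (by omega)
    set W := {x : Fin 1 → ℤ | (x 0 < 0 ∧ -X < (x 0 : ℝ)) ∧ ∀ p : ℕ, p.Prime → LocD S p (x 0)}
    set V := {x : Fin 1 → ℤ | (∀ p ∈ (M + 1).primesBelow, LocD S p (x 0)) ∧ x 0 < 0 ∧ -X < (x 0 : ℝ)}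
    set C := {x : Fin 1 → ℤ | (x 0 < 0 ∧ -X < (x 0 : ℝ)) ∧ ∃ p : ℕ, M < p ∧ (p : ℤ) ^ 2 ∣ x 0}
    have hfin := finite_neg_gt X
    have hsub : V ⊆ W ∪ C := by
      rintro x ⟨h1, h2⟩
      by_cases h : ∀ p : ℕ, p.Prime → LocD S p (x 0)
      · exact Or.inl ⟨h2, h⟩
      · push Not at h
        obtain ⟨p, hp, hpf⟩ := h
        have hMp : M < p := by
          by_contra hMp
          exact hpf (h1 p (Nat.mem_primesBelow.mpr ⟨by omega, hp⟩))
        exact Or.inr ⟨h2, p, hMp, LocD.of_gt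
          (fun q hq => (Finset.le_sup (f := id) hq).trans hSM) h2M hMp hpf⟩
    have hle : V.ncard ≤ W.ncard + C.ncard :=
      (Set.ncard_le_ncard hsub ((hfin.subset fun f hf => hf.1).union
        (hfin.subset fun f hf => hf.1))).trans (Set.ncard_union_le _ _)
    have hle' : (V.ncard : ℝ) ≤ W.ncard + C.ncard := by exact_mod_cast hle
    have h3 : X * (M : ℝ)⁻¹ ≤ X * ε := mul_le_mul_of_nonneg_left hM hX.le
    rw [le_div_iff₀ hX, sub_mul, div_mul_cancel₀ _ hX.ne']
    linarith

end Discriminants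

section Average

open Topology

lemma sum_ncard_forms {S U : Finset ℕ} (hS : ∀ p ∈ S, p.Prime) (hUS : U ⊆ S)
    {R : (Fin 4 → ℤ) → Prop} (hR : ∀ f, R f → WRed f) (X : ℝ) :
    ∑ d ∈ (finite_famD S X).toFinset, (forms R (∏ p ∈ U, (p : ℤ)) d).ncard =
      {f : Fin 4 → ℤ | R f ∧ f 0 ≠ 0 ∧ (-disc f : ℝ) < (∏ p ∈ U, (p : ℝ)) ^ 2 * X ∧
        ∀ p : ℕ, p.Prime → Loc S U p f}.ncard := by
  classical
  have hn0 : (0 : ℤ) < ∏ p ∈ U, (p : ℤ) :=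
    Finset.prod_pos fun p hp => by exact_mod_cast (hS p (hUS hp)).pos
  have ecast : (∏ p ∈ U, (p : ℝ)) = ((∏ p ∈ U, (p : ℤ) : ℤ) : ℝ) := by push_cast; rfl
  rw [ecast]
  have hloc := fun f => exists_hessDvd_iff hS hUS (f := f)
  generalize ∏ p ∈ U, (p : ℤ) = n at *
  have hn0' : (0 : ℝ) < n := by exact_mod_cast hn0
  have hfin : {f : Fin 4 → ℤ | R f ∧ f 0 ≠ 0 ∧ (-disc f : ℝ) < (n : ℝ) ^ 2 * X ∧
        ∀ p : ℕ, p.Prime → Loc S U p f}.Finite :=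
    (finite_wRed_lt _).subset fun f hf => ⟨hR f hf.1, hf.2.2.1⟩
  have hiff : ∀ (d : ℤ) (f : Fin 4 → ℤ), d ∈ famD S X ∧ f ∈ forms R n d ↔
      (R f ∧ f 0 ≠ 0 ∧ (-disc f : ℝ) < (n : ℝ) ^ 2 * X ∧ ∀ p : ℕ, p.Prime → Loc S U p f) ∧
        disc f = n ^ 2 * d := by
    intro d f
    constructor
    · rintro ⟨⟨⟨h1, h2⟩, h3⟩, ⟨h4, h5⟩, h6⟩
      refine ⟨⟨h5, h6, ?_, (hloc f).mp ⟨d, h4, (fund_and_split_iff hS).mpr h3⟩⟩, h4.2.2.2⟩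
      rw [h4.2.2.2]
      push_cast
      rw [← mul_neg]
      exact mul_lt_mul_of_pos_left (by linarith) (by positivity)
    · rintro ⟨⟨h1, h2, h3, h4⟩, h5⟩
      obtain ⟨d', h6, h7⟩ := (hloc f).mpr h4
      obtain rfl : d = d' := by
        have := h6.2.2.2
        rw [h5] at this
        exact mul_left_cancel₀ (pow_ne_zero 2 hn0.ne') this
      have hneg : disc f < 0 := by
        have := (wRed_cast.mpr (hR f h1)).disc_neg
        rw [disc_cast] at this
        exact_mod_cast this
      refine ⟨⟨⟨?_, ?_⟩, (fund_and_split_iff hS).mp h7⟩, ⟨h6, h1⟩, h2⟩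
      · rw [h5] at hneg
        exact neg_of_mul_neg_right hneg (sq_nonneg n)
      · rw [h5] at h3
        push_cast at h3
        rw [← mul_neg] at h3
        have := lt_of_mul_lt_mul_left h3 (by positivity)
        linarith
  rw [Set.ncard_eq_toFinset_card _ hfin]
  rw [Finset.card_eq_sum_card_fiberwise (f := fun f => disc f / n ^ 2)
    (t := (finite_famD S X).toFinset)]
  · refine Finset.sum_congr rfl fun d hd => ?_
    rw [← Set.ncard_coe_finset]
    congr 1
    ext f
    have hd' : d ∈ famD S X := (finite_famD S X).mem_toFinset.mp hd
    rw [Finset.mem_coe, Finset.mem_filter, Set.Finite.mem_toFinset, Set.mem_ofPred_eq]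
    constructor
    · intro hf
      have h := (hiff d f).mp ⟨hd', hf⟩
      refine ⟨h.1, ?_⟩
      rw [h.2]
      exact Int.mul_ediv_cancel_left d (pow_ne_zero 2 hn0.ne')
    · rintro ⟨h1, h2⟩
      refine ((hiff d f).mpr ⟨h1, ?_⟩).2
      obtain ⟨d', h6, -⟩ := (hloc f).mpr h1.2.2.2
      rw [← h2, h6.2.2.2, Int.mul_ediv_cancel_left d' (pow_ne_zero 2 hn0.ne')]
  · intro f hf
    rw [Finset.mem_coe, Set.Finite.mem_toFinset, Set.mem_ofPred_eq] at hf
    obtain ⟨d', h6, -⟩ := (hloc f).mpr hf.2.2.2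
    beta_reduce
    rw [Finset.mem_coe, Set.Finite.mem_toFinset, h6.2.2.2,
      Int.mul_ediv_cancel_left d' (pow_ne_zero 2 hn0.ne')]
    exact ((hiff d' f).mpr ⟨hf, h6.2.2.2⟩).1

lemma sum_two_pow_card (S : Finset ℕ) : ∑ U ∈ S.powerset, (2 : ℝ) ^ U.card = 3 ^ S.card := by
  have := Finset.sum_pow_mul_eq_add_pow (2 : ℝ) 1 S
  norm_num at this
  exact this

lemma tendsto_sum_forms {S : Finset ℕ} (hS : ∀ p ∈ S, p.Prime) {δ : ℝ}
    (hδ : Tendsto (fun M : ℕ => ∏ p ∈ (M + 1).primesBelow, discDensity S p) atTop (𝓝 δ))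
    {R : (Fin 4 → ℤ) → Prop} (hR1 : ∀ f, SRed f → R f) (hR2 : ∀ f, R f → WRed f) :
    Tendsto (fun X : ℝ => (∑ d ∈ (finite_famD S X).toFinset,
      ∑ U ∈ S.powerset, ((forms R (∏ p ∈ U, (p : ℤ)) d).ncard : ℝ)) / X) atTop
      (𝓝 (2 * δ * 3 ^ S.card)) := by
  rw [← sum_two_pow_card, Finset.mul_sum]
  have key : ∀ U ∈ S.powerset, Tendsto (fun X : ℝ => (({f : Fin 4 → ℤ | R f ∧ f 0 ≠ 0 ∧
      (-disc f : ℝ) < (∏ p ∈ U, (p : ℝ)) ^ 2 * X ∧ ∀ p : ℕ, p.Prime → Loc S U p f}.ncard : ℕ) : ℝ) / X)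
      atTop (𝓝 (2 * δ * 2 ^ U.card)) := by
    intro U hU
    have hUS := Finset.mem_powerset.mp hU
    have hn : (0 : ℝ) < ∏ p ∈ U, (p : ℝ) :=
      Finset.prod_pos fun p hp => by exact_mod_cast (hS p (hUS hp)).pos
    have h1 := tendsto_ncard_loc hUS hR1 hR2
      (tendsto_formDensity (fun p hp => hS p (hUS hp)) hδ)
    have h2 := (h1.comp (tendsto_id.const_mul_atTop (pow_pos hn 2))).mul_const
      ((∏ p ∈ U, (p : ℝ)) ^ 2)
    rw [Finset.prod_div_distrib, Finset.prod_const, Finset.prod_pow] at h2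
    have e : Real.pi ^ 2 / 6 * (6 / Real.pi ^ 2 * δ * (2 ^ U.card / (∏ p ∈ U, (p : ℝ)) ^ 2) * 2) *
        (∏ p ∈ U, (p : ℝ)) ^ 2 = 2 * δ * 2 ^ U.card := by
      have := Real.pi_ne_zero
      field_simp
    rw [e] at h2
    refine h2.congr' ?_
    filter_upwards [eventually_gt_atTop 0] with X hX
    simp only [Function.comp_apply, id]
    field_simp
  refine (tendsto_finsetSum _ key).congr fun X => ?_
  rw [Finset.sum_comm, Finset.sum_div]
  refine Finset.sum_congr rfl fun U hU => ?_
  rw [← sum_ncard_forms hS (Finset.mem_powerset.mp hU) hR2]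
  push_cast
  rfl

lemma sum_small_le {S : Finset ℕ} {E : ℤ → ℝ} (hE : ∀ d, 0 ≤ E d) (X : ℝ) :
    ∑ d ∈ (finite_famD S X).toFinset, (if -4 ≤ d then E d else 0) ≤ ∑ d ∈ Finset.Icc (-4) 0, E d := by
  rw [← Finset.sum_filter]
  refine Finset.sum_le_sum_of_subset_of_nonneg (fun d hd => ?_) fun d _ _ => hE d
  rw [Finset.mem_filter, Set.Finite.mem_toFinset] at hd
  exact Finset.mem_Icc.mpr ⟨hd.2, hd.1.1.1.le⟩

lemma tendsto_add_const_div {c L : ℝ} {g : ℝ → ℝ} (h : Tendsto (fun X => g X / X) atTop (𝓝 L)) :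
    Tendsto (fun X => (g X + c) / X) atTop (𝓝 L) := by
  have := h.add (tendsto_const_nhds (x := c).div_atTop tendsto_id)
  rw [add_zero] at this
  refine this.congr fun X => ?_
  rw [add_div]
  rfl

theorem tendsto_sum_torsion {S : Finset ℕ} (hS : ∀ p ∈ S, p.Prime) {δ : ℝ}
    (hδ : Tendsto (fun M : ℕ => ∏ p ∈ (M + 1).primesBelow, discDensity S p) atTop (𝓝 δ)) :
    Tendsto (fun X : ℝ => (∑ d ∈ (finite_famD S X).toFinset,
      (Nat.card {x : ClS S d // x ^ 3 = 1} : ℝ)) / X) atTop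
      (𝓝 (δ * (1 + 3 ^ (-(S.card : ℤ))))) := by
  set h : ℤ → ℝ := fun d => (Nat.card {x : ClS S d // x ^ 3 = 1} : ℝ) with hh
  set k : ((Fin 4 → ℤ) → Prop) → ℤ → ℝ := fun R d =>
    ∑ U ∈ S.powerset, ((forms R (∏ p ∈ U, (p : ℤ)) d).ncard : ℝ) with hk
  set c : ℝ := 2 * 3 ^ S.card with hc
  have hc0 : 0 < c := by positivity
  have hk0 : ∀ R d, 0 ≤ k R d := fun R d => Finset.sum_nonneg fun _ _ => Nat.cast_nonneg _
  have hh0 : ∀ d, 0 ≤ h d := fun d => Nat.cast_nonneg _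
  have hsplit : ∀ {X : ℝ} {d : ℤ}, d ∈ (finite_famD S X).toFinset →
      Fund d ∧ ∀ p ∈ S, SplitCond p d :=
    fun hd => (fund_and_split_iff hS).mpr ((Set.Finite.mem_toFinset _).mp hd).2
  have hU : ∀ X : ℝ, c * ∑ d ∈ (finite_famD S X).toFinset, h d ≤
      2 * ((famD S X).ncard : ℝ) + ∑ d ∈ (finite_famD S X).toFinset, k HRed d +
        ∑ d ∈ Finset.Icc (-4) 0, c * h d := by
    intro X
    have h1 := sum_small_le (S := S) (fun d => mul_nonneg hc0.le (hh0 d)) X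
    have h2 : c * ∑ d ∈ (finite_famD S X).toFinset, h d ≤ ∑ d ∈ (finite_famD S X).toFinset,
        (2 + k HRed d + if -4 ≤ d then c * h d else 0) := by
      rw [Finset.mul_sum]
      refine Finset.sum_le_sum fun d hd => ?_
      split_ifs with h4
      · linarith [hk0 HRed d]
      · obtain ⟨hF, hsp⟩ := hsplit hd
        have := two_mul_card_torsion_le hF (not_le.mp h4) S hS hsp
        have h5 := Nat.cast_le (α := ℝ).mpr this
        push_cast at h5
        rw [hc, hh, hk]
        linarith
    rw [Finset.sum_add_distrib, Finset.sum_add_distrib, Finset.sum_const, nsmul_eq_mul,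
      ← Set.ncard_eq_toFinset_card _ (finite_famD S X)] at h2
    linarith
  have hL : ∀ X : ℝ, 2 * ((famD S X).ncard : ℝ) + ∑ d ∈ (finite_famD S X).toFinset, k SRed d +
      -∑ d ∈ Finset.Icc (-4) 0, (2 + k SRed d) ≤ c * ∑ d ∈ (finite_famD S X).toFinset, h d := by
    intro X
    have h1 := sum_small_le (S := S) (E := fun d => 2 + k SRed d)
      (fun d => by linarith [hk0 SRed d]) X
    have h2 : ∑ d ∈ (finite_famD S X).toFinset, (2 + k SRed d) ≤
        ∑ d ∈ (finite_famD S X).toFinset, (c * h d + if -4 ≤ d then 2 + k SRed d else 0) := by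
      refine Finset.sum_le_sum fun d hd => ?_
      split_ifs with h4
      · linarith [mul_nonneg hc0.le (hh0 d)]
      · obtain ⟨hF, hsp⟩ := hsplit hd
        have := le_two_mul_card_torsion hF (not_le.mp h4) S hS hsp
        have h5 := Nat.cast_le (α := ℝ).mpr this
        push_cast at h5
        rw [hc, hh, hk]
        linarith
    rw [Finset.sum_add_distrib, Finset.sum_add_distrib, Finset.sum_const, nsmul_eq_mul,
      ← Set.ncard_eq_toFinset_card _ (finite_famD S X), ← Finset.mul_sum] at h2
    linarith
  have hlim : ∀ {R : (Fin 4 → ℤ) → Prop}, (∀ f, SRed f → R f) → (∀ f, R f → WRed f) → ∀ e : ℝ,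
      Tendsto (fun X : ℝ => c⁻¹ * ((2 * ((famD S X).ncard : ℝ) +
        ∑ d ∈ (finite_famD S X).toFinset, k R d + e) / X)) atTop
        (𝓝 (δ * (1 + 3 ^ (-(S.card : ℤ))))) := by
    intro R hR1 hR2 e
    have h1 := ((tendsto_ncard_famD hδ).const_mul 2).add (tendsto_sum_forms hS hδ hR1 hR2)
    have h2 : Tendsto (fun X : ℝ => (2 * ((famD S X).ncard : ℝ) +
        ∑ d ∈ (finite_famD S X).toFinset, k R d) / X) atTop (𝓝 (2 * δ + 2 * δ * 3 ^ S.card)) :=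
      h1.congr fun X => by rw [add_div, mul_div_assoc]
    have h3 := (tendsto_add_const_div (c := e) h2).const_mul c⁻¹
    have e2 : c⁻¹ * (2 * δ + 2 * δ * 3 ^ S.card) = δ * (1 + 3 ^ (-(S.card : ℤ))) := by
      rw [hc, zpow_neg, zpow_natCast]
      field_simp
      ring
    rwa [e2] at h3
  refine tendsto_of_tendsto_of_tendsto_of_le_of_le' (hlim (fun f hf => hf) (fun f hf => hf.wRed)
    (-∑ d ∈ Finset.Icc (-4) 0, (2 + k SRed d)))
    (hlim (R := HRed) (fun f hf => ⟨hf.1, hf.2.1, hf.2.2.1, hf.2.2.2.le⟩) (fun f hf => hf.wRed)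
      (∑ d ∈ Finset.Icc (-4) 0, c * h d)) ?_ ?_
  · filter_upwards [eventually_gt_atTop 0] with X hX
    rw [inv_mul_le_iff₀ hc0, ← mul_div_assoc]
    exact div_le_div_of_nonneg_right (hL X) hX.le
  · filter_upwards [eventually_gt_atTop 0] with X hX
    rw [le_inv_mul_iff₀ hc0, ← mul_div_assoc]
    exact div_le_div_of_nonneg_right (hU X) hX.le

end Average

end DH

/-- When ordered by absolute discriminant, the average size of `Cl(K)_S[3]` over
imaginary quadratic fields in which every prime of `S` splits completely is
`1 + 3^{-|S|}`. -/
theorem avg_ClS_three_torsion_imaginary_split (S : Finset ℕ) (hS : ∀ p ∈ S, p.Prime) :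
    HasAverage (fun d => IsFundamentalDiscriminant d ∧ d < 0 ∧ ∀ p ∈ S, SplitsIn p d)
      (fun d => (Nat.card {x : ClS S d // x ^ 3 = 1} : ℝ))
      (1 + (3 : ℝ) ^ (-(S.card : ℤ))) := by
  have hset : ∀ X : ℝ, {d : ℤ | (IsFundamentalDiscriminant d ∧ d < 0 ∧ ∀ p ∈ S, SplitsIn p d) ∧
      |(d : ℝ)| < X} = DH.famD S X := by
    intro X
    ext d
    simp only [DH.famD, Set.mem_ofPred_eq, DH.isFundamentalDiscriminant_iff,
      ← DH.fund_and_split_iff hS]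
    constructor
    · rintro ⟨⟨⟨-, hF⟩, hd, hsp⟩, hX⟩
      exact ⟨⟨hd, (abs_lt.mp hX).1⟩, hF, fun p hp => (DH.splitsIn_iff hF hd (hS p hp)).mp (hsp p hp)⟩
    · rintro ⟨⟨hd, hX⟩, hF, hsp⟩
      refine ⟨⟨⟨by omega, hF⟩, hd, fun p hp => (DH.splitsIn_iff hF hd (hS p hp)).mpr (hsp p hp)⟩, ?_⟩
      rw [abs_of_neg (by exact_mod_cast hd)]
      linarith
  obtain ⟨δ, hδ0, hδ⟩ := DH.exists_tendsto_discDensity hS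
  have h := (DH.tendsto_sum_torsion hS hδ).div (DH.tendsto_ncard_famD hδ) hδ0.ne'
  rw [mul_div_cancel_left₀ _ hδ0.ne'] at h
  refine h.congr' ((eventually_gt_atTop 0).mono fun X hX => ?_)
  have e1 : Nat.card {d : ℤ // (IsFundamentalDiscriminant d ∧ d < 0 ∧ ∀ p ∈ S, SplitsIn p d) ∧
      |(d : ℝ)| < X} = (DH.famD S X).ncard := by
    rw [← hset X]
    exact Nat.card_coe_set_eq _
  have e2 : (∑ᶠ d ∈ {d : ℤ | (IsFundamentalDiscriminant d ∧ d < 0 ∧ ∀ p ∈ S, SplitsIn p d) ∧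
      |(d : ℝ)| < X}, (Nat.card {x : ClS S d // x ^ 3 = 1} : ℝ)) =
      ∑ d ∈ (DH.finite_famD S X).toFinset, (Nat.card {x : ClS S d // x ^ 3 = 1} : ℝ) := by
    rw [hset X]
    exact finsum_mem_eq_finite_toFinset_sum _ _
  beta_reduce
  rw [Pi.div_apply, e1, e2]
  exact div_div_div_cancel_right₀ hX.ne' _ _
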